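/- Let k > 5 be an integer, G a finite group, S_0 a generating k-tuple of G, and let V = Σ'_k(G). Let Δ_{Σ'} = 4k²·I − A be the non-normalized graph Laplacian on ℂ^V, where A(u,w) is the number of generators s of A_k with s.u = w. Then every nonzero eigenvalue of Δ_{Σ'} is at least 0.35·(k−5); equivalently, the spectral gap of the normalized Laplacian (1/(4k²))·Δ_{Σ'} is at least 0.35·(k−5)/(4k²). -/

import Mathlib

noncomputable section

namespace PRA

open FreeGroup

variable {α : Type*} [DecidableEq α]

/-- The endomorphism of the free group sending `x_i ↦ x_j x_i` and fixing other generators. -/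
def lA (i j : α) : FreeGroup α →* FreeGroup α :=
  FreeGroup.lift fun p => if p = i then FreeGroup.of j * FreeGroup.of p else FreeGroup.of p

/-- The endomorphism of the free group sending `x_i ↦ x_j⁻¹ x_i` and fixing other generators. -/
def lB (i j : α) : FreeGroup α →* FreeGroup α :=
  FreeGroup.lift fun p => if p = i then (FreeGroup.of j)⁻¹ * FreeGroup.of p else FreeGroup.of p

/-- The endomorphism of the free group sending `x_i ↦ x_i x_j` and fixing other generators. -/
def rA (i j : α) : FreeGroup α →* FreeGroup α :=
  FreeGroup.lift fun p => if p = i then FreeGroup.of p * FreeGroup.of j else FreeGroup.of p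

/-- The endomorphism of the free group sending `x_i ↦ x_i x_j⁻¹` and fixing other generators. -/
def rB (i j : α) : FreeGroup α →* FreeGroup α :=
  FreeGroup.lift fun p => if p = i then FreeGroup.of p * (FreeGroup.of j)⁻¹ else FreeGroup.of p

lemma lBA (i j : α) (h : i ≠ j) : (lB i j).comp (lA i j) = MonoidHom.id _ := by
  ext p
  by_cases hp : p = i
  · subst hp
    simp [lA, lB, Ne.symm h]
  · simp [lA, lB, hp]

lemma lAB (i j : α) (h : i ≠ j) : (lA i j).comp (lB i j) = MonoidHom.id _ := by
  ext p
  by_cases hp : p = i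
  · subst hp
    simp [lA, lB, Ne.symm h]
  · simp [lA, lB, hp]

lemma rBA (i j : α) (h : i ≠ j) : (rB i j).comp (rA i j) = MonoidHom.id _ := by
  ext p
  by_cases hp : p = i
  · subst hp
    simp [rA, rB, Ne.symm h]
  · simp [rA, rB, hp]

lemma rAB (i j : α) (h : i ≠ j) : (rA i j).comp (rB i j) = MonoidHom.id _ := by
  ext p
  by_cases hp : p = i
  · subst hp
    simp [rA, rB, Ne.symm h]
  · simp [rA, rB, hp]

/-- The Nielsen automorphism `L_{ij} : x_i ↦ x_j x_i` (defined to be `1` when `i = j`). -/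
def nL (i j : α) : MulAut (FreeGroup α) :=
  if h : i = j then 1
  else MonoidHom.toMulEquiv (lA i j) (lB i j) (lBA i j h) (lAB i j h)

/-- The Nielsen automorphism `R_{ij} : x_i ↦ x_i x_j` (defined to be `1` when `i = j`). -/
def nR (i j : α) : MulAut (FreeGroup α) :=
  if h : i = j then 1
  else MonoidHom.toMulEquiv (rA i j) (rB i j) (rBA i j h) (rAB i j h)

/-- The generating set of the group `A_k`: Nielsen automorphisms `L_{ij}^±`, `R_{ij}^±`
of `F_{k+1} = ⟨x_0, x_1, …, x_k⟩` with `i ≠ j` and `j ≠ 0`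
(i.e. the C-generators, with `i = 0`, and the N-generators, with `i, j ≥ 1`). -/
def AgenSet (k : ℕ) : Set (MulAut (FreeGroup (Fin (k + 1)))) :=
  {φ | ∃ i j : Fin (k + 1), i ≠ j ∧ j ≠ 0 ∧
    (φ = nL i j ∨ φ = (nL i j)⁻¹ ∨ φ = nR i j ∨ φ = (nR i j)⁻¹)}

/-- The group `A_k ≤ Aut(F_{k+1})`. -/
def Ak (k : ℕ) : Subgroup (MulAut (FreeGroup (Fin (k + 1)))) :=
  Subgroup.closure (AgenSet k)

lemma nL_mem {k : ℕ} (i j : Fin (k + 1)) (hj : j ≠ 0) : nL i j ∈ Ak k := by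
  by_cases h : i = j
  · subst h
    rw [nL, dif_pos rfl]
    exact (Ak k).one_mem
  · exact Subgroup.subset_closure ⟨i, j, h, hj, Or.inl rfl⟩

lemma nR_mem {k : ℕ} (i j : Fin (k + 1)) (hj : j ≠ 0) : nR i j ∈ Ak k := by
  by_cases h : i = j
  · subst h
    rw [nR, dif_pos rfl]
    exact (Ak k).one_mem
  · exact Subgroup.subset_closure ⟨i, j, h, hj, Or.inr (Or.inr (Or.inl rfl))⟩

/-- `L_{ij}` as an element of the group `A_k`. -/
def Lg {k : ℕ} (i j : Fin (k + 1)) (hj : j ≠ 0) : Ak k := ⟨nL i j, nL_mem i j hj⟩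

/-- `R_{ij}` as an element of the group `A_k`. -/
def Rg {k : ℕ} (i j : Fin (k + 1)) (hj : j ≠ 0) : Ak k := ⟨nR i j, nR_mem i j hj⟩

end PRA
namespace PRA

open FreeGroup

variable {k : ℕ} {G : Type*} [Group G]

/-- The action of an automorphism `ψ` of `F_{k+1}` on `(k+1)`-tuples of elements of `G`
(identified with homomorphisms `F_{k+1} → G`): `(ψ.g) i = (lift g) (ψ⁻¹ x_i)`. -/
def tupAct (ψ : MulAut (FreeGroup (Fin (k + 1)))) (g : Fin (k + 1) → G) : Fin (k + 1) → G :=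
  fun i => FreeGroup.lift g (ψ⁻¹ (FreeGroup.of i))

/-- The initial tuple `(1 | S_0)`. -/
def initTup (k : ℕ) (S0 : Fin k → G) : Fin (k + 1) → G :=
  Fin.cases 1 S0

/-- The vertex set of `Σ'_k(G)`: the orbit of `(1|S_0)` under the action of `A_k`. -/
def SigmaSet (k : ℕ) (G : Type*) [Group G] (S0 : Fin k → G) : Set (Fin (k + 1) → G) :=
  {v | ∃ ψ ∈ Ak k, v = tupAct ψ (initTup k S0)}

/-- The list of `4k²` generators of `A_k`, indexed by a label `c : Fin 4`
(for `L, L⁻¹, R, R⁻¹`) and a pair of indices. -/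
def genAut (k : ℕ) (c : Fin 4) (i j : Fin (k + 1)) : MulAut (FreeGroup (Fin (k + 1))) :=
  ![nL i j, (nL i j)⁻¹, nR i j, (nR i j)⁻¹] c

/-- The distribution `μ_t` of the lazy random walk on `Σ'_k(G)` started at `(1|S_0)`;
in one step, with probability `1/2` stay put, with probability `1/2` move along one
of the `4k²` edges chosen uniformly. -/
def walkDist (k : ℕ) (G : Type*) [Group G] [Fintype G] [DecidableEq G] (S0 : Fin k → G) :
    ℕ → (Fin (k + 1) → G) → ℝ
  | 0, v => if v = initTup k S0 then 1 else 0
  | t + 1, v =>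
      (1 / 2) * walkDist k G S0 t v +
        (1 / (8 * (k : ℝ) ^ 2)) *
          ∑ c : Fin 4, ∑ i : Fin (k + 1), ∑ j : Fin (k + 1),
            if i ≠ j ∧ j ≠ 0 then walkDist k G S0 t (tupAct (genAut k c i j)⁻¹ v) else 0

open scoped Classical in
/-- The distribution `ν_t` of the accumulator:
`ν_t(g) = μ_t {(g_0|g_1,…,g_k) ∈ Σ'_k(G) : g_0 = g}`. -/
def accDist (k : ℕ) (G : Type*) [Group G] [Fintype G] [DecidableEq G] (S0 : Fin k → G)
    (t : ℕ) (g : G) : ℝ :=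
  ∑ v : Fin (k + 1) → G,
    if v ∈ SigmaSet k G S0 ∧ v 0 = g then walkDist k G S0 t v else 0

/-- The total variation distance between two (distributions given as) functions
on a finite set: `(1/2)·Σ_x |μ x − ν x|`. -/
def tvDist {X : Type*} [Fintype X] (μ ν : X → ℝ) : ℝ :=
  (∑ x : X, |μ x - ν x|) / 2

/-- The uniform distribution on a finite group `G`. -/
def unifG (G : Type*) [Group G] [Fintype G] : G → ℝ :=
  fun _ => (Fintype.card G : ℝ)⁻¹

open scoped Classical in
/-- The uniform distribution on `Σ'_k(G)`, as a function on all `(k+1)`-tuples. -/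
def unifSigma (k : ℕ) (G : Type*) [Group G] [Fintype G] (S0 : Fin k → G) :
    (Fin (k + 1) → G) → ℝ :=
  fun v => if v ∈ SigmaSet k G S0 then ((SigmaSet k G S0).ncard : ℝ)⁻¹ else 0

end PRA

set_option linter.all false
set_option maxRecDepth 100000
namespace PRA5

abbrev Wd (ι : Type*) := List ((ι × Bool) × (ι × Bool))

section act
variable {ι : Type*} [DecidableEq ι] {G : Type*} [Group G]

def sv (S : ι → G) (b : ι × Bool) : G := if b.2 then (S b.1)⁻¹ else S b.1

def lact (l : (ι × Bool) × (ι × Bool)) (S : ι → G) : ι → G :=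
  if l.1.1 = l.2.1 then S else
    Function.update S l.1.1 (if l.1.2 then (sv S l.2)⁻¹ * S l.1.1 else S l.1.1 * sv S l.2)

def fl {ι : Type*} (b : ι × Bool) : ι × Bool := (b.1, !b.2)

def linv {ι : Type*} (l : (ι × Bool) × (ι × Bool)) : (ι × Bool) × (ι × Bool) := (l.1, fl l.2)

def wact (w : Wd ι) (S : ι → G) : ι → G := w.foldl (fun S l => lact l S) S

def winv {ι : Type*} (w : Wd ι) : Wd ι := (w.map linv).reverse

@[simp] lemma fl_fl {ι : Type*} (b : ι × Bool) : fl (fl b) = b := by simp [fl]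
@[simp] lemma linv_linv {ι : Type*} (l : (ι × Bool) × (ι × Bool)) : linv (linv l) = l := by
  simp [linv]

lemma lact_linv (l : (ι × Bool) × (ι × Bool)) (S : ι → G) : lact (linv l) (lact l S) = S := by
  obtain ⟨⟨a, s⟩, ⟨b, t⟩⟩ := l
  by_cases h : a = b
  · simp [lact, linv, fl, h]
  · have h' : b ≠ a := fun e => h e.symm
    cases s <;> cases t <;> simp [lact, linv, fl, h, h', sv, Function.update_of_ne]

lemma lact_linv' (l : (ι × Bool) × (ι × Bool)) (S : ι → G) : lact l (lact (linv l) S) = S := by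
  simpa using lact_linv (linv l) S

@[simp] lemma wact_nil (S : ι → G) : wact [] S = S := rfl
lemma wact_cons (l) (w : Wd ι) (S : ι → G) : wact (l :: w) S = wact w (lact l S) := rfl
lemma wact_append (w v : Wd ι) (S : ι → G) : wact (w ++ v) S = wact v (wact w S) := by
  simp [wact, List.foldl_append]

@[simp] lemma winv_winv {ι : Type*} (w : Wd ι) : winv (winv w) = w := by
  simp [winv, Function.comp_def]
lemma winv_append {ι : Type*} (w v : Wd ι) : winv (w ++ v) = winv v ++ winv w := by
  simp [winv]

lemma wact_winv (w : Wd ι) (S : ι → G) : wact (winv w) (wact w S) = S := by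
  induction w generalizing S with
  | nil => rfl
  | cons l w ih =>
    have : winv (l :: w) = winv w ++ [linv l] := by simp [winv]
    rw [this, wact_append, wact_cons l w, ih]
    simp [wact_cons, lact_linv]

lemma wact_winv' (w : Wd ι) (S : ι → G) : wact w (wact (winv w) S) = S := by
  simpa using wact_winv (winv w) S

def wequiv (w : Wd ι) : (ι → G) ≃ (ι → G) where
  toFun := wact w
  invFun := wact (winv w)
  left_inv := wact_winv w
  right_inv := wact_winv' w

end act

def rl {ι κ : Type*} (g : ι × Bool → κ × Bool) (w : Wd ι) : Wd κ := w.map (Prod.map g g)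

lemma rl_append {ι κ : Type*} (g : ι × Bool → κ × Bool) (w v : Wd ι) :
    rl g (w ++ v) = rl g w ++ rl g v := by simp [rl]

lemma rl_rl {ι κ τ : Type*} (g : ι × Bool → κ × Bool) (h : κ × Bool → τ × Bool) (w : Wd ι) :
    rl h (rl g w) = rl (h ∘ g) w := by simp [rl, Function.comp_def]

lemma rl_winv {ι κ : Type*} (g : ι × Bool → κ × Bool) (hg : ∀ b, g (fl b) = fl (g b)) (w : Wd ι) :
    rl g (winv w) = winv (rl g w) := by
  simp only [rl, winv, List.map_reverse, List.map_map]
  congr 2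
  funext l
  simp [linv, hg]

/-- signed relabelings fixing the index `z` -/
def Rg {ι : Type*} (z : ι) : Subgroup (Equiv.Perm (ι × Bool)) where
  carrier := {g | (∀ b, g (fl b) = fl (g b)) ∧ ∀ b, (g b).1 = z ↔ b.1 = z}
  mul_mem' := by
    rintro a b ⟨h1, h2⟩ ⟨h3, h4⟩
    exact ⟨fun c => by simp [h1, h3], fun c => by simp [h2, h4]⟩
  one_mem' := ⟨fun _ => rfl, fun _ => Iff.rfl⟩
  inv_mem' := by
    rintro a ⟨h1, h2⟩
    refine ⟨fun c => ?_, fun c => ?_⟩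
    · apply a.injective; rw [h1]; simp
    · rw [← h2]; simp

/-- abstract properties of the averaged displacement function -/
structure PS {ι : Type*} [DecidableEq ι] (z : ι) (G : Type*) [Group G] (Ψ : Wd ι → ℝ) : Prop where
  nil : Ψ [] = 0
  inv : ∀ w, Ψ (winv w) = Ψ w
  rel : ∀ g ∈ Rg z, ∀ w, Ψ (rl g w) = Ψ w
  eq : ∀ w v : Wd ι, (∀ S : ι → G, wact w S = wact v S) → Ψ w = Ψ v
  psd : ∀ (I : Type) [Fintype I] (y : I → ℝ) (w : I → Wd ι),
    0 ≤ ∑ i, ∑ j, y i * y j * (Ψ (w i) + Ψ (w j) - Ψ (winv (w i) ++ w j))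

namespace PS
variable {ι : Type*} [DecidableEq ι] {z : ι} {G : Type*} [Group G] {Ψ : Wd ι → ℝ}

lemma inv_self (h : PS z G Ψ) (w : Wd ι) : Ψ (winv w ++ w) = 0 := by
  rw [← h.nil]; apply h.eq; intro S; rw [wact_append, wact_winv']; rfl

lemma nonneg (h : PS z G Ψ) (w : Wd ι) : 0 ≤ Ψ w := by
  have := h.psd Unit (fun _ => 1) (fun _ => w)
  simp [h.inv_self] at this; linarith

lemma sub (h : PS z G Ψ) (w v : Wd ι) : Ψ (w ++ v) ≤ 2 * Ψ w + 2 * Ψ v := by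
  have := h.psd Bool (fun _ => 1) (fun b => if b then winv w else v)
  have e : Ψ (winv v ++ winv w) = Ψ (w ++ v) := by rw [← winv_append, h.inv]
  have e1 : Ψ (w ++ winv w) = 0 := by simpa using h.inv_self (winv w)
  simp [h.inv_self, h.inv, e, e1] at this
  linarith

end PS

section pull
variable {ι κ : Type*} [DecidableEq ι] [DecidableEq κ] {G : Type*} [Group G]

def pull (g : ι × Bool → κ × Bool) (S : κ → G) : ι → G := fun i => sv S (g (i, false))

lemma sv_fl (S : κ → G) (b : κ × Bool) : sv S (fl b) = (sv S b)⁻¹ := by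
  obtain ⟨b, s⟩ := b; cases s <;> simp [sv, fl]

lemma sv_pull (g : ι × Bool → κ × Bool) (hg : ∀ b, g (fl b) = fl (g b)) (S : κ → G)
    (b : ι × Bool) : sv (pull g S) b = sv S (g b) := by
  obtain ⟨b, s⟩ := b
  cases s
  · simp [sv, pull]
  · have : g (b, true) = fl (g (b, false)) := by rw [← hg]; rfl
    rw [this, sv_fl]; rfl

lemma fst_eq_iff {τ : Type*} (x y : τ × Bool) : x.1 = y.1 ↔ x = y ∨ x = fl y := by
  obtain ⟨x, s⟩ := x
  obtain ⟨y, t⟩ := y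
  cases s <;> cases t <;> simp [fl]

lemma g_fst (g : ι × Bool → κ × Bool) (hi : Function.Injective g) (hg : ∀ b, g (fl b) = fl (g b))
    (a b : ι × Bool) : (g a).1 = (g b).1 ↔ a.1 = b.1 := by
  rw [fst_eq_iff, fst_eq_iff, ← hg, hi.eq_iff, hi.eq_iff]

lemma sv_lact (l : (κ × Bool) × (κ × Bool)) (S : κ → G) (h : l.1.1 ≠ l.2.1) (c : κ × Bool) :
    sv (lact l S) c = if c = l.1 then sv S l.1 * sv S l.2
      else if c = fl l.1 then (sv S l.2)⁻¹ * sv S (fl l.1) else sv S c := by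
  obtain ⟨⟨a, s⟩, ⟨b, t⟩⟩ := l
  obtain ⟨c, u⟩ := c
  simp only at h
  by_cases hc : c = a
  · subst hc
    cases s <;> cases t <;> cases u <;> simp [sv, lact, fl, h]
  · simp [sv, lact, fl, h, hc, Function.update_of_ne]

lemma pull_lact (g : ι × Bool → κ × Bool) (hi : Function.Injective g)
    (hg : ∀ b, g (fl b) = fl (g b)) (l : (ι × Bool) × (ι × Bool)) (S : κ → G) :
    pull g (lact (Prod.map g g l) S) = lact l (pull g S) := by
  by_cases h : l.1.1 = l.2.1
  · rw [lact, lact, if_pos h, if_pos]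
    exact (g_fst g hi hg _ _).2 h
  · have h' : (Prod.map g g l).1.1 ≠ (Prod.map g g l).2.1 := fun e => h ((g_fst g hi hg _ _).1 e)
    funext i
    have h1 : pull g (lact (Prod.map g g l) S) i = sv (lact (Prod.map g g l) S) (g (i, false)) := rfl
    have h2 : lact l (pull g S) i = sv (lact l (pull g S)) (i, false) := by simp [sv]
    rw [h1, h2, sv_lact _ _ h, sv_lact _ _ h']
    simp only [Prod.map_fst, Prod.map_snd, ← hg, hi.eq_iff, sv_pull g hg]

lemma pull_wact (g : ι × Bool → κ × Bool) (hi : Function.Injective g)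
    (hg : ∀ b, g (fl b) = fl (g b)) (w : Wd ι) (S : κ → G) :
    pull g (wact (rl g w) S) = wact w (pull g S) := by
  induction w generalizing S with
  | nil => rfl
  | cons l w ih =>
    have : rl g (l :: w) = Prod.map g g l :: rl g w := rfl
    rw [this, wact_cons, wact_cons, ih, pull_lact g hi hg]

lemma wact_out (g : ι × Bool → κ × Bool) (w : Wd ι) (S : κ → G) (i : κ)
    (h : ∀ b, (g b).1 ≠ i) : wact (rl g w) S i = S i := by
  induction w generalizing S with
  | nil => rfl
  | cons l w ih =>
    have : rl g (l :: w) = Prod.map g g l :: rl g w := rfl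
    rw [this, wact_cons, ih, lact]
    by_cases h1 : (Prod.map g g l).1.1 = (Prod.map g g l).2.1
    · rw [if_pos h1]
    · rw [if_neg h1, Function.update_of_ne]; exact (h l.1).symm

lemma wact_rl_eq (g : ι × Bool → κ × Bool) (hi : Function.Injective g)
    (hg : ∀ b, g (fl b) = fl (g b)) (w v : Wd ι) (h : ∀ S : ι → G, wact w S = wact v S)
    (S : κ → G) : wact (rl g w) S = wact (rl g v) S := by
  funext i
  by_cases hb : ∃ b, (g b).1 = i
  · obtain ⟨b, rfl⟩ := hb
    have h1 : ∀ w : Wd ι, sv (wact (rl g w) S) (g b) = sv (wact w (pull g S)) b := fun w => by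
      rw [← pull_wact g hi hg, sv_pull g hg]
    have h2 := (h1 w).trans ((by rw [h]) : _ = _) |>.trans (h1 v).symm
    simp only [sv] at h2
    split_ifs at h2 with h3
    · exact inv_injective h2
    · exact h2
  · push Not at hb
    rw [wact_out g _ _ _ hb, wact_out g _ _ _ hb]

lemma PS.comap {z : κ} {z0 : ι} {Ψ : Wd κ → ℝ} (h : PS z G Ψ) (e : ι → κ)
    (he : Function.Injective e) (hz : e z0 = z) :
    PS z0 G (fun w => Ψ (rl (Prod.map e id) w)) where
  nil := h.nil
  inv w := by
    show Ψ _ = _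
    rw [rl_winv (Prod.map e id) (fun b => rfl), h.inv]
  rel g hg w := by
    classical
    let em : ι × Bool ↪ κ × Bool := ⟨Prod.map e id, he.prodMap Function.injective_id⟩
    have hem : ∀ b, em (fl b) = fl (em b) := fun b => rfl
    have key : ∀ b, (g.viaEmbedding em) (em b) = em (g b) := fun b =>
      Equiv.Perm.viaEmbedding_apply g em b
    have := h.rel (g.viaEmbedding em) ⟨?_, ?_⟩ (rl em w)
    · show Ψ _ = Ψ _
      rw [rl_rl] at this ⊢
      rw [show (Prod.map e id ∘ g : ι × Bool → κ × Bool) = (g.viaEmbedding em) ∘ em from ?_]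
      · exact this
      · funext b; exact (key b).symm
    · intro b
      by_cases hb : ∃ a, em a = b
      · obtain ⟨a, rfl⟩ := hb
        rw [← hem, key, key, hg.1, hem]
      · rw [Equiv.Perm.viaEmbedding_apply_of_notMem, Equiv.Perm.viaEmbedding_apply_of_notMem]
        · exact fun ⟨a, ha⟩ => hb ⟨a, ha⟩
        · rintro ⟨a, ha⟩; exact hb ⟨fl a, by rw [hem, ha, fl_fl]⟩
    · intro b
      by_cases hb : ∃ a, em a = b
      · obtain ⟨a, rfl⟩ := hb
        rw [key]
        show e (g a).1 = z ↔ e a.1 = z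
        rw [← hz, he.eq_iff, he.eq_iff]; exact hg.2 a
      · rw [Equiv.Perm.viaEmbedding_apply_of_notMem]
        exact fun ⟨a, ha⟩ => hb ⟨a, ha⟩
  eq w v hwv := h.eq _ _ (wact_rl_eq _ (he.prodMap Function.injective_id) (fun _ => rfl) w v hwv)
  psd I _ y w := by
    have := h.psd I y (fun i => rl (Prod.map e id) (w i))
    simpa only [rl_append, rl_winv (Prod.map e id) (fun b => rfl)] using this

end pull

section phi
variable {ι : Type*} [DecidableEq ι] [Fintype ι] {G : Type*} [Group G] [Fintype G]

def phi (f : (ι → G) → ℝ) (w : Wd ι) : ℝ := ∑ S, f S * (f S - f (wact w S))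

lemma sum_wact (w : Wd ι) (F : (ι → G) → ℝ) : ∑ S, F (wact w S) = ∑ S, F S :=
  Equiv.sum_comp (wequiv w) F

lemma phi_key (f : (ι → G) → ℝ) (w v : Wd ι) :
    phi f w + phi f v - phi f (winv w ++ v) =
      ∑ S, (f S - f (wact w S)) * (f S - f (wact v S)) := by
  have h3 : phi f (winv w ++ v) = ∑ S, f (wact w S) * (f (wact w S) - f (wact v S)) := by
    rw [phi, ← sum_wact w]
    apply Finset.sum_congr rfl; intro S _
    rw [wact_append, wact_winv]
  have h4 : ∑ S, f (wact w S) * f (wact w S) = ∑ S, f S * f S :=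
    sum_wact w (fun S => f S * f S)
  rw [h3, phi, phi]
  simp only [mul_sub, sub_mul, Finset.sum_sub_distrib] at *
  rw [h4]
  have : ∑ S, f (wact w S) * f S = ∑ S, f S * f (wact w S) :=
    Finset.sum_congr rfl fun _ _ => mul_comm _ _
  rw [this]; ring

lemma phi_nil (f : (ι → G) → ℝ) : phi f [] = 0 := by simp [phi]

lemma phi_inv (f : (ι → G) → ℝ) (w : Wd ι) : phi f (winv w) = phi f w := by
  rw [phi, ← sum_wact w]
  simp only [wact_winv, phi, mul_sub, Finset.sum_sub_distrib]
  rw [sum_wact w (fun S => f S * f S)]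
  congr 1
  exact Finset.sum_congr rfl fun _ _ => mul_comm _ _

open scoped Classical in
def Psi (z : ι) (f : (ι → G) → ℝ) (w : Wd ι) : ℝ := ∑ g : Rg z, phi f (rl g.1 w)

lemma psi_psd (f : (ι → G) → ℝ) (I : Type) [Fintype I] (y : I → ℝ) (w : I → Wd ι) :
    0 ≤ ∑ i, ∑ j, y i * y j * (phi f (w i) + phi f (w j) - phi f (winv (w i) ++ w j)) := by
  have : ∑ i, ∑ j, y i * y j * (phi f (w i) + phi f (w j) - phi f (winv (w i) ++ w j)) =
      ∑ S, (∑ i, y i * (f S - f (wact (w i) S))) ^ 2 := by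
    simp only [phi_key, sq, Fintype.sum_mul_sum]
    simp only [Finset.mul_sum]
    rw [Finset.sum_congr rfl fun i _ => Finset.sum_comm, Finset.sum_comm]
    refine Finset.sum_congr rfl fun S _ => Finset.sum_congr rfl fun i _ =>
      Finset.sum_congr rfl fun j _ => by ring
  rw [this]; positivity

lemma Psi_PS (z : ι) (f : (ι → G) → ℝ) : PS z G (Psi z f) where
  nil := by simp [Psi, rl, phi_nil]
  inv w := by
    refine Finset.sum_congr rfl fun g _ => ?_
    rw [rl_winv _ g.2.1, phi_inv]
  rel g hg w := by
    classical
    simp only [Psi, rl_rl]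
    exact Fintype.sum_equiv (Equiv.mulRight (⟨g, hg⟩ : Rg z)) _ _ (fun x => rfl)
  eq w v h := by
    refine Finset.sum_congr rfl fun g _ => ?_
    unfold phi
    refine Finset.sum_congr rfl fun S _ => ?_
    rw [wact_rl_eq g.1 g.1.injective g.2.1 w v h]
  psd I _ y w := by
    classical
    have : ∑ i, ∑ j, y i * y j * (Psi z f (w i) + Psi z f (w j) - Psi z f (winv (w i) ++ w j)) =
      ∑ g : Rg z, ∑ i, ∑ j, y i * y j * (phi f (rl g.1 (w i)) + phi f (rl g.1 (w j))
        - phi f (winv (rl g.1 (w i)) ++ rl g.1 (w j))) := by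
      simp only [Psi, ← Finset.sum_add_distrib, ← Finset.sum_sub_distrib, Finset.mul_sum]
      rw [Finset.sum_congr rfl fun i _ => Finset.sum_comm, Finset.sum_comm]
      refine Finset.sum_congr rfl fun g _ => ?_
      simp only [rl_append, rl_winv _ g.2.1]
    rw [this]
    exact Finset.sum_nonneg fun g _ => psi_psd f I y _
end phi

abbrev Lt (k : ℕ) := (Fin (k + 1) × Bool) × (Fin (k + 1) × Bool)

def Gen (k : ℕ) : Finset (Lt k) := Finset.univ.filter fun l => l.1.1 ≠ l.2.1 ∧ l.2.1 ≠ 0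

lemma mem_Gen {k : ℕ} (l : Lt k) : l ∈ Gen k ↔ l.1.1 ≠ l.2.1 ∧ l.2.1 ≠ 0 := by simp [Gen]

/-- the key inequality -/
def KEY (k : ℕ) (G : Type*) [Group G] : Prop :=
  ∀ Ψ : Wd (Fin (k + 1)) → ℝ, PS 0 G Ψ →
    0.35 * ((k : ℝ) - 5) * ∑ l ∈ Gen k, Ψ [l] ≤
      ∑ l ∈ Gen k, ∑ m ∈ Gen k, (Ψ [l] + Ψ [m] - Ψ [l, m])

section lap
variable {k : ℕ} {G : Type*} [Group G] [Fintype G]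

lemma linv_mem_Gen (l : Lt k) : linv l ∈ Gen k ↔ l ∈ Gen k := by simp [mem_Gen, linv, fl]

lemma rl_mem_Gen (g : Rg (0 : Fin (k + 1))) (l : Lt k) : Prod.map g.1 g.1 l ∈ Gen k ↔ l ∈ Gen k := by
  simp only [mem_Gen, Prod.map_fst, Prod.map_snd, ne_eq, g.2.2,
    g_fst g.1 g.1.injective g.2.1]

lemma sum_rl_Gen (g : Rg (0 : Fin (k + 1))) (F : Lt k → ℝ) :
    ∑ l ∈ Gen k, F (Prod.map g.1 g.1 l) = ∑ l ∈ Gen k, F l :=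
  Finset.sum_equiv (Equiv.prodCongr g.1 g.1) (fun l => (rl_mem_Gen g l).symm) (fun _ _ => rfl)

lemma sum_linv_Gen (F : Lt k → ℝ) : ∑ l ∈ Gen k, F (linv l) = ∑ l ∈ Gen k, F l :=
  Finset.sum_equiv ⟨linv, linv, linv_linv, linv_linv⟩ (fun l => (linv_mem_Gen l).symm)
    (fun _ _ => rfl)

def Lap (f : (Fin (k + 1) → G) → ℝ) (S : Fin (k + 1) → G) : ℝ :=
  ∑ l ∈ Gen k, (f S - f (lact l S))

lemma phi1 (f : (Fin (k + 1) → G) → ℝ) (l : Lt k) :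
    phi f [l] = ∑ S, f S * (f S - f (lact l S)) := rfl

lemma lap_phi (f : (Fin (k + 1) → G) → ℝ) : ∑ S, f S * Lap f S = ∑ l ∈ Gen k, phi f [l] := by
  simp only [Lap, phi1, Finset.mul_sum]
  rw [Finset.sum_comm]

lemma lap_sq (f : (Fin (k + 1) → G) → ℝ) : ∑ S, Lap f S ^ 2 =
    ∑ l ∈ Gen k, ∑ m ∈ Gen k, (phi f [l] + phi f [m] - phi f [l, m]) := by
  have h : ∀ l m : Lt k, phi f [linv l] + phi f [m] - phi f [l, m] =
      ∑ S, (f S - f (lact (linv l) S)) * (f S - f (lact m S)) := by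
    intro l m
    have := phi_key f [linv l] [m]
    simpa [winv, wact] using this
  rw [← sum_linv_Gen (fun l => ∑ m ∈ Gen k, (phi f [l] + phi f [m] - phi f [l, m]))]
  have h2 : ∀ l m : Lt k, phi f [linv l] + phi f [m] - phi f [linv l, m] =
      ∑ S, (f S - f (lact l S)) * (f S - f (lact m S)) := by
    intro l m
    have h3 : phi f [linv l] = phi f [l] := phi_inv f [l]
    have := h (linv l) m
    rw [linv_linv] at this
    rw [h3, this]
  simp only [h2, Lap, sq, Finset.sum_mul_sum]
  rw [Finset.sum_comm]
  exact Finset.sum_congr rfl fun l _ => Finset.sum_comm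

lemma lap_ineq (hK : KEY k G) (f : (Fin (k + 1) → G) → ℝ) :
    0.35 * ((k : ℝ) - 5) * ∑ S, f S * Lap f S ≤ ∑ S, Lap f S ^ 2 := by
  classical
  have h := hK (Psi 0 f) (Psi_PS 0 f)
  have h1 : ∑ l ∈ Gen k, Psi 0 f [l] = (Fintype.card (Rg (0 : Fin (k + 1))) : ℝ) *
      ∑ S, f S * Lap f S := by
    unfold Psi
    rw [Finset.sum_comm]
    have this : ∀ g : Rg (0 : Fin (k + 1)), ∑ l ∈ Gen k, phi f (rl g.1 [l]) =
        ∑ S, f S * Lap f S :=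
      fun g => (sum_rl_Gen g (fun l => phi f [l])).trans (lap_phi f).symm
    rw [Finset.sum_congr rfl fun g _ => this g]
    simp
  have h2 : ∑ l ∈ Gen k, ∑ m ∈ Gen k, (Psi 0 f [l] + Psi 0 f [m] - Psi 0 f [l, m]) =
      (Fintype.card (Rg (0 : Fin (k + 1))) : ℝ) * ∑ S, Lap f S ^ 2 := by
    unfold Psi
    simp only [← Finset.sum_add_distrib, ← Finset.sum_sub_distrib]
    rw [Finset.sum_congr rfl fun l _ => Finset.sum_comm, Finset.sum_comm]
    have : ∀ g : Rg (0 : Fin (k + 1)), ∑ l ∈ Gen k, ∑ m ∈ Gen k,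
        (phi f (rl g.1 [l]) + phi f (rl g.1 [m]) - phi f (rl g.1 [l, m])) =
        ∑ S, Lap f S ^ 2 := by
      intro g
      rw [lap_sq]
      refine Eq.trans ?_ (sum_rl_Gen g (fun l => ∑ m ∈ Gen k, (phi f [l] + phi f [m] - phi f [l, m])))
      refine Finset.sum_congr rfl fun l _ => ?_
      exact sum_rl_Gen g (fun m => phi f [Prod.map g.1 g.1 l] + phi f [m] - phi f [Prod.map g.1 g.1 l, m])
    rw [Finset.sum_congr rfl fun g _ => this g]
    simp
  rw [h1, h2] at h
  have hc : (0 : ℝ) < Fintype.card (Rg (0 : Fin (k + 1))) := by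
    exact_mod_cast Fintype.card_pos
  have h3 : (Fintype.card (Rg (0 : Fin (k + 1))) : ℝ) * (0.35 * ((k : ℝ) - 5) * ∑ S, f S * Lap f S)
      ≤ (Fintype.card (Rg (0 : Fin (k + 1))) : ℝ) * ∑ S, Lap f S ^ 2 := by linarith
  exact le_of_mul_le_mul_left h3 hc

lemma lap_symm (f g : (Fin (k + 1) → G) → ℝ) : ∑ S, g S * Lap f S = ∑ S, Lap g S * f S := by
  simp only [Lap, Finset.mul_sum, Finset.sum_mul]
  rw [Finset.sum_comm, Finset.sum_comm (s := Finset.univ)]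
  simp only [mul_sub, sub_mul, Finset.sum_sub_distrib]
  congr 1
  rw [← sum_linv_Gen (fun l => ∑ x, g x * f (lact l x))]
  refine Finset.sum_congr rfl fun l _ => ?_
  have := sum_wact [l] (fun S => g S * f (lact (linv l) S))
  rw [← this]
  refine Finset.sum_congr rfl fun S _ => ?_
  simp [wact, lact_linv]

/-- eigenvalue deduction -/
lemma eig_bound (hk : 5 < k) (hK : KEY k G) (a b : (Fin (k + 1) → G) → ℝ) (α β : ℝ)
    (ha : ∀ S, Lap a S = α * a S - β * b S) (hb : ∀ S, Lap b S = α * b S + β * a S)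
    (hne : ∃ S, a S ≠ 0 ∨ b S ≠ 0) (hμ : α ≠ 0 ∨ β ≠ 0) :
    0.35 * ((k : ℝ) - 5) ≤ α := by
  set N : ℝ := ∑ S, (a S ^ 2 + b S ^ 2) with hN
  have hNpos : 0 < N := by
    obtain ⟨S, hS⟩ := hne
    refine Finset.sum_pos' (fun S _ => by positivity) ⟨S, Finset.mem_univ _, ?_⟩
    rcases hS with h | h <;> positivity
  have hs := lap_symm a b
  simp only [ha, hb] at hs
  have hβ : β = 0 := by
    have : β * N = 0 := by
      have e : β * N = (∑ S, (α * b S + β * a S) * a S) - ∑ S, b S * (α * a S - β * b S) := by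
        rw [hN, Finset.mul_sum, ← Finset.sum_sub_distrib]
        exact Finset.sum_congr rfl fun _ _ => by ring
      rw [e, hs, sub_self]
    rcases mul_eq_zero.1 this with h | h
    · exact h
    · exact absurd h hNpos.ne'
  subst hβ
  have hα : α ≠ 0 := by tauto
  have ea : ∑ S, a S * Lap a S + ∑ S, b S * Lap b S = α * N := by
    rw [hN, Finset.mul_sum, ← Finset.sum_add_distrib]
    exact Finset.sum_congr rfl fun _ _ => by rw [ha, hb]; ring
  have e2 : ∑ S, Lap a S ^ 2 + ∑ S, Lap b S ^ 2 = α ^ 2 * N := by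
    rw [hN, Finset.mul_sum, ← Finset.sum_add_distrib]
    exact Finset.sum_congr rfl fun _ _ => by rw [ha, hb]; ring
  have hpos : ∀ f : (Fin (k + 1) → G) → ℝ, 0 ≤ ∑ S, f S * Lap f S := by
    intro f
    rw [lap_phi]
    refine Finset.sum_nonneg fun l _ => ?_
    have := psi_psd f Unit (fun _ => 1) (fun _ => [l])
    have h0 : phi f (winv [l] ++ [l]) = 0 := by
      simp [phi, winv, wact, lact_linv']
    simp [h0] at this
    linarith
  have h1 := lap_ineq hK a
  have h2 := lap_ineq hK b
  have h3 := hpos a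
  have h4 := hpos b
  have hα0 : 0 ≤ α := by
    by_contra hlt
    push Not at hlt
    nlinarith
  have hα1 : 0 < α := lt_of_le_of_ne hα0 (Ne.symm hα)
  have h5 : 0.35 * ((k : ℝ) - 5) * (α * N) ≤ α ^ 2 * N := by
    rw [← ea, ← e2]; linarith
  have h6 : 0 < α * N := by positivity
  have h7 : 0.35 * ((k : ℝ) - 5) * (α * N) ≤ α * (α * N) := by linarith
  exact le_of_mul_le_mul_right h7 h6
end lap

section link
open PRA
variable {k : ℕ} {G : Type*} [Group G]

def gl {k : ℕ} (c : Fin 4) (i j : Fin (k + 1)) : Lt k :=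
  ![((i, true), (j, false)), ((i, true), (j, true)), ((i, false), (j, true)),
    ((i, false), (j, false))] c

lemma nL_inv_of (i j : Fin (k + 1)) (h : i ≠ j) (p : Fin (k + 1)) :
    (nL i j)⁻¹ (FreeGroup.of p) = lB i j (FreeGroup.of p) := by
  rw [nL, dif_neg h]; rfl
lemma nL_of (i j : Fin (k + 1)) (h : i ≠ j) (p : Fin (k + 1)) :
    (nL i j) (FreeGroup.of p) = lA i j (FreeGroup.of p) := by
  rw [nL, dif_neg h]; rfl
lemma nR_inv_of (i j : Fin (k + 1)) (h : i ≠ j) (p : Fin (k + 1)) :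
    (nR i j)⁻¹ (FreeGroup.of p) = rB i j (FreeGroup.of p) := by
  rw [nR, dif_neg h]; rfl
lemma nR_of (i j : Fin (k + 1)) (h : i ≠ j) (p : Fin (k + 1)) :
    (nR i j) (FreeGroup.of p) = rA i j (FreeGroup.of p) := by
  rw [nR, dif_neg h]; rfl

lemma nL_symm_of (i j : Fin (k + 1)) (h : i ≠ j) (p : Fin (k + 1)) :
    (MulEquiv.symm (nL i j)) (FreeGroup.of p) = lB i j (FreeGroup.of p) := nL_inv_of i j h p
lemma nR_symm_of (i j : Fin (k + 1)) (h : i ≠ j) (p : Fin (k + 1)) :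
    (MulEquiv.symm (nR i j)) (FreeGroup.of p) = rB i j (FreeGroup.of p) := nR_inv_of i j h p

lemma tupAct_gen (c : Fin 4) (i j : Fin (k + 1)) (h : i ≠ j) (S : Fin (k + 1) → G) :
    tupAct (genAut k c i j) S = lact (gl c i j) S := by
  funext p
  by_cases hp : p = i
  · subst hp
    fin_cases c <;>
      simp [tupAct, genAut, gl, lact, sv, h, nL_of, nL_inv_of, nR_of, nR_inv_of, nL_symm_of, nR_symm_of, lA, lB, rA, rB]
  · fin_cases c <;>
      simp [tupAct, genAut, gl, lact, sv, h, nL_of, nL_inv_of, nR_of, nR_inv_of, nL_symm_of, nR_symm_of, lA, lB, rA, rB,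
        hp]

lemma tupAct_mul (φ ψ : MulAut (FreeGroup (Fin (k + 1)))) (S : Fin (k + 1) → G) :
    tupAct (φ * ψ) S = tupAct φ (tupAct ψ S) := by
  have key : ∀ x, FreeGroup.lift (tupAct ψ S) x = FreeGroup.lift S (ψ⁻¹ x) := by
    intro x
    have : FreeGroup.lift (tupAct ψ S) = (FreeGroup.lift S).comp (ψ⁻¹ : MulAut _).toMonoidHom := by
      ext p; simp [tupAct]
    rw [this]; rfl
  funext p
  simp only [tupAct, mul_inv_rev, MulAut.mul_apply]
  exact (key _).symm

lemma gen_mem (c : Fin 4) (i j : Fin (k + 1)) (h : i ≠ j) (hj : j ≠ 0) : genAut k c i j ∈ Ak k := by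
  apply Subgroup.subset_closure
  refine ⟨i, j, h, hj, ?_⟩
  fin_cases c <;> simp [genAut]

lemma sigma_gen (S0 : Fin k → G) (c : Fin 4) (i j : Fin (k + 1)) (h : i ≠ j) (hj : j ≠ 0)
    (S : Fin (k + 1) → G) : tupAct (genAut k c i j) S ∈ SigmaSet k G S0 ↔ S ∈ SigmaSet k G S0 := by
  constructor
  · rintro ⟨ψ, hψ, e⟩
    refine ⟨(genAut k c i j)⁻¹ * ψ, (Ak k).mul_mem ((Ak k).inv_mem (gen_mem c i j h hj)) hψ, ?_⟩
    rw [tupAct_mul, ← e, ← tupAct_mul, inv_mul_cancel]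
    funext p; simp [tupAct]
  · rintro ⟨ψ, hψ, e⟩
    exact ⟨genAut k c i j * ψ, (Ak k).mul_mem (gen_mem c i j h hj) hψ, by rw [tupAct_mul, e]⟩

lemma sum_Gen {M : Type*} [AddCommMonoid M] (F : Lt k → M) : ∑ l ∈ Gen k, F l =
    ∑ c : Fin 4, ∑ i : Fin (k + 1), ∑ j : Fin (k + 1),
      if i ≠ j ∧ j ≠ 0 then F (gl c i j) else 0 := by
  rw [Gen, Finset.sum_filter, Fintype.sum_prod_type]
  simp only [Fintype.sum_prod_type, Fintype.sum_bool, Fin.sum_univ_four, gl]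
  simp only [Matrix.cons_val, ← Finset.sum_add_distrib]
  refine Finset.sum_congr rfl fun i _ => Finset.sum_congr rfl fun j _ => ?_
  split_ifs
  · abel
  · simp

lemma card_Gen : ∑ l ∈ Gen k, (1 : ℂ) = 4 * (k : ℂ) ^ 2 := by
  rw [sum_Gen]
  simp only [Finset.sum_const, Finset.card_univ, Fintype.card_fin]
  have h : ∀ i : Fin (k + 1), (∑ j : Fin (k + 1), if i ≠ j ∧ j ≠ 0 then (1 : ℂ) else 0) =
      if i = 0 then (k : ℂ) else k - 1 := by
    intro i
    rw [Fin.sum_univ_succ]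
    simp only [ne_eq, not_true_eq_false, and_false, if_false, zero_add, Fin.succ_ne_zero,
      not_false_eq_true, and_true]
    refine Fin.cases ?_ (fun i => ?_) i
    · simp [Fin.succ_ne_zero, (Fin.succ_ne_zero _).symm]
    · have : ∀ j : Fin k, (if ¬ i.succ = j.succ then (1 : ℂ) else 0) = 1 - if i = j then 1 else 0 := by
        intro j
        by_cases h : i = j <;> simp [h]
      rw [Finset.sum_congr rfl fun j _ => this j, Finset.sum_sub_distrib, Finset.sum_ite_eq]
      simp [Fin.succ_ne_zero]
  simp only [h]
  rw [Fin.sum_univ_succ]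
  simp [Fin.succ_ne_zero]
  ring

open scoped Classical in
theorem reduce (k : ℕ) (hk : 5 < k) (G : Type*) [Group G] [Fintype G] (hK : KEY k G)
    (S0 : Fin k → G)
    (f : {v : Fin (k + 1) → G // v ∈ SigmaSet k G S0} → ℂ) (hf : f ≠ 0) (μ : ℂ)
    (heig : ∀ u : {v : Fin (k + 1) → G // v ∈ SigmaSet k G S0},
      4 * (k : ℂ) ^ 2 * f u -
          (∑ c : Fin 4, ∑ i : Fin (k + 1), ∑ j : Fin (k + 1),
            if h : (i ≠ j ∧ j ≠ 0) ∧ tupAct (genAut k c i j) u.val ∈ SigmaSet k G S0 then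
              f ⟨tupAct (genAut k c i j) u.val, h.2⟩ else 0)
        = μ * f u)
    (hμ : μ ≠ 0) :
    0.35 * ((k : ℝ) - 5) ≤ μ.re := by
  let F : (Fin (k + 1) → G) → ℂ := fun S => if h : S ∈ SigmaSet k G S0 then f ⟨S, h⟩ else 0
  have hF : ∀ S, ∑ l ∈ Gen k, (F S - F (lact l S)) = μ * F S := by
    intro S
    rw [Finset.sum_sub_distrib]
    have e1 : ∑ l ∈ Gen k, F S = 4 * (k : ℂ) ^ 2 * F S := by
      rw [← card_Gen, Finset.sum_mul]; simp
    rw [e1, sum_Gen]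
    by_cases hS : S ∈ SigmaSet k G S0
    · have := heig ⟨S, hS⟩
      have e2 : F S = f ⟨S, hS⟩ := by simp [F, hS]
      rw [e2, ← this]
      congr 1
      refine Finset.sum_congr rfl fun c _ => Finset.sum_congr rfl fun i _ =>
        Finset.sum_congr rfl fun j _ => ?_
      by_cases hij : i ≠ j ∧ j ≠ 0
      · have hm := (sigma_gen S0 c i j hij.1 hij.2 S).2 hS
        rw [if_pos hij, dif_pos ⟨hij, hm⟩]
        have : F (tupAct (genAut k c i j) S) = f ⟨_, hm⟩ := dif_pos hm
        rw [← tupAct_gen c i j hij.1, this]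
      · rw [if_neg hij, dif_neg (fun h => hij h.1)]
    · have e2 : F S = 0 := by simp [F, hS]
      rw [e2]
      simp only [mul_zero, zero_sub, neg_eq_zero]
      refine Finset.sum_eq_zero fun c _ => Finset.sum_eq_zero fun i _ =>
        Finset.sum_eq_zero fun j _ => ?_
      by_cases hij : i ≠ j ∧ j ≠ 0
      · have hm : tupAct (genAut k c i j) S ∉ SigmaSet k G S0 :=
          fun h => hS ((sigma_gen S0 c i j hij.1 hij.2 S).1 h)
        rw [if_pos hij, ← tupAct_gen c i j hij.1]
        exact dif_neg hm
      · rw [if_neg hij]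
  refine eig_bound hk hK (fun S => (F S).re) (fun S => (F S).im) μ.re μ.im ?_ ?_ ?_ ?_
  · intro S
    have := congrArg Complex.re (hF S)
    simpa [Lap, Complex.re_sum] using this
  · intro S
    have := congrArg Complex.im (hF S)
    simpa [Lap, Complex.im_sum] using this
  · obtain ⟨u, hu⟩ := Function.ne_iff.1 hf
    refine ⟨u.1, ?_⟩
    have : F u.1 = f u := by simp [F, u.2]
    simp only [this]
    by_contra hcon
    push Not at hcon
    exact hu (Complex.ext hcon.1 hcon.2)
  · by_contra hcon
    push Not at hcon
    exact hμ (Complex.ext hcon.1 hcon.2)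
end link

section pat
variable {ι : Type*}

/-- sign-summed pattern -/
def Ga (Ψ : Wd ι → ℝ) (i j i' j' : ι) : ℝ :=
  ∑ s : Bool, ∑ t : Bool, ∑ s' : Bool, ∑ t' : Bool,
    (Ψ [((i, s), (j, t))] + Ψ [((i', s'), (j', t'))] - Ψ [((i, s), (j, t)), ((i', s'), (j', t'))])

def Dd (Ψ : Wd ι → ℝ) (i j : ι) : ℝ := ∑ s : Bool, ∑ t : Bool, Ψ [((i, s), (j, t))]

lemma Ga_perm [DecidableEq ι] {z : ι} {G : Type*} [Group G] {Ψ : Wd ι → ℝ} (h : PS z G Ψ)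
    (π : Equiv.Perm ι) (hπ : π z = z) (i j i' j' : ι) :
    Ga Ψ (π i) (π j) (π i') (π j') = Ga Ψ i j i' j' := by
  have hg : (Equiv.prodCongr π (Equiv.refl Bool)) ∈ Rg z := by
    refine ⟨fun b => rfl, fun b => ?_⟩
    show π b.1 = z ↔ _
    nth_rw 1 [← hπ]
    exact π.injective.eq_iff
  have key : ∀ w, Ψ (rl (Equiv.prodCongr π (Equiv.refl Bool)) w) = Ψ w := h.rel _ hg
  unfold Ga
  refine Finset.sum_congr rfl fun s _ => Finset.sum_congr rfl fun t _ =>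
    Finset.sum_congr rfl fun s' _ => Finset.sum_congr rfl fun t' _ => ?_
  rw [← key [((i, s), (j, t))], ← key [((i', s'), (j', t'))],
    ← key [((i, s), (j, t)), ((i', s'), (j', t'))]]
  rfl

lemma Dd_perm [DecidableEq ι] {z : ι} {G : Type*} [Group G] {Ψ : Wd ι → ℝ} (h : PS z G Ψ)
    (π : Equiv.Perm ι) (hπ : π z = z) (i j : ι) :
    Dd Ψ (π i) (π j) = Dd Ψ i j := by
  have hg : (Equiv.prodCongr π (Equiv.refl Bool)) ∈ Rg z := by
    refine ⟨fun b => rfl, fun b => ?_⟩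
    show π b.1 = z ↔ _
    nth_rw 1 [← hπ]
    exact π.injective.eq_iff
  have key : ∀ w, Ψ (rl (Equiv.prodCongr π (Equiv.refl Bool)) w) = Ψ w := h.rel _ hg
  unfold Dd
  refine Finset.sum_congr rfl fun s _ => Finset.sum_congr rfl fun t _ => ?_
  rw [← key [((i, s), (j, t))]]
  rfl

end pat

section comb
variable {n : ℕ}

lemma lemA (F : Fin n → ℝ) (a : Fin n) (c : ℝ) (h : ∀ x, x ≠ a → F x = c) :
    ∑ x, F x = F a + ((n : ℝ) - 1) * c := by
  have : ∑ x, (F x - c) = F a - c := by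
    rw [Finset.sum_eq_single a]
    · intro b _ hb; rw [h b hb, sub_self]
    · simp
  rw [Finset.sum_sub_distrib] at this
  simp at this
  linarith

lemma lemB (F : Fin n → ℝ) (a b : Fin n) (hab : a ≠ b) (c : ℝ)
    (h : ∀ x, x ≠ a → x ≠ b → F x = c) :
    ∑ x, F x = F a + F b + ((n : ℝ) - 2) * c := by
  have := lemA (fun x => F x - if x = b then F b - c else 0) a c (by
    intro x hx
    by_cases hb : x = b
    · simp [hb]
    · simp [hb, h x hx hb])
  rw [Finset.sum_sub_distrib] at this
  simp [hab] at this
  linarith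

lemma lemC (F : Fin n → ℝ) (a b d : Fin n) (hab : a ≠ b) (had : a ≠ d) (hbd : b ≠ d) (c : ℝ)
    (h : ∀ x, x ≠ a → x ≠ b → x ≠ d → F x = c) :
    ∑ x, F x = F a + F b + F d + ((n : ℝ) - 3) * c := by
  have := lemB (fun x => F x - if x = d then F d - c else 0) a b hab c (by
    intro x hx hb
    by_cases hd : x = d
    · simp [hd]
    · simp [hd, h x hx hb hd])
  rw [Finset.sum_sub_distrib] at this
  simp [had, hbd] at this
  linarith

lemma lemP0 (H : Fin n → Fin n → ℝ) (c : ℝ) (h : ∀ x y, x ≠ y → H x y = c) :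
    ∑ x, ∑ y, (if x ≠ y then H x y else 0) = n * (n - 1) * c := by
  have : ∀ x, ∑ y, (if x ≠ y then H x y else 0) = ((n : ℝ) - 1) * c := by
    intro x
    rw [lemA _ x c (fun y hy => by rw [if_pos (Ne.symm hy)]; exact h x y (Ne.symm hy))]
    simp
  simp only [this]
  simp; ring

lemma lemP1 (H : Fin n → Fin n → ℝ) (a : Fin n) (c1 c2 c3 : ℝ) (h1 : ∀ x, x ≠ a → H a x = c1)
    (h2 : ∀ x, x ≠ a → H x a = c2) (h3 : ∀ x y, x ≠ y → x ≠ a → y ≠ a → H x y = c3) :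
    ∑ x, ∑ y, (if x ≠ y then H x y else 0) =
      ((n : ℝ) - 1) * c1 + (n - 1) * c2 + (n - 1) * (n - 2) * c3 := by
  rw [lemA _ a (c2 + (n - 2) * c3)]
  · rw [lemA _ a c1 (fun y hy => by rw [if_pos (Ne.symm hy)]; exact h1 y hy)]
    simp; ring
  · intro x hx
    rw [lemB _ x a hx c3 (fun y hy hya => by
      rw [if_pos (Ne.symm hy)]; exact h3 x y (Ne.symm hy) hx hya)]
    simp [hx, h2 x hx]

lemma lemP2 (H : Fin n → Fin n → ℝ) (a b : Fin n) (hab : a ≠ b) (c1 c2 c3 c4 o : ℝ)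
    (h1 : ∀ x, x ≠ a → x ≠ b → H a x = c1)
    (h2 : ∀ x, x ≠ a → x ≠ b → H b x = c2)
    (h3 : ∀ x, x ≠ a → x ≠ b → H x a = c3)
    (h4 : ∀ x, x ≠ a → x ≠ b → H x b = c4)
    (h5 : ∀ x y, x ≠ y → x ≠ a → x ≠ b → y ≠ a → y ≠ b → H x y = o) :
    ∑ x, ∑ y, (if x ≠ y then H x y else 0) =
      H a b + H b a + ((n : ℝ) - 2) * (c1 + c2 + c3 + c4) + (n - 2) * (n - 3) * o := by
  have hba := hab.symm
  rw [lemB _ a b hab (c3 + c4 + (n - 3) * o)]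
  · rw [lemB _ a b hab c1 (fun y hy hyb => by rw [if_pos (Ne.symm hy)]; exact h1 y hy hyb),
      lemB _ a b hab c2 (fun y hy hyb => by rw [if_pos (Ne.symm hyb)]; exact h2 y hy hyb)]
    simp [hab, hba]; ring
  · intro x hx hxb
    rw [lemC _ x a b hx hxb hab o (fun y hy hya hyb => by
      rw [if_pos (Ne.symm hy)]; exact h5 x y (Ne.symm hy) hx hxb hya hyb)]
    simp [hx, hxb, h3 x hx hxb, h4 x hx hxb]

lemma ext_perm {m : ℕ} (f g : Fin m → Fin n) (hf : Function.Injective f)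
    (hg : Function.Injective g) : ∃ π : Equiv.Perm (Fin n), ∀ x, π (f x) = g x := by
  let e : {x // x ∈ Set.range f} ≃ {x // x ∈ Set.range g} :=
    (Equiv.ofInjective f hf).symm.trans (Equiv.ofInjective g hg)
  refine ⟨e.extendSubtype, fun x => ?_⟩
  rw [Equiv.extendSubtype_apply_of_mem e (f x) ⟨x, rfl⟩]
  have : (Equiv.ofInjective f hf).symm ⟨f x, x, rfl⟩ = x := by
    rw [Equiv.symm_apply_eq]; rfl
  simp [e, this]

lemma sum_Gen' (F : Lt n → ℝ) : ∑ l ∈ Gen n, F l =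
    (∑ j : Fin n, ∑ s : Bool, ∑ t : Bool, F ((0, s), (j.succ, t))) +
    ∑ i : Fin n, ∑ j : Fin n, if i ≠ j then
      ∑ s : Bool, ∑ t : Bool, F ((i.succ, s), (j.succ, t)) else 0 := by
  rw [sum_Gen]
  simp only [gl, Fin.sum_univ_four, Matrix.cons_val, ← Finset.sum_add_distrib]
  rw [Fin.sum_univ_succ]
  have su : ∀ f : Fin (n + 1) → ℝ, ∑ i, f i = f 0 + ∑ i : Fin n, f i.succ := Fin.sum_univ_succ
  simp only [su]
  simp only [ne_eq, not_true_eq_false, and_false, if_false, Fin.succ_ne_zero, not_false_eq_true,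
    and_true, (Fin.succ_ne_zero _).symm, if_true, Fin.succ_inj, zero_add, add_zero]
  conv_rhs => rw [Finset.sum_add_distrib]
  have aux : ∀ a b c d : ℝ, a = c → b = d → a + b = c + d := fun a b c d h h' => by rw [h, h']
  refine aux _ _ _ _ (Finset.sum_congr rfl fun j _ => ?_)
    (Finset.sum_congr rfl fun i _ => Finset.sum_congr rfl fun j _ => ?_)
  · simp only [Fintype.sum_bool]; ring
  · by_cases hij : i = j
    · simp [hij]
    · simp only [hij, not_false_eq_true, if_true, Fintype.sum_bool]; ring

/-- extension of an index map by zero -/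
def ez (e : Fin 5 → Fin n) : Fin 6 → Fin (n + 1) := Fin.cases 0 (fun i => (e i).succ)

lemma ez_inj {e : Fin 5 → Fin n} (he : Function.Injective e) : Function.Injective (ez e) := by
  intro a b
  refine Fin.cases ?_ (fun a => ?_) a <;> refine Fin.cases ?_ (fun b => ?_) b <;>
    simp [ez, (Fin.succ_ne_zero _).symm, he.eq_iff]

def down (e : Fin 5 → Fin n) (Ψ : Wd (Fin (n + 1)) → ℝ) : Wd (Fin 6) → ℝ :=
  fun w => Ψ (rl (Prod.map (ez e) id) w)

lemma down_PS {G : Type*} [Group G] {e : Fin 5 → Fin n} (he : Function.Injective e)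
    {Ψ : Wd (Fin (n + 1)) → ℝ} (h : PS 0 G Ψ) : PS 0 G (down e Ψ) :=
  h.comap (ez e) (ez_inj he) rfl

def pS1 (Ψ : Wd (Fin 6) → ℝ) : ℝ := Ga Ψ 0 1 0 1
def pS2 (Ψ : Wd (Fin 6) → ℝ) : ℝ := Ga Ψ 1 2 1 2 + Ga Ψ 1 2 2 1
def pA2 (Ψ : Wd (Fin 6) → ℝ) : ℝ :=
  Ga Ψ 0 1 0 2 + Ga Ψ 0 1 1 2 + Ga Ψ 1 2 0 1 + Ga Ψ 0 1 2 1 + Ga Ψ 2 1 0 1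
def pO3 (Ψ : Wd (Fin 6) → ℝ) : ℝ := Ga Ψ 0 1 2 3 + Ga Ψ 2 3 0 1
def pA3 (Ψ : Wd (Fin 6) → ℝ) : ℝ := Ga Ψ 1 2 1 3 + Ga Ψ 1 2 2 3 + Ga Ψ 1 2 3 1 + Ga Ψ 1 2 3 2
def pO4 (Ψ : Wd (Fin 6) → ℝ) : ℝ := Ga Ψ 1 2 3 4
def pd1 (Ψ : Wd (Fin 6) → ℝ) : ℝ := Dd Ψ 0 1
def pd2 (Ψ : Wd (Fin 6) → ℝ) : ℝ := Dd Ψ 1 2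

variable {G : Type*} [Group G] {e : Fin 5 → Fin n} {Ψ : Wd (Fin (n + 1)) → ℝ}

/-- Γ on general indices equals the 5-level one, if indices are matched -/
lemma Ga_match (he : Function.Injective e) (h : PS 0 G Ψ) {m : ℕ} (f : Fin m → Fin 5)
    (hf : Function.Injective f) (g : Fin m → Fin n) (hg : Function.Injective g)
    (a b c d : Option (Fin m)) :
    Ga Ψ (a.elim 0 fun x => (g x).succ) (b.elim 0 fun x => (g x).succ)
      (c.elim 0 fun x => (g x).succ) (d.elim 0 fun x => (g x).succ) =
    Ga (down e Ψ) (a.elim 0 fun x => (f x).succ) (b.elim 0 fun x => (f x).succ)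
      (c.elim 0 fun x => (f x).succ) (d.elim 0 fun x => (f x).succ) := by
  obtain ⟨π, hπ⟩ := ext_perm (e ∘ f) g (he.comp hf) hg
  let π' : Equiv.Perm (Fin (n + 1)) :=
    { toFun := Fin.cases 0 (fun i => (π i).succ)
      invFun := Fin.cases 0 (fun i => (π.symm i).succ)
      left_inv := fun i => by refine Fin.cases ?_ (fun i => ?_) i <;> simp
      right_inv := fun i => by refine Fin.cases ?_ (fun i => ?_) i <;> simp }
  have key : ∀ a : Option (Fin m), (a.elim 0 fun x => (g x).succ) =
      π' (ez e (a.elim 0 fun x => (f x).succ)) := by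
    intro a
    cases a with
    | none => rfl
    | some x => simp only [Option.elim, ← hπ]; rfl
  rw [key a, key b, key c, key d, Ga_perm h π' rfl]
  rfl

lemma Dd_match (he : Function.Injective e) (h : PS 0 G Ψ) {m : ℕ} (f : Fin m → Fin 5)
    (hf : Function.Injective f) (g : Fin m → Fin n) (hg : Function.Injective g)
    (a b : Option (Fin m)) :
    Dd Ψ (a.elim 0 fun x => (g x).succ) (b.elim 0 fun x => (g x).succ) =
    Dd (down e Ψ) (a.elim 0 fun x => (f x).succ) (b.elim 0 fun x => (f x).succ) := by
  obtain ⟨π, hπ⟩ := ext_perm (e ∘ f) g (he.comp hf) hg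
  let π' : Equiv.Perm (Fin (n + 1)) :=
    { toFun := Fin.cases 0 (fun i => (π i).succ)
      invFun := Fin.cases 0 (fun i => (π.symm i).succ)
      left_inv := fun i => by refine Fin.cases ?_ (fun i => ?_) i <;> simp
      right_inv := fun i => by refine Fin.cases ?_ (fun i => ?_) i <;> simp }
  have key : ∀ a : Option (Fin m), (a.elim 0 fun x => (g x).succ) =
      π' (ez e (a.elim 0 fun x => (f x).succ)) := by
    intro a
    cases a with
    | none => rfl
    | some x => simp only [Option.elim, ← hπ]; rfl
  rw [key a, key b, Dd_perm h π' rfl]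
  rfl

lemma inj1 (a : Fin n) : Function.Injective ![a] := by
  intro x y _; exact Subsingleton.elim x y
lemma inj2 {a b : Fin n} (h : a ≠ b) : Function.Injective ![a, b] := by
  intro x y; fin_cases x <;> fin_cases y <;> simp [h, h.symm]
lemma inj3 {a b c : Fin n} (h : a ≠ b) (h1 : c ≠ a) (h2 : c ≠ b) :
    Function.Injective ![a, b, c] := by
  intro x y; fin_cases x <;> fin_cases y <;> simp [h, h.symm, h1, h2, h1.symm, h2.symm]
lemma inj4 {a b c d : Fin n} (h : a ≠ b) (h1 : c ≠ a) (h2 : c ≠ b) (h3 : d ≠ a) (h4 : d ≠ b)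
    (h5 : c ≠ d) : Function.Injective ![a, b, c, d] := by
  intro x y; fin_cases x <;> fin_cases y <;>
    simp [h, h.symm, h1, h2, h1.symm, h2.symm, h3, h4, h5, h3.symm, h4.symm, h5.symm]

lemma f1 : Function.Injective (![0] : Fin 1 → Fin 5) := by decide
lemma f2 : Function.Injective (![0, 1] : Fin 2 → Fin 5) := by decide
lemma f2' : Function.Injective (![1, 0] : Fin 2 → Fin 5) := by decide
lemma f3 : Function.Injective (![0, 1, 2] : Fin 3 → Fin 5) := by decide
lemma f3' : Function.Injective (![1, 2, 0] : Fin 3 → Fin 5) := by decide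
lemma f4 : Function.Injective (![0, 1, 2, 3] : Fin 4 → Fin 5) := by decide

lemma sum_Psi (he : Function.Injective e) (h : PS 0 G Ψ) : ∑ l ∈ Gen n, Ψ [l] =
    n * pd1 (down e Ψ) + n * (n - 1) * pd2 (down e Ψ) := by
  rw [sum_Gen']
  congr 1
  · have : ∀ j : Fin n, ∑ s : Bool, ∑ t : Bool, Ψ [((0, s), (j.succ, t))] = pd1 (down e Ψ) :=
      fun j => Dd_match he h ![0] f1 ![j] (inj1 j) none (some 0)
    simp only [this]
    simp
  · refine lemP0 _ _ fun x y hxy => ?_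
    exact Dd_match he h ![0, 1] f2 ![x, y] (inj2 hxy) (some 0) (some 1)

/-- the N-only part of the total sum -/
def totN (Ψ : Wd (Fin (n + 1)) → ℝ) : ℝ :=
  ∑ i : Fin n, ∑ j : Fin n, if i ≠ j then
    (∑ i' : Fin n, ∑ j' : Fin n, if i' ≠ j' then Ga Ψ i.succ j.succ i'.succ j'.succ else 0) else 0

lemma totN_eq (he : Function.Injective e) (h : PS 0 G Ψ) : totN Ψ =
    n * (n - 1) * (pS2 (down e Ψ) + (n - 2) * pA3 (down e Ψ) +
      (n - 2) * (n - 3) * pO4 (down e Ψ)) := by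
  refine lemP0 (fun i j => ∑ i' : Fin n, ∑ j' : Fin n,
    if i' ≠ j' then Ga Ψ i.succ j.succ i'.succ j'.succ else 0) _ fun i j hij => ?_
  rw [lemP2 (fun i' j' => Ga Ψ i.succ j.succ i'.succ j'.succ) i j hij
    (Ga (down e Ψ) 1 2 1 3) (Ga (down e Ψ) 1 2 2 3) (Ga (down e Ψ) 1 2 3 1)
    (Ga (down e Ψ) 1 2 3 2) (pO4 (down e Ψ))
    (fun x h1 h2 => Ga_match he h ![0, 1, 2] f3 ![i, j, x] (inj3 hij h1 h2)
      (some 0) (some 1) (some 0) (some 2))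
    (fun x h1 h2 => Ga_match he h ![0, 1, 2] f3 ![i, j, x] (inj3 hij h1 h2)
      (some 0) (some 1) (some 1) (some 2))
    (fun x h1 h2 => Ga_match he h ![0, 1, 2] f3 ![i, j, x] (inj3 hij h1 h2)
      (some 0) (some 1) (some 2) (some 0))
    (fun x h1 h2 => Ga_match he h ![0, 1, 2] f3 ![i, j, x] (inj3 hij h1 h2)
      (some 0) (some 1) (some 2) (some 1))
    (fun x y h0 h1 h2 h3 h4 => Ga_match he h ![0, 1, 2, 3] f4 ![i, j, x, y]
      (inj4 hij h1 h2 h3 h4 h0) (some 0) (some 1) (some 2) (some 3))]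
  have e1 : Ga Ψ i.succ j.succ i.succ j.succ = Ga (down e Ψ) 1 2 1 2 :=
    Ga_match he h ![0, 1] f2 ![i, j] (inj2 hij) (some 0) (some 1) (some 0) (some 1)
  have e2 : Ga Ψ i.succ j.succ j.succ i.succ = Ga (down e Ψ) 1 2 2 1 :=
    Ga_match he h ![0, 1] f2 ![i, j] (inj2 hij) (some 0) (some 1) (some 1) (some 0)
  rw [e1, e2, pS2, pA3]

lemma tot_split (Ψ : Wd (Fin (n + 1)) → ℝ) :
    ∑ l ∈ Gen n, ∑ m ∈ Gen n, (Ψ [l] + Ψ [m] - Ψ [l, m]) =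
    (∑ j : Fin n, ∑ j' : Fin n, Ga Ψ 0 j.succ 0 j'.succ) +
    (∑ j : Fin n, ∑ i' : Fin n, ∑ j' : Fin n,
      if i' ≠ j' then Ga Ψ 0 j.succ i'.succ j'.succ else 0) +
    (∑ i : Fin n, ∑ j : Fin n, if i ≠ j then
      ∑ j' : Fin n, Ga Ψ i.succ j.succ 0 j'.succ else 0) + totN Ψ := by
  have key : ∀ i j : Fin (n + 1), ∑ s : Bool, ∑ t : Bool, ∑ m ∈ Gen n,
      (Ψ [((i, s), (j, t))] + Ψ [m] - Ψ [((i, s), (j, t)), m]) =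
      (∑ j' : Fin n, Ga Ψ i j 0 j'.succ) + ∑ i' : Fin n, ∑ j' : Fin n,
        if i' ≠ j' then Ga Ψ i j i'.succ j'.succ else 0 := by
    intro i j
    simp only [sum_Gen' (fun m => Ψ [((i, _), (j, _))] + Ψ [m] - Ψ [((i, _), (j, _)), m])]
    simp only [Finset.sum_add_distrib]
    have sw : ∀ (F : Bool → Bool → Fin n → ℝ), ∑ s, ∑ t, ∑ x, F s t x = ∑ x, ∑ s, ∑ t, F s t x := by
      intro F
      rw [Finset.sum_congr rfl fun s _ => Finset.sum_comm, Finset.sum_comm]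
    congr 1
    · rw [sw]; rfl
    · rw [sw]
      refine Finset.sum_congr rfl fun i' _ => ?_
      rw [sw]
      refine Finset.sum_congr rfl fun j' _ => ?_
      split_ifs
      · rfl
      · simp
  rw [sum_Gen' (fun l => ∑ m ∈ Gen n, (Ψ [l] + Ψ [m] - Ψ [l, m]))]
  simp only [key]
  rw [Finset.sum_add_distrib, totN]
  have : ∀ i j : Fin n, ∀ x y : ℝ, (if i ≠ j then x + y else 0) =
      (if i ≠ j then x else 0) + (if i ≠ j then y else 0) := by
    intro i j x y; split_ifs <;> simp
  simp only [this, Finset.sum_add_distrib]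
  ring

lemma tot_eq (he : Function.Injective e) (h : PS 0 G Ψ) :
    ∑ l ∈ Gen n, ∑ m ∈ Gen n, (Ψ [l] + Ψ [m] - Ψ [l, m]) =
    n * pS1 (down e Ψ) + n * (n - 1) * pA2 (down e Ψ) + n * (n - 1) * (n - 2) * pO3 (down e Ψ) +
    n * (n - 1) * (pS2 (down e Ψ) + (n - 2) * pA3 (down e Ψ) +
      (n - 2) * (n - 3) * pO4 (down e Ψ)) := by
  rw [tot_split, totN_eq he h]
  have e1 : ∀ j : Fin n, ∑ j' : Fin n, Ga Ψ 0 j.succ 0 j'.succ =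
      pS1 (down e Ψ) + (n - 1) * Ga (down e Ψ) 0 1 0 2 := by
    intro j
    rw [lemA (fun j' => Ga Ψ 0 j.succ 0 j'.succ) j (Ga (down e Ψ) 0 1 0 2) (fun x hx =>
      Ga_match he h ![0, 1] f2 ![j, x] (inj2 hx.symm) none (some 0) none (some 1))]
    congr 1
    exact Ga_match he h ![0] f1 ![j] (inj1 j) none (some 0) none (some 0)
  have e2 : ∀ j : Fin n, (∑ i' : Fin n, ∑ j' : Fin n,
      if i' ≠ j' then Ga Ψ 0 j.succ i'.succ j'.succ else 0) =
      (n - 1) * Ga (down e Ψ) 0 1 1 2 + (n - 1) * Ga (down e Ψ) 0 1 2 1 +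
      (n - 1) * (n - 2) * Ga (down e Ψ) 0 1 2 3 := by
    intro j
    exact lemP1 (fun i' j' => Ga Ψ 0 j.succ i'.succ j'.succ) j _ _ _
      (fun x hx => Ga_match he h ![0, 1] f2 ![j, x] (inj2 hx.symm)
        none (some 0) (some 0) (some 1))
      (fun x hx => Ga_match he h ![0, 1] f2 ![j, x] (inj2 hx.symm)
        none (some 0) (some 1) (some 0))
      (fun x y hxy hx hy => Ga_match he h ![0, 1, 2] f3 ![j, x, y] (inj3 hx.symm hy hxy.symm)
        none (some 0) (some 1) (some 2))
  have e3 : (∑ i : Fin n, ∑ j : Fin n, if i ≠ j then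
      ∑ j' : Fin n, Ga Ψ i.succ j.succ 0 j'.succ else 0) =
      n * (n - 1) * (Ga (down e Ψ) 1 2 0 1 + Ga (down e Ψ) 2 1 0 1 +
        (n - 2) * Ga (down e Ψ) 2 3 0 1) := by
    refine lemP0 (fun i j => ∑ j' : Fin n, Ga Ψ i.succ j.succ 0 j'.succ) _ fun i j hij => ?_
    rw [lemB (fun j' => Ga Ψ i.succ j.succ 0 j'.succ) i j hij (Ga (down e Ψ) 2 3 0 1) (fun x h1 h2 =>
      Ga_match he h ![1, 2, 0] f3' ![i, j, x] (inj3 hij h1 h2)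
        (some 0) (some 1) none (some 2))]
    congr 2
    · exact Ga_match he h ![0, 1] f2 ![i, j] (inj2 hij) (some 0) (some 1) none (some 0)
    · exact Ga_match he h ![1, 0] f2' ![i, j] (inj2 hij) (some 0) (some 1) none (some 1)
  simp only [e1, e2]
  rw [e3, pA2, pO3]
  simp only [Finset.sum_const, Finset.card_univ, Fintype.card_fin, nsmul_eq_mul]
  ring

end comb

section pos
variable {G : Type*} [Group G] {Ψ : Wd (Fin 6) → ℝ}

lemma psd_set {ι : Type*} [DecidableEq ι] {z : ι} {Ψ : Wd ι → ℝ} (h : PS z G Ψ) (I : Type)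
    [Fintype I] (l : I → (ι × Bool) × (ι × Bool)) (σ : Equiv.Perm I)
    (hσ : ∀ i, l (σ i) = linv (l i)) (y : I → ℝ) (hy : ∀ i, y (σ i) = y i) :
    0 ≤ ∑ i, ∑ j, y i * y j * (Ψ [l i] + Ψ [l j] - Ψ [l i, l j]) := by
  have := h.psd I y (fun i => [l i])
  rw [← Equiv.sum_comp σ] at this
  refine this.trans (le_of_eq ?_)
  refine Finset.sum_congr rfl fun i _ => Finset.sum_congr rfl fun j _ => ?_
  have e1 : Ψ [l (σ i)] = Ψ [l i] := by rw [hσ]; exact h.inv [l i]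
  have e2 : winv [l (σ i)] = [l i] := by simp [winv, hσ]
  rw [e1, hy, e2]
  rfl

lemma gen_sum_nonneg {n : ℕ} {Ψ : Wd (Fin (n + 1)) → ℝ} (h : PS 0 G Ψ) :
    0 ≤ ∑ l ∈ Gen n, ∑ m ∈ Gen n, (Ψ [l] + Ψ [m] - Ψ [l, m]) := by
  have := psd_set h (Lt n) id ⟨linv, linv, linv_linv, linv_linv⟩ (fun _ => rfl)
    (fun l => if l ∈ Gen n then 1 else 0) (fun l => by simp [linv_mem_Gen])
  simp only [id] at this
  have e : ∀ l m : Lt n, (if l ∈ Gen n then (1 : ℝ) else 0) * (if m ∈ Gen n then 1 else 0) *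
      (Ψ [l] + Ψ [m] - Ψ [l, m]) = if l ∈ Gen n then
        (if m ∈ Gen n then (Ψ [l] + Ψ [m] - Ψ [l, m]) else 0) else 0 := by
    intro l m; split_ifs <;> simp
  simp only [e] at this
  refine this.trans (le_of_eq ?_)
  have q : ∀ F : Lt n → ℝ, ∑ l, (if l ∈ Gen n then F l else 0) = ∑ l ∈ Gen n, F l := by
    intro F; rw [Finset.sum_ite_mem]; simp
  rw [← q]
  refine Finset.sum_congr rfl fun l _ => ?_
  split_ifs
  · exact q _
  · simp

lemma totN_nonneg {n : ℕ} {Ψ : Wd (Fin (n + 1)) → ℝ} (h : PS 0 G Ψ) : 0 ≤ totN Ψ := by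
  let I := (Fin n × Bool) × (Fin n × Bool)
  let l : I → Lt n := fun x => ((x.1.1.succ, x.1.2), (x.2.1.succ, x.2.2))
  let y : I → ℝ := fun x => if x.1.1 ≠ x.2.1 then 1 else 0
  have := psd_set h I l ⟨fun x => (x.1, fl x.2), fun x => (x.1, fl x.2),
    fun x => by simp, fun x => by simp⟩ (fun _ => rfl) y (fun x => by simp [y, fl])
  have sN : ∀ F : I → ℝ, ∑ x, y x * F x = ∑ i : Fin n, ∑ j : Fin n, if i ≠ j then
      ∑ s : Bool, ∑ t : Bool, F ((i, s), (j, t)) else 0 := by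
    intro F
    simp only [I, Fintype.sum_prod_type, y]
    refine Finset.sum_congr rfl fun i _ => ?_
    rw [Finset.sum_comm]
    refine Finset.sum_congr rfl fun j _ => ?_
    split_ifs
    · simp
    · simp
  simp only [mul_assoc, ← Finset.mul_sum] at this
  rw [sN] at this
  refine this.trans (le_of_eq ?_)
  unfold totN
  refine Finset.sum_congr rfl fun i _ => Finset.sum_congr rfl fun j _ => ?_
  split_ifs
  · simp only [sN]
    have sw : ∀ (F : Bool → Bool → Fin n → ℝ), ∑ s, ∑ t, ∑ x, F s t x = ∑ x, ∑ s, ∑ t, F s t x := by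
      intro F
      rw [Finset.sum_congr rfl fun s _ => Finset.sum_comm, Finset.sum_comm]
    rw [sw]
    refine Finset.sum_congr rfl fun i' _ => ?_
    rw [sw]
    refine Finset.sum_congr rfl fun j' _ => ?_
    split_ifs
    · rfl
    · simp
  · rfl

lemma Ga_comm_nonneg (h : PS 0 G Ψ) (i j i' j' : Fin 6) (h1 : i ≠ i') (h2 : i ≠ j') (h3 : j ≠ i') :
    0 ≤ Ga Ψ i j i' j' := by
  have key : ∀ s t s' t' : Bool, 0 ≤ 2 * (Ψ [((i, s), (j, t))] + Ψ [((i', s'), (j', t'))]) -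
      Ψ [((i, s), (j, t)), ((i', s'), (j', t'))] -
      Ψ [((i, s), (j, !t)), ((i', s'), (j', t'))] := by
    intro s t s' t'
    set l := ((i, s), (j, t)) with hl
    set m := ((i', s'), (j', t')) with hm
    have hc : ∀ (l m : (Fin 6 × Bool) × (Fin 6 × Bool)) (S : Fin 6 → G), l.1.1 ≠ m.1.1 →
        l.1.1 ≠ m.2.1 → l.2.1 ≠ m.1.1 → lact l (lact m S) = lact m (lact l S) := by
      intro l m S a b c
      funext p
      unfold lact
      by_cases e1 : l.1.1 = l.2.1
      · simp [e1]
      by_cases e2 : m.1.1 = m.2.1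
      · simp [e2]
      simp only [e1, e2, if_false]
      by_cases p1 : p = l.1.1
      · subst p1
        simp [Function.update_of_ne a, sv, Function.update_of_ne c, Function.update_of_ne b.symm]
      · by_cases p2 : p = m.1.1
        · subst p2
          simp [Function.update_of_ne a.symm, sv, Function.update_of_ne b.symm]
        · simp [Function.update_of_ne p1, Function.update_of_ne p2]
    have := h.psd (Fin 4) ![1, -1, -1, 1] ![[], [l], [m], [l, m]]
    simp only [Fin.sum_univ_four, Matrix.cons_val, winv, List.map_cons, List.map_nil,
      List.reverse_cons, List.reverse_nil, List.nil_append, List.append_nil, List.cons_append] at this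
    have hb : ∀ S : Fin 6 → G, lact l (lact m S) = lact m (lact l S) := fun S => hc l m S h1 h2 h3
    have r0 : Ψ [] = 0 := h.nil
    have r1 : Ψ [linv l] = Ψ [l] := h.inv [l]
    have r2 : Ψ [linv m] = Ψ [m] := h.inv [m]
    have r3 : Ψ [linv m, linv l] = Ψ [l, m] := h.inv [l, m]
    have r4 : Ψ [linv l, l] = 0 := h.inv_self [l]
    have r5 : Ψ [linv m, m] = 0 := h.inv_self [m]
    have r6 : Ψ [linv m, l] = Ψ [linv l, m] := by
      rw [← h.inv [linv m, l]]; simp [winv]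
    have r7 : Ψ [linv l, l, m] = Ψ [m] := h.eq _ _ fun S => by simp [wact, lact_linv']
    have r8 : Ψ [linv m, l, m] = Ψ [l] := h.eq _ _ fun S => by
      simp only [wact, List.foldl_cons, List.foldl_nil]
      rw [← hb, lact_linv']
    have r9 : Ψ [linv m, linv l, l] = Ψ [m] := by
      rw [← r2]; exact h.eq _ _ fun S => by simp [wact, lact_linv']
    have r10 : Ψ [linv m, linv l, m] = Ψ [l] := by
      rw [← r8, ← h.inv [linv m, l, m]]; simp [winv]
    have r11 : Ψ [linv m, linv l, l, m] = 0 := h.inv_self [l, m]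
    rw [r0, r1, r2, r3, r4, r5, r6, r7, r8, r9, r10, r11] at this
    have r12 : linv l = ((i, s), (j, !t)) := rfl
    rw [← r12]
    linarith
  have := Finset.sum_nonneg fun s (_ : s ∈ Finset.univ) => Finset.sum_nonneg
    fun t (_ : t ∈ Finset.univ) => Finset.sum_nonneg fun s' (_ : s' ∈ Finset.univ) =>
      Finset.sum_nonneg fun t' (_ : t' ∈ Finset.univ) => key s t s' t'
  unfold Ga
  simp only [Fintype.sum_bool, Bool.not_true, Bool.not_false] at this ⊢
  have f1 : ∀ s t, Ψ [((i, s), (j, t))] = Ψ [((i, s), (j, !t))] := fun s t =>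
    (h.inv [((i, s), (j, t))]).symm
  have f2 := f1 true true
  have f3 := f1 false true
  simp only [Bool.not_true] at f2 f3
  linarith

lemma Ga_symm (h : PS 0 G Ψ) (i j i' j' : Fin 6) : Ga Ψ i j i' j' = Ga Ψ i' j' i j := by
  have key : ∀ s t s' t', Ψ [((i, s), (j, t)), ((i', s'), (j', t'))] =
      Ψ [((i', s'), (j', !t')), ((i, s), (j, !t))] := by
    intro s t s' t'
    rw [← h.inv]; rfl
  unfold Ga
  simp only [key]
  simp only [Fintype.sum_bool, Bool.not_true, Bool.not_false]
  ring

lemma down_id (Ψ : Wd (Fin 6) → ℝ) : down id Ψ = Ψ := by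
  have : ez (id : Fin 5 → Fin 5) = id := by
    funext i; refine Fin.cases rfl (fun i => rfl) i
  funext w
  simp [down, this, rl]

/-- the two certificates give the key inequality -/
theorem key_of_certs {k : ℕ} (hk : 5 < k)
    (hN : ∀ Ψ : Wd (Fin 6) → ℝ, PS 0 G Ψ → 93 / 64 * pd2 Ψ ≤ 3 * pA3 Ψ + 18 * pO4 Ψ)
    (hC : ∀ Ψ : Wd (Fin 6) → ℝ, PS 0 G Ψ →
      45 / 32 * pd1 Ψ - 21 / 8 * pd2 Ψ ≤ 4 * pA2 Ψ + 32 * pO3 Ψ) : KEY k G := by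
  intro Ψ h
  let e : Fin 5 → Fin k := Fin.castLE hk.le
  have he : Function.Injective e := Fin.castLE_injective _
  rw [sum_Psi he h, tot_eq he h]
  have h5 := down_PS he h
  set Φ := down e Ψ
  have c1 := hN Φ h5
  have c2 := hC Φ h5
  have c3 := totN_nonneg (n := 5) h5
  rw [totN_eq (e := id) Function.injective_id h5, down_id] at c3
  have c4 := gen_sum_nonneg (n := 5) h5
  rw [tot_eq (e := id) Function.injective_id h5, down_id] at c4
  have c5 : 0 ≤ pO4 Φ := Ga_comm_nonneg h5 _ _ _ _ (by decide) (by decide) (by decide)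
  have c6 : 0 ≤ pO3 Φ := add_nonneg
    (Ga_comm_nonneg h5 _ _ _ _ (by decide) (by decide) (by decide))
    (Ga_comm_nonneg h5 _ _ _ _ (by decide) (by decide) (by decide))
  have c7 : 0 ≤ pd1 Φ := by
    unfold pd1 Dd
    exact Finset.sum_nonneg fun _ _ => Finset.sum_nonneg fun _ _ => h5.nonneg _
  have c8 : 0 ≤ pd2 Φ := by
    unfold pd2 Dd
    exact Finset.sum_nonneg fun _ _ => Finset.sum_nonneg fun _ _ => h5.nonneg _
  generalize pO4 Φ = O4 at *
  generalize pO3 Φ = O3 at *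
  generalize pA3 Φ = A3 at *
  generalize pA2 Φ = A2 at *
  generalize pS1 Φ = S1 at *
  generalize pS2 Φ = S2 at *
  generalize pd1 Φ = d1 at *
  generalize pd2 Φ = d2 at *
  have hk6 : (6 : ℝ) ≤ k := by exact_mod_cast hk
  generalize (k : ℝ) = K at *
  push_cast at c3 c4
  have q1 : 0 ≤ K := by linarith
  have q5 : 0 ≤ K - 5 := by linarith
  have q6 : 0 ≤ K - 6 := by linarith
  have q7 : 0 ≤ K - 1 := by linarith
  have t1 := mul_nonneg q1 c4
  have t2 := mul_nonneg (mul_nonneg q1 q5) c3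
  have t3 := mul_nonneg (mul_nonneg (mul_nonneg q1 q7) q5) (sub_nonneg.2 c1)
  have t4 := mul_nonneg (mul_nonneg q1 q5) (sub_nonneg.2 c2)
  have t5 := mul_nonneg (mul_nonneg (mul_nonneg q1 q5) q6) c6
  have t6 := mul_nonneg (mul_nonneg (mul_nonneg (mul_nonneg q1 q7) q5) q6) c5
  have t7 := mul_nonneg (mul_nonneg q1 q5) c7
  have t8 := mul_nonneg (mul_nonneg q1 q5) c8
  have t9 := mul_nonneg (mul_nonneg (mul_nonneg q1 q5) q6) c8
  ring_nf at t1 t2 t3 t4 t5 t6 t7 t8 t9 ⊢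
  linarith
end pos

abbrev PP := Equiv.Perm (Fin 5)
abbrev SS := Fin 6 → Bool

def hat (π : PP) : Equiv.Perm (Fin 6) where
  toFun := Fin.cases 0 (fun j => (π j).succ)
  invFun := Fin.cases 0 (fun j => (π.symm j).succ)
  left_inv := by intro i; refine Fin.cases ?_ (fun j => ?_) i <;> simp
  right_inv := by intro i; refine Fin.cases ?_ (fun j => ?_) i <;> simp

@[simp] lemma hat_zero (π : PP) : hat π 0 = 0 := rfl
@[simp] lemma hat_succ (π : PP) (j : Fin 5) : hat π j.succ = (π j).succ := rfl

lemma hat_mul (π w : PP) (i : Fin 6) : hat (π * w) i = hat π (hat w i) := by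
  refine Fin.cases ?_ (fun j => ?_) i <;> simp

def xs (s : SS) : Equiv.Perm SS where
  toFun t := fun i => xor (t i) (s i)
  invFun t := fun i => xor (t i) (s i)
  left_inv := by intro t; funext i; simp
  right_inv := by intro t; funext i; simp

def act (π : PP) (σ : SS) : Equiv.Perm (Fin 6 × Bool) where
  toFun b := (hat π b.1, xor b.2 (σ b.1))
  invFun b := ((hat π).symm b.1, xor b.2 (σ ((hat π).symm b.1)))
  left_inv := by intro b; simp
  right_inv := by intro b; simp

lemma act_apply (π : PP) (σ : SS) (b) : act π σ b = (hat π b.1, xor b.2 (σ b.1)) := rfl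

lemma act_mem (π : PP) (σ : SS) : act π σ ∈ Rg (0 : Fin 6) := by
  constructor
  · rintro ⟨b, s⟩; simp [act_apply, fl]
  · rintro ⟨b, s⟩
    simp only [act_apply]
    refine Fin.cases ?_ (fun j => ?_) b <;> simp

lemma act_mul (π w : PP) (σ s : SS) (b) :
    act π σ (act w s b) = act (π * w) (xs (fun i => σ (hat w i)) s) b := by
  simp [act_apply, hat_mul, xs, Bool.xor_assoc]

def chi (A σ : SS) : ℝ := ∏ i, if (A i && σ i) then -1 else 1

lemma chi_xs (A σ s : SS) : chi A (xs σ s) = chi A s * chi A σ := by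
  unfold chi
  rw [← Finset.prod_mul_distrib]
  apply Finset.prod_congr rfl
  intro i _
  have aux : ∀ a b c : Bool, (if (a && (xor b c)) then (-1:ℝ) else 1) =
      (if (a && b) then -1 else 1) * (if (a && c) then -1 else 1) := by
    intro a b c; cases a <;> cases b <;> cases c <;> simp
  exact aux (A i) (s i) (σ i)

lemma chi_comp (A σ : SS) (e : Equiv.Perm (Fin 6)) : chi (fun i => A (e i)) (fun i => σ (e i)) = chi A σ := by
  unfold chi
  exact Equiv.prod_comp e (fun i => if (A i && σ i) then (-1:ℝ) else 1)

lemma chi_sq (A σ : SS) : chi A σ * chi A σ = 1 := by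
  unfold chi
  rw [← Finset.prod_mul_distrib]
  apply Finset.prod_eq_one
  intro i _
  split_ifs <;> norm_num

def tws (t : Bool) (π : PP) : ℝ := if t then ((Equiv.Perm.sign π : ℤ) : ℝ) else 1

lemma tws_mul (t : Bool) (π w : PP) : tws t (π * w) = tws t π * tws t w := by
  cases t <;> simp [tws]

lemma tws_sq (t : Bool) (π : PP) : tws t π * tws t π = 1 := by
  cases t
  · simp [tws]
  · simp only [tws, if_true]
    rcases Int.units_eq_one_or (Equiv.Perm.sign π) with h | h <;> simp [h]

/-- the overlap sum -/
def ovl (π : PP) (m m' : Fin 5 → Fin 5 → ℝ) : ℝ := ∑ p, ∑ q, m (π p) (π q) * m' p q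

def bb (Ψ : Wd (Fin 6) → ℝ) (w v : Wd (Fin 6)) : ℝ := Ψ w + Ψ v - Ψ (winv w ++ v)

def Rr (t : Bool) (A : SS) (m : Fin 5 → Fin 5 → ℝ) (π : PP) (σ : SS) (B : SS) (p q : Fin 5) : ℝ :=
  tws t π * chi A σ * (if (fun i => B (hat π i)) = A then 1 else 0) * m (π.symm p) (π.symm q)

lemma Rr_sum (t : Bool) (A A' : SS) (m m' : Fin 5 → Fin 5 → ℝ) (π w : PP) (σ s : SS) :
    ∑ B, ∑ p, ∑ q, Rr t A m π σ B p q *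
      Rr t A' m' (π * w) (xs (fun i => σ (hat w i)) s) B p q =
    if (fun i => A (hat w i)) = A' then tws t w * chi A' s * ovl w m m' else 0 := by
  have e1 : ∀ B : SS, ∑ p, ∑ q, Rr t A m π σ B p q *
      Rr t A' m' (π * w) (xs (fun i => σ (hat w i)) s) B p q =
      if (fun i => B (hat π i)) = A then
        (if (fun i => A (hat w i)) = A' then tws t w * chi A' s * ovl w m m' else 0) else 0 := by
    intro B
    by_cases hB : (fun i => B (hat π i)) = A
    · have e : (fun i => B (hat (π * w) i)) = fun i => A (hat w i) := by
        funext i; rw [hat_mul]; exact congrFun hB (hat w i)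
      by_cases hA : (fun i => A (hat w i)) = A'
      · simp only [Rr, hB, e, hA, if_true, chi_xs, tws_mul]
        have e3 : chi A' (fun i => σ (hat w i)) = chi A σ := by
          rw [← hA]; exact chi_comp A σ (hat w)
        rw [e3, ← Equiv.sum_comp (π * w), ovl, Finset.mul_sum]
        apply Finset.sum_congr rfl; intro p _
        rw [← Equiv.sum_comp (π * w), Finset.mul_sum]
        apply Finset.sum_congr rfl; intro q _
        have : ∀ x, (Equiv.symm π) ((π * w) x) = w x := by intro x; simp
        rw [this, this, Equiv.symm_apply_apply, Equiv.symm_apply_apply]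
        linear_combination (chi A σ * chi A σ * tws t w * chi A' s * m (w p) (w q) * m' p q) * tws_sq t π
          + (tws t w * chi A' s * m (w p) (w q) * m' p q) * chi_sq A σ
      · simp [Rr, e, hA]
    · simp [Rr, hB]
  rw [Finset.sum_congr rfl (fun B _ => e1 B)]
  have e2 : ∀ B : SS, ((fun i => B (hat π i)) = A) ↔ B = fun i => A ((hat π).symm i) := by
    intro B
    constructor
    · intro h; funext i; rw [← h]; simp
    · intro h; funext i; rw [h]; simp
  simp only [e2]
  simp

lemma rl_act_mul (π w : PP) (σ s : SS) (x : Wd (Fin 6)) :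
    rl (act (π * w) (xs (fun i => σ (hat w i)) s)) x = rl (act π σ) (rl (act w s) x) := by
  rw [rl_rl]; congr 1; funext b; simp [act_mul]

lemma bb_rl {G : Type*} [Group G] {Ψ : Wd (Fin 6) → ℝ} (h : PS 0 G Ψ) (π : PP) (σ : SS)
    (x y : Wd (Fin 6)) : bb Ψ (rl (act π σ) x) (rl (act π σ) y) = bb Ψ x y := by
  unfold bb
  rw [h.rel _ (act_mem π σ), h.rel _ (act_mem π σ), ← rl_winv _ (act_mem π σ).1, ← rl_append,
    h.rel _ (act_mem π σ)]

theorem psd_rows {G : Type*} [Group G] {Ψ : Wd (Fin 6) → ℝ} (h : PS 0 G Ψ) {U : Type} [Fintype U]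
    {T N : ℕ} (x : U → Wd (Fin 6)) (blk : U → Fin T) (tw : Fin T → Bool) (A : U → SS)
    (m : U → Fin 5 → Fin 5 → ℝ) (L : U → Fin N → ℝ) :
    0 ≤ ∑ u, ∑ v, ∑ π : PP, ∑ σ : SS,
      (if blk u = blk v ∧ (fun i => A u (hat π i)) = A v then
        (∑ p, L u p * L v p) * (tws (tw (blk u)) π * chi (A v) σ * ovl π (m u) (m v)) else 0) *
      bb Ψ (x u) (rl (act π σ) (x v)) := by
  have key : ∀ (t : Fin T) (p : Fin N) (B : SS) (i j : Fin 5),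
      0 ≤ ∑ u, ∑ π : PP, ∑ σ : SS, ∑ v, ∑ w : PP, ∑ s : SS,
        ((if blk u = t then L u p else 0) * Rr (tw t) (A u) (m u) π σ B i j) *
        ((if blk v = t then L v p else 0) *
          Rr (tw t) (A v) (m v) (π * w) (xs (fun i => σ (hat w i)) s) B i j) *
        bb Ψ (x u) (rl (act w s) (x v)) := by
    intro t p B i j
    have := h.psd (U × PP × SS)
      (fun a => (if blk a.1 = t then L a.1 p else 0) * Rr (tw t) (A a.1) (m a.1) a.2.1 a.2.2 B i j)
      (fun a => rl (act a.2.1 a.2.2) (x a.1))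
    refine this.trans (le_of_eq ?_)
    simp only [Fintype.sum_prod_type]
    refine Finset.sum_congr rfl fun u _ => Finset.sum_congr rfl fun π _ =>
      Finset.sum_congr rfl fun σ _ => Finset.sum_congr rfl fun v _ => ?_
    rw [← Equiv.sum_comp (Equiv.mulLeft π)]
    refine Finset.sum_congr rfl fun w _ => ?_
    rw [← Equiv.sum_comp (xs (fun i => σ (hat w i)))]
    refine Finset.sum_congr rfl fun s _ => ?_
    simp only [Equiv.coe_mulLeft, rl_act_mul]
    congr 1
    exact bb_rl h π σ _ _
  have tot : 0 ≤ ∑ t : Fin T, ∑ p : Fin N, ∑ B : SS, ∑ i : Fin 5, ∑ j : Fin 5,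
      ∑ u, ∑ π : PP, ∑ σ : SS, ∑ v, ∑ w : PP, ∑ s : SS,
        ((if blk u = t then L u p else 0) * Rr (tw t) (A u) (m u) π σ B i j) *
        ((if blk v = t then L v p else 0) *
          Rr (tw t) (A v) (m v) (π * w) (xs (fun i => σ (hat w i)) s) B i j) *
        bb Ψ (x u) (rl (act w s) (x v)) :=
    Finset.sum_nonneg fun t _ => Finset.sum_nonneg fun p _ => Finset.sum_nonneg fun B _ =>
      Finset.sum_nonneg fun i _ => Finset.sum_nonneg fun j _ => key t p B i j
  have sw : ∀ (F : Fin T → Fin N → SS → Fin 5 → Fin 5 → U → PP → SS → U → PP → SS → ℝ),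
      ∑ t, ∑ p, ∑ B, ∑ i, ∑ j, ∑ u, ∑ π, ∑ σ, ∑ v, ∑ w, ∑ s, F t p B i j u π σ v w s =
      ∑ π, ∑ σ, ∑ u, ∑ v, ∑ w, ∑ s, ∑ t, ∑ p, ∑ B, ∑ i, ∑ j, F t p B i j u π σ v w s := by
    intro F
    have l : ∑ a : Fin T × Fin N × SS × Fin 5 × Fin 5, ∑ b : U × PP × SS × U × PP × SS,
        F a.1 a.2.1 a.2.2.1 a.2.2.2.1 a.2.2.2.2 b.1 b.2.1 b.2.2.1 b.2.2.2.1 b.2.2.2.2.1 b.2.2.2.2.2 =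
       ∑ b : U × PP × SS × U × PP × SS, ∑ a : Fin T × Fin N × SS × Fin 5 × Fin 5,
        F a.1 a.2.1 a.2.2.1 a.2.2.2.1 a.2.2.2.2 b.1 b.2.1 b.2.2.1 b.2.2.2.1 b.2.2.2.2.1 b.2.2.2.2.2 :=
      Finset.sum_comm
    simp only [Fintype.sum_prod_type] at l
    rw [l, Finset.sum_comm]
    refine Finset.sum_congr rfl fun π _ => ?_
    rw [Finset.sum_comm]
  rw [sw] at tot
  have ev : ∀ (π : PP) (σ : SS) (u v : U) (w : PP) (s : SS),
      ∑ t : Fin T, ∑ p : Fin N, ∑ B : SS, ∑ i : Fin 5, ∑ j : Fin 5,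
        ((if blk u = t then L u p else 0) * Rr (tw t) (A u) (m u) π σ B i j) *
        ((if blk v = t then L v p else 0) *
          Rr (tw t) (A v) (m v) (π * w) (xs (fun i => σ (hat w i)) s) B i j) *
        bb Ψ (x u) (rl (act w s) (x v)) =
      (if blk u = blk v ∧ (fun i => A u (hat w i)) = A v then
        (∑ p, L u p * L v p) * (tws (tw (blk u)) w * chi (A v) s * ovl w (m u) (m v)) else 0) *
      bb Ψ (x u) (rl (act w s) (x v)) := by
    intro π σ u v w s
    have e1 : ∀ (t : Fin T) (p : Fin N), ∑ B : SS, ∑ i : Fin 5, ∑ j : Fin 5,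
        ((if blk u = t then L u p else 0) * Rr (tw t) (A u) (m u) π σ B i j) *
        ((if blk v = t then L v p else 0) *
          Rr (tw t) (A v) (m v) (π * w) (xs (fun i => σ (hat w i)) s) B i j) *
        bb Ψ (x u) (rl (act w s) (x v)) =
        ((if blk u = t then L u p else 0) * (if blk v = t then L v p else 0)) *
        (if (fun i => A u (hat w i)) = A v then
          tws (tw t) w * chi (A v) s * ovl w (m u) (m v) else 0) *
        bb Ψ (x u) (rl (act w s) (x v)) := by
      intro t p
      rw [← Rr_sum (tw t) (A u) (A v) (m u) (m v) π w σ s]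
      simp only [Finset.mul_sum, Finset.sum_mul]
      refine Finset.sum_congr rfl fun B _ => Finset.sum_congr rfl fun i _ =>
        Finset.sum_congr rfl fun j _ => ?_
      ring
    simp only [e1]
    rw [Finset.sum_eq_single (blk u)]
    · by_cases hb : blk u = blk v
      · by_cases hA : (fun i => A u (hat w i)) = A v
        · simp only [hb, hA, if_true, and_self, ← Finset.sum_mul]
        · simp [hA]
      · have hb' : blk v ≠ blk u := fun e => hb e.symm
        simp [hb, hb']
    · intro t _ ht
      have : blk u ≠ t := fun e => ht e.symm
      simp [this]
    · simp
  simp only [ev] at tot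
  simp only [Finset.sum_const, nsmul_eq_mul] at tot
  have c1 : (0:ℝ) < (Finset.univ : Finset PP).card := by
    exact_mod_cast Finset.card_pos.mpr Finset.univ_nonempty
  have c2 : (0:ℝ) < (Finset.univ : Finset SS).card := by
    exact_mod_cast Finset.card_pos.mpr Finset.univ_nonempty
  have := (mul_nonneg_iff_of_pos_left c1).mp tot
  have := (mul_nonneg_iff_of_pos_left c2).mp this
  exact this

def lsum {α : Type} (l : List α) (f : α → ℕ) : ℕ :=
  List.rec (motive := fun _ => ℕ) 0 (fun a _ ih => Nat.add (f a) ih) l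

def nsum (n : ℕ) (f : ℕ → ℕ) : ℕ :=
  Nat.rec (motive := fun _ => ℕ) 0 (fun i ih => Nat.add (f i) ih) n

/-- if-then-else on a Boolean -/
def bc {α : Type} (b : Bool) (x y : α) : α := Bool.rec (motive := fun _ => α) y x b

def lfil {α : Type} (f : α → Bool) (l : List α) : List α :=
  List.rec (motive := fun _ => List α) [] (fun a _ ih => bc (f a) (List.cons a ih) ih) l

structure MV where
  d : ℕ
  ps : List ℕ
  ns : List ℕ

structure Rw where
  h : ℕ
  m : MV
  n : ℕ
  L : ℕ

structure Gp where
  A : ℕ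
  rs : List Rw

structure Ob where
  r : ℕ
  z : ℕ
  h : ℕ
  w : List (ℕ × ℕ)
  gs : List Gp

structure En where
  t : ℕ
  m : MV
  m' : MV
  n : ℕ
  L : ℕ
  n' : ℕ
  L' : ℕ

def hd (p i : ℕ) : ℕ := Nat.land (Nat.shiftRight p (Nat.mul 3 i)) 7
def sgp (p : ℕ) : ℕ := Nat.land (Nat.shiftRight p 18) 1

def dvs (d : ℕ) (l : List ℕ) (p : ℕ) : ℕ :=
  lsum l fun e => Nat.land (Nat.shiftRight d (Nat.land (Nat.shiftRight p e) 127)) 15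

def tA (u v : MV) (p : ℕ) : ℕ := Nat.add (dvs u.d v.ps p) (lsum v.ns fun _ => 8)
def tB (u v : MV) (p : ℕ) : ℕ := Nat.add (dvs u.d v.ns p) (lsum v.ps fun _ => 8)

def tPs (t : ℕ) (u v : MV) (c : List ℕ) : ℕ :=
  lsum c fun p => bc (Nat.beq (Nat.land t (sgp p)) 1) (tB u v p) (tA u v p)
def tNs (t : ℕ) (u v : MV) (c : List ℕ) : ℕ :=
  lsum c fun p => bc (Nat.beq (Nat.land t (sgp p)) 1) (tA u v p) (tB u v p)

def dig (U i : ℕ) : ℕ := Nat.land (Nat.shiftRight U (Nat.mul 26 i)) 67108863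

def qP (n U V : ℕ) : ℕ :=
  nsum n fun i => Nat.add (Nat.mul (dig U i) (dig V i)) 1125899906842624
def qN (n U V : ℕ) : ℕ := Nat.mul 33554432 (Nat.add (nsum n (dig U)) (nsum n (dig V)))

def mn (a b : ℕ) : ℕ := Nat.sub a (Nat.sub a b)

def eP (c : List ℕ) (e : En) : ℕ :=
  En.rec (motive := fun _ => ℕ) (fun t u v n U n' V =>
    Nat.add (Nat.mul (qP (mn n n') U V) (tPs t u v c)) (Nat.mul (qN (mn n n') U V) (tNs t u v c))) e
def eN (c : List ℕ) (e : En) : ℕ :=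
  En.rec (motive := fun _ => ℕ) (fun t u v n U n' V =>
    Nat.add (Nat.mul (qP (mn n n') U V) (tNs t u v c)) (Nat.mul (qN (mn n n') U V) (tPs t u v c))) e

def ents1 (u : Rw) (vs : List Rw) (tl : List En) : List En :=
  Rw.rec (motive := fun _ => List En) (fun h m n L =>
    List.rec (motive := fun _ => List En) tl (fun v _ ih =>
      Rw.rec (motive := fun _ => List En) (fun h' m' n' L' =>
        bc (Nat.beq h h') (List.cons ⟨h, m, m', n, L, n', L'⟩ ih) ih) v) vs) u

def ents (us vs : List Rw) : List En :=
  List.rec (motive := fun _ => List En) [] (fun u _ ih => ents1 u vs ih) us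

/-- bits of the preimage mask -/
def pim (A p : ℕ) : ℕ :=
  nsum 6 fun i => Nat.shiftLeft (Nat.land (Nat.shiftRight A (hd p i)) 1) i
def mt (A B : ℕ) (p : ℕ) : Bool := Nat.beq (pim A p) B

/-- contribution of all groups of `a` against one group of `b` -/
def hP (us : List Gp) (B : ℕ) (vs : List Rw) (c : List ℕ) (f : List ℕ → En → ℕ) : ℕ :=
  lsum us fun g => Gp.rec (motive := fun _ => ℕ) (fun A rs =>
    List.rec (motive := fun _ => ℕ) 0 (fun _ _ _ => lsum (ents rs vs) (f (lfil (mt A B) c)))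
      (lfil (mt A B) c)) g

/-- parity of the number of bits of a number below 64 -/
def par (n : ℕ) : Bool := Nat.beq (Nat.land (Nat.shiftRight 0x6996966996696996 n) 1) 1

def kP (us vs : List Gp) (c : List ℕ) (t : ℕ) : ℕ :=
  lsum vs fun g => Gp.rec (motive := fun _ => ℕ) (fun B rs =>
    bc (par (Nat.land B t)) (hP us B rs c eN) (hP us B rs c eP)) g
def kN (us vs : List Gp) (c : List ℕ) (t : ℕ) : ℕ :=
  lsum vs fun g => Gp.rec (motive := fun _ => ℕ) (fun B rs =>
    bc (par (Nat.land B t)) (hP us B rs c eP) (hP us B rs c eN)) g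

/-- code of a permutation -/
def cdg (ra p j : ℕ) : ℕ := bc (Nat.ble (hd p (Nat.succ j)) ra) (hd p (Nat.succ j)) 0
def cde (ra rb p : ℕ) : ℕ := nsum rb fun j => Nat.shiftLeft (cdg ra p j) (Nat.mul 3 j)
def msk (ra rb z p : ℕ) : ℕ :=
  Nat.add z (nsum rb fun j => bc (Nat.ble (hd p (Nat.succ j)) ra) (Nat.shiftLeft 2 j) 0)

def sme (ra rb p q : ℕ) : Bool := Nat.beq (cde ra rb p) (cde ra rb q)

/-- classes of a list of permutations: fuel, list -/
def mkcls (ra rb : ℕ) (fuel : ℕ) : List ℕ → List (List ℕ) :=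
  Nat.rec (motive := fun _ => List ℕ → List (List ℕ)) (fun _ => [])
    (fun _ ih l => List.rec (motive := fun _ => List (List ℕ)) []
      (fun p t _ => List.cons (List.cons p (lfil (sme ra rb p) t))
        (ih (lfil (fun q => Bool.not (sme ra rb p q)) t))) l) fuel

def sbs (M : ℕ) : List ℕ := lfil (fun t => Nat.beq (Nat.land t M) t) (List.range 64)

def wts (M : ℕ) : ℕ := Nat.div 64 (lsum (sbs M) fun _ => 1)

def hdm (ra rb z : ℕ) (c : List ℕ) : ℕ :=
  List.rec (motive := fun _ => ℕ) 0 (fun p _ _ => msk ra rb z p) c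

def ztot (us vs : List Gp) (ra rb z f : ℕ) (k : List Gp → List Gp → List ℕ → ℕ → ℕ)
    (cs : List (List ℕ)) : ℕ :=
  lsum cs fun c => lsum (sbs (hdm ra rb z c)) fun t =>
    Nat.mul (Nat.mul f (wts (hdm ra rb z c))) (k us vs c t)

/-- words in codes -/
abbrev CW := List (ℕ × ℕ)

def rcd (p t x : ℕ) : ℕ :=
  Nat.add (Nat.mul 2 (hd p (Nat.shiftRight x 1)))
    (Nat.land (Nat.xor x (Nat.shiftRight t (Nat.shiftRight x 1))) 1)

def rn (p t : ℕ) (w : CW) : CW :=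
  List.rec (motive := fun _ => CW) [] (fun l _ ih =>
    Prod.rec (motive := fun _ => CW) (fun a b => List.cons (rcd p t a, rcd p t b) ih) l) w

def app (w v : CW) : CW := List.rec (motive := fun _ => CW) v (fun l _ ih => List.cons l ih) w

/-- inverse word -/
def nv (w : CW) : CW :=
  List.rec (motive := fun _ => CW) [] (fun l _ ih =>
    Prod.rec (motive := fun _ => CW) (fun a b => app ih (List.cons (a, Nat.xor b 1) [])) l) w

/-- an item -/
structure It where
  k : ℕ
  k' : ℕ
  H : ℕ
  w : CW

def hid (H : ℕ) : ℕ := Nat.land H 4095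

def cits (us vs : List Gp) (c : List ℕ) (f : ℕ) (wa : CW) (p : ℕ) (wb : CW) (ts : List ℕ) :
    ℕ → List It :=
  List.rec (motive := fun _ => ℕ → List It) (fun _ => [])
    (fun t _ ih H => List.cons ⟨Nat.mul f (kP us vs c t), Nat.mul f (kN us vs c t),
      Nat.land H 67108863, app wa (rn p t wb)⟩ (ih (Nat.shiftRight H 26))) ts

def hd0 (l : List ℕ) : ℕ := List.rec (motive := fun _ => ℕ) 0 (fun a _ _ => a) l
def tl0 (l : List ℕ) : List ℕ := List.rec (motive := fun _ => List ℕ) [] (fun _ t _ => t) l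

def clits (us vs : List Gp) (ra rb z f : ℕ) (wa wb : CW) (cs : List (List ℕ)) :
    List ℕ → List (List It) :=
  List.rec (motive := fun _ => List ℕ → List (List It)) (fun _ => [])
    (fun c _ ih Hs => List.cons
      (cits us vs c (Nat.mul f (wts (hdm ra rb z c))) wa (hd0 c) wb (sbs (hdm ra rb z c)) (hd0 Hs))
      (ih (tl0 Hs))) cs

structure Pr where
  a : Ob
  b : Ob
  f : ℕ
  hs : List ℕ

def pits (PT : List ℕ) (q : Pr) : List (List It) :=
  Pr.rec (motive := fun _ => List (List It)) (fun a b f hs =>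
    Ob.rec (motive := fun _ => List (List It)) (fun ra za ha wa us =>
      Ob.rec (motive := fun _ => List (List It)) (fun rb zb hb wb vs =>
        List.cons [⟨ztot us vs ra rb (Nat.land za zb) f kN (mkcls ra rb 120 PT),
            ztot us vs ra rb (Nat.land za zb) f kP (mkcls ra rb 120 PT), ha, wa⟩,
          ⟨ztot us vs ra rb (Nat.land za zb) f kN (mkcls ra rb 120 PT),
            ztot us vs ra rb (Nat.land za zb) f kP (mkcls ra rb 120 PT), hb, wb⟩]
        (clits us vs ra rb (Nat.land za zb) f (nv wa) wb (mkcls ra rb 120 PT) hs)) b) a) q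

/-- target pattern -/
structure Tg where
  c : ℕ
  i : ℕ
  j : ℕ
  i' : ℕ
  j' : ℕ
  H : ℕ

def bt (s i : ℕ) : ℕ := Nat.land (Nat.shiftRight s i) 1

def tits (g : Tg) : List It :=
  Tg.rec (motive := fun _ => List It) (fun c i j i' j' H =>
    List.map (fun s => ⟨0, c, Nat.land (Nat.shiftRight H (Nat.mul 26 s)) 67108863,
      [(Nat.add (Nat.mul 2 i) (bt s 0), Nat.add (Nat.mul 2 j) (bt s 1)),
        (Nat.add (Nat.mul 2 i') (bt s 2), Nat.add (Nat.mul 2 j') (bt s 3))]⟩) (List.range 16)) g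

/-- positive part at digit `2*id`, negative part at digit `2*id+1` -/
def zit (it : It) : ℕ :=
  It.rec (motive := fun _ => ℕ) (fun k k' H _ =>
    bc (Nat.ble (Nat.add (Nat.sub k k') (Nat.sub k' k)) 1152921504606846976)
      (Nat.add (Nat.shiftLeft (Nat.sub k k') (Nat.mul 148 (hid H)))
        (Nat.shiftLeft (Nat.sub k' k) (Nat.add (Nat.mul 148 (hid H)) 74)))
      (Nat.shiftLeft 1 607000)) it

def zs2 (l : List (List It)) : ℕ := lsum l fun c => lsum c zit
def cn2 (l : List (List It)) : ℕ := lsum l fun c => lsum c fun _ => 1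

def zdg (Z j : ℕ) : ℕ := Nat.land (Nat.shiftRight Z (Nat.mul 74 j)) 18889465931478580854783

def zneg (nl nr Z i : ℕ) : ℕ :=
  bc (Nat.ble i nl) 0 (bc (Nat.ble nr i) 0
    (Nat.sub (zdg Z (Nat.succ (Nat.mul 2 i))) (zdg Z (Nat.mul 2 i))))

def zbad (nl nr Z : ℕ) : ℕ :=
  Nat.add (zdg Z (Nat.succ (Nat.mul 2 nr)))
    (nsum 64 fun i => nsum 64 fun j => zneg nl nr Z (Nat.add (Nat.mul 64 i) j))

def zgd (nl nr Z i : ℕ) : Bool :=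
  Nat.ble (Nat.add (zdg Z (Nat.succ (Nat.mul 2 i))) (Nat.mul 16 (zbad nl nr Z))) (zdg Z (Nat.mul 2 i))

/-- final check -/
def fchk (nl nr Z : ℕ) : Bool :=
  bc (Nat.ble (Nat.shiftLeft 1 (Nat.mul 148 (Nat.succ nr))) Z) false
    (bc (zgd nl nr Z 1) (zgd nl nr Z nl) false)

/-! ### word check -/

def rc (c : ℕ) (u : List ℕ) : List ℕ :=
  List.rec (motive := fun _ => List ℕ) (List.cons c [])
    (fun d t _ => bc (Nat.beq (Nat.xor c 1) d) t (List.cons c (List.cons d t))) u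

def sub1 (a b : ℕ) (u : List ℕ) : List ℕ :=
  List.rec (motive := fun _ => List ℕ) [] (fun c _ ih =>
    bc (Nat.beq c a) (rc c (rc b ih))
      (bc (Nat.beq (Nat.xor c 1) a) (rc (Nat.xor b 1) (rc c ih)) (rc c ih))) u

def img (c : ℕ) (w : CW) : List ℕ :=
  List.rec (motive := fun _ => List ℕ) (List.cons c []) (fun l _ ih =>
    Prod.rec (motive := fun _ => List ℕ) (fun a b => sub1 a b ih) l) w

def lbe (u : List ℕ) : List ℕ → Bool :=
  List.rec (motive := fun _ => List ℕ → Bool)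
    (fun v => List.rec (motive := fun _ => Bool) true (fun _ _ _ => false) v)
    (fun c _ ih v => List.rec (motive := fun _ => Bool) false
      (fun d t _ => bc (Nat.beq c d) (ih t) false) v) u

def lall {α : Type} (l : List α) (f : α → Bool) : Bool :=
  List.rec (motive := fun _ => Bool) true (fun a _ ih => bc (f a) ih false) l

def eqa (w v : CW) : Bool :=
  lall [0, 2, 4, 6, 8, 10] fun c => lbe (img c w) (img c v)

/-- admissible letters; `m` is the smallest allowed first code -/
def vlt (m : ℕ) (l : ℕ × ℕ) : Bool :=
  Prod.rec (motive := fun _ => Bool) (fun a b => bc (Nat.ble m a) (bc (Nat.ble 2 b)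
    (bc (Nat.ble a 11) (bc (Nat.ble b 11)
      (Bool.not (Nat.beq (Nat.shiftRight a 1) (Nat.shiftRight b 1))) false) false) false) false) l

def vld (m : ℕ) (w : CW) : Bool :=
  bc (Nat.ble (lsum w fun _ => 1) 4) (lall w (vlt m)) false

def unp (n : ℕ) : CW :=
  Nat.rec (motive := fun _ => ℕ → CW) (fun _ => []) (fun _ ih n =>
    bc (Nat.beq n 0) [] (List.cons (Nat.pred (Nat.land n 15), Nat.pred (Nat.land (Nat.shiftRight n 4) 15))
      (ih (Nat.shiftRight n 8)))) 4 n

def rep (RT i : ℕ) : CW := unp (Nat.land (Nat.shiftRight RT (Nat.mul 32 i)) 4294967295)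

/-- decoded permutation -/
def ptd (PB i : ℕ) : ℕ := Nat.mul 8 (Nat.land (Nat.shiftRight PB (Nat.mul 15 i)) 32767)

def rhs (PB RT H : ℕ) : CW :=
  rn (ptd PB (Nat.land (Nat.shiftRight H 12) 127)) (Nat.land (Nat.shiftRight H 19) 63) (rep RT (hid H))

def rhv (PB RT H : ℕ) : CW :=
  bc (Nat.beq (Nat.land (Nat.shiftRight H 25) 1) 1) (nv (rhs PB RT H)) (rhs PB RT H)

def chk (m nr PB RT H : ℕ) (w : CW) : Bool :=
  bc (vld m w) (bc (Nat.beq (hid H) nr) true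
    (bc (Nat.ble nr (hid H)) false (bc (vld 0 (rhv PB RT H)) (eqa w (rhv PB RT H)) false))) false

def chi2 (m nr PB RT : ℕ) (l : List (List It)) : Bool :=
  lall l fun c => lall c fun it =>
    It.rec (motive := fun _ => Bool) (fun _ _ H w => chk m nr PB RT H w) it

/-! ### elementary facts on the list functions -/

@[simp] lemma bc_true {α : Type} (x y : α) : bc true x y = x := rfl
@[simp] lemma bc_false {α : Type} (x y : α) : bc false x y = y := rfl
lemma bc_eq {α : Type} (b : Bool) (x y : α) : bc b x y = if b then x else y := by cases b <;> rfl
lemma bc_and {b c : Bool} (h : bc b c false = true) : b = true ∧ c = true := by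
  cases b <;> simp_all

lemma lfil_eq {α : Type} (f : α → Bool) (l : List α) : lfil f l = l.filter f := by
  induction l with
  | nil => rfl
  | cons a l ih =>
    rw [List.filter_cons, ← ih, ← bc_eq]; rfl

lemma lall_mem {α : Type} {l : List α} {f : α → Bool} (h : lall l f = true) : ∀ a ∈ l, f a = true := by
  induction l with
  | nil => simp
  | cons a l ih =>
    obtain ⟨h1, h2⟩ := bc_and (show bc (f a) (lall l f) false = true from h)
    simpa [h1] using ih h2

lemma nsum_eq (n : ℕ) (f : ℕ → ℕ) : nsum n f = ∑ i ∈ Finset.range n, f i := by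
  induction n with
  | zero => rfl
  | succ n ih =>
    have : nsum (n + 1) f = f n + nsum n f := rfl
    rw [this, Finset.sum_range_succ, ← ih, add_comm (f n)]

lemma lsum_eq {α : Type} (l : List α) (f : α → ℕ) : lsum l f = (l.map f).sum := by
  induction l with
  | nil => rfl
  | cons a l ih => rw [List.map_cons, List.sum_cons, ← ih]; rfl

/-! ### codes and words -/

def dc (c : ℕ) : Fin 6 × Bool := (Fin.ofNat 6 (c / 2), c.testBit 0)

def wd (w : CW) : Wd (Fin 6) := w.map fun l => (dc l.1, dc l.2)

lemma dc_xor (c : ℕ) : dc (Nat.xor c 1) = fl (dc c) := by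
  have e : Nat.xor c 1 = c ^^^ 1 := rfl
  have h1 : (c ^^^ 1) / 2 = c / 2 := by
    have := Nat.shiftRight_xor_distrib (a := c) (b := 1) (i := 1)
    simpa [Nat.shiftRight_eq_div_pow] using this
  have h2 : (c ^^^ 1).testBit 0 = !(c.testBit 0) := by
    rw [Nat.testBit_xor]; simp
  rw [e]; unfold dc fl; rw [h1, h2]

lemma dc_xor2 (c : ℕ) : dc (c ^^^ 1) = fl (dc c) := dc_xor c

@[simp] lemma wd_nil : wd [] = [] := rfl
lemma wd_cons (l) (w : CW) : wd (l :: w) = (dc l.1, dc l.2) :: wd w := rfl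
lemma app_eq (w v : CW) : app w v = w ++ v := by
  induction w with
  | nil => rfl
  | cons l w ih => rw [List.cons_append, ← ih]; rfl
lemma wd_app (w v : CW) : wd (app w v) = wd w ++ wd v := by simp [app_eq, wd]
lemma wd_nv (w : CW) : wd (nv w) = winv (wd w) := by
  induction w with
  | nil => rfl
  | cons l w ih =>
    have : nv (l :: w) = app (nv w) [(l.1, Nat.xor l.2 1)] := rfl
    rw [this, wd_app, ih]
    simp [wd, winv, linv, dc_xor, dc_xor2]

/-- the number `p` describes the permutation `π` -/
def PK (p : ℕ) (π : PP) : Prop := ∀ i : Fin 6, hd p i = hat π i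

def bs (t : ℕ) : SS := fun i => t.testBit i

lemma dc_mk (i : Fin 6) (b : Bool) : dc (2 * i + b.toNat) = (i, b) := by
  revert i b; decide

lemma dc_fst {c : ℕ} (h : c < 12) : ((dc c).1 : ℕ) = c / 2 := by
  simp [dc, Fin.ofNat]; omega

lemma land_one (n : ℕ) : Nat.land n 1 = (n.testBit 0).toNat := by
  show n &&& 1 = _
  rw [Nat.and_one_is_mod, Nat.testBit_zero]
  rcases Nat.mod_two_eq_zero_or_one n with h | h <;> simp [h]

lemma dc_rcd {p : ℕ} {π : PP} (hp : PK p π) (t : ℕ) {x : ℕ} (hx : x < 12) :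
    dc (rcd p t x) = act π (bs t) (dc x) ∧ rcd p t x < 12 := by
  have h1 : Nat.shiftRight x 1 = ((dc x).1 : ℕ) := by
    rw [dc_fst hx]; exact Nat.shiftRight_eq_div_pow x 1
  have h2 : rcd p t x = 2 * (hat π (dc x).1 : ℕ) + ((x.testBit 0) ^^ (t.testBit (dc x).1)).toNat := by
    unfold rcd
    rw [h1, hp, land_one]
    have : (Nat.xor x (Nat.shiftRight t (dc x).1)).testBit 0 = (x.testBit 0 ^^ t.testBit (dc x).1) := by
      show (x ^^^ (t >>> _)).testBit 0 = _
      rw [Nat.testBit_xor, Nat.testBit_shiftRight]; rfl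
    rw [this]; rfl
  rw [h2]
  refine ⟨?_, ?_⟩
  · rw [dc_mk]; rfl
  · have := (hat π (dc x).1).2
    have := Bool.toNat_lt (x.testBit 0 ^^ t.testBit (dc x).1)
    omega

/-- all codes small -/
def Sm (w : CW) : Prop := ∀ l ∈ w, l.1 < 12 ∧ l.2 < 12

lemma wd_rn {p : ℕ} {π : PP} (hp : PK p π) (t : ℕ) {w : CW} (hw : Sm w) :
    wd (rn p t w) = rl (act π (bs t)) (wd w) ∧ Sm (rn p t w) := by
  induction w with
  | nil => exact ⟨rfl, by simp [Sm, rn]⟩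
  | cons l w ih =>
    have h0 : rn p t (l :: w) = (rcd p t l.1, rcd p t l.2) :: rn p t w := rfl
    obtain ⟨h1, h2⟩ := hw l (by simp)
    obtain ⟨i1, i2⟩ := ih fun l hl => hw l (by simp [hl])
    rw [h0, wd_cons, i1, (dc_rcd hp t h1).1, (dc_rcd hp t h2).1]
    refine ⟨rfl, ?_⟩
    intro l' hl'
    rcases List.mem_cons.1 hl' with rfl | hl'
    · exact ⟨(dc_rcd hp t h1).2, (dc_rcd hp t h2).2⟩
    · exact i2 _ hl'

lemma Sm_nv {w : CW} (hw : Sm w) : Sm (nv w) := by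
  induction w with
  | nil => simp [Sm, nv]
  | cons l w ih =>
    have : nv (l :: w) = app (nv w) [(l.1, Nat.xor l.2 1)] := rfl
    rw [this, app_eq]
    intro l' hl'
    rcases List.mem_append.1 hl' with h | h
    · exact ih (fun l hl => hw l (by simp [hl])) _ h
    · obtain ⟨h1, h2⟩ := hw l (by simp)
      simp only [List.mem_singleton] at h
      subst h
      refine ⟨h1, ?_⟩
      show Nat.xor l.2 1 < 12
      generalize l.2 = c at h2
      interval_cases c <;> decide

/-! ### evaluation in the free group -/
section ev
variable {G : Type*} [Group G]

def ev (S : Fin 6 → G) (u : List ℕ) : G := (u.map fun c => sv S (dc c)).prod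

lemma ev_cons (S : Fin 6 → G) (c : ℕ) (u) : ev S (c :: u) = sv S (dc c) * ev S u := by simp [ev]

lemma ev_rc (S : Fin 6 → G) (c : ℕ) (u) : ev S (rc c u) = sv S (dc c) * ev S u := by
  cases u with
  | nil => simp [rc, ev]
  | cons d t =>
    have : rc c (d :: t) = bc (Nat.beq (Nat.xor c 1) d) t (c :: d :: t) := rfl
    rw [this]
    cases h : Nat.beq (Nat.xor c 1) d with
    | false => simp [ev]
    | true =>
      have := Nat.eq_of_beq_eq_true h
      subst this
      rw [bc_true, ev_cons, dc_xor, sv_fl]; simp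

lemma rc_lt {c : ℕ} {u : List ℕ} (hc : c < 12) (hu : ∀ d ∈ u, d < 12) : ∀ d ∈ rc c u, d < 12 := by
  cases u with
  | nil => simpa [rc] using hc
  | cons d t =>
    have : rc c (d :: t) = bc (Nat.beq (Nat.xor c 1) d) t (c :: d :: t) := rfl
    rw [this]
    cases h : Nat.beq (Nat.xor c 1) d with
    | false => simp at hu ⊢; exact ⟨hc, hu⟩
    | true => simp at hu ⊢; exact hu.2

lemma xor_lt {c : ℕ} (hc : c < 12) : Nat.xor c 1 < 12 := by interval_cases c <;> decide

lemma dc_inj {c d : ℕ} (hc : c < 12) (hd : d < 12) (h : dc c = dc d) : c = d := by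
  revert h; interval_cases c <;> interval_cases d <;> decide

lemma xor_xor (c : ℕ) : Nat.xor (Nat.xor c 1) 1 = c := by
  show c ^^^ 1 ^^^ 1 = c
  rw [Nat.xor_assoc]; simp

lemma sub1_spec (S : Fin 6 → G) {a b : ℕ} (ha : a < 12) (hb : b < 12) (hab : a / 2 ≠ b / 2)
    {u : List ℕ} (hu : ∀ d ∈ u, d < 12) :
    ev S (sub1 a b u) = ev (lact (dc a, dc b) S) u ∧ ∀ d ∈ sub1 a b u, d < 12 := by
  induction u with
  | nil => simp [sub1, ev]
  | cons c u ih =>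
    obtain ⟨i1, i2⟩ := ih fun d hd => hu d (by simp [hd])
    have hc := hu c (by simp)
    have hne : (dc a).1 ≠ (dc b).1 := by
      intro e; apply hab; rw [← dc_fst ha, ← dc_fst hb, e]
    have h0 : sub1 a b (c :: u) = bc (Nat.beq c a) (rc c (rc b (sub1 a b u)))
      (bc (Nat.beq (Nat.xor c 1) a) (rc (Nat.xor b 1) (rc c (sub1 a b u))) (rc c (sub1 a b u))) := rfl
    rw [h0, ev_cons, sv_lact _ _ hne, ← i1]
    by_cases h1 : c = a
    · subst h1
      simp only [Nat.beq_refl, bc_true, ev_rc, if_true]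
      exact ⟨by simp [mul_assoc], rc_lt hc (rc_lt hb i2)⟩
    · have h1' : Nat.beq c a = false := by
        cases h : Nat.beq c a
        · rfl
        · exact absurd (Nat.eq_of_beq_eq_true h) h1
      have h1'' : dc c ≠ dc a := fun e => h1 (dc_inj hc ha e)
      by_cases h2 : Nat.xor c 1 = a
      · have h3 : dc c = fl (dc a) := by rw [← h2, dc_xor, fl_fl]
        have h4 : Nat.beq (Nat.xor c 1) a = true := by rw [h2]; exact Nat.beq_refl a
        rw [h1', h4]
        simp only [bc_true, bc_false, ev_rc]
        refine ⟨?_, rc_lt (xor_lt hb) (rc_lt hc i2)⟩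
        have h5 : fl (dc a) ≠ dc a := h3 ▸ h1''
        simp [h3, h5, dc_xor, dc_xor2, sv_fl, mul_assoc]
      · have h2' : Nat.beq (Nat.xor c 1) a = false := by
          cases h : Nat.beq (Nat.xor c 1) a
          · rfl
          · exact absurd (Nat.eq_of_beq_eq_true h) h2
        have h3 : dc c ≠ fl (dc a) := by
          intro e; apply h2
          apply dc_inj (xor_lt hc) ha
          rw [dc_xor, e, fl_fl]
        rw [h1', h2']
        simp only [bc_false, ev_rc]
        refine ⟨?_, rc_lt hc i2⟩
        simp [h1'', h3]

/-- valid words -/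
def Vw (w : CW) : Prop := ∀ l ∈ w, l.1 < 12 ∧ l.2 < 12 ∧ l.1 / 2 ≠ l.2 / 2

lemma img_spec (S : Fin 6 → G) {c : ℕ} (hc : c < 12) {w : CW} (hw : Vw w) :
    ev S (img c w) = sv (wact (wd w) S) (dc c) ∧ ∀ d ∈ img c w, d < 12 := by
  induction w generalizing S with
  | nil => simp [img, ev, hc]
  | cons l w ih =>
    have h0 : img c (l :: w) = sub1 l.1 l.2 (img c w) := rfl
    obtain ⟨h1, h2, h3⟩ := hw l (by simp)
    have hw' : Vw w := fun l hl => hw l (by simp [hl])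
    obtain ⟨j1, j2⟩ := sub1_spec S h1 h2 h3 (ih S hw').2
    rw [h0, j1, wd_cons, wact_cons]
    exact ⟨(ih _ hw').1, j2⟩

lemma lbe_eq {u v : List ℕ} (h : lbe u v = true) : u = v := by
  induction u generalizing v with
  | nil => cases v with
    | nil => rfl
    | cons d t => exact absurd h (by simp [lbe])
  | cons c u ih => cases v with
    | nil => exact absurd h (by simp [lbe])
    | cons d t =>
      obtain ⟨h1, h2⟩ := bc_and (show bc (Nat.beq c d) (lbe u t) false = true from h)
      rw [Nat.eq_of_beq_eq_true h1, ih h2]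

lemma eqa_spec {w v : CW} (hw : Vw w) (hv : Vw v) (h : eqa w v = true) (S : Fin 6 → G) :
    wact (wd w) S = wact (wd v) S := by
  have key := lall_mem h
  have k2 : ∀ i : Fin 6, wact (wd w) S i = wact (wd v) S i := by
    intro i
    have hm : (2 * i.1) ∈ [0, 2, 4, 6, 8, 10] := by revert i; decide
    have hl : 2 * i.1 < 12 := by omega
    have e := lbe_eq (key _ hm)
    have e1 := (img_spec S hl hw).1
    rw [e, (img_spec S hl hv).1] at e1
    have e2 : dc (2 * i.1) = (i, false) := by simpa using dc_mk i false
    rw [e2] at e1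
    simpa [sv] using e1.symm
  funext i; exact k2 i

end ev

/-- letters with indices in the allowed range, at most four of them -/
def Vm (m : ℕ) (w : CW) : Prop := w.length ≤ 4 ∧ ∀ l ∈ w, m ≤ l.1 ∧ 2 ≤ l.2 ∧ l.1 < 12 ∧ l.2 < 12 ∧
  l.1 / 2 ≠ l.2 / 2

lemma vld_spec {m : ℕ} {w : CW} (h : vld m w = true) : Vm m w := by
  obtain ⟨h1, h2⟩ := bc_and h
  refine ⟨?_, fun l hl => ?_⟩
  · have := Nat.le_of_ble_eq_true h1
    rw [lsum_eq] at this
    simpa using this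
  · have := lall_mem h2 l hl
    obtain ⟨a1, this⟩ := bc_and this
    obtain ⟨a2, this⟩ := bc_and this
    obtain ⟨a3, this⟩ := bc_and this
    obtain ⟨a4, this⟩ := bc_and this
    refine ⟨Nat.le_of_ble_eq_true a1, Nat.le_of_ble_eq_true a2, Nat.lt_succ_of_le (Nat.le_of_ble_eq_true a3),
      Nat.lt_succ_of_le (Nat.le_of_ble_eq_true a4), fun e => ?_⟩
    have e' : l.1.shiftRight 1 = l.2.shiftRight 1 := by
      have := Nat.shiftRight_eq_div_pow l.1 1
      have := Nat.shiftRight_eq_div_pow l.2 1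
      simp_all
    rw [e'] at this
    simp [Nat.beq_refl] at this

lemma Vm.vw {m : ℕ} {w : CW} (h : Vm m w) : Vw w := fun l hl =>
  ⟨(h.2 l hl).2.2.1, (h.2 l hl).2.2.2.1, (h.2 l hl).2.2.2.2⟩

/-- all entries of the table are permutations -/
def POK (PB : ℕ) : Prop := ∀ i < 128, ∃ π, PK (ptd PB i) π

lemma Vm.sm {m : ℕ} {w : CW} (h : Vm m w) : Sm w := fun l hl => ⟨(h.vw l hl).1, (h.vw l hl).2.1⟩

/-- representatives are valid -/
def ROK (nr RT : ℕ) : Prop := ∀ i < nr, Sm (rep RT i)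

lemma ptd_lt (H : ℕ) : Nat.land (Nat.shiftRight H 12) 127 < 128 :=
  lt_of_le_of_lt (Nat.and_le_right (n := Nat.shiftRight H 12) (m := 127)) (by norm_num)

section chk
variable {G : Type*} [Group G] {Ψ : Wd (Fin 6) → ℝ}

lemma chk_spec (h : PS 0 G Ψ) {m nr PB RT : ℕ} (hB : POK PB) (hR : ROK nr RT) {H : ℕ} {w : CW}
    (hc : chk m nr PB RT H w = true) :
    Vm m w ∧ (hid H = nr ∨ hid H < nr ∧ Ψ (wd w) = Ψ (wd (rep RT (hid H)))) := by
  obtain ⟨h1, hc⟩ := bc_and hc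
  refine ⟨vld_spec h1, ?_⟩
  cases e : Nat.beq (hid H) nr with
  | true => exact Or.inl (Nat.eq_of_beq_eq_true e)
  | false =>
    right
    rw [e, bc_false] at hc
    cases e2 : Nat.ble nr (hid H) with
    | true => simp [e2] at hc
    | false =>
      have e3 : hid H < nr := by
        by_contra hh
        rw [Nat.ble_eq_true_of_le (not_lt.1 hh)] at e2; simp at e2
      rw [e2, bc_false] at hc
      obtain ⟨h2, h3⟩ := bc_and hc
      refine ⟨e3, ?_⟩
      have hv := vld_spec h2
      have h4 : Ψ (wd w) = Ψ (wd (rhv PB RT H)) :=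
        h.eq _ _ fun S => eqa_spec (vld_spec h1).vw hv.vw h3 S
      obtain ⟨π, hπ⟩ := hB _ (ptd_lt H)
      have h5 : Ψ (wd (rhs PB RT H)) = Ψ (wd (rep RT (hid H))) := by
        unfold rhs
        rw [(wd_rn hπ _ (hR _ e3)).1]
        exact h.rel _ (act_mem _ _) _
      rw [h4, ← h5]
      unfold rhv
      cases Nat.beq (Nat.land (Nat.shiftRight H 25) 1) 1 with
      | false => rfl
      | true => rw [bc_true, wd_nv]; exact h.inv _
end chk

/-! ### reduction to codes -/

lemma ext_perm' {ι κ : Type} [Finite κ] (f g : ι → κ) (hf : Function.Injective f)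
    (hg : Function.Injective g) : ∃ π : Equiv.Perm κ, ∀ x, π (f x) = g x := by
  classical
  let e : {x // x ∈ Set.range f} ≃ {x // x ∈ Set.range g} :=
    (Equiv.ofInjective f hf).symm.trans (Equiv.ofInjective g hg)
  refine ⟨e.extendSubtype, fun x => ?_⟩
  rw [Equiv.extendSubtype_apply_of_mem e (f x) ⟨x, rfl⟩]
  have : (Equiv.ofInjective f hf).symm ⟨f x, x, rfl⟩ = x := by
    rw [Equiv.symm_apply_eq]; rfl
  simp [e, this]

section red
variable {G : Type*} [Group G] {Ψ : Wd (Fin 6) → ℝ}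

/-- signed permutation -/
def sact (ρ : Equiv.Perm (Fin 6)) (σ : SS) : Equiv.Perm (Fin 6 × Bool) where
  toFun b := (ρ b.1, xor b.2 (σ b.1))
  invFun b := (ρ.symm b.1, xor b.2 (σ (ρ.symm b.1)))
  left_inv := by intro b; simp
  right_inv := by intro b; simp

lemma sact_mem {ρ : Equiv.Perm (Fin 6)} (h0 : ρ 0 = 0) (σ : SS) : sact ρ σ ∈ Rg (0 : Fin 6) := by
  constructor
  · rintro ⟨b, s⟩; simp [sact, fl]
  · rintro ⟨b, s⟩
    show ρ b = 0 ↔ b = 0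
    conv_lhs => rw [← h0]
    exact ρ.injective.eq_iff

lemma code_red (h : PS 0 G Ψ) (Xa Xb : Fin 6 → Prop) (π π' : PP) (σ τ : SS)
    (hC : ∀ j, Xb j → (Xa (hat π j) ∨ Xa (hat π' j)) → hat π j = hat π' j ∧ σ j = τ j)
    {xa xb : Wd (Fin 6)} (ha : ∀ l ∈ xa, Xa l.1.1 ∧ Xa l.2.1) (hb : ∀ l ∈ xb, Xb l.1.1 ∧ Xb l.2.1) :
    Ψ (winv xa ++ rl (act π σ) xb) = Ψ (winv xa ++ rl (act π' τ) xb) := by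
  classical
  let T := {y : Fin 6 // y = 0 ∨ Xa y ∨ ∃ j, Xb j ∧ hat π' j = y}
  let g : T → Fin 6 := fun y => if Xa y.1 then y.1 else hat π ((hat π').symm y.1)
  have h00 : ∀ w : PP, hat w 0 = 0 := fun w => rfl
  have h00' : ∀ w : PP, (hat w).symm 0 = 0 := fun w => rfl
  have aux : ∀ y y' : T, Xa y.1 → ¬ Xa y'.1 → g y = g y' → y = y' := by
    rintro ⟨y, hy⟩ ⟨y', hy'⟩ h1 h2 e
    simp only at h1 h2
    simp only [g, h1, h2, if_true, if_false] at e
    apply Subtype.ext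
    show y = y'
    rcases hy' with h3 | h3 | ⟨j, h3, h4⟩
    · subst h3
      rw [h00', h00] at e; exact e
    · exact absurd h3 h2
    · have : (hat π').symm y' = j := by rw [← h4]; simp
      rw [this] at e
      rw [e, ← h4]
      exact (hC j h3 (Or.inl (e ▸ h1))).1
  have hg : Function.Injective g := by
    intro y y' e
    by_cases h1 : Xa y.1 <;> by_cases h2 : Xa y'.1
    · simp only [g, h1, h2, if_true] at e; exact Subtype.ext e
    · exact aux y y' h1 h2 e
    · exact (aux y' y h2 h1 e.symm).symm
    · simp only [g, h1, h2, if_false] at e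
      exact Subtype.ext ((hat π').symm.injective ((hat π).injective e))
  obtain ⟨ρ, hρ⟩ := ext_perm' (fun y : T => y.1) g Subtype.val_injective hg
  have r0 : ρ 0 = 0 := by
    have := hρ ⟨0, Or.inl rfl⟩
    simp only [g] at this
    rw [this, h00', h00]; simp
  have ra : ∀ y, Xa y → ρ y = y := by
    intro y hy
    have := hρ ⟨y, Or.inr (Or.inl hy)⟩
    simpa [g, hy] using this
  have rb : ∀ j, Xb j → ρ (hat π' j) = hat π j := by
    intro j hj
    by_cases hy : Xa (hat π' j)
    · rw [ra _ hy]; exact (hC j hj (Or.inr hy)).1.symm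
    · have := hρ ⟨hat π' j, Or.inr (Or.inr ⟨j, hj, rfl⟩)⟩
      simpa [g, hy] using this
  let s : SS := fun i => if Xa i then false else xor (σ ((hat π').symm i)) (τ ((hat π').symm i))
  have e1 : rl (sact ρ s) (winv xa) = winv xa := by
    rw [rl_winv _ (sact_mem r0 s).1]
    congr 1
    unfold rl
    conv_rhs => rw [← List.map_id xa]
    refine List.map_congr_left fun l hl => ?_
    obtain ⟨h1, h2⟩ := ha l hl
    simp [sact, Prod.map, s, h1, h2, ra]
  have e2 : rl (sact ρ s) (rl (act π' τ) xb) = rl (act π σ) xb := by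
    rw [rl_rl]
    unfold rl
    have key : ∀ b : Fin 6 × Bool, Xb b.1 → sact ρ s (act π' τ b) = act π σ b := by
      rintro ⟨b, t⟩ hb
      have hb : Xb b := hb
      simp only [sact, act_apply, Equiv.coe_fn_mk, rb b hb, s]
      by_cases hy : Xa (hat π' b)
      · simp [hy, (hC b hb (Or.inr hy)).2]
      · simp [hy]; cases σ b <;> cases τ b <;> rfl
    refine List.map_congr_left fun l hl => ?_
    obtain ⟨h1, h2⟩ := hb l hl
    simp only [Prod.map, Function.comp_apply, key _ h1, key _ h2]
  rw [← e2]
  conv_lhs => rw [← e1]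
  rw [← rl_append]
  exact h.rel _ (sact_mem r0 s) _

end red

/-! ### real list sums -/
section rs
variable {α β : Type}

def rs (l : List α) (f : α → ℝ) : ℝ := (l.map f).sum

@[simp] lemma rs_nil (f : α → ℝ) : rs [] f = 0 := rfl
@[simp] lemma rs_cons (a : α) (l : List α) (f : α → ℝ) : rs (a :: l) f = f a + rs l f := by simp [rs]
lemma rs_append (l l' : List α) (f : α → ℝ) : rs (l ++ l') f = rs l f + rs l' f := by simp [rs]
lemma rs_congr {l : List α} {f g : α → ℝ} (h : ∀ a ∈ l, f a = g a) : rs l f = rs l g := by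
  unfold rs; rw [List.map_congr_left h]
lemma rs_zero (l : List α) : rs l (fun _ => 0) = 0 := by
  induction l with
  | nil => rfl
  | cons a l ih => simp [ih]
lemma rs_add (l : List α) (f g : α → ℝ) : rs l (fun a => f a + g a) = rs l f + rs l g := by
  induction l with
  | nil => simp
  | cons a l ih => simp [ih]; ring
lemma rs_sub (l : List α) (f g : α → ℝ) : rs l (fun a => f a - g a) = rs l f - rs l g := by
  induction l with
  | nil => simp
  | cons a l ih => simp [ih]; ring
lemma rs_mul (l : List α) (c : ℝ) (f : α → ℝ) : rs l (fun a => c * f a) = c * rs l f := by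
  induction l with
  | nil => simp
  | cons a l ih => simp [ih]; ring
lemma rs_mul' (l : List α) (c : ℝ) (f : α → ℝ) : rs l (fun a => f a * c) = rs l f * c := by
  induction l with
  | nil => simp
  | cons a l ih => simp [ih]; ring
lemma rs_comm (l : List α) (m : List β) (f : α → β → ℝ) :
    rs l (fun a => rs m (f a)) = rs m (fun b => rs l fun a => f a b) := by
  induction l with
  | nil => simp [rs_zero]
  | cons a l ih => simp [ih, rs_add]
lemma rs_sum {ι : Type} (l : List α) (s : Finset ι) (f : α → ι → ℝ) :
    rs l (fun a => ∑ i ∈ s, f a i) = ∑ i ∈ s, rs l fun a => f a i := by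
  induction l with
  | nil => simp
  | cons a l ih => simp [ih, Finset.sum_add_distrib]
lemma rs_filter (l : List α) (p : α → Bool) (f : α → ℝ) :
    rs (l.filter p) f = rs l fun a => if p a then f a else 0 := by
  induction l with
  | nil => rfl
  | cons a l ih =>
    rw [List.filter_cons]
    cases h : p a <;> simp [h, ih]
lemma rs_map (l : List α) (g : α → β) (f : β → ℝ) : rs (l.map g) f = rs l fun a => f (g a) := by
  simp [rs, Function.comp_def]
lemma rs_flatMap (l : List α) (g : α → List β) (f : β → ℝ) :
    rs (l.flatMap g) f = rs l fun a => rs (g a) f := by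
  induction l with
  | nil => rfl
  | cons a l ih => simp [rs_append, ih]
lemma cast_lsum (l : List α) (f : α → ℕ) : ((lsum l f : ℕ) : ℝ) = rs l fun a => (f a : ℝ) := by
  rw [lsum_eq]
  induction l with
  | nil => simp
  | cons a l ih => simp [ih]
lemma rs_fin (l : List α) (f : α → ℝ) : ∑ u : Fin l.length, f (l.get u) = rs l f := by
  induction l with
  | nil => simp
  | cons a l ih =>
    rw [rs_cons, ← ih]
    exact Fin.sum_univ_succ (n := l.length) _
end rs

/-! ### permutation numbers -/

structure PTok (p : ℕ) (π : PP) : Prop where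
  pk : PK p π
  sg : sgp p = if Equiv.Perm.sign π = 1 then 0 else 1
  dg : ∀ i j : Fin 5, Nat.land (Nat.shiftRight p (19 + 7 * (5 * i + j))) 127 = 4 * (5 * π i + π j)

open scoped Classical in
def pm (p : ℕ) : PP := if h : ∃ π, PTok p π then h.choose else 1

lemma pm_spec {p : ℕ} (h : ∃ π, PTok p π) : PTok p (pm p) := by
  unfold pm; rw [dif_pos h]; exact h.choose_spec

/-! ### the overlap -/

def ec (x : Fin 5 × Fin 5) : ℕ := 19 + 7 * (5 * x.1 + x.2)

lemma ec_inj : Function.Injective ec := by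
  rintro ⟨a, b⟩ ⟨c, d⟩ h
  simp only [ec] at h
  ext <;> simp <;> omega

def mr (m : MV) (i j : Fin 5) : ℝ := (Nat.land (Nat.shiftRight m.d (4 * (5 * i + j))) 15 : ℕ) - 8

structure MVok (m : MV) : Prop where
  ps : ∀ e ∈ m.ps, ∃ x, e = ec x
  ns : ∀ e ∈ m.ns, ∃ x, e = ec x
  ct : ∀ i j : Fin 5, Nat.land (Nat.shiftRight m.d (4 * (5 * i + j))) 15 + m.ns.count (ec (i, j)) =
    8 + m.ps.count (ec (i, j))

lemma rs_count (l : List ℕ) (hl : ∀ e ∈ l, ∃ x, e = ec x) (g : ℕ → ℝ) :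
    rs l g = ∑ x : Fin 5 × Fin 5, g (ec x) * (l.count (ec x) : ℝ) := by
  induction l with
  | nil => simp
  | cons a l ih =>
    obtain ⟨y, rfl⟩ := hl a (by simp)
    rw [rs_cons, ih fun e he => hl e (by simp [he])]
    have : ∀ x, (((ec y :: l).count (ec x) : ℕ) : ℝ) = l.count (ec x) + if y = x then 1 else 0 := by
      intro x
      rw [List.count_cons]
      by_cases h : y = x
      · simp [h]
      · have : ec y ≠ ec x := fun e => h (ec_inj e)
        simp [h, this]
    simp only [this, mul_add, Finset.sum_add_distrib]
    simp [add_comm]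

lemma tAB {u v : MV} (hv : MVok v) {p : ℕ} {π : PP} (hp : PTok p π) :
    ((tA u v p : ℕ) : ℝ) - tB u v p = ovl π (mr u) (mr v) := by
  let g : ℕ → ℝ := fun e =>
    ((Nat.land (Nat.shiftRight u.d (Nat.land (Nat.shiftRight p e) 127)) 15 : ℕ) : ℝ) - 8
  have e1 : ((tA u v p : ℕ) : ℝ) - tB u v p = rs v.ps g - rs v.ns g := by
    have a1 : tA u v p = dvs u.d v.ps p + lsum v.ns fun _ => 8 := rfl
    have a2 : tB u v p = dvs u.d v.ns p + lsum v.ps fun _ => 8 := rfl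
    rw [a1, a2]
    push_cast
    simp only [dvs, cast_lsum, g, rs_sub]
    push_cast; ring
  have e2 : ∀ x : Fin 5 × Fin 5, g (ec x) = mr u (π x.1) (π x.2) := by
    intro x
    simp only [g, ec, hp.dg, mr]
  rw [e1, rs_count _ hv.ps, rs_count _ hv.ns, ← Finset.sum_sub_distrib, Fintype.sum_prod_type, ovl]
  refine Finset.sum_congr rfl fun i _ => Finset.sum_congr rfl fun j _ => ?_
  rw [e2, ← mul_sub]
  congr 1
  have := hv.ct i j
  have h2 : ((Nat.land (Nat.shiftRight v.d (4 * (5 * i + j))) 15 : ℕ) : ℝ) + (v.ns.count (ec (i, j)) : ℝ) =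
    8 + (v.ps.count (ec (i, j)) : ℝ) := by exact_mod_cast this
  simp only [mr]
  linarith

def od (t : ℕ) : Bool := t.testBit 0

lemma land_sg (t : ℕ) {s : ℕ} (hs : s = 0 ∨ s = 1) :
    Nat.beq (Nat.land t s) 1 = (od t && decide (s = 1)) := by
  rcases hs with rfl | rfl
  · have : Nat.land t 0 = 0 := Nat.and_zero t
    rw [this]; simp; rfl
  · rw [land_one, od]; cases t.testBit 0 <;> rfl

lemma tPN (t : ℕ) {u v : MV} (hv : MVok v) {c : List ℕ} (hc : ∀ p ∈ c, PTok p (pm p)) :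
    ((tPs t u v c : ℕ) : ℝ) - tNs t u v c =
      rs c fun p => tws (od t) (pm p) * ovl (pm p) (mr u) (mr v) := by
  simp only [tPs, tNs, cast_lsum, ← rs_sub]
  refine rs_congr fun p hp => ?_
  rw [← tAB hv (hc p hp)]
  have hs := (hc p hp).sg
  rcases Int.units_eq_one_or (Equiv.Perm.sign (pm p)) with h1 | h1
  · have hs' : sgp p = 0 := by rw [hs, h1]; rfl
    rw [land_sg t (Or.inl hs'), hs', tws, h1]
    cases od t <;> simp
  · have hs' : sgp p = 1 := by rw [hs, h1]; rfl
    rw [land_sg t (Or.inr hs'), hs', tws, h1]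
    cases od t <;> simp

/-! ### the Gram part -/

def lr (n U : ℕ) (i : Fin 64) : ℝ := if (i : ℕ) < n then (dig U i : ℝ) - 33554432 else 0

lemma mn_eq (a b : ℕ) : mn a b = min a b := by
  show a - (a - b) = _
  omega

lemma qPN {n n' U V : ℕ} (hn : n ≤ 64) :
    ((qP (mn n n') U V : ℕ) : ℝ) - qN (mn n n') U V = ∑ i, lr n U i * lr n' V i := by
  have e0 : qP (mn n n') U V = nsum (mn n n') fun i => dig U i * dig V i + 1125899906842624 := rfl
  have e1 : qN (mn n n') U V = 33554432 * (nsum (mn n n') (dig U) + nsum (mn n n') (dig V)) := rfl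
  rw [e0, e1]
  simp only [nsum_eq]
  push_cast
  rw [← Finset.sum_add_distrib, Finset.mul_sum, ← Finset.sum_sub_distrib]
  have e2 : ∀ i : Fin 64, lr n U i * lr n' V i = if (i : ℕ) < mn n n' then
      ((dig U i : ℝ) - 33554432) * ((dig V i : ℝ) - 33554432) else 0 := by
    intro i
    rw [mn_eq]
    simp only [lr, lt_min_iff]
    by_cases h1 : (i : ℕ) < n <;> by_cases h2 : (i : ℕ) < n' <;> simp [h1, h2]
  simp only [e2]
  rw [Fin.sum_univ_eq_sum_range (fun i => if i < mn n n' then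
      ((dig U i : ℝ) - 33554432) * ((dig V i : ℝ) - 33554432) else 0) 64, ← Finset.sum_filter]
  have e3 : (Finset.range 64).filter (fun i => i < mn n n') = Finset.range (mn n n') := by
    ext i; simp only [Finset.mem_filter, Finset.mem_range, mn_eq]; omega
  rw [e3]
  refine Finset.sum_congr rfl fun i _ => ?_
  ring

/-! ### entries -/

lemma lsum_ents1 (u : Rw) (vs : List Rw) (tl : List En) (f : En → ℕ) :
    lsum (ents1 u vs tl) f = (lsum vs fun v => bc (Nat.beq u.h v.h)
      (f ⟨u.h, u.m, v.m, u.n, u.L, v.n, v.L⟩) 0) + lsum tl f := by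
  induction vs with
  | nil => exact (Nat.zero_add _).symm
  | cons v vs ih =>
    have e1 : ents1 u (v :: vs) tl = bc (Nat.beq u.h v.h)
      (⟨u.h, u.m, v.m, u.n, u.L, v.n, v.L⟩ :: ents1 u vs tl) (ents1 u vs tl) := rfl
    have e2 : ∀ F : Rw → ℕ, lsum (v :: vs) F = F v + lsum vs F := fun _ => rfl
    rw [e1, e2, add_assoc, ← ih]
    cases Nat.beq u.h v.h
    · simp
    · rfl

lemma lsum_ents (us vs : List Rw) (f : En → ℕ) :
    lsum (ents us vs) f = lsum us fun u => lsum vs fun v => bc (Nat.beq u.h v.h)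
      (f ⟨u.h, u.m, v.m, u.n, u.L, v.n, v.L⟩) 0 := by
  induction us with
  | nil => rfl
  | cons u us ih =>
    have e1 : ents (u :: us) vs = ents1 u vs (ents us vs) := rfl
    rw [e1, lsum_ents1, ih]; rfl

structure RwOK (r : Rw) : Prop where
  m : MVok r.m
  n : r.n ≤ 64
  h : r.h < 256

def Qr (u v : Rw) : ℝ := ∑ i, lr u.n u.L i * lr v.n v.L i

lemma ePN {u v : Rw} (hu : RwOK u) (hv : RwOK v) {c : List ℕ} (hc : ∀ p ∈ c, PTok p (pm p)) :
    ((eP c ⟨u.h, u.m, v.m, u.n, u.L, v.n, v.L⟩ : ℕ) : ℝ) - eN c ⟨u.h, u.m, v.m, u.n, u.L, v.n, v.L⟩ =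
    rs c fun p => Qr u v * (tws (od u.h) (pm p) * ovl (pm p) (mr u.m) (mr v.m)) := by
  rw [rs_mul, ← tPN u.h hv.m hc, Qr, ← qPN hu.n]
  have a1 : eP c ⟨u.h, u.m, v.m, u.n, u.L, v.n, v.L⟩ =
    qP (mn u.n v.n) u.L v.L * tPs u.h u.m v.m c + qN (mn u.n v.n) u.L v.L * tNs u.h u.m v.m c := rfl
  have a2 : eN c ⟨u.h, u.m, v.m, u.n, u.L, v.n, v.L⟩ =
    qP (mn u.n v.n) u.L v.L * tNs u.h u.m v.m c + qN (mn u.n v.n) u.L v.L * tPs u.h u.m v.m c := rfl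
  rw [a1, a2]
  push_cast
  ring

/-! ### masks -/

def fb (b : Fin 6 → Bool) : ℕ := ∑ i : Fin 6, (b i).toNat <<< (i : ℕ)

lemma bs_fb : ∀ b : Fin 6 → Bool, bs (fb b) = b := by decide +kernel
lemma fb_bs : ∀ n < 64, fb (bs n) = n := by decide +kernel
lemma fb_lt : ∀ b : Fin 6 → Bool, fb b < 64 := by decide +kernel

lemma pim_eq {A p : ℕ} {π : PP} (hp : PK p π) : pim A p = fb fun i => bs A (hat π i) := by
  unfold pim fb
  rw [nsum_eq, ← Fin.sum_univ_eq_sum_range (fun i => Nat.shiftLeft (Nat.land (Nat.shiftRight A (hd p i)) 1) i)]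
  refine Finset.sum_congr rfl fun i _ => ?_
  rw [land_one, hp]
  have : (Nat.shiftRight A (hat π i)).testBit 0 = bs A (hat π i) := by
    show (A >>> _).testBit 0 = _
    rw [Nat.testBit_shiftRight]; rfl
  rw [this]; rfl

lemma mt_iff {A B p : ℕ} {π : PP} (hp : PK p π) (hB : B < 64) :
    mt A B p = true ↔ (fun i => bs A (hat π i)) = bs B := by
  unfold mt
  rw [pim_eq hp]
  constructor
  · intro h
    have := Nat.eq_of_beq_eq_true h
    rw [← this, bs_fb]
  · intro h
    rw [h, fb_bs B hB, Nat.beq_refl]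

lemma par_spec : ∀ n < 64, (∏ i : Fin 6, if bs n i then (-1 : ℤ) else 1) = if par n then -1 else 1 := by
  decide +kernel

lemma chi_par {B t : ℕ} (hB : B < 64) : chi (bs B) (bs t) = if par (Nat.land B t) then -1 else 1 := by
  have h := par_spec (B &&& t) (lt_of_le_of_lt Nat.and_le_left hB)
  have e : chi (bs B) (bs t) = ((∏ i : Fin 6, if bs (B &&& t) i then (-1 : ℤ) else 1 : ℤ) : ℝ) := by
    push_cast
    unfold chi
    refine Finset.prod_congr rfl fun i _ => ?_
    have : bs (B &&& t) i = (bs B i && bs t i) := Nat.testBit_and B t i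
    rw [this]
  rw [e, h]
  have : B &&& t = Nat.land B t := rfl
  rw [this]
  cases par (Nat.land B t) <;> simp

structure GpOK (g : Gp) : Prop where
  A : g.A < 64
  rs : ∀ r ∈ g.rs, RwOK r

/-- the coefficient -/
def Kc (g g' : Gp) (u v : Rw) (π : PP) (σ : SS) : ℝ :=
  if u.h = v.h ∧ (fun i => bs g.A (hat π i)) = bs g'.A then
    Qr u v * (tws (od u.h) π * chi (bs g'.A) σ * ovl π (mr u.m) (mr v.m)) else 0

def Kf (us vs : List Gp) (π : PP) (σ : SS) : ℝ :=
  rs vs fun g' => rs us fun g => rs g.rs fun u => rs g'.rs fun v => Kc g g' u v π σ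

lemma hPe (us : List Gp) (B : ℕ) (vs : List Rw) (c : List ℕ) (f : List ℕ → En → ℕ)
    (hf : f = eP ∨ f = eN) :
    hP us B vs c f = lsum us fun g => lsum (ents g.rs vs) (f (lfil (mt g.A B) c)) := by
  have h0 : ∀ e, f [] e = 0 := by
    intro e; cases e
    rcases hf with rfl | rfl <;> rfl
  unfold hP
  congr 1
  funext g
  show (List.rec (motive := fun _ => ℕ) 0
    (fun _ _ _ => lsum (ents g.rs vs) (f (lfil (mt g.A B) c))) (lfil (mt g.A B) c)) = _
  cases e : lfil (mt g.A B) c with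
  | nil =>
    have : f [] = fun _ => 0 := funext h0
    rw [lsum_eq, this]
    simp
  | cons p t => rfl

lemma hPN {us : List Gp} {g' : Gp} {c : List ℕ} (hu : ∀ g ∈ us, GpOK g) (hv : GpOK g')
    (hc : ∀ p ∈ c, PTok p (pm p)) (t : ℕ) :
    (((hP us g'.A g'.rs c eP : ℕ) : ℝ) - hP us g'.A g'.rs c eN) * chi (bs g'.A) (bs t) =
    rs c fun p => rs us fun g => rs g.rs fun u => rs g'.rs fun v => Kc g g' u v (pm p) (bs t) := by
  rw [hPe _ _ _ _ _ (Or.inl rfl), hPe _ _ _ _ _ (Or.inr rfl)]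
  simp only [cast_lsum, lsum_ents, ← rs_sub, ← rs_mul']
  rw [rs_comm c us]
  refine rs_congr fun g hg => ?_
  rw [rs_comm c g.rs]
  refine rs_congr fun u hu' => ?_
  rw [rs_comm c g'.rs]
  refine rs_congr fun v hv' => ?_
  have hc' : ∀ p ∈ lfil (mt g.A g'.A) c, PTok p (pm p) := by
    intro p hp; rw [lfil_eq] at hp; exact hc p (List.mem_filter.1 hp).1
  cases h : Nat.beq u.h v.h with
  | false =>
    have h' : u.h ≠ v.h := by
      intro e; rw [e, Nat.beq_refl] at h; simp at h
    simp [Kc, h', rs_zero]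
  | true =>
    have h' := Nat.eq_of_beq_eq_true h
    rw [bc_true, bc_true, ePN ((hu g hg).rs u hu') (hv.rs v hv') hc', lfil_eq, rs_filter, ← rs_mul']
    refine rs_congr fun p hp => ?_
    simp only [Kc, ← mt_iff (hc p hp).pk hv.A, h', true_and]
    cases mt g.A g'.A p
    · simp
    · simp only [if_true]; ring

theorem kPN {us vs : List Gp} {c : List ℕ} (hu : ∀ g ∈ us, GpOK g) (hv : ∀ g ∈ vs, GpOK g)
    (hc : ∀ p ∈ c, PTok p (pm p)) (t : ℕ) :
    ((kP us vs c t : ℕ) : ℝ) - kN us vs c t = rs c fun p => Kf us vs (pm p) (bs t) := by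
  unfold Kf
  rw [rs_comm]
  simp only [kP, kN, cast_lsum, ← rs_sub]
  refine rs_congr fun g' hg' => ?_
  rw [← hPN hu (hv g' hg') hc t, chi_par (hv g' hg').A]
  show ((bc (par (Nat.land g'.A t)) (hP us g'.A g'.rs c eN) (hP us g'.A g'.rs c eP) : ℕ) : ℝ) -
    (bc (par (Nat.land g'.A t)) (hP us g'.A g'.rs c eP) (hP us g'.A g'.rs c eN) : ℕ) = _
  cases par (Nat.land g'.A t) <;> simp

/-! ### classes -/

lemma mkcls_cons (ra rb fuel p : ℕ) (t : List ℕ) : mkcls ra rb (fuel + 1) (p :: t) =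
    (p :: t.filter (sme ra rb p)) ::
      mkcls ra rb fuel (t.filter (fun q => Bool.not (sme ra rb p q))) := by
  rw [← lfil_eq, ← lfil_eq]; rfl

lemma mkcls_sum (ra rb : ℕ) (F : ℕ → ℝ) : ∀ (fuel : ℕ) (l : List ℕ), l.length ≤ fuel →
    rs (mkcls ra rb fuel l) (fun c => rs c F) = rs l F := by
  intro fuel
  induction fuel with
  | zero => intro l hl; have : l = [] := by simpa using hl
            subst this; rfl
  | succ n ih =>
    intro l hl
    cases l with
    | nil => rfl
    | cons p t =>
      rw [mkcls_cons, rs_cons, rs_cons, rs_cons, ih, rs_filter, rs_filter, add_assoc, ← rs_add]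
      · congr 1
        refine rs_congr fun q _ => ?_
        cases sme ra rb p q <;> simp
      · have := List.length_filter_le (fun q => !sme ra rb p q) t
        simp at hl; omega

lemma mkcls_mem (ra rb : ℕ) : ∀ (fuel : ℕ) (l c : List ℕ), c ∈ mkcls ra rb fuel l →
    ∃ p t, c = p :: t ∧ (∀ q ∈ c, q ∈ l) ∧ ∀ q ∈ c, cde ra rb p = cde ra rb q := by
  intro fuel
  induction fuel with
  | zero => intro l c hc; cases hc
  | succ n ih =>
    intro l c hc
    cases l with
    | nil => cases hc
    | cons p t =>
      rw [mkcls_cons] at hc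
      rcases List.mem_cons.1 hc with rfl | hc
      · refine ⟨p, _, rfl, ?_, ?_⟩
        · intro q hq
          rcases List.mem_cons.1 hq with rfl | hq
          · simp
          · exact List.mem_cons_of_mem _ (List.mem_filter.1 hq).1
        · intro q hq
          rcases List.mem_cons.1 hq with rfl | hq
          · rfl
          · exact Nat.eq_of_beq_eq_true (List.mem_filter.1 hq).2
      · obtain ⟨p', t', h1, h2, h3⟩ := ih _ _ hc
        exact ⟨p', t', h1, fun q hq => List.mem_cons_of_mem _ (List.mem_filter.1 (h2 q hq)).1, h3⟩

lemma nsum_succ (n : ℕ) (f : ℕ → ℕ) : nsum (n + 1) f = f n + nsum n f := rfl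

lemma nsum_lt {d : ℕ → ℕ} (hd : ∀ i, d i < 8) (n : ℕ) :
    nsum n (fun j => Nat.shiftLeft (d j) (Nat.mul 3 j)) < 8 ^ n := by
  induction n with
  | zero => show 0 < 1; norm_num
  | succ n ih =>
    have e : Nat.shiftLeft (d n) (Nat.mul 3 n) = d n * 8 ^ n := by
      have : d n <<< (3 * n) = d n * 8 ^ n := by rw [Nat.shiftLeft_eq, pow_mul]; norm_num
      exact this
    rw [nsum_succ, e, pow_succ]
    have := hd n
    have h2 : d n * 8 ^ n ≤ 7 * 8 ^ n := Nat.mul_le_mul_right _ (by omega)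
    omega

lemma nsum_inj {d d' : ℕ → ℕ} (hd : ∀ i, d i < 8) (hd' : ∀ i, d' i < 8) (n : ℕ)
    (h : nsum n (fun j => Nat.shiftLeft (d j) (Nat.mul 3 j)) =
      nsum n (fun j => Nat.shiftLeft (d' j) (Nat.mul 3 j))) : ∀ j < n, d j = d' j := by
  induction n with
  | zero => intro j hj; omega
  | succ n ih =>
    have e : ∀ d : ℕ → ℕ, Nat.shiftLeft (d n) (Nat.mul 3 n) = d n * 8 ^ n := by
      intro d
      have : d n <<< (3 * n) = d n * 8 ^ n := by rw [Nat.shiftLeft_eq, pow_mul]; norm_num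
      exact this
    rw [nsum_succ, nsum_succ, e, e] at h
    have l1 := nsum_lt hd n
    have l2 := nsum_lt hd' n
    have k1 : d n = d' n := by
      have a1 := congrArg (· / 8 ^ n) h
      have hp : 0 < 8 ^ n := by positivity
      simp only [mul_comm _ (8 ^ n), Nat.mul_add_div hp, Nat.div_eq_of_lt l1, Nat.div_eq_of_lt l2] at a1
      simpa using a1
    intro j hj
    rcases Nat.lt_succ_iff_lt_or_eq.1 hj with hj | rfl
    · refine ih ?_ j hj
      rw [k1] at h; omega
    · exact k1

lemma hd_lt (p i : ℕ) : hd p i < 8 :=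
  lt_of_le_of_lt (Nat.and_le_right (n := Nat.shiftRight p (Nat.mul 3 i)) (m := 7)) (by norm_num)

lemma cdg_eq (ra p j : ℕ) : cdg ra p j = if hd p (j + 1) ≤ ra then hd p (j + 1) else 0 := by
  unfold cdg
  rw [bc_eq]
  simp [Nat.ble_eq]

lemma cdg_lt (ra p j : ℕ) : cdg ra p j < 8 := by
  rw [cdg_eq]; split
  · exact hd_lt _ _
  · norm_num

lemma cde_inj {ra rb p q : ℕ} (h : cde ra rb p = cde ra rb q) : ∀ j < rb, cdg ra p j = cdg ra q j :=
  nsum_inj (cdg_lt ra p) (cdg_lt ra q) rb h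

/-- the support of an orbit representative -/
def Xs (r z : ℕ) (i : Fin 6) : Prop := (i : ℕ) ≤ r ∧ (i = 0 → z = 1)

lemma cde_hat {ra rb za zb p q : ℕ} {π ρ : PP} (hp : PK p π) (hq : PK q ρ) (h : cde ra rb p = cde ra rb q)
    (j : Fin 6) (hj : Xs rb zb j) (hx : Xs ra za (hat π j) ∨ Xs ra za (hat ρ j)) : hat π j = hat ρ j := by
  revert hj hx
  refine Fin.cases ?_ (fun j => ?_) j
  · intro _ _; rfl
  · intro hj hx
    have h1 := cde_inj h j (by have := hj.1; simp at this; omega)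
    rw [cdg_eq, cdg_eq] at h1
    have a1 : hd p (j + 1) = hat π j.succ := by simpa using hp j.succ
    have a2 : hd q (j + 1) = hat ρ j.succ := by simpa using hq j.succ
    rw [a1, a2] at h1
    have p1 : 0 < ((hat π j.succ : Fin 6) : ℕ) := by show 0 < ((π j).succ : ℕ); simp
    have p2 : 0 < ((hat ρ j.succ : Fin 6) : ℕ) := by show 0 < ((ρ j).succ : ℕ); simp
    apply Fin.ext
    rcases hx with hx | hx
    · have := hx.1
      rw [if_pos this] at h1
      split at h1 <;> omega
    · have := hx.1
      rw [if_pos this] at h1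
      split at h1 <;> omega

open scoped Classical in
/-- the relevant signs -/
def bx (ra za rb zb : ℕ) (π : PP) : SS := fun i => decide (Xs rb zb i ∧ Xs ra za (hat π i))

lemma land_le_one {a b : ℕ} (ha : a ≤ 1) (hb : b ≤ 1) : Nat.land a b = if a = 1 ∧ b = 1 then 1 else 0 := by
  interval_cases a <;> interval_cases b <;> rfl

lemma msk_eq {ra rb za zb p : ℕ} {π : PP} (hp : PK p π) (hr : rb ≤ 5) (ha : za ≤ 1) (hb : zb ≤ 1) :
    msk ra rb (Nat.land za zb) p = fb (bx ra za rb zb π) := by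
  have e0 : msk ra rb (Nat.land za zb) p = Nat.land za zb + nsum rb (fun j =>
    bc (Nat.ble (hd p (Nat.succ j)) ra) (Nat.shiftLeft 2 j) 0) := rfl
  rw [e0, nsum_eq, fb, Fin.sum_univ_succ]
  have h0 : hat π 0 = 0 := rfl
  congr 1
  · rw [land_le_one ha hb]
    by_cases h1 : za = 1 <;> by_cases h2 : zb = 1 <;> simp [bx, Xs, h0, h1, h2]
  · have e1 : ∀ j : Fin 5, (bx ra za rb zb π j.succ).toNat <<< (j.succ : ℕ) =
        if (j : ℕ) < rb then bc (Nat.ble (hd p (Nat.succ j)) ra) (Nat.shiftLeft 2 j) 0 else 0 := by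
      intro j
      have a1 : hd p (Nat.succ j) = hat π j.succ := by simpa using hp j.succ
      have a2 : Nat.shiftLeft 2 (j : ℕ) = 1 <<< (j + 1 : ℕ) := by
        show 2 <<< (j : ℕ) = _
        rw [Nat.shiftLeft_eq, Nat.shiftLeft_eq, pow_succ]; ring
      have p1 : hat π j.succ ≠ 0 := by show (π j).succ ≠ 0; simp
      rw [a1, a2, bc_eq]
      simp only [bx, Xs, Fin.val_succ, Nat.succ_le_iff, p1, Fin.succ_ne_zero, false_imp_iff, and_true,
        Nat.ble_eq]
      generalize ((hat π j.succ : Fin 6) : ℕ) = x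
      by_cases h1 : (j : ℕ) < rb <;> by_cases h2 : x ≤ ra <;> simp [h1, h2]
    simp only [e1]
    rw [Fin.sum_univ_eq_sum_range (fun j => if j < rb then
      bc (Nat.ble (hd p (Nat.succ j)) ra) (Nat.shiftLeft 2 j) 0 else 0) 5, ← Finset.sum_filter]
    congr 1
    ext i; simp only [Finset.mem_filter, Finset.mem_range]; omega

/-! ### sums over signs -/

def wchk : Bool := lall (List.range 64) fun M => lall (List.range 64) fun t =>
  Nat.beq (lsum (List.range 64) fun s => bc (Nat.beq (Nat.land s M) t) 1 0)
    (bc (Nat.beq (Nat.land t M) t) (wts M) 0)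

lemma wchk_true : wchk = true := by decide +kernel

lemma wcount {M t : ℕ} (hM : M < 64) (ht : t < 64) :
    (lsum (List.range 64) fun s => bc (Nat.beq (Nat.land s M) t) 1 0) =
    bc (Nat.beq (Nat.land t M) t) (wts M) 0 :=
  Nat.eq_of_beq_eq_true (lall_mem (lall_mem wchk_true M (by simpa using hM)) t (by simpa using ht))

lemma sum_SS (F : SS → ℝ) : ∑ σ, F σ = rs (List.range 64) fun s => F (bs s) := by
  have : ∑ σ, F σ = ∑ s ∈ Finset.range 64, F (bs s) := by
    refine Finset.sum_bij' (fun σ _ => fb σ) (fun s _ => bs s) ?_ ?_ ?_ ?_ ?_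
    · intro σ _; simpa using fb_lt σ
    · intro s _; simp
    · intro σ _; exact bs_fb σ
    · intro s hs; exact fb_bs s (by simpa using hs)
    · intro σ _; rw [bs_fb]
  rw [this]
  rfl

lemma rs_ite {α : Type} [DecidableEq α] (l : List α) (hl : l.Nodup) {a : α} (ha : a ∈ l) (f : α → ℝ) :
    rs l (fun x => if a = x then f x else 0) = f a := by
  induction l with
  | nil => cases ha
  | cons b l ih =>
    rw [rs_cons]
    rcases List.mem_cons.1 ha with rfl | h
    · rw [if_pos rfl, rs_congr (g := fun _ => 0), rs_zero, add_zero]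
      intro x hx
      rw [if_neg]; rintro rfl; exact (List.nodup_cons.1 hl).1 hx
    · rw [ih (List.nodup_cons.1 hl).2 h, if_neg, zero_add]
      rintro rfl; exact (List.nodup_cons.1 hl).1 h

lemma sum_signs (b : SS) (F : SS → ℝ) (hF : ∀ σ, F σ = F fun i => (σ i && b i)) :
    ∑ σ, F σ = wts (fb b) * rs (sbs (fb b)) fun t => F (bs t) := by
  have hM := fb_lt b
  rw [sum_SS]
  have e1 : ∀ s, F (bs s) = F (bs (Nat.land s (fb b))) := by
    intro s
    rw [hF]; congr 1; funext i
    have : bs (Nat.land s (fb b)) i = (bs s i && bs (fb b) i) := Nat.testBit_and s _ i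
    rw [this, bs_fb]
  have e2 : ∀ s ∈ List.range 64, F (bs s) =
      rs (List.range 64) fun t => if Nat.land s (fb b) = t then F (bs t) else 0 := by
    intro s hs
    rw [e1, rs_ite (List.range 64) List.nodup_range (a := Nat.land s (fb b)) (f := fun t => F (bs t))]
    have h1 : Nat.land s (fb b) ≤ fb b := Nat.and_le_right
    exact List.mem_range.2 (by omega)
  rw [rs_congr e2, rs_comm, sbs, lfil_eq, rs_filter, ← rs_mul]
  refine rs_congr fun t ht => ?_
  have h3 := wcount hM (by simpa using ht : t < 64)
  have h4 : (rs (List.range 64) fun s => if Nat.land s (fb b) = t then F (bs t) else 0) =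
      ((lsum (List.range 64) fun s => bc (Nat.beq (Nat.land s (fb b)) t) 1 0 : ℕ) : ℝ) * F (bs t) := by
    rw [cast_lsum, ← rs_mul']
    refine rs_congr fun s _ => ?_
    by_cases h : Nat.land s (fb b) = t
    · rw [h, Nat.beq_refl]; simp
    · have : Nat.beq (Nat.land s (fb b)) t = false := by
        cases h' : Nat.beq (Nat.land s (fb b)) t
        · rfl
        · exact absurd (Nat.eq_of_beq_eq_true h') h
      rw [this, if_neg h, bc_false]; simp
  rw [h4, h3]
  cases Nat.beq (Nat.land t (fb b)) t <;> simp

lemma mem_sbs {b : SS} {t : ℕ} (ht : t ∈ sbs (fb b)) : (fun i => (bs t i && b i)) = bs t := by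
  rw [sbs, lfil_eq] at ht
  have h := Nat.eq_of_beq_eq_true (List.mem_filter.1 ht).2
  funext i
  conv_rhs => rw [← h]
  have : bs (Nat.land t (fb b)) i = (bs t i && bs (fb b) i) := Nat.testBit_and t _ i
  rw [this, bs_fb]

/-! ### pairs of orbits -/

structure ObOK (a : Ob) : Prop where
  r : a.r ≤ 5
  z : a.z ≤ 1
  gs : ∀ g ∈ a.gs, GpOK g
  ms : ∀ g ∈ a.gs, ∀ i, bs g.A i = true → Xs a.r a.z i
  sm : Sm a.w
  wx : ∀ l ∈ wd a.w, Xs a.r a.z l.1.1 ∧ Xs a.r a.z l.2.1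

lemma chi_and {B b : SS} (h : ∀ i, B i = true → b i = true) (σ : SS) :
    chi B σ = chi B fun i => (σ i && b i) := by
  unfold chi
  refine Finset.prod_congr rfl fun i _ => ?_
  cases hB : B i
  · simp
  · simp [h i hB]

lemma Kf_and {a b : Ob} (ha : ObOK a) (hb : ObOK b) (π : PP) (σ : SS) :
    Kf a.gs b.gs π σ = Kf a.gs b.gs π fun i => (σ i && bx a.r a.z b.r b.z π i) := by
  refine rs_congr fun g' hg' => rs_congr fun g hg => rs_congr fun u _ => rs_congr fun v _ => ?_
  unfold Kc
  by_cases h : u.h = v.h ∧ (fun i => bs g.A (hat π i)) = bs g'.A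
  · rw [if_pos h, if_pos h, ← chi_and]
    intro i hi
    simp only [bx, decide_eq_true_eq]
    refine ⟨hb.ms g' hg' i hi, ha.ms g hg _ ?_⟩
    rw [← hi, ← h.2]
  · rw [if_neg h, if_neg h]

section pairs
variable {G : Type*} [Group G] {Ψ : Wd (Fin 6) → ℝ}

def Sp (Ψ : Wd (Fin 6) → ℝ) (a b : Ob) : ℝ :=
  ∑ π, ∑ σ, Kf a.gs b.gs π σ * bb Ψ (wd a.w) (rl (act π σ) (wd b.w))

lemma class_sum (h : PS 0 G Ψ) {a b : Ob} (ha : ObOK a) (hb : ObOK b) {p : ℕ} {t : List ℕ}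
    (hc : ∀ q ∈ p :: t, PTok q (pm q)) (he : ∀ q ∈ p :: t, cde a.r b.r p = cde a.r b.r q) :
    (rs (p :: t) fun q => ∑ σ, Kf a.gs b.gs (pm q) σ * bb Ψ (wd a.w) (rl (act (pm q) σ) (wd b.w))) =
    rs (sbs (msk a.r b.r (Nat.land a.z b.z) p)) fun s => wts (msk a.r b.r (Nat.land a.z b.z) p) *
      (((kP a.gs b.gs (p :: t) s : ℕ) : ℝ) - kN a.gs b.gs (p :: t) s) *
      (Ψ (wd a.w) + Ψ (wd b.w) - Ψ (wd (app (nv a.w) (rn p s b.w)))) := by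
  have hp := (hc p (by simp)).pk
  rw [msk_eq hp hb.r ha.z hb.z]
  set β := bx a.r a.z b.r b.z (pm p) with hβ
  have hbq : ∀ q ∈ p :: t, bx a.r a.z b.r b.z (pm q) = β := by
    intro q hq
    funext i
    simp only [hβ, bx, decide_eq_decide]
    refine and_congr_right fun hi => ⟨fun hx => ?_, fun hx => ?_⟩
    · rw [cde_hat hp (hc q hq).pk (he q hq) i hi (Or.inr hx)]; exact hx
    · rw [← cde_hat hp (hc q hq).pk (he q hq) i hi (Or.inl hx)]; exact hx
  let B0 : SS → ℝ := fun σ => Ψ (wd a.w) + Ψ (wd b.w) -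
    Ψ (winv (wd a.w) ++ rl (act (pm p) fun i => (σ i && β i)) (wd b.w))
  have e1 : ∀ q ∈ p :: t,
      ∑ σ, Kf a.gs b.gs (pm q) σ * bb Ψ (wd a.w) (rl (act (pm q) σ) (wd b.w)) =
      wts (fb β) * rs (sbs (fb β)) fun s => Kf a.gs b.gs (pm q) (bs s) * B0 (bs s) := by
    intro q hq
    rw [← sum_signs β (fun σ => Kf a.gs b.gs (pm q) σ * B0 σ)]
    · refine Finset.sum_congr rfl fun σ _ => ?_
      congr 1
      simp only [B0, bb]
      rw [h.rel _ (act_mem _ _)]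
      congr 1
      refine code_red h (Xs a.r a.z) (Xs b.r b.z) (pm q) (pm p) σ _ ?_ ha.wx hb.wx
      intro j hj hx
      have h1 := (cde_hat hp (hc q hq).pk (he q hq) j hj hx.symm).symm
      refine ⟨h1, ?_⟩
      have : β j = true := by
        simp only [hβ, bx, decide_eq_true_eq]
        refine ⟨hj, ?_⟩
        rcases hx with hx | hx
        · exact h1 ▸ hx
        · exact hx
      simp [this]
    · intro σ
      rw [Kf_and ha hb (pm q) σ, hbq q hq]
      simp only [B0]
      congr 3
      simp [Bool.and_assoc]
  rw [rs_congr e1, rs_mul, rs_comm, ← rs_mul]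
  refine rs_congr fun s hs => ?_
  rw [rs_mul', ← kPN ha.gs hb.gs hc s, mul_assoc]
  congr 2
  simp only [B0]
  rw [mem_sbs hs, wd_app, wd_nv, (wd_rn hp s hb.sm).1]

/-- value of an item -/
def rit (Ψ : Wd (Fin 6) → ℝ) (it : It) : ℝ := ((it.k : ℝ) - it.k') * Ψ (wd it.w)

lemma cits_sum (us vs : List Gp) (c : List ℕ) (f : ℕ) (wa : CW) (p : ℕ) (wb : CW) (ts : List ℕ) (H : ℕ) :
    rs (cits us vs c f wa p wb ts H) (rit Ψ) = rs ts fun t =>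
      f * (((kP us vs c t : ℕ) : ℝ) - kN us vs c t) * Ψ (wd (app wa (rn p t wb))) := by
  induction ts generalizing H with
  | nil => rfl
  | cons t ts ih =>
    have : cits us vs c f wa p wb (t :: ts) H = ⟨f * kP us vs c t, f * kN us vs c t,
      Nat.land H 67108863, app wa (rn p t wb)⟩ :: cits us vs c f wa p wb ts (Nat.shiftRight H 26) := rfl
    rw [this, rs_cons, rs_cons, ih]
    congr 1
    simp only [rit]
    push_cast
    ring

lemma clits_sum (us vs : List Gp) (ra rb z f : ℕ) (wa wb : CW) (cs : List (List ℕ)) (Hs : List ℕ) :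
    rs (clits us vs ra rb z f wa wb cs Hs) (fun l => rs l (rit Ψ)) = rs cs fun c =>
      rs (sbs (hdm ra rb z c)) fun t => ((f * wts (hdm ra rb z c) : ℕ) : ℝ) *
        (((kP us vs c t : ℕ) : ℝ) - kN us vs c t) * Ψ (wd (app wa (rn (hd0 c) t wb))) := by
  induction cs generalizing Hs with
  | nil => rfl
  | cons c cs ih =>
    have : clits us vs ra rb z f wa wb (c :: cs) Hs =
      cits us vs c (f * wts (hdm ra rb z c)) wa (hd0 c) wb (sbs (hdm ra rb z c)) (hd0 Hs) ::
        clits us vs ra rb z f wa wb cs (tl0 Hs) := rfl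
    rw [this, rs_cons, rs_cons, ih, cits_sum]

/-- the permutation table -/
structure TOK (PT : List ℕ) : Prop where
  ok : ∀ p ∈ PT, PTok p (pm p)
  sum : ∀ F : PP → ℝ, ∑ π, F π = rs PT fun p => F (pm p)
  len : PT.length ≤ 120

theorem pits_sum (h : PS 0 G Ψ) {PT : List ℕ} (hT : TOK PT) (q : Pr) (ha : ObOK q.a) (hb : ObOK q.b) :
    rs (pits PT q) (fun l => rs l (rit Ψ)) = -(q.f * Sp Ψ q.a q.b) := by
  obtain ⟨a, b, f, hs⟩ := q
  simp only at ha hb ⊢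
  set z := Nat.land a.z b.z with hz
  set cs := mkcls a.r b.r 120 PT with hcs
  have e0 : pits PT ⟨a, b, f, hs⟩ =
    [⟨ztot a.gs b.gs a.r b.r z f kN cs, ztot a.gs b.gs a.r b.r z f kP cs, a.h, a.w⟩,
     ⟨ztot a.gs b.gs a.r b.r z f kN cs, ztot a.gs b.gs a.r b.r z f kP cs, b.h, b.w⟩] ::
    clits a.gs b.gs a.r b.r z f (nv a.w) b.w cs hs := rfl
  have e1 : Sp Ψ a b = rs cs fun c => rs (sbs (hdm a.r b.r z c)) fun s => wts (hdm a.r b.r z c) *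
      (((kP a.gs b.gs c s : ℕ) : ℝ) - kN a.gs b.gs c s) *
      (Ψ (wd a.w) + Ψ (wd b.w) - Ψ (wd (app (nv a.w) (rn (hd0 c) s b.w)))) := by
    unfold Sp
    rw [hT.sum, ← mkcls_sum a.r b.r _ 120 PT hT.len, ← hcs]
    refine rs_congr fun c hc => ?_
    obtain ⟨p, t, rfl, h1, h2⟩ := mkcls_mem a.r b.r 120 PT c hc
    exact class_sum h ha hb (fun q hq => hT.ok q (h1 q hq)) h2
  rw [e0, rs_cons, clits_sum, rs_cons, rs_cons, rs_nil, e1]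
  simp only [rit, ztot, cast_lsum]
  rw [← sub_eq_zero]
  simp only [← rs_sub, ← rs_mul, ← rs_mul', ← rs_add, sub_neg_eq_add, add_zero]
  rw [← rs_zero cs]
  refine rs_congr fun c _ => ?_
  rw [← rs_zero (sbs (hdm a.r b.r z c))]
  refine rs_congr fun s _ => ?_
  have : ∀ x y : ℕ, Nat.mul x y = x * y := fun _ _ => rfl
  simp only [this]
  push_cast
  ring

end pairs

/-! ### positivity of the sum over pairs -/

lemma hat_inv (π : PP) (i : Fin 6) : hat π⁻¹ (hat π i) = i := by
  rw [← hat_mul, inv_mul_cancel]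
  refine Fin.cases ?_ (fun j => ?_) i <;> rfl

lemma hat_inv' (π : PP) (i : Fin 6) : hat π (hat π⁻¹ i) = i := by
  simpa using hat_inv π⁻¹ i

lemma tws_inv (t : Bool) (π : PP) : tws t π⁻¹ = tws t π := by
  cases t <;> simp [tws]

lemma ovl_inv (π : PP) (m m' : Fin 5 → Fin 5 → ℝ) : ovl π⁻¹ m' m = ovl π m m' := by
  unfold ovl
  rw [← Equiv.sum_comp π]
  refine Finset.sum_congr rfl fun p _ => ?_
  rw [← Equiv.sum_comp π]
  refine Finset.sum_congr rfl fun q _ => ?_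
  simp [mul_comm]

lemma Kc_symm (g g' : Gp) (u v : Rw) (π : PP) (σ : SS) :
    Kc g' g v u π⁻¹ (fun i => σ (hat π⁻¹ i)) = Kc g g' u v π σ := by
  unfold Kc
  have hc : (v.h = u.h ∧ (fun i => bs g'.A (hat π⁻¹ i)) = bs g.A) ↔
      (u.h = v.h ∧ (fun i => bs g.A (hat π i)) = bs g'.A) := by
    refine and_congr eq_comm ⟨fun h => ?_, fun h => ?_⟩
    · rw [← h]; funext i
      show bs g'.A (hat π⁻¹ (hat π i)) = _
      rw [hat_inv]
    · rw [← h]; funext i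
      show bs g.A (hat π (hat π⁻¹ i)) = _
      rw [hat_inv']
  by_cases h : u.h = v.h ∧ (fun i => bs g.A (hat π i)) = bs g'.A
  · rw [if_pos h, if_pos (hc.2 h), tws_inv, ovl_inv]
    have e1 : chi (bs g.A) (fun i => σ (hat π⁻¹ i)) = chi (bs g'.A) σ := by
      rw [← h.2, ← chi_comp (bs g.A) (fun i => σ (hat π⁻¹ i)) (hat π)]
      simp [hat_inv]
    have e2 : Qr v u = Qr u v := by
      unfold Qr; exact Finset.sum_congr rfl fun i _ => mul_comm _ _
    rw [e1, e2, h.1]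
  · rw [if_neg h, if_neg fun h' => h (hc.1 h')]

lemma Kf_symm (us vs : List Gp) (π : PP) (σ : SS) :
    Kf vs us π⁻¹ (fun i => σ (hat π⁻¹ i)) = Kf us vs π σ := by
  unfold Kf
  rw [rs_comm]
  refine rs_congr fun g' _ => rs_congr fun g _ => ?_
  rw [rs_comm]
  exact rs_congr fun u _ => rs_congr fun v _ => Kc_symm ..

section pos
variable {G : Type*} [Group G] {Ψ : Wd (Fin 6) → ℝ}

lemma bb_symm (h : PS 0 G Ψ) (w v : Wd (Fin 6)) : bb Ψ w v = bb Ψ v w := by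
  have : Ψ (winv w ++ v) = Ψ (winv v ++ w) := by
    rw [← h.inv (winv w ++ v), winv_append]; simp
  unfold bb
  rw [this]; ring

lemma Sp_symm (h : PS 0 G Ψ) (a b : Ob) : Sp Ψ b a = Sp Ψ a b := by
  unfold Sp
  rw [← Equiv.sum_comp (Equiv.inv PP)]
  refine Finset.sum_congr rfl fun π _ => ?_
  simp only [Equiv.inv_apply]
  let E : SS ≃ SS := Equiv.arrowCongr (hat π) (Equiv.refl Bool)
  rw [← Equiv.sum_comp E]
  refine Finset.sum_congr rfl fun σ _ => ?_
  have hE : E σ = fun i => σ (hat π⁻¹ i) := by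
    funext i
    show σ ((hat π).symm i) = _
    congr 1
  rw [hE, Kf_symm]
  congr 1
  rw [bb_symm h, ← bb_rl h π σ]
  congr 1
  rw [rl_rl]
  unfold rl
  conv_rhs => rw [← List.map_id (wd a.w)]
  congr 1
  have key : ∀ c, act π σ (act π⁻¹ (fun i => σ (hat π⁻¹ i)) c) = c := by
    rintro ⟨i, t⟩
    simp [act_apply, hat_inv']
  funext l
  simp [Prod.map, key]

def fr (obs : List Ob) : List (Ob × Gp × Rw) :=
  obs.flatMap fun a => a.gs.flatMap fun g => g.rs.map fun u => (a, g, u)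

lemma rs_fr (obs : List Ob) (F : Ob × Gp × Rw → ℝ) :
    rs (fr obs) F = rs obs fun a => rs a.gs fun g => rs g.rs fun u => F (a, g, u) := by
  simp only [fr, rs_flatMap, rs_map]

lemma fr_mem {obs : List Ob} (hO : ∀ a ∈ obs, ObOK a) {x : Ob × Gp × Rw} (hx : x ∈ fr obs) :
    x.2.2.h < 256 := by
  simp only [fr, List.mem_flatMap, List.mem_map] at hx
  obtain ⟨a, ha, g, hg, u, hu, rfl⟩ := hx
  exact (((hO a ha).gs g hg).rs u hu).h

theorem Sp_pos (h : PS 0 G Ψ) {obs : List Ob} (hO : ∀ a ∈ obs, ObOK a) :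
    0 ≤ rs obs fun a => rs obs fun b => Sp Ψ a b := by
  let U := Fin (fr obs).length
  let y : U → Ob × Gp × Rw := fun u => (fr obs).get u
  have key := psd_rows h (U := U) (T := 256) (N := 64) (fun u => wd (y u).1.w)
    (fun u => Fin.ofNat 256 (y u).2.2.h) (fun t => od t) (fun u => bs (y u).2.1.A)
    (fun u => mr (y u).2.2.m) (fun u => lr (y u).2.2.n (y u).2.2.L)
  refine key.trans (le_of_eq ?_)
  have hlt : ∀ u : U, (y u).2.2.h < 256 := fun u => fr_mem hO (List.get_mem _ _)
  have e1 : ∀ u v : U, ∀ π : PP, ∀ σ : SS,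
      (if Fin.ofNat 256 (y u).2.2.h = Fin.ofNat 256 (y v).2.2.h ∧
        (fun i => bs (y u).2.1.A (hat π i)) = bs (y v).2.1.A then
        (∑ p, lr (y u).2.2.n (y u).2.2.L p * lr (y v).2.2.n (y v).2.2.L p) *
        (tws (od (Fin.ofNat 256 (y u).2.2.h : Fin 256)) π * chi (bs (y v).2.1.A) σ *
          ovl π (mr (y u).2.2.m) (mr (y v).2.2.m)) else 0) =
      Kc (y u).2.1 (y v).2.1 (y u).2.2 (y v).2.2 π σ := by
    intro u v π σ
    have a1 : ((Fin.ofNat 256 (y u).2.2.h : Fin 256) : ℕ) = (y u).2.2.h := Nat.mod_eq_of_lt (hlt u)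
    have a2 : ((Fin.ofNat 256 (y v).2.2.h : Fin 256) : ℕ) = (y v).2.2.h := Nat.mod_eq_of_lt (hlt v)
    simp only [Fin.ext_iff, a1, a2]
    rfl
  simp only [e1]
  have e2 : ∀ F : Ob × Gp × Rw → ℝ, ∑ u : U, F (y u) = rs (fr obs) F := fun F => rs_fin (fr obs) F
  have e3 : ∀ u : U, (∑ v : U, ∑ π : PP, ∑ σ : SS, Kc (y u).2.1 (y v).2.1 (y u).2.2 (y v).2.2 π σ *
      bb Ψ (wd (y u).1.w) (rl (act π σ) (wd (y v).1.w))) =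
      rs (fr obs) fun x => ∑ π : PP, ∑ σ : SS, Kc (y u).2.1 x.2.1 (y u).2.2 x.2.2 π σ *
      bb Ψ (wd (y u).1.w) (rl (act π σ) (wd x.1.w)) := fun u =>
    e2 fun x => ∑ π : PP, ∑ σ : SS, Kc (y u).2.1 x.2.1 (y u).2.2 x.2.2 π σ *
      bb Ψ (wd (y u).1.w) (rl (act π σ) (wd x.1.w))
  rw [Finset.sum_congr rfl fun u _ => e3 u]
  rw [e2 fun x' => rs (fr obs) fun x => ∑ π : PP, ∑ σ : SS, Kc x'.2.1 x.2.1 x'.2.2 x.2.2 π σ *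
      bb Ψ (wd x'.1.w) (rl (act π σ) (wd x.1.w))]
  rw [rs_fr]
  refine rs_congr fun a _ => ?_
  simp only [rs_fr]
  have e4 : (rs a.gs fun g => rs g.rs fun u => rs obs fun b => rs b.gs fun g' => rs g'.rs fun v =>
      ∑ π : PP, ∑ σ : SS, Kc g g' u v π σ * bb Ψ (wd a.w) (rl (act π σ) (wd b.w))) =
      rs obs fun b => rs b.gs fun g' => rs a.gs fun g => rs g.rs fun u => rs g'.rs fun v =>
      ∑ π : PP, ∑ σ : SS, Kc g g' u v π σ * bb Ψ (wd a.w) (rl (act π σ) (wd b.w)) := by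
    simp only [rs_comm _ obs]
    refine rs_congr fun b _ => ?_
    simp only [rs_comm _ b.gs]
  rw [e4]
  refine rs_congr fun b _ => ?_
  unfold Sp Kf
  simp only [rs_sum, rs_mul']

def pairsOf : List Ob → List (Ob × Ob × ℕ)
  | [] => []
  | x :: t => (x, x, 1) :: (t.map (fun b => (x, b, 2)) ++ pairsOf t)

lemma rs_pairs (h : PS 0 G Ψ) (l : List Ob) :
    rs (pairsOf l) (fun x => (x.2.2 : ℝ) * Sp Ψ x.1 x.2.1) = rs l fun a => rs l fun b => Sp Ψ a b := by
  induction l with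
  | nil => rfl
  | cons x t ih =>
    simp only [pairsOf, rs_cons, rs_append, rs_map, ih, rs_add, rs_mul]
    rw [rs_congr (l := t) (f := fun a => Sp Ψ a x) fun a _ => Sp_symm h x a]
    push_cast
    ring

theorem pairs_neg (h : PS 0 G Ψ) {PT : List ℕ} (hT : TOK PT) {obs : List Ob} (hO : ∀ a ∈ obs, ObOK a)
    {prs : List Pr} (hp : prs.map (fun q => (q.a, q.b, q.f)) = pairsOf obs)
    (hm : ∀ q ∈ prs, q.a ∈ obs ∧ q.b ∈ obs) :
    rs prs (fun q => rs (pits PT q) fun l => rs l (rit Ψ)) ≤ 0 := by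
  have e : rs prs (fun q => rs (pits PT q) fun l => rs l (rit Ψ)) =
      - rs obs fun a => rs obs fun b => Sp Ψ a b := by
    rw [← rs_pairs h, ← hp, rs_map, ← sub_eq_zero, sub_neg_eq_add, ← rs_add, ← rs_zero prs]
    refine rs_congr fun q hq => ?_
    rw [pits_sum h hT q (hO _ (hm q hq).1) (hO _ (hm q hq).2)]
    ring
  rw [e]
  have := Sp_pos h hO
  linarith

end pos

/-! ### reading off the digits of the total -/

lemma digit_eq {B : ℕ} (n : ℕ) (d : ℕ → ℕ) (hd : ∀ j, d j < B) (i : ℕ) (hi : i < n) :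
    (∑ j ∈ Finset.range n, d j * B ^ j) / B ^ i % B = d i := by
  have hB : 0 < B := lt_of_le_of_lt (Nat.zero_le _) (hd 0)
  induction n generalizing d i with
  | zero => omega
  | succ n ih =>
    have e : (∑ j ∈ Finset.range (n + 1), d j * B ^ j) =
        d 0 + B * ∑ j ∈ Finset.range n, d (j + 1) * B ^ j := by
      rw [Finset.sum_range_succ', Finset.mul_sum, add_comm]
      congr 1
      · simp
      · exact Finset.sum_congr rfl fun j _ => by ring
    rw [e]
    cases i with
    | zero => simp [Nat.mod_eq_of_lt (hd 0)]
    | succ i =>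
      rw [pow_succ', ← Nat.div_div_eq_div_mul, Nat.add_mul_div_left _ _ hB, Nat.div_eq_of_lt (hd 0),
        zero_add]
      exact ih (fun j => d (j + 1)) (fun j => hd _) i (by omega)

lemma zdg_eq (Z j : ℕ) : zdg Z j = Z / (2 ^ 74) ^ j % 2 ^ 74 := by
  have : zdg Z j = (Z >>> (74 * j)) &&& (2 ^ 74 - 1) := rfl
  rw [this, Nat.and_two_pow_sub_one_eq_mod, Nat.shiftRight_eq_div_pow, pow_mul]

def dt (it : It) (j : ℕ) : ℕ :=
  if j = 2 * hid it.H then it.k - it.k' else if j = 2 * hid it.H + 1 then it.k' - it.k else 0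

def dd (its : List It) (j : ℕ) : ℕ := lsum its fun it => dt it j

lemma dt_sum (it : It) (n : ℕ) (h : hid it.H < n) :
    ∑ j ∈ Finset.range (2 * n), dt it j * (2 ^ 74) ^ j =
      (it.k - it.k') * 2 ^ (148 * hid it.H) + (it.k' - it.k) * 2 ^ (148 * hid it.H + 74) := by
  have e : ∀ j, dt it j * (2 ^ 74) ^ j =
      (if j = 2 * hid it.H then (it.k - it.k') * 2 ^ (148 * hid it.H) else 0) +
      (if j = 2 * hid it.H + 1 then (it.k' - it.k) * 2 ^ (148 * hid it.H + 74) else 0) := by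
    intro j
    unfold dt
    by_cases h1 : j = 2 * hid it.H
    · have h2 : ¬ j = 2 * hid it.H + 1 := by omega
      rw [if_pos h1, if_pos h1, if_neg h2, h1, ← pow_mul, add_zero]
      congr 2; ring
    · by_cases h2 : j = 2 * hid it.H + 1
      · rw [if_neg h1, if_pos h2, if_neg h1, if_pos h2, h2, ← pow_mul, zero_add]
        congr 2; ring
      · simp [h1, h2]
  rw [Finset.sum_congr rfl fun j _ => e j, Finset.sum_add_distrib, Finset.sum_ite_eq',
    Finset.sum_ite_eq', if_pos (by simp; omega), if_pos (by simp; omega)]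

set_option exponentiation.threshold 1000000 in
lemma zit_eq (it : It) : zit it = if it.k - it.k' + (it.k' - it.k) ≤ 2 ^ 60 then
    (it.k - it.k') * 2 ^ (148 * hid it.H) + (it.k' - it.k) * 2 ^ (148 * hid it.H + 74) else
    2 ^ 607000 := by
  obtain ⟨k, k', H, w⟩ := it
  have e : zit ⟨k, k', H, w⟩ = bc (Nat.ble (k - k' + (k' - k)) (2 ^ 60))
      ((k - k') <<< (148 * hid H) + (k' - k) <<< (148 * hid H + 74)) (1 <<< 607000) := by
    rfl
  rw [e, bc_eq]
  simp only [Nat.shiftLeft_eq, one_mul, Nat.ble_eq]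

lemma lsum_nil {α : Type} (f : α → ℕ) : lsum [] f = 0 := rfl
lemma lsum_cons {α : Type} (a : α) (l : List α) (f : α → ℕ) : lsum (a :: l) f = f a + lsum l f := rfl

lemma le_lsum {α : Type} {l : List α} (f : α → ℕ) {a : α} (h : a ∈ l) : f a ≤ lsum l f := by
  induction l with
  | nil => simp at h
  | cons b l ih =>
    rw [lsum_cons]
    rcases List.mem_cons.1 h with rfl | h
    · omega
    · have := ih h; omega

lemma dd_sum (its : List It) (n : ℕ) (h : ∀ it ∈ its, hid it.H < n)
    (h' : ∀ it ∈ its, it.k - it.k' + (it.k' - it.k) ≤ 2 ^ 60) :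
    lsum its zit = ∑ j ∈ Finset.range (2 * n), dd its j * (2 ^ 74) ^ j := by
  induction its with
  | nil => simp [dd, lsum_nil]
  | cons it its ih =>
    rw [lsum_cons, ih (fun i hi => h i (by simp [hi])) (fun i hi => h' i (by simp [hi])), zit_eq,
      if_pos (h' it (by simp)), ← dt_sum it n (h it (by simp)), ← Finset.sum_add_distrib]
    exact Finset.sum_congr rfl fun j _ => by simp only [dd, lsum_cons]; ring

lemma dd_le (its : List It) (h' : ∀ it ∈ its, it.k - it.k' + (it.k' - it.k) ≤ 2 ^ 60) (j : ℕ) :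
    dd its j ≤ its.length * 2 ^ 60 := by
  induction its with
  | nil => simp [dd, lsum_nil]
  | cons it its ih =>
    have h1 := ih fun i hi => h' i (by simp [hi])
    have h2 := h' it (by simp)
    have h3 : dt it j ≤ 2 ^ 60 := by unfold dt; split_ifs <;> omega
    simp only [dd, lsum_cons, List.length_cons] at *
    rw [add_mul]
    omega

lemma zgd_le {nl nr Z i : ℕ} (h : zgd nl nr Z i = true) :
    zdg Z (2 * i + 1) + 16 * zbad nl nr Z ≤ zdg Z (2 * i) := by
  unfold zgd at h
  generalize zbad nl nr Z = b at *
  exact Nat.le_of_ble_eq_true h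

set_option exponentiation.threshold 1000000 in
theorem fchk_pos {nl nr : ℕ} (hnr : nr ≤ 4095) (hnl : nl = 1 ∨ nl = 2) (hlt : nl < nr)
    (its : List It) (hlen : its.length ≤ 16383) (hc : fchk nl nr (lsum its zit) = true)
    (r : ℕ → ℝ) (hr0 : r 0 = 0) (ℓ : ℝ) (hl : ℓ = ∑ i ∈ Finset.Icc 1 nl, r i)
    (hr : ∀ i < nr, 0 ≤ r i ∧ r i ≤ 16 * ℓ) (ψ : CW → ℝ)
    (hψ : ∀ it ∈ its, 0 ≤ ψ it.w ∧ ψ it.w ≤ 16 * ℓ ∧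
      (hid it.H = nr ∨ hid it.H < nr ∧ ψ it.w = r (hid it.H))) :
    0 ≤ rs its fun it => ((it.k : ℝ) - it.k') * ψ it.w := by
  have hid_lt : ∀ it ∈ its, hid it.H < nr + 1 := fun it hit => by
    rcases (hψ it hit).2.2 with h | h <;> omega
  generalize hZ : lsum its zit = Z at hc
  have hZlt : Z < 2 ^ (148 * (nr + 1)) ∧ zgd nl nr Z 1 = true ∧ zgd nl nr Z nl = true := by
    unfold fchk at hc
    cases hb : Nat.ble (Nat.shiftLeft 1 (Nat.mul 148 (Nat.succ nr))) Z with
    | true => rw [hb] at hc; simp at hc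
    | false =>
      rw [hb, bc_false] at hc
      refine ⟨?_, bc_and hc⟩
      by_contra hcon
      have : Nat.ble (1 <<< (148 * (nr + 1))) Z = true := by
        rw [Nat.ble_eq, Nat.shiftLeft_eq]; omega
      have hb' : Nat.ble (1 <<< (148 * (nr + 1))) Z = false := hb
      rw [this] at hb'; simp at hb'
  obtain ⟨hZlt, hg1, hg2⟩ := hZlt
  have hsm : ∀ it ∈ its, it.k - it.k' + (it.k' - it.k) ≤ 2 ^ 60 := by
    intro it hit
    by_contra hcon
    have h1 := le_lsum zit hit
    rw [zit_eq, if_neg hcon, hZ] at h1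
    have h2 : 2 ^ (148 * (nr + 1)) ≤ 2 ^ 607000 := Nat.pow_le_pow_right (by norm_num) (by omega)
    exact absurd (h1.trans_lt hZlt) (not_lt.2 h2)
  have hdd : ∀ j, dd its j < 2 ^ 74 := fun j => by
    have := dd_le its hsm j
    omega
  have hdig : ∀ j < 2 * (nr + 1), zdg Z j = dd its j := by
    intro j hj
    rw [zdg_eq, ← hZ, dd_sum its (nr + 1) hid_lt hsm]
    exact digit_eq _ _ hdd j hj
  -- lower bound for the sum
  have hℓ : 0 ≤ ℓ := by
    rw [hl]; refine Finset.sum_nonneg fun i hi => (hr i ?_).1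
    simp at hi; omega
  let lo : ℕ → ℝ := fun i => if i < nr then r i else 0
  let hh : ℕ → ℝ := fun i => if i < nr then r i else 16 * ℓ
  have low : ∑ i ∈ Finset.range (nr + 1), ((dd its (2 * i) : ℝ) * lo i - (dd its (2 * i + 1) : ℝ) * hh i) ≤
      rs its fun it => ((it.k : ℝ) - it.k') * ψ it.w := by
    clear hZ hsm hdd hdig hlen hZlt hg1 hg2 hc
    induction its with
    | nil => simp [dd, lsum_nil]
    | cons it its ih =>
      have ih' := ih (fun i hi => hψ i (by simp [hi])) (fun i hi => hid_lt i (by simp [hi]))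
      rw [rs_cons]
      have e : ∑ i ∈ Finset.range (nr + 1), ((dd (it :: its) (2 * i) : ℝ) * lo i -
          (dd (it :: its) (2 * i + 1) : ℝ) * hh i) =
          ∑ i ∈ Finset.range (nr + 1), ((dt it (2 * i) : ℝ) * lo i - (dt it (2 * i + 1) : ℝ) * hh i) +
          ∑ i ∈ Finset.range (nr + 1), ((dd its (2 * i) : ℝ) * lo i - (dd its (2 * i + 1) : ℝ) * hh i) := by
        rw [← Finset.sum_add_distrib]
        refine Finset.sum_congr rfl fun i _ => ?_
        simp only [dd, lsum_cons]; push_cast; ring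
      rw [e]
      refine add_le_add ?_ ih'
      have e2 : ∀ i, ((dt it (2 * i) : ℝ) * lo i - (dt it (2 * i + 1) : ℝ) * hh i) =
          if i = hid it.H then (((it.k - it.k' : ℕ) : ℝ) * lo i - ((it.k' - it.k : ℕ) : ℝ) * hh i) else 0 := by
        intro i
        unfold dt
        by_cases h : i = hid it.H
        · subst h
          have : ¬ (2 * hid it.H + 1 = 2 * hid it.H) := by omega
          simp [this]
        · have h1 : ¬ (2 * i = 2 * hid it.H) := by omega
          have h2 : ¬ (2 * i = 2 * hid it.H + 1) := by omega
          have h3 : ¬ (2 * i + 1 = 2 * hid it.H) := by omega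
          have h4 : ¬ (2 * i + 1 = 2 * hid it.H + 1) := by omega
          simp [h, h1, h2, h3, h4]
      rw [Finset.sum_congr rfl fun i _ => e2 i, Finset.sum_ite_eq',
        if_pos (by simpa using hid_lt it (by simp))]
      have hk : (it.k : ℝ) - it.k' = ((it.k - it.k' : ℕ) : ℝ) - ((it.k' - it.k : ℕ) : ℝ) := by
        rcases le_total it.k it.k' with h | h
        · rw [Nat.sub_eq_zero_of_le h, Nat.cast_sub h]; simp
        · rw [Nat.sub_eq_zero_of_le h, Nat.cast_sub h]; simp
      rw [hk, sub_mul]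
      obtain ⟨h1, h2, h3⟩ := hψ it (by simp)
      have p1 : (0 : ℝ) ≤ ((it.k - it.k' : ℕ) : ℝ) := Nat.cast_nonneg _
      have p2 : (0 : ℝ) ≤ ((it.k' - it.k : ℕ) : ℝ) := Nat.cast_nonneg _
      rcases h3 with h3 | ⟨h3, h4⟩
      · simp only [lo, hh, h3, lt_irrefl, if_false, mul_zero]
        have := mul_le_mul_of_nonneg_left h2 p2
        have := mul_nonneg p1 h1
        linarith
      · simp only [lo, hh, h3, if_true, h4]
        exact le_rfl
  refine le_trans ?_ low
  -- the digits
  obtain ⟨bad, hbd⟩ : ∃ b, b = zbad nl nr Z := ⟨_, rfl⟩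
  have hbad : (bad : ℝ) = dd its (2 * nr + 1) + ∑ i ∈ Finset.Ico (nl + 1) nr,
      ((dd its (2 * i + 1) - dd its (2 * i) : ℕ) : ℝ) := by
    have e1 : bad = zdg Z (2 * nr + 1) + ∑ i ∈ Finset.range 64, ∑ j ∈ Finset.range 64,
        zneg nl nr Z (64 * i + j) := by
      rw [hbd]
      unfold zbad
      simp only [nsum_eq]
      rfl
    have e2 : ∑ i ∈ Finset.range 64, ∑ j ∈ Finset.range 64, zneg nl nr Z (64 * i + j) =
        ∑ i ∈ Finset.range 4096, zneg nl nr Z i := by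
      have : ∀ n (f : ℕ → ℕ), ∑ i ∈ Finset.range n, ∑ j ∈ Finset.range 64, f (64 * i + j) =
          ∑ i ∈ Finset.range (64 * n), f i := by
        intro n f
        induction n with
        | zero => simp
        | succ n ih => rw [Finset.sum_range_succ, ih, mul_add, mul_one, Finset.sum_range_add]
      exact this 64 _
    have e3 : ∑ i ∈ Finset.range 4096, zneg nl nr Z i =
        ∑ i ∈ Finset.Ico (nl + 1) nr, (dd its (2 * i + 1) - dd its (2 * i)) := by
      symm
      have hz : ∀ i, zneg nl nr Z i = if i ≤ nl then 0 else if nr ≤ i then 0 else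
          zdg Z (2 * i + 1) - zdg Z (2 * i) := by
        intro i
        have : zneg nl nr Z i = bc (Nat.ble i nl) 0 (bc (Nat.ble nr i) 0
          (zdg Z (2 * i + 1) - zdg Z (2 * i))) := rfl
        rw [this, bc_eq, bc_eq]
        simp only [Nat.ble_eq]
      have hs : Finset.Ico (nl + 1) nr ⊆ Finset.range 4096 := by
        intro i hi; simp at *; omega
      rw [← Finset.sum_subset hs (f := zneg nl nr Z)]
      · refine Finset.sum_congr rfl fun i hi => ?_
        simp at hi
        rw [hz, if_neg (by omega), if_neg (by omega), hdig _ (by omega), hdig _ (by omega)]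
      · intro i _ hi
        simp at hi
        rw [hz]
        by_cases h : i ≤ nl
        · simp [h]
        · rw [if_neg h, if_pos (hi (by omega))]
    rw [e1, e2, e3, hdig _ (by omega)]
    push_cast
    rfl
  have hgood : ∀ i ∈ Finset.Icc 1 nl, (dd its (2 * i + 1) : ℝ) + 16 * bad ≤ dd its (2 * i) := by
    intro i hi
    have hi' : i = 1 ∨ i = nl := by simp at hi; omega
    have hz : zgd nl nr Z i = true := by
      rcases hi' with e | e
      · rw [e]; exact hg1
      · rw [e]; exact hg2
    have hz' := zgd_le hz
    rw [← hbd] at hz'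
    simp at hi
    rw [hdig _ (by omega), hdig _ (by omega)] at hz'
    exact_mod_cast hz'
  rw [Finset.sum_range_succ]
  have t1 : ∑ i ∈ Finset.range nr, ((dd its (2 * i) : ℝ) * lo i - (dd its (2 * i + 1) : ℝ) * hh i) =
      ∑ i ∈ Finset.range nr, ((dd its (2 * i) : ℝ) - (dd its (2 * i + 1) : ℝ)) * r i := by
    refine Finset.sum_congr rfl fun i hi => ?_
    simp only [lo, hh, Finset.mem_range.1 hi, if_true]; ring
  have t2 : ∑ i ∈ Finset.range nr, ((dd its (2 * i) : ℝ) - (dd its (2 * i + 1) : ℝ)) * r i =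
      ∑ i ∈ Finset.Icc 1 nl, ((dd its (2 * i) : ℝ) - (dd its (2 * i + 1) : ℝ)) * r i +
      ∑ i ∈ Finset.Ico (nl + 1) nr, ((dd its (2 * i) : ℝ) - (dd its (2 * i + 1) : ℝ)) * r i := by
    have a : Finset.Icc 1 nl = Finset.Ico 1 (nl + 1) := by ext; simp
    rw [a, Finset.sum_Ico_consecutive _ (by omega) (by omega), Finset.range_eq_Ico,
      ← Finset.sum_Ico_consecutive _ (Nat.zero_le 1) (by omega : 1 ≤ nr)]
    simp [hr0]
  have t3 : 16 * (bad : ℝ) * ℓ ≤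
      ∑ i ∈ Finset.Icc 1 nl, ((dd its (2 * i) : ℝ) - (dd its (2 * i + 1) : ℝ)) * r i := by
    rw [hl, Finset.mul_sum]
    refine Finset.sum_le_sum fun i hi => ?_
    have h1 := hgood i hi
    simp at hi
    exact mul_le_mul_of_nonneg_right (by linarith) (hr i (by omega)).1
  have t4 : - (16 * ℓ) * (∑ i ∈ Finset.Ico (nl + 1) nr, ((dd its (2 * i + 1) - dd its (2 * i) : ℕ) : ℝ)) ≤
      ∑ i ∈ Finset.Ico (nl + 1) nr, ((dd its (2 * i) : ℝ) - (dd its (2 * i + 1) : ℝ)) * r i := by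
    rw [Finset.mul_sum]
    refine Finset.sum_le_sum fun i hi => ?_
    simp at hi
    obtain ⟨h1, h2⟩ := hr i (by omega)
    rcases le_total (dd its (2 * i + 1)) (dd its (2 * i)) with h | h
    · rw [Nat.sub_eq_zero_of_le h]
      have : (0 : ℝ) ≤ (dd its (2 * i) : ℝ) - (dd its (2 * i + 1) : ℝ) := by
        rw [sub_nonneg]; exact_mod_cast h
      have := mul_nonneg this h1
      simpa using this
    · rw [Nat.cast_sub h]
      have : (0 : ℝ) ≤ (dd its (2 * i + 1) : ℝ) - (dd its (2 * i) : ℝ) := by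
        rw [sub_nonneg]; exact_mod_cast h
      have := mul_le_mul_of_nonneg_left h2 this
      linarith
  rw [t1, t2]
  simp only [lo, hh, lt_irrefl, if_false, mul_zero]
  rw [hbad] at t3
  linarith

/-! ### letters, targets and the conclusion -/
section fin
variable {G : Type*} [Group G] {Ψ : Wd (Fin 6) → ℝ}

lemma letter (h : PS 0 G Ψ) {i j i' j' : Fin 6} (hij : i ≠ j) (hij' : i' ≠ j') (hj : j ≠ 0)
    (hj' : j' ≠ 0) (hz : i = 0 ↔ i' = 0) (s t s' t' : Bool) :
    Ψ [((i, s), (j, t))] = Ψ [((i', s'), (j', t'))] := by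
  let ρ : Equiv.Perm (Fin 6) := Equiv.swap (Equiv.swap i i' j) j' * Equiv.swap i i'
  let σ : SS := fun x => if x = i then xor s s' else xor t t'
  have q0 : Equiv.swap i i' 0 = 0 := by
    by_cases h0 : i = 0
    · rw [h0, hz.1 h0]; simp
    · exact Equiv.swap_apply_of_ne_of_ne (Ne.symm h0) (fun e => h0 (hz.2 e.symm))
  have r0 : ρ 0 = 0 := by
    show Equiv.swap (Equiv.swap i i' j) j' (Equiv.swap i i' 0) = 0
    rw [q0]
    refine Equiv.swap_apply_of_ne_of_ne (fun e => hj ?_) hj'.symm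
    apply (Equiv.swap i i').injective
    rw [← e, q0]
  have r1 : ρ i = i' := by
    show Equiv.swap (Equiv.swap i i' j) j' (Equiv.swap i i' i) = i'
    rw [Equiv.swap_apply_left]
    refine Equiv.swap_apply_of_ne_of_ne (fun e => hij ?_) hij'
    apply (Equiv.swap i i').injective
    rw [← e, Equiv.swap_apply_left]
  have r2 : ρ j = j' := by
    show Equiv.swap (Equiv.swap i i' j) j' (Equiv.swap i i' j) = j'
    rw [Equiv.swap_apply_left]
  rw [← h.rel _ (sact_mem r0 σ) [((i, s), (j, t))]]
  have e1 : sact ρ σ (i, s) = (i', s') := by simp [sact, r1, σ]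
  have e2 : sact ρ σ (j, t) = (j', t') := by simp [sact, r2, σ, hij.symm]
  simp [rl, e1, e2]

def V1 (Ψ : Wd (Fin 6) → ℝ) : ℝ := Ψ (wd [(2, 4)])
def V2 (Ψ : Wd (Fin 6) → ℝ) : ℝ := Ψ (wd [(0, 2)])

lemma letter1 (h : PS 0 G Ψ) {i j : Fin 6} (hij : i ≠ j) (hj : j ≠ 0) (hi : i ≠ 0) (s t : Bool) :
    Ψ [((i, s), (j, t))] = V1 Ψ := by
  have : wd [(2, 4)] = [((1, false), (2, false))] := by decide
  rw [V1, this]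
  exact letter h hij (by decide) hj (by decide) (by simp [hi]) _ _ _ _

lemma letter2 (h : PS 0 G Ψ) {j : Fin 6} (hj : j ≠ 0) (s t : Bool) :
    Ψ [((0, s), (j, t))] = V2 Ψ := by
  have : wd [(0, 2)] = [((0, false), (1, false))] := by decide
  rw [V2, this]
  exact letter h hj.symm (by decide) hj (by decide) (by simp) _ _ _ _

def Wt (Ψ : Wd (Fin 6) → ℝ) (i j i' j' : Fin 6) : ℝ :=
  ∑ s : Bool, ∑ t : Bool, ∑ s' : Bool, ∑ t' : Bool, Ψ [((i, s), (j, t)), ((i', s'), (j', t'))]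

lemma Ga_eq {i j i' j' : Fin 6} {a b : ℝ} (ha : ∀ s t, Ψ [((i, s), (j, t))] = a)
    (hb : ∀ s t, Ψ [((i', s), (j', t))] = b) : Ga Ψ i j i' j' = 16 * a + 16 * b - Wt Ψ i j i' j' := by
  simp only [Ga, Wt, ha, hb, Fintype.sum_bool]
  ring

lemma Dd_eq {i j : Fin 6} {a : ℝ} (ha : ∀ s t, Ψ [((i, s), (j, t))] = a) : Dd Ψ i j = 4 * a := by
  simp only [Dd, ha, Fintype.sum_bool]
  ring

lemma bt_eq (s i : ℕ) : bt s i = (s.testBit i).toNat := by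
  have : bt s i = Nat.land (s >>> i) 1 := rfl
  rw [this, land_one, Nat.testBit_shiftRight, add_zero]

lemma tits_sum (c : ℕ) (i j i' j' : Fin 6) (H : ℕ) :
    rs (tits ⟨c, i, j, i', j', H⟩) (rit Ψ) = -(c * Wt Ψ i j i' j') := by
  have e : rs (tits ⟨c, i, j, i', j', H⟩) (rit Ψ) = rs (List.range 16) fun s =>
      -(c * Ψ [((i, s.testBit 0), (j, s.testBit 1)), ((i', s.testBit 2), (j', s.testBit 3))]) := by
    show rs (List.map _ _) _ = _
    rw [rs_map]
    refine rs_congr fun s _ => ?_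
    have k : ∀ (x : Fin 6) m, dc (Nat.add (Nat.mul 2 x) (bt s m)) = (x, s.testBit m) := fun x m => by
      rw [bt_eq]; exact dc_mk x _
    simp only [rit, wd, List.map_cons, List.map_nil, k]
    push_cast
    ring
  rw [e]
  simp only [Wt, Fintype.sum_bool]
  have : List.range 16 = [0, 1, 2, 3, 4, 5, 6, 7, 8, 9, 10, 11, 12, 13, 14, 15] := rfl
  rw [this]
  simp only [rs_cons, rs_nil]
  simp [Nat.testBit, Nat.shiftRight_eq_div_pow]
  ring

lemma word_le (h : PS 0 G Ψ) {ℓ : ℝ} {m : ℕ} (hℓ : 0 ≤ ℓ)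
    (hL : ∀ l : ℕ × ℕ, m ≤ l.1 → 2 ≤ l.2 → l.1 < 12 → l.2 < 12 → l.1 / 2 ≠ l.2 / 2 → Ψ (wd [l]) ≤ ℓ)
    {w : CW} (hw : Vm m w) : Ψ (wd w) ≤ 16 * ℓ := by
  obtain ⟨hlen, hl⟩ := hw
  have hL' : ∀ l ∈ w, Ψ (wd [l]) ≤ ℓ := fun l hlw => by
    obtain ⟨a, b, c, d, e⟩ := hl l hlw
    exact hL l a b c d e
  have step : ∀ (l : ℕ × ℕ) (v : CW), Ψ (wd (l :: v)) ≤ 2 * Ψ (wd [l]) + 2 * Ψ (wd v) := fun l v =>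
    h.sub (wd [l]) (wd v)
  match w, hlen, hL' with
  | [], _, _ => simpa [h.nil] using hℓ
  | [a], _, hL' => have := hL' a (by simp); linarith
  | [a, b], _, hL' =>
    have := hL' a (by simp); have := hL' b (by simp); have := step a [b]; linarith
  | [a, b, c], _, hL' =>
    have := hL' a (by simp); have := hL' b (by simp); have := hL' c (by simp)
    have := step a [b, c]; have := step b [c]; linarith
  | [a, b, c, d], _, hL' =>
    have := hL' a (by simp); have := hL' b (by simp); have := hL' c (by simp)
    have := hL' d (by simp); have : wd [a, b, c, d] = wd [a, b] ++ wd [c, d] := rfl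
    have := h.sub (wd [a, b]) (wd [c, d])
    have := step a [b]; have := step c [d]
    rw [‹wd [a, b, c, d] = _›]; linarith
  | _ :: _ :: _ :: _ :: _ :: _, hlen, _ => simp at hlen; omega

lemma let_ne {l : ℕ × ℕ} (h1 : 2 ≤ l.2) (h2 : l.1 < 12) (h3 : l.2 < 12) (h4 : l.1 / 2 ≠ l.2 / 2) :
    (dc l.1).1 ≠ (dc l.2).1 ∧ (dc l.2).1 ≠ 0 := by
  constructor
  · intro e; apply h4; rw [← dc_fst h2, ← dc_fst h3, e]
  · intro e
    have := dc_fst h3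
    rw [e] at this
    simp at this; omega

lemma letN (h : PS 0 G Ψ) (l : ℕ × ℕ) (h0 : 2 ≤ l.1) (h1 : 2 ≤ l.2) (h2 : l.1 < 12) (h3 : l.2 < 12)
    (h4 : l.1 / 2 ≠ l.2 / 2) : Ψ (wd [l]) = V1 Ψ := by
  obtain ⟨a, b⟩ := let_ne h1 h2 h3 h4
  refine letter1 h a b ?_ (dc l.1).2 (dc l.2).2
  intro e
  have := dc_fst h2
  rw [e] at this
  simp at this; omega

lemma letC (h : PS 0 G Ψ) (l : ℕ × ℕ) (h1 : 2 ≤ l.2) (h2 : l.1 < 12) (h3 : l.2 < 12)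
    (h4 : l.1 / 2 ≠ l.2 / 2) : Ψ (wd [l]) ≤ V1 Ψ + V2 Ψ := by
  have p1 : 0 ≤ V1 Ψ := h.nonneg _
  have p2 : 0 ≤ V2 Ψ := h.nonneg _
  by_cases h0 : 2 ≤ l.1
  · rw [letN h l h0 h1 h2 h3 h4]; linarith
  · obtain ⟨a, b⟩ := let_ne h1 h2 h3 h4
    have z : (dc l.1).1 = 0 := by
      have := dc_fst h2
      apply Fin.ext
      rw [this]; simp; omega
    have : Ψ (wd [l]) = Ψ [((0, (dc l.1).2), (dc l.2))] := by
      rw [← z]; rfl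
    rw [this]
    have := letter2 h b (dc l.1).2 (dc l.2).2
    have e : Ψ [((0, (dc l.1).2), (dc l.2))] = V2 Ψ := this
    rw [e]; linarith

/-! ### combination -/

lemma lsum_append {α : Type} (l l' : List α) (f : α → ℕ) : lsum (l ++ l') f = lsum l f + lsum l' f := by
  simp [lsum_eq]
lemma lsum_flatMap {α β : Type} (l : List α) (g : α → List β) (f : β → ℕ) :
    lsum (l.flatMap g) f = lsum l fun a => lsum (g a) f := by
  induction l with
  | nil => rfl
  | cons a l ih => rw [List.flatMap_cons, lsum_append, ih, lsum_cons]
lemma lsum_flatten {β : Type} (l : List (List β)) (f : β → ℕ) :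
    lsum l.flatten f = lsum l fun a => lsum a f := by
  induction l with
  | nil => rfl
  | cons a l ih => rw [List.flatten_cons, lsum_append, ih, lsum_cons]
lemma rs_flatten {β : Type} (l : List (List β)) (f : β → ℝ) :
    rs l.flatten f = rs l fun a => rs a f := by
  induction l with
  | nil => rfl
  | cons a l ih => rw [List.flatten_cons, rs_append, ih, rs_cons]

lemma len_lsum {α : Type} (l : List α) : l.length = lsum l fun _ => 1 := by
  simp [lsum_eq]

lemma chi2_mem {m nr PB RT : ℕ} {l : List (List It)} (h : chi2 m nr PB RT l = true) :
    ∀ it ∈ l.flatten, chk m nr PB RT it.H it.w = true := by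
  intro it hit
  rw [List.mem_flatten] at hit
  obtain ⟨c, hc, hi⟩ := hit
  exact lall_mem (lall_mem h c hc) it hi

lemma pairsOf_mem (obs : List Ob) : ∀ x ∈ pairsOf obs, x.1 ∈ obs ∧ x.2.1 ∈ obs := by
  induction obs with
  | nil => simp [pairsOf]
  | cons a t ih =>
    intro x hx
    simp only [pairsOf, List.mem_cons, List.mem_append, List.mem_map] at hx
    rcases hx with rfl | ⟨b, hb, rfl⟩ | hx
    · simp
    · simp [hb]
    · have := ih x hx; simp [this.1, this.2]

/-- everything that has to be checked about the tables -/
structure Data (nl nr m PB RT : ℕ) (PT : List ℕ) (obs : List Ob) (prs : List Pr) (lt : List It)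
    (tgs : List Tg) : Prop where
  nr_le : nr ≤ 4095
  nl_lt : nl < nr
  nlm : nl = 1 ∧ m = 2 ∨ nl = 2 ∧ m = 0 ∧ rep RT 2 = [(0, 2)]
  pt : TOK PT
  pb : POK PB
  rp : lall (List.range nr) (fun i => vld m (rep RT i)) = true
  r0 : rep RT 0 = []
  r1 : rep RT 1 = [(2, 4)]
  ob : ∀ a ∈ obs, ObOK a
  pr : prs.map (fun q => (q.a, q.b, q.f)) = pairsOf obs
  c1 : fchk nl nr (Nat.add (lsum prs fun q => zs2 (pits PT q)) (Nat.add (zs2 (List.cons lt []))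
    (lsum tgs fun g => lsum (tits g) zit))) = true
  c2 : lall prs (fun q => chi2 m nr PB RT (pits PT q)) = true
  c3 : Nat.ble (lsum prs fun q => cn2 (pits PT q)) 16000 = true
  c4 : chi2 m nr PB RT (lt :: tgs.map tits) = true
  c5 : (lt :: tgs.map tits).flatten.length ≤ 383

theorem Data.pos {nl nr m PB RT : ℕ} {PT : List ℕ} {obs : List Ob} {prs : List Pr} {lt : List It}
    {tgs : List Tg} (D : Data nl nr m PB RT PT obs prs lt tgs) (h : PS 0 G Ψ) :
    0 ≤ rs lt (rit Ψ) + rs tgs fun g => rs (tits g) (rit Ψ) := by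
  let its : List It := (prs.flatMap fun q => (pits PT q).flatten) ++ (lt :: tgs.map tits).flatten
  have hneg : rs prs (fun q => rs (pits PT q) fun l => rs l (rit Ψ)) ≤ 0 := by
    refine pairs_neg h D.pt D.ob D.pr fun q hq => ?_
    have : (q.a, q.b, q.f) ∈ pairsOf obs := by
      rw [← D.pr]; exact List.mem_map_of_mem (f := fun q : Pr => (q.a, q.b, q.f)) hq
    exact pairsOf_mem obs _ this
  have hsum : rs its (rit Ψ) = rs prs (fun q => rs (pits PT q) fun l => rs l (rit Ψ)) +
      (rs lt (rit Ψ) + rs tgs fun g => rs (tits g) (rit Ψ)) := by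
    simp only [its, rs_append, rs_flatMap, rs_flatten, rs_cons, rs_map]
  suffices 0 ≤ rs its (rit Ψ) by linarith
  have hz : lsum its zit = Nat.add (lsum prs fun q => zs2 (pits PT q)) (Nat.add (zs2 (List.cons lt []))
      (lsum tgs fun g => lsum (tits g) zit)) := by
    have a : lsum (tgs.map tits).flatten zit = lsum tgs fun g => lsum (tits g) zit := by
      rw [← List.flatMap_def, lsum_flatMap]
    simp only [its, lsum_append, lsum_flatMap, lsum_flatten, List.flatten_cons]
    rw [← lsum_flatten, a]
    rfl
  have hlen : its.length ≤ 16383 := by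
    have h3 := Nat.le_of_ble_eq_true D.c3
    have h5 := D.c5
    have : its.length = (lsum prs fun q => cn2 (pits PT q)) + (lt :: tgs.map tits).flatten.length := by
      simp only [its, List.length_append]
      congr 1
      rw [len_lsum, lsum_flatMap]
      simp only [lsum_flatten]
      rfl
    omega
  have hrp : ∀ i < nr, Vm m (rep RT i) := fun i hi =>
    vld_spec (lall_mem D.rp i (List.mem_range.2 hi))
  have hchk : ∀ it ∈ its, chk m nr PB RT it.H it.w = true := by
    intro it hit
    rcases List.mem_append.1 hit with hit | hit
    · obtain ⟨q, hq, hi⟩ := List.mem_flatMap.1 hit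
      exact chi2_mem (lall_mem D.c2 q hq) it hi
    · exact chi2_mem D.c4 it hit
  let r : ℕ → ℝ := fun i => Ψ (wd (rep RT i))
  have e1 : r 1 = V1 Ψ := by simp only [r, D.r1, V1]
  have p1 : 0 ≤ V1 Ψ := h.nonneg _
  have p2 : 0 ≤ V2 Ψ := h.nonneg _
  obtain ⟨ℓ, hℓ, h0, hb⟩ : ∃ ℓ, ℓ = ∑ i ∈ Finset.Icc 1 nl, r i ∧ 0 ≤ ℓ ∧
      ∀ w, Vm m w → Ψ (wd w) ≤ 16 * ℓ := by
    rcases D.nlm with ⟨rfl, rfl⟩ | ⟨rfl, rfl, h2⟩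
    · refine ⟨V1 Ψ, by simp [e1], p1, fun w hw => word_le h p1 ?_ hw⟩
      intro l a b c d e
      exact (letN h l a b c d e).le
    · have e2 : r 2 = V2 Ψ := by simp only [r, h2, V2]
      refine ⟨V1 Ψ + V2 Ψ, ?_, by linarith, fun w hw => word_le h (by linarith) ?_ hw⟩
      · rw [← e1, ← e2]
        simp [Finset.sum_Icc_succ_top]
      · intro l _ b c d e
        exact letC h l b c d e
  refine fchk_pos (r := r) (ℓ := ℓ) (ψ := fun w => Ψ (wd w)) D.nr_le ?_ D.nl_lt its hlen
    (by rw [hz]; exact D.c1) ?_ hℓ (fun i hi => ⟨h.nonneg _, hb _ (hrp i hi)⟩) ?_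
  · rcases D.nlm with ⟨h, _⟩ | ⟨h, _⟩ <;> simp [h]
  · simp only [r, D.r0, wd_nil, h.nil]
  · intro it hit
    obtain ⟨a, b⟩ := chk_spec h D.pb (fun i hi => (hrp i hi).sm) (hchk it hit)
    exact ⟨h.nonneg _, hb _ a, b⟩

end fin
def PT : List ℕ := [
 0x305cb15284c911203c70d182c509101c305080c101002c688,0x244c8901e5cc162a5068e182c508121c30506101010065688,0x3058b95283860d162899124407890e203050808181006b888,
 0x183868b1458c172a50893244078712203050410181001d888,0x24449901e3460e1628b963054a080e2430506082010023a88,0x183470b1444913203cb173054a071024305040c201005ca88,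
 0x305ca96284c910223c4880c1c28e1a2c60a080c082006c4c8,0x244c8111e5cc152c504090c1c28d1c2c60a061008200254c8,0x3054b9628243080e14990244478e163460a0804182002a8c8,
 0xc244070a54c172c50813244478b1c3460a021018200558c8,0x24409911e203090e14b953058a0d163860a06042020062ac8,0xc204870a40913223ca973058a0b1a3860a020c2020014ac8,
 0x3058a97283860b1a284870c20293224090f0808083002b508,0x183858d1458c152e503890c20291264090f0410083005d508,0x3054b172824307101470b1834513204490f0804103006a708,
 0xc243880a54c162e5058e1834510264490f02101030015708,0x182c70d141c3091014b15305ca11204c90f0404203001ab08,0xc1c4880a2c60e1a28a96305ca10224c90f02082030053b08,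
 0x24448131e3460b1c284070c242972c54c1406080840063548,0x183458e1444910263c3880c242962e54c14040c084001c548,0x24408931e20307121468b18385172a58c1406041040022748,
 0xc203890a40911263c58d18385152e58c14020c1040054748,0x182c68e141c3081214890244c7962a5cc140404184005a948,0xc1c4090a2c60d1c28811244c7952c5cc1402081840013948,
 0x305cb142a4c9111e4070d1828584060800112203850c6c650,0x244c88f205cc16285468e1828583080800110243850c25650,0x3058b942a3860d142c991243c804040c001121c4050c2b850,
 0x183868a1658c172854893243c802080c0010e244050c5d850,0x244498f203460e142cb963050a830410001101c4850c63a50,0x183470a16449131e40b173050a8206100010e204850c1ca50,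
 0x305ca162a4c90f2240203000808e1a2860b12202870c2c2d0,0x244c791205cc142c54184000808d1c2860b10242870c652d0,0x3050b962a10003040498f244480e143460b12144070c698d0,
 0x101820250c172c54793244480a1c3460b0a244070c0d8d0,0x243c991200c0040404b943058a8d143860b10144870c21ad0,0xc202023c9132240a173058a8a1a3860b0a204870c4cad0,
 0x3058a172a3860a1a2c202000c093223c910121c2880c6b310,0x183850d1658c142e54104000c091263c9100e242880c1d310,0x3050b172a10002060470a18345931e4491012143880c29710,
 0x101030250c162e5450e183458f26449100a243880c4d710,0x182870d16080040604b14305ca911e4c9100e144880c59b10,0x8203022860e1a2ca16305ca8f224c9100a1c4880c0bb10,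
 0x2444793203460a1c2c18200100972c50c15101c2890c23350,0x183450e164490f264010300100962e50c150e202890c5c350,0x243c893200c002080468a18385972858c1510143890c61750,
 0xc104023c911264050d18385942e58c150a203890c0c750,0x182868e1608003080488f244c816285cc150e144090c19950,0x8184022860d1c2c791244c8142c5cc150a1c4090c4b950,
 0x305ca942c4c9101e444880c1438406040021c3458a182c458,0x244c80f225cc1528584090c1438308040021a3858a1865458,0x3054b942c243080a1c990243c884020c0021c2c68a186a858,
 0xc244050e54c172858813243c881080c002163868a1815858,0x244098f22203090a1cb953050b0302100021a2c70a1822a58,0xc204850e409131e44a973050b010610002163470a1854a58,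
 0x305ca152c4c90f2044203000410910143071c3450b186c298,0x244c790225cc142a58184000410812143071a3850b1825298,0x3050b952c10003020898f24408890a203071c2868b1829898,
 0x101810450c172a5879324408851220307143868b184d898,0x243c990220c0040208b943054b080a243071a2870b1861a98,0xc201043c9132044a173054b051024307143470b180ca98,
 0x3054a172c24305101c201000c113203c9111c2c50d182a318,0xc242880e54c142e58084000c110263c911163850d1855318,0x3050a972c1000106084850c203931e409111c2858d1869518,
 0x100830450c152e582890c2038f2640911143858d180d518,0xc144880e040040608a94305cb101e4c911162870d1811b18,0x42030414309101ca15305cb0f204c911142c70d184ab18,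
 0x24407932220305121c18100101172a50c161a2c50e1862358,0xc202890e4090f264408300101152e50c16163450e1814358,0x243c813220c00108084050c243972854c161a2858e1821558,
 0xc084043c91026442880c243942e54c16143458e184c558,0xc144090e04003080880f244c895285cc16162868e1851958,0x41840414308121c790244c8942a5cc16142c68e180a958,
 0x3058a942e3860b14344870c144040404003264480f246b460,0x183858a1a58c15285c3890c144020804003224c80f241d460,0x3054b142e243070a2070b18286840208003264088f242a660,
 0xc243851054c16285c58e18286810808003204c88f2455660,0x182c70a1a1c3090a20b153050b820210003224098f245aa60,0xc1c485102c60e1434a963050b810410003204498f2413a60,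
 0x3058a152e3860a163420200041890e143082644790242b2a0,0x183850b1a58c142a5c10400041871214308224c790245d2a0,0x3050b152e10002020c70a182c6890a1c308263c89024696a0,
 0x101010650c162a5c50e182c685121c3081e4c890240d6a0,0x182870b1a08004020cb143054b870a24308223c9902419aa0,0x8201062860e1634a163054b850e243081e44990244baa0,
 0x3054a162e243050e20201000818e162860d2640791246a2e0,0xc242871054c142c5c084000818b1c2860d204c79124152e0,0x3050a962e10001040c4850c1c40e142c60d263c81124294e0,
 0x100820650c152c5c2890c1c40a1c2c60d1e4c811244d4e0,0xc144871004004040ca943058b8b143860d203c9912451ae0,0x420206143090e20a153058b8a163860d1e40991240aae0,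
 0x182c50e1a1c305122010100101962a50c172240793241a360,0xc1c289102c60a1c3408200101952c50c1720447932453360,0x182858e1a08001080c3850c244162854c17223c8132459560,
 0x8084062860b1c342870c244142c54c171e44813240b560,0xc143891004002080c58a18386952858c17203c8932411760,0x41040614307122050b18386942a58c171e40893244a760,
 0x244480f263460b14384070c1448304040042e58a943023468,0x183458a1c449101e4c3880c1448206040042c5ca94305c468,0x244088f26203070a2468b182870302080042e54b143062668,
 0xc2038512409111e4c58d182870106080042a5cb143014668,0x182c68a1c1c3080a24890243c982020c0042c54b94301a868,0xc1c405122c60d1438811243c981040c0042a58b943053868,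
 0x2444790263460a163818200042080e143092e58a1530632a8,0x183450b1c4490f204c103000420710143092c5ca15301c2a8,0x243c890260c002021068a182c7080a1c3092e50b1530216a8,
 0xc101083c911204c50d182c705101c309285cb15304c6a8,0x182868b1c08003021088f24409870a203092c50b9530598a8,0x8181082860d163879124409850e203092858b95300b8a8,
 0x244079126203050e24181000820d162860e2e54a1630222e8,0xc20287124090f224c083000820b1a2860e2a5ca1630542e8,0x243c811260c00104104050c1c48d142c60e2e50a9630614e8,
 0xc082083c910224c2880c1c48a1a2c60e285ca96300c4e8,0xc144071204003041080f244498b143460e2a50b9630118e8,0x418208143080e24790244498a163460e2854b96304a8e8,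
 0x182c50d1c1c3051024101000c211203c9132c54a17305a328,0xc1c288122c60a1a38082000c210223c9132a58a173013328,0x182858d1c0800106103850c204911e409132c50a973019528,
 0x8083082860b1a382870c2048f22409132858a97304b528,0xc143881204002061058a18347101e449132a50b173051728,0x41030814307102450b183470f20449132854b17300a728]

/-! ### compressed data -/

/-- row entries stored with a width of their own -/
def exL (n U w : ℕ) : ℕ :=
  nsum n fun i => Nat.shiftLeft (Nat.sub (Nat.add (Nat.land (Nat.shiftRight U (Nat.mul w i))
    (Nat.pred (Nat.shiftLeft 1 w))) 33554432) (Nat.shiftLeft 1 (Nat.pred w))) (Nat.mul 26 i)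

def ro (h : ℕ) (m : MV) (n U : ℕ) : Rw := ⟨h, m, n, exL n (Nat.shiftRight U 5) (Nat.land U 31)⟩

def push (E v : ℕ) (R : List ℕ) : List ℕ :=
  bc (Nat.beq E 1) (List.cons v R) (List.rec (motive := fun _ => List ℕ) []
    (fun a t _ => List.cons (Nat.add v (Nat.shiftLeft a 26)) t) R)

/-- hints of a pair: flag for the end of a class, kind, fields -/
def hdec (e z r fuel : ℕ) : ℕ → ℕ → List ℕ :=
  Nat.rec (motive := fun _ => ℕ → ℕ → List ℕ) (fun _ _ => []) (fun _ ih H x =>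
    bc (Nat.beq H 0) [] (bc (Nat.beq (Nat.land H 6) 0)
      (push (Nat.land H 1) r (ih (Nat.shiftRight H 3) x))
    (bc (Nat.beq (Nat.land H 6) 2)
      (push (Nat.land H 1) x (ih (Nat.shiftRight H 3) (Nat.succ x)))
    (bc (Nat.beq (Nat.land H 6) 4)
      (push (Nat.land H 1) (Nat.land (Nat.shiftRight H 3) (Nat.pred (Nat.shiftLeft 1 e)))
        (ih (Nat.shiftRight H (Nat.add 3 e)) x))
      (push (Nat.land H 1) (Nat.add (Nat.land (Nat.shiftRight H 3) (Nat.pred (Nat.shiftLeft 1 e)))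
          (Nat.add (Nat.shiftLeft (Nat.land (Nat.shiftRight H (Nat.add 3 e)) 127) 12)
            (Nat.shiftLeft (Nat.land (Nat.shiftRight H (Nat.add 10 e)) (Nat.shiftRight 127 z))
              (Nat.add 19 z))))
        (ih (Nat.shiftRight H (Nat.sub (Nat.add 17 e) z)) x)))))) fuel

def mp (e z r : ℕ) (a b : Ob) (f H : ℕ) : Pr :=
  ⟨a, b, f, hdec e z r 9999 (Nat.shiftRight H 12) (Nat.land H 4095)⟩
def pn : Ob → Ob → ℕ → ℕ → Pr := mp 12 1 2441
def pc : Ob → Ob → ℕ → ℕ → Pr := mp 10 0 553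

def PB : ℕ :=
  0xb1a36346c68d8d1b1a36346c68d8d129ca8b94b52b2a54ccad194a8ea31d313b0a7542ec45d2e2acc54c6ac2d570ab1955386b50d519b1335c46c68d29d88bb0b5632ac4cd8d1b0aae235c35394a7152e545c2ea8cd50d6a52d474a959513a6354c55995331d46568c2a568cacc55c2ab50d711acab1a36335474a8d531d46332a70d4cd89d31394a7614d4a5c54b5617542e545d88b2e54cca8c7542ea70d519a8bb1336235c54b89d31566232b50d68d8d531a94b56169ca5474a76155c2a56558ca4e52d4a5474c4e971531aa53b0b56155c35385d50d6a152b3156558cd51995336265ca8c75176235c46568d8d1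

/-! ### checking the tables -/

def enc (π : PP) : ℕ :=
  nsum 6 (fun i => (hat π (Fin.ofNat 6 i) : ℕ) <<< (3 * i)) +
  (if Equiv.Perm.sign π = 1 then 0 else 1) <<< 18 +
  nsum 25 fun e => (4 * (5 * (π (Fin.ofNat 5 (e / 5)) : ℕ) + π (Fin.ofNat 5 e))) <<< (19 + 7 * e)

lemma PK_inj {p : ℕ} {π π' : PP} (h : PK p π) (h' : PK p π') : π = π' := by
  ext i
  have e : hat π i.succ = hat π' i.succ := by
    apply Fin.ext; rw [← h i.succ, ← h' i.succ]
  have e' : (π i).succ = (π' i).succ := e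
  rw [Fin.succ_injective _ e']

set_option maxRecDepth 100000 in
lemma enc_ok : ∀ π : PP, PTok (enc π) π := by
  have : ∀ π : PP, (∀ i : Fin 6, hd (enc π) i = hat π i) ∧
      (sgp (enc π) = if Equiv.Perm.sign π = 1 then 0 else 1) ∧
      ∀ i j : Fin 5, Nat.land (Nat.shiftRight (enc π) (19 + 7 * (5 * i + j))) 127 =
        4 * (5 * π i + π j) := by decide +kernel
  exact fun π => ⟨(this π).1, (this π).2.1, (this π).2.2⟩

lemma pm_enc (π : PP) : pm (enc π) = π := PK_inj (pm_spec ⟨π, enc_ok π⟩).pk (enc_ok π).pk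

set_option maxRecDepth 100000 in
lemma PT_enc : (PT : Multiset ℕ) = (Finset.univ : Finset PP).val.map enc := by decide +kernel

lemma PT_ok : TOK PT where
  ok p hp := by
    have : p ∈ (PT : Multiset ℕ) := hp
    rw [PT_enc, Multiset.mem_map] at this
    obtain ⟨π, _, rfl⟩ := this
    exact pm_spec ⟨π, enc_ok π⟩
  sum F := by
    have : rs PT (fun p => F (pm p)) = ((PT : Multiset ℕ).map fun p => F (pm p)).sum := by
      simp [rs]
    rw [this, PT_enc, Multiset.map_map]
    simp only [Function.comp_apply, pm_enc]
    rfl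
  len := by
    have : PT.length = (PT : Multiset ℕ).card := rfl
    rw [this, PT_enc, Multiset.card_map]
    show Fintype.card PP ≤ 120
    rw [Fintype.card_perm]; decide

set_option maxRecDepth 100000 in
lemma PB_ok : POK PB := by
  have : ∀ i : Fin 128, ∃ π : PP, ∀ j : Fin 6, hd (ptd PB i) j = hat π j := by decide +kernel
  exact fun i hi => this ⟨i, hi⟩

def mvc (m : MV) : Bool := decide ((∀ e ∈ m.ps, ∃ x, e = ec x) ∧ (∀ e ∈ m.ns, ∃ x, e = ec x) ∧
  ∀ i j : Fin 5, Nat.land (Nat.shiftRight m.d (4 * (5 * i + j))) 15 + m.ns.count (ec (i, j)) =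
    8 + m.ps.count (ec (i, j)))

def xsc (r z : ℕ) (i : Fin 6) : Bool := decide ((i : ℕ) ≤ r ∧ (i = 0 → z = 1))

def obc (a : Ob) : Bool := decide (a.r ≤ 5 ∧ a.z ≤ 1 ∧
  (∀ g ∈ a.gs, g.A < 64 ∧ (∀ r ∈ g.rs, mvc r.m = true ∧ r.n ≤ 64 ∧ r.h < 256) ∧
    ∀ i, bs g.A i = true → xsc a.r a.z i = true) ∧
  (∀ l ∈ a.w, l.1 < 12 ∧ l.2 < 12) ∧
  ∀ l ∈ wd a.w, xsc a.r a.z l.1.1 = true ∧ xsc a.r a.z l.2.1 = true)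

lemma obc_spec {obs : List Ob} (h : lall obs obc = true) : ∀ a ∈ obs, ObOK a := by
  intro a ha
  have h1 := of_decide_eq_true (lall_mem h a ha)
  obtain ⟨hr, hz, hg, hw, hx⟩ := h1
  have X : ∀ i, xsc a.r a.z i = true → Xs a.r a.z i := by
    intro i hi
    have h2 : decide ((i : ℕ) ≤ a.r ∧ (i = 0 → a.z = 1)) = true := hi
    have h3 := of_decide_eq_true h2
    exact h3
  refine ⟨hr, hz, fun g hgm => ⟨(hg g hgm).1, fun r hrm => ?_⟩, fun g hgm i hi => X _ ((hg g hgm).2.2 i hi),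
    hw, fun l hl => ⟨X _ (hx l hl).1, X _ (hx l hl).2⟩⟩
  obtain ⟨h1, h2, h3⟩ := (hg g hgm).2.1 r hrm
  obtain ⟨m1, m2, m3⟩ := of_decide_eq_true h1
  exact ⟨⟨m1, m2, m3⟩, h2, h3⟩

def v0 : MV := ⟨0x9888889888889888889888889,[19,61,103,145,187],[]⟩
def v1 : MV := ⟨0x788888788888788888788888c,[19,19,19,19],[61,103,145,187]⟩
def v2 : MV := ⟨0x788888788888788888c888887,[61,61,61,61],[19,103,145,187]⟩
def v3 : MV := ⟨0x8997798977998777778b777b8,[26,26,26,54,54,54,110,117,138,152,173,180],[33,40,47,68,75,82,89,96,124,131,159,166]⟩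
def v4 : MV := ⟨0x8889788897888977778b99958,[33,40,47,54,54,54,96,131,166],[26,26,26,68,75,82,89,124,159]⟩
def v5 : MV := ⟨0x788888788888788888b888888,[61,61,61],[103,145,187]⟩
def v6 : MV := ⟨0x788888788888788888888888b,[19,19,19],[103,145,187]⟩
def v7 : MV := ⟨0x8888888888888888887888889,[19],[61]⟩
def v8 : MV := ⟨0x788888788888c888887888887,[103,103,103,103],[19,61,145,187]⟩
def v9 : MV := ⟨0x7888889888888888888888888,[145],[187]⟩
def v10 : MV := ⟨0x89797987977787b9978777b78,[33,33,33,75,82,89,89,89,131,152,166,180],[26,40,47,54,68,96,110,117,124,138,159,173]⟩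
def v11 : MV := ⟨0x8977998779778b777b8799778,[40,47,68,68,68,96,96,96,124,152,159,180],[26,33,54,75,82,89,110,117,131,138,166,173]⟩
def v12 : MV := ⟨0x889968877a97888978886a888,[40,40,82,117,124,124,166,173],[47,47,75,110,131,138,159,159]⟩
def v13 : MV := ⟨0x88969887a7978886a88897888,[47,75,75,117,131,131,159,173],[40,82,82,110,124,138,166,166]⟩
def v14 : MV := ⟨0x88987889877787b8898799598,[26,40,47,68,89,89,89,138,173],[33,33,33,54,96,110,117,124,159]⟩
def v15 : MV := ⟨0x8897888978778b79958988978,[33,54,75,82,96,96,96,138,173],[26,68,68,68,89,110,117,131,166]⟩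
def v16 : MV := ⟨0x788888788888b888887888888,[103,103,103],[61,145,187]⟩
def v17 : MV := ⟨0x788888788888b888888888887,[103,103,103],[19,145,187]⟩
def v18 : MV := ⟨0x788888788888888888788888b,[19,19,19],[61,145,187]⟩
def v19 : MV := ⟨0x788888788888888888b888887,[61,61,61],[19,145,187]⟩
def v20 : MV := ⟨0x8a778a8778778a877a8888888,[68,68,96,96,152,152,180,180],[75,82,110,117,131,138,166,173]⟩
def v21 : MV := ⟨0x8a787a87877788a8888877a88,[33,33,89,89,152,152,180,180],[40,47,110,117,124,138,159,173]⟩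
def v22 : MV := ⟨0x8a877a8877888887788a778a8,[26,26,54,54,152,152,180,180],[40,47,75,82,124,131,159,166]⟩
def v23 : MV := ⟨0x788888788888a888888888888,[103,103],[145,187]⟩
def v24 : MV := ⟨0x788888788888888888a888888,[61,61],[145,187]⟩
def v25 : MV := ⟨0x788888788888888888888888a,[19,19],[145,187]⟩
def v26 : MV := ⟨0x8888888888887888888888889,[19],[103]⟩
def v27 : MV := ⟨0x8888888888887888889888888,[61],[103]⟩
def v28 : MV := ⟨0x888888888888788888788888a,[19,19],[61,103]⟩
def v29 : MV := ⟨0x888888888888788888a888887,[61,61],[19,103]⟩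
def oC0 : Ob := ⟨1, 1, 2, [(0, 2)], [
 ⟨0,[
 ro 0 v0 1 0xce00d57,ro 4 v1 1 0xc97aef7]⟩,
 ⟨2,[
 ro 14 v0 1 0x1a09aef8]⟩,
 ⟨1,[
 ro 58 v0 1 0x7bb31d6,ro 62 v1 1 0xcf6c757]⟩,
 ⟨3,[
 ro 72 v0 1 0x1a7af3d8]⟩]⟩
def oC1 : Ob := ⟨2, 0, 1, [(2, 4)], [
 ⟨0,[
 ro 0 v0 2 0x4a179cc203f37,ro 4 v1 2 0x68ad05780ba77,ro 4 v2 3 0x3335c14ab04072d8317,ro 8 v3 1 0xc37b7f7,ro 12 v4 1 0xcb9d377]⟩,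
 ⟨2,[
 ro 14 v0 2 0x1a9acf8e99dd58,ro 18 v5 1 0x1c1ca1f8]⟩,
 ⟨4,[
 ro 14 v0 3 0x1aeac3ef32104f0b8bf8,ro 18 v6 2 0x1c03ecaf34feb8]⟩,
 ⟨6,[
 ro 24 v0 1 0x1f6ea3b8,ro 32 v7 1 0x37d74159]⟩]⟩
def oC2 : Ob := ⟨2, 1, 3, [(0, 2), (0, 4)], [
 ⟨0,[
 ro 0 v0 3 0x909ba6161bd1c3f95,ro 4 v1 4 0x1cbfc27d5b3be7829af7bd5,ro 4 v2 5 0x1e551f4161e93ab50302f137354,ro 8 v3 2 0x18b82058b7f4,ro 12 v4 2 0x610592477435]⟩,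
 ⟨2,[
 ro 14 v0 4 0x1c9d7b4682d8f4bb6ae26076,ro 18 v5 3 0x6e5c0b56563b9208b6]⟩,
 ⟨4,[
 ro 14 v0 5 0x6b7440fee8d42288325eebbdd4e16,ro 18 v6 4 0x1c9097c7e728ddc1cd82ff76]⟩,
 ⟨6,[
 ro 24 v0 2 0x1db2f01346036,ro 32 v7 2 0x73a927ac37b77]⟩,
 ⟨1,[
 ro 58 v0 2 0x738f6e223b15,ro 62 v1 2 0x6bf021b05495,ro 62 v2 3 0xc03ccc445fde9e6d5,ro 66 v3 1 0x1d31a94,ro 70 v4 1 0x1d659d4]⟩,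
 ⟨3,[
 ro 72 v0 2 0x1d3104bb03ed6,ro 76 v5 1 0x34bd6b5]⟩,
 ⟨5,[
 ro 72 v0 3 0x69bb4cf70ea41a23d6,ro 76 v6 2 0x193dd3b866316]⟩,
 ⟨7,[
 ro 82 v0 1 0x73f1cd6,ro 90 v7 1 0xca0ea17]⟩]⟩
def oC3 : Ob := ⟨2, 1, 0x80004, [(0, 2), (1, 4)], [
 ⟨0,[
 ro 0 v0 4 0x13fc25d8d0ce2dfc7b1d3,ro 4 v1 6 0x1def9ac9ac8de7de1e77c69654e44494,ro 8 v3 3 0x1ef5576b0f73dea94]⟩,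
 ⟨2,[
 ro 14 v0 6 0x79870164432f84106d1b3440d9a582eb5,ro 18 v5 5 0x6e7e5acac5644bcb4f9a50c38b756]⟩,
 ⟨6,[
 ro 24 v0 3 0x62d4eac20c2400eb96]⟩,
 ⟨1,[
 ro 62 v1 4 0x1eb476ec382d40a6c4a934,ro 70 v4 2 0x6b916e1ec1d5]⟩,
 ⟨3,[
 ro 72 v0 4 0x184a5dca6d76ed79733d4176,ro 76 v5 3 0x33a81547fe8087c2b97]⟩,
 ⟨7,[
 ro 90 v7 2 0x7076d56343737]⟩]⟩
def oC4 : Ob := ⟨2, 1, 5, [(0, 2), (2, 4)], [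
 ⟨0,[
 ro 0 v0 5 0x193d82882b7672e94222af48574,ro 4 v1 7 0x190bf30f835002191e3d31a468e2cdaf56d74,ro 4 v2 8 0x17836e68582873ec9f090e5b531a6bf471aaf533,ro 8 v3 4 0x1b64ba23f37159c821b93,
 ro 12 v4 3 0x326216d7a276d7b3]⟩,
 ⟨2,[
 ro 14 v0 7 0xd723a3eb76626d5b3c4846daf6b7cba5f10a15,ro 18 v5 6 0x1fb4f5155a7136bbd5a3337f7ed48094]⟩,
 ⟨4,[
 ro 14 v0 8 0x183193a2a89c838333a5b7031178ea9844e6d9f48995,ro 18 v6 7 0xca32c3752c64a4838a6068eb0bb89f5a26cd75]⟩,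
 ⟨6,[
 ro 24 v0 4 0x1cb9ad8e886e97d693adc55,ro 32 v7 3 0x63aa9da42164c5c956]⟩,
 ⟨1,[
 ro 58 v0 3 0x3b2fb5be934a69d3,ro 62 v1 5 0x1b89a72a3ff2465360d84d93e94,ro 62 v2 6 0x76ddb9e1986d8f338c14f0dc69c733,ro 66 v3 2 0x5c30bcf2693,ro 70 v4 3 0x1894b308c2553ce34]⟩,
 ⟨3,[
 ro 72 v0 5 0x3827253d79d7baff5387b1a00d15,ro 76 v5 4 0x1834f28e1a3c12ea2f79cd5]⟩,
 ⟨5,[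
 ro 72 v0 6 0x5e11e19cb0ce5ba5c12213d91e20fe5b5,ro 76 v6 5 0x2eb1d5284fb71d8772bed1b3ae95]⟩,
 ⟨7,[
 ro 82 v0 2 0x6eeca3cbbcf5,ro 90 v7 3 0x68e58d333036809eb6]⟩]⟩
def oC5 : Ob := ⟨2, 1, 0x10000b, [(0, 2), (3, 4)], [
 ⟨0,[
 ro 0 v0 6 0x14de4821b94de82aae1bc5803d460174,ro 4 v1 9 0xca6f6c5094680ea327f7343f2194c974f2e6128d17d3,ro 4 v2 10 0x187eaf70f9706879223bef768f4f954bd5c0d3f3ade119af9f54,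
 ro 8 v3 5 0xb8a4145e56c80364a2e808513,ro 12 v4 4 0x1d56323a3e7607b38b453]⟩,
 ⟨2,[
 ro 14 v0 9 0x359aaf1276639014b42a19e5149013eaac1424cabfdf4d735,ro 18 v5 8 0x1d387d8a012503ba5addf0ea1c5bbf2b4ba69e37b7b5]⟩,
 ⟨4,[
 ro 14 v0 10 0x7370492f08f59cc64fa994eb06a05624bd60b5671cc89053092095,ro 18 v6 9 0x346d76f20a28c679bac839d83e2f6b638b53532b14974ca75]⟩,
 ⟨6,[
 ro 24 v0 5 0x3cbb14e876e321065024a216a7f5,ro 32 v7 4 0x18e3276411833a88439227597]⟩,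
 ⟨1,[
 ro 58 v0 4 0x16aa9c529d0a887f9e9cb4,ro 62 v1 7 0x13485f1e1ca7bc1ebf1b70c6f0d5e490f6d34,ro 62 v2 8 0x18a8e916ff5967f1759ed98b7dd9519425c9fb73,ro 66 v3 3 0x36598325bedecbd3,
 ro 70 v4 4 0x1ef8aa63434b8c6f53ad3]⟩,
 ⟨3,[
 ro 72 v0 7 0xd93a8372f4d176e7038df8b542363199ef5d95,ro 76 v5 6 0x65e1ed5640f311a9a06b3d01493224655]⟩,
 ⟨5,[
 ro 72 v0 8 0x1745bca38973c2511c9ba71507270698a201f314b275,ro 76 v6 7 0xbfe55178cddb80c321fe98c3f8c12e41aab955]⟩,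
 ⟨7,[
 ro 82 v0 3 0xef0c4db1351bb44b5,ro 90 v7 4 0x18d1e664a55b47143476d0fd7]⟩]⟩
def oC6 : Ob := ⟨2, 1, 6, [(0, 2), (4, 2)], [
 ⟨0,[
 ro 0 v0 7 0x1169c146b22f77eecff09e6bad991b4f1e3d4,ro 4 v1 11 0x13373586ab87426cf6bbcd5ba9f7a0ed843b6027952c91040fc5e4974,ro 4 v2 12 0x122d1313ecb36286452af335cdd23b9f6ad502dbb8f86d6aeb11c63cf32b74,
 ro 8 v3 6 0x19d23aaaa10ff90ef3e7ab97c8dfad94,ro 12 v4 5 0x1fc63f882033cb3b0c12b1f83b4]⟩,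
 ⟨2,[
 ro 14 v0 11 0xd30be94b149901951fbe69189754fe2e2fce369e56985d84cec64efc4f5,ro 18 v5 10 0x6fdd48034d92396d7f27f3fdc0f2f984fc501609b7c0927a047db5]⟩,
 ⟨4,[
 ro 14 v0 12 0x128d5f9fd2b2ddf83f501b43f6b57a70bb55421275ec7b6da88144df34e4289b5,ro 18 v6 11 0x7291e3085c240cd716a286bfd9d93b38f3bed54fb409485a08e048346a0d96]⟩,
 ⟨6,[
 ro 24 v0 6 0x188e796686a10a38bb58b6b68b5b5621556,ro 32 v7 5 0xd73cd67004b1b7639402b3d7f44cd7]⟩,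
 ⟨1,[
 ro 58 v0 5 0x240ab0fa403b5f98548c6cfc22b5,ro 62 v1 9 0x169b6cf4ecd753a50acdce52c32510f45493adb7042ae14,ro 62 v2 10 0x1dae9b6447d29d96f8a7c7472eeba94f573b66bc3a35df8d0134,
 ro 66 v3 4 0x1f59f6fc230ff64ea5feb4,ro 70 v4 5 0xef405ac089fabb37001546ff3]⟩,
 ⟨3,[
 ro 72 v0 9 0x38e0f714098676da46230a2f8cf4c3436c3d1da90f831f7f5,ro 76 v5 8 0x187f8b405141197e7bc443ce8c1ab1bddd171bbbf26156]⟩,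
 ⟨5,[
 ro 72 v0 10 0x4e9b0a15914e3a02eeaffae64c196f108d8e1841421fc04d075355,ro 76 v6 9 0x707373017a3c06e4d320b14db52d21f4d3d6c52fda28541c4d6]⟩,
 ⟨7,[
 ro 82 v0 4 0x1cd9add33e0302377cc2c0f6,ro 90 v7 5 0xe015349959a1ddce849f4427f912d7]⟩]⟩
def oC7 : Ob := ⟨2, 1, 0x200000c, [(0, 2), (4, 3)], [
 ⟨0,[
 ro 0 v0 8 0x11dc1a25cedc25807a56ee612938163362271a73,ro 4 v1 13 0x95a0b137e584a7b4274f2c690d241b1962014c9c16f4402c7a1933f7413c933,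
 ro 4 v2 14 0x47cff7c83919ec9fa9ab70066bc36ba831ece9dae948e2b0f8310b3f039bcb6f7133,ro 8 v3 7 0x2653cc6d3232afea176da7003a7217472d3,ro 12 v4 6 0x1868d8ebaa0e74e0b8e17048fae9de14]⟩,
 ⟨2,[
 ro 14 v0 13 0x1d4eb89a3b0cc72b29ad55d81d3f1d07eea287fd74a5cd928876f188d9d16165bf4,ro 18 v5 12 0x1fb98b0e0f6fdf166924ee8bb2aba10984072e11ac2cc4f1ed2fc504ec4f34]⟩,
 ⟨4,[
 ro 14 v0 14 0x462145e4c9d171948fe44cb499a50d1aa836e72dd4cf3a5a01aaaecfdd792141bc78db6f535,ro 18 v6 13 0x1fb3870f8033d31f046f7197b074c7aceb4107ab70eb9cbdc5ed3cf3a53aca68c14]⟩,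
 ⟨6,[
 ro 24 v0 7 0xd878b48753e5e43ab42ea8cd79ba6e3ee75675,ro 32 v7 6 0x1c029fbe86d0f50603caf46e8302b2e2e96]⟩,
 ⟨1,[
 ro 58 v0 6 0x1293db841a7828f10a287434e905b1d4,ro 62 v1 11 0x59788af33e3fff68d3a307804fbaee1032b5165afa061bd3c32,ro 62 v2 12 0x145f49feea3ea386ea2ecb2c06345b571b80a19c1f80fb02be35b7d0c33,
 ro 66 v3 5 0xe758dc05712240a183591e8b3,ro 70 v4 6 0x70f48ad5c36bc50c8794f0bc589453]⟩,
 ⟨3,[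
 ro 72 v0 11 0x19eb02fd7f0c401217b1927544b624ad604929d3aa07a711d64fe2ff4,ro 76 v5 10 0x60e40d9d230f1b4f571cacf62467209e95a8b7b0da3f2071e772d5]⟩,
 ⟨5,[
 ro 72 v0 12 0x15815b76479045d16396702f56f347eeb3d17903c2021ae8191330fb4c9394,ro 76 v6 11 0xd9c60b5d5b23b044e0e3e570f2bbe055e5b7d12cf17ebaa364a2a25f0b5]⟩,
 ⟨7,[
 ro 82 v0 5 0x60c81b028d9bf10e30021538973d6,ro 90 v7 6 0x1ae3a0b05c64d4109b6678b2090cbbdf0f6]⟩]⟩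
def oC8 : Ob := ⟨3, 1, 7, [(0, 2), (4, 6)], [
 ⟨0,[
 ro 0 v0 9 0x80775afdf6d5f896b39f9c18eae4314c021d20ec3aa01238b63d7,ro 4 v1 15 0x40ef63001dbbe0beafbd99be37f8c10283996510b03941da12beafdc4ddfad817736b73cf281c079bdf6,
 ro 4 v2 16 0x10154ca06b51bf59da7f592ef7a279f9b7d39dd3486fe7ef99955e9aa4bcffba89ef110153a9edec51b4ae177b8877,
 ro 4 v8 17 0x80bd58fe8a99fbd66c051327d878b01f3ea00c6abc894e7358c4fc00e1e4105390fb986b04323b5f8e0265379e4c81809b7,ro 7 v9 1 0x1eeef638,ro 8 v3 8 0x185049e35546a48cd00f7cfd904cc0363b9e85d2feb5,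
 ro 8 v10 9 0x443584e957bb2a6319d20fc38747135554173f33d879bbc45d6,ro 8 v11 10 0x101f6e41846508d094086ff09338431b84f56aa452b3f1a21109a5776,ro 11 v12 1 0xc4b7757,ro 11 v13 2 0x1cc2a3f28e3f6,
 ro 12 v4 7 0x71c5172a85b3fc54476427c80832ef07042fd776,ro 12 v14 8 0x1364e53f7c7d3bbc7b4e47057b41b955696a93bc003ab6,ro 12 v15 9 0x812dc9045d61aa148c877418616a105eb25fcd27bfca8d3a25e17]⟩,
 ⟨2,[
 ro 14 v0 15 0x100f996ff1eaaf02e7105341aeaeee903cc70f6b608f000330cf5bce3ae42fe8170d774a2ed72f4fd6b1a7946d58,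
 ro 18 v5 14 0x79f0a484b6bd9424d99a1aab054a1a3ed5b02893e22537473a22b927670d36eda436044f29c7598bb7,
 ro 18 v16 15 0x279042b267fab38d55be2e38e4fae458502b44980c06095e75934bd60299b09d0371aaa395448ecce67556b7,ro 21 v9 1 0x39247839,ro 22 v20 1 0xd44c717]⟩,
 ⟨4,[
 ro 14 v0 16 0x1019549021160f8f4faf53f6af63a48e7cff8f97ef6f4fbb71673470310b2e8c552de8c810afe94fa31fe739e21100bb38,
 ro 18 v6 16 0x12f97add6c3a3fdd338449c76313898d0ab51442370e4c092cefb4a6fd45fe256c34ae51492a1991cbb56188e62f77,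
 ro 18 v17 17 0x109731cf720c11b8240f8c98ae1fa6b120a86e1f62504fbccfa5266eb37712869c302530ef57eeed6438efd554af3344655a7778,ro 21 v9 2 0x652f421a71b879,ro 22 v21 2 0x6b92b98372597]⟩,
 ⟨8,[
 ro 14 v0 17 0x81e414fd25a5fc8eec08ccb945d5cef04a5953ce3ee7999ade9af08726602d935a1007440ea9aa9dc5faebba74b48b19437,
 ro 18 v18 18 0x48113d718009499a8938fa33af59739b7975e7526452132b9cbc4eeee303ea065d3c64a696363192f2ed3a5ce3655aaa737ffd877,
 ro 18 v19 19 0x100fec504fcb6fbccd10a7e4af46570f8afb8e9abdf25a6ad010bf6de4406f3b0ccfda797026bb90b8ac6ecb4d106fa1aec3668546335018a7b8,ro 21 v9 3 0xdc6248b73adb9cea3099,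
 ro 22 v22 3 0x31b0acc47d548d05097]⟩,
 ⟨6,[
 ro 24 v0 8 0x1da646b0d9b75bc43c48d2df6b38ea1f8209294a3802ad97,ro 28 v23 1 0x1ba209f8,ro 31 v9 1 0x616bcd9a,ro 32 v7 7 0xc707d845dec79e669bd00525ba21bd0b234b69e801f59]⟩,
 ⟨10,[
 ro 24 v0 9 0xe007ba18d3f6370646ffdc759ebd11f10775d43db56c0eceb86d7,ro 28 v24 2 0x1f035dd3952378,ro 31 v9 2 0x79c3fa5ed9f419,ro 32 v26 8 0x1f82fa9200f82b67652b18fc8d7fe1d37d802dc2fe52f42db8]⟩,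
 ⟨12,[
 ro 24 v0 10 0x10958ef29484f06ae7f2240b8ff590af33862e8ebd10915910a409c2a169f8,ro 28 v25 3 0x1be45a167c688e491ef8,ro 31 v9 3 0xe2843bb2c26fe1f0ac19,
 ro 32 v27 9 0x24b66ff0170a17a87fd3699746171722eea9ce8910d33b0bf60a5d6579]⟩,
 ⟨14,[
 ro 36 v0 1 0x180e70d8,ro 40 v28 1 0x1f364398,ro 40 v29 2 0x61e4dba00bd639,ro 47 v9 1 0x37ca03b9]⟩,
 ⟨1,[
 ro 58 v0 7 0x40873af3df4328a88bd8d9b751faca2118e8f796,ro 62 v1 13 0x450b70fbf8142603d02a0fc92d22ee914bbf9ed0af773e231cf1dd3c6923ac6622809a876,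
 ro 62 v2 14 0x11ac6a4c6027267ae4deb64c30ea6bc78076fdaba4ea71d364b18ebf5d4eabfe98d0653536e7836,ro 62 v8 15 0x41fc58e974e4ad1e0c17dfc90196c4f72e1c491571b952159b19183be572177d615b24b1350efb6c6db6,
 ro 65 v9 1 0x1dff4258,ro 66 v3 6 0x184340a5a8b76ae663eb67ac64ea475f6b6,ro 66 v10 7 0x5529a0d9bd02bde3585f034d6a3f2c1d4ced5f96,ro 66 v11 8 0x12fa71b65c3fd40c94640f88ebddde375e03f527def5,
 ro 69 v12 1 0xca1bcb7,ro 69 v13 2 0x1e3289eb392f6,ro 70 v4 7 0x4f34e7af13318538ac4cc03170c9184c2cfcbf96,ro 70 v14 8 0x13d5183e3107157abb739a819d105453cd2090a475f116,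
 ro 70 v15 9 0x56e4db9590dcdec387b10faf8b8ae91a5cdb9ef01a8ba4eb5b6]⟩,
 ⟨3,[
 ro 72 v0 13 0x101fa3cfb883ef2676effab2eeabd1b0284ccebb6270c1274fb22f4c86a18ff8f4ce733a07ef6e78,ro 76 v5 12 0x186555ef918d12590aceb3c60e999c703e018d9af4ceff9bed2bd1b0244490b7cab1f71fd8,
 ro 76 v16 13 0xcbfc93153d6d3cdb1bb39b15d9ed927f1f9c087691612f75adc2eccf2619f164c3d68ca5d797,ro 79 v9 1 0x38cb5819,ro 80 v20 1 0xd2d1ad7]⟩,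
 ⟨5,[
 ro 72 v0 14 0x4f43b9b7ca2e72845eef1cdc0de90b194ad37e7e558f2acb7aee6b9e4ccbc491d29ef3cf8a26c0a697,ro 76 v6 14 0x55497a839781480a0508a5a0e1fa76fd5ff186825bc4134654f0c4c110f27dae4f255259df6802f937,
 ro 76 v17 15 0x328839364053a00c2535ed11d9daf12afb98a2afaf18f2894af8c7dbe776faecf28d52043afca2cf4734a1b7,ro 79 v9 2 0x6acde3998abb79,ro 80 v21 2 0x6a30349667497]⟩,
 ⟨9,[
 ro 72 v0 15 0x4dd37eea90c39f2f0a28b323b791ebf84d2632218347c4320941ceb1b47351cadf1789f30e5372cdc1f6,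
 ro 76 v18 16 0x1da7fae31489dca8ac83d6e90b5ef5a2023c719d89c24dce55b297816cb05f2e5e362710d9c9ebad3a7407364510d7,
 ro 76 v19 17 0xa1bbbd0d5622eeae0e40e7a750b6ef944437537d34d3105932bd2ea131ff80e43a73969831f0cd656393973fd38ba37b497,ro 79 v9 3 0xe56633b93570ddc14139,ro 80 v22 3 0x327812c3f12a8b2e677]⟩,
 ⟨7,[
 ro 82 v0 6 0x1b6116ed64421150c6eccd2cf1b3fb4e121518,ro 86 v23 1 0x1de8ebd8,ro 89 v9 1 0x3def7e59,ro 90 v7 7 0xc8f5a53af1a6a13aafaffbac8865ad63883255c9de679]⟩,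
 ⟨11,[
 ro 82 v0 7 0x18f922d12aa84cb04f9000a613d8558a635871f50118,ro 86 v24 2 0x1ec97932d59e78,ro 89 v9 2 0x795305de7e0359,ro 90 v26 8 0x19056d088228fc44950a27881904dda977dcc1b38781daea9c79]⟩,
 ⟨13,[
 ro 82 v0 8 0x195f77b2548d0efd62ae1228d1a2fc11860aaae8466f638778,ro 86 v25 3 0x1e5d4232c2cc8fb4b798,ro 89 v9 3 0xe8f207320da6203e1659,
 ro 90 v27 9 0x13eabe7039c1d00e5f3ef94b35df3472ab8418e91bacd9e06f7fb038]⟩,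
 ⟨15,[
 ro 94 v0 1 0x1b3292f8,ro 98 v28 1 0x30959959,ro 98 v29 2 0x6105f2e6e97db9,ro 105 v9 1 0x355d4439]⟩]⟩
def oC9 : Ob := ⟨2, 1, 0x220000b, [(2, 4), (0, 2)], [
 ⟨0,[
 ro 0 v0 10 0x40cea5f63e501e847d918378741f0bf5064b839fd6a5e15d6b1db5,ro 4 v1 18 0x10767d002a0fa8a2f9892fb6a5119b2f7dd90a7f5862c92a441207c81f534f54472b1fa761d72ef00d7146e09754,
 ro 4 v2 19 0x808b7416b25f66cb021578677ebe32fa1d80cf14da7fe444532ea72bd90f0b36c6c0e10bc9677431574186d884174e1c15f75,ro 8 v3 11 0x20c35bddc17f98f0f18608e25e1a0962ec9e9ba18838e3970cc553,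
 ro 12 v4 10 0x416157326f3220b0c5727f06af55c833f0585001338343413]⟩,
 ⟨2,[
 ro 14 v0 18 0x415ec1fb46d061127a4e54199f1eb94b3a32db43023e28721392952eaa14288b255d66ee5254d75864c52bd4ea350755,
 ro 18 v5 20 0x103cb180eed401d7988e516030321bcb4b610678f2ad329808c2a3f0e01c7f3355996945f60f998253572cb0cb48e14be2f24e1cbb5]⟩,
 ⟨4,[
 ro 14 v0 19 0x40b0f0fdc6a3edea503c17414222fbfb238f56cffc5338e134d1f9bd09a52a3fde3ea36cd3ad5adb666bf30c11760cffae8ca3be16,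
 ro 18 v6 21 0x207258fcd797c6773fa6e5f8505107cb68feed0af92214790310a8e033c59bb5f04becbb3326bea49cdf5ba89436e7b76d71443a6dfa11b5]⟩,
 ⟨6,[
 ro 24 v0 11 0x4167f6cea1520eadab9623cda37f25853be381a5e94db3bd4a71584af6dff6,ro 32 v7 10 0x4086873e9a0507ac1246936c374beb079e522e7c176633a4f1345dd2f57]⟩,
 ⟨1,[
 ro 58 v0 8 0x1042837cfe742cb562e7931e685718c21dd2b636fe95,ro 62 v1 16 0x10429f0c0e703edb0aeaaf5a7725dfc5add72b37f0d7fcdf2811fd626a0fd0d50ef0d548490ed2f6f4,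
 ro 62 v2 17 0x8779f06815df1646f507cd1d359d5e624509bcca1b2bb96e9a0a9859949041772f59ac2c5cda586db3,ro 66 v3 9 0x104711021bafea450fa9d066f145a5748838ca21c793f74,
 ro 70 v4 10 0x462a39ebcb878362bb09826e363f69ba9c084fc5bad464873]⟩,
 ⟨3,[
 ro 72 v0 16 0x104a7b807e9c0d9edd12053d9839d4974a254a55f8d431268a0e6aba6ecde9b0dfed87d68a978d0deaeed5,
 ro 76 v5 18 0x49efd5f7432826664103f5f6395517fd290db773193c89c972fc3293cd5a561bcd330b2f04cfa4571a614f3d4488fc15]⟩,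
 ⟨5,[
 ro 72 v0 17 0x213776fbeb7865c64029de17090dc42674b81cf6eda7b756eefbd7febe27fc15f30089f43819aa3d3bbbe45ebf5,
 ro 76 v6 19 0x84fcc41144e01666b251e7306ebd4732391d0f6cdb8f10fb8d77a54bcceefb56f94d3944655157ac917394a2203123a6123f5]⟩,
 ⟨7,[
 ro 82 v0 9 0x6600932891ac80b97000ee444a81071133597e0ebddb90fffd6,ro 90 v7 10 0x1599fca2bea4632d546daa797e026048833cc38166a92d03d00ee4a76]⟩]⟩
def oC10 : Ob := ⟨2, 1, 0x2200005, [(2, 4), (0, 3)], [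
 ⟨0,[
 ro 0 v0 11 0x10258efa2d302314fe01d052a313695408dcfb9837ef60c5effb46594,ro 4 v1 20 0x102a1b00236fcd6cfd35ef86e4fa72b099c8fe4c915bb8ef7aad1382f3f9b599e7463d26bdb201bea9997cd726cea96d0c8174,
 ro 4 v2 21 0x20155f0041f7f89cbecbadff5d704f4a801d8c067f1eb446fcd357aeeda5ada9dd7d6dd91ab44fdae9e19e3f1c082f77b742bb880a15b495,ro 8 v3 12 0x10452bd96cfacc3ea912eff5812d9a6d9e4b9b940c55947038db1392,
 ro 12 v4 11 0x1060bb02062f1ebb2b91af8d4ebb4d13fea0fd1567770bcb888f9d0b4]⟩,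
 ⟨2,[
 ro 14 v0 20 0x1016d1807a6beab9a0082cf32eb7fb01c49ade8a406dd71772fa4c8a8a605af81168c82a3e590acf861672707e78c9fc5f9fa455c95,
 ro 18 v5 22 0x409cfa0579afbc177e4b63f09d9f8c2913ec76b3e6d0596e830432007991b6d4b18d60c9f2a742139e0d466acda4e91b2c3e94a163ff87a7b54f5]⟩,
 ⟨4,[
 ro 14 v0 21 0x4042d2ffe933f7f1304328bf5fd303d073f09f500200ba2a5d1e8654c8ef9351a3328f43337cd9b07c0f46f14abcc5fe9feb6bf23032f42f1e196,
 ro 18 v6 23 0x80d05c0a591ff74b01ee17fc383fa67a02194fb22f7ee66432855fff40cd3817e35eba94f22e656f5ae688ef3a528cdbd382f1021d92954635e1fcc1f5]⟩,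
 ⟨6,[
 ro 24 v0 12 0x101bfd7b2b54710b9e303547eb02fcb00e873254db5dde2383fa30e359e7fdeb5,ro 32 v7 11 0x41bdb8f7d6ed00586f3b95d5e7697e5d645a7b0e578294bb97cf81cc9bc696]⟩,
 ⟨1,[
 ro 58 v0 9 0x102bf2f6afb048ccefbfadb888c06234a7ee4d232653434,ro 62 v1 18 0x103254fd658fdac703758f99eb09cdef92a3099f3035bb08c2316a1cdb9a552185327e6f01e84700eb887b31e034,
 ro 62 v2 19 0x80c72c02b4e02590fca997d11a3fe25e00827069f17b6de48f10e02586e435a8fe0f43114f07199077837059e110ca20b5e55,ro 66 v3 10 0x412297eff304691f4784bb1c957b7906720c9a44a8b2402f3,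
 ro 70 v4 11 0x103767076bd0d9a7292a4f6e049b12ce4f68c30109bb65072e5961274]⟩,
 ⟨3,[
 ro 72 v0 18 0x41411e0c19afccab8814cbf8c49fe5b2f04d27ee29d5777ea42ccd11737802019409613ad0a1a79cd703bd9f8e21b115,
 ro 76 v5 20 0x1050630b9a903e0ef5f3ac8410e5100f679b2601906655673609b39bc21bcb8b465411d1a2d090c8cabea54ee437d058b96894]⟩,
 ⟨5,[
 ro 72 v0 19 0x408b3900b30c011dd04ef4c0d26afe8f3ba8a2b27e4c418467211564836c564bccc54656d20879e88990cfd2bc2d6fe1af1c07ee36,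
 ro 76 v6 21 0x105378ffc02fcaeb0a4290e89ade794f84153bc74ed244d88af1ba7c99736bcec11cfaf3683d105008343ab37f6f23a325e8dbf59d4]⟩,
 ⟨7,[
 ro 82 v0 10 0x416d251c1532bdef7efe7bc28a921ed91f58184bd05967e4a2b6f5,ro 90 v7 11 0x83833465525cbff6a09f87aea2eda149f47516d7120356a30703fc653d5]⟩]⟩
def prC : List Pr := [
 pc oC0 oC0 1 0x60004e0800079a4004008,pc oC0 oC1 2 0x20003f800006e8100017a00b,pc oC0 oC2 2 0x1a8c000fea300037269003001600d,pc oC0 oC3 2 0xe6013e1d8027814a04001f809800b030006e02000fe81800370130016014,pc oC0 oC4 2 0x69a49a400c015,pc oC0 oC5 2 0x1a69463002e68180057020000e01e,pc oC0 oC6 2 0x1a0e601bf180017839808b269003000e025,pc oC0 oC7 2 0x1a0e6019e8398083222080097403000e02b,pc oC0 oC8 2 0x1a82602af00c053a0980bb403016e0e601de8398093220003c00e02f,pc oC0 oC9 2 0x2700093c83017e8c0022f00c051a300083403015e690030036033,pc oC0 oC10 2 0x2500077ca3018684001be10c017a10006742301666a3800d746001a6036,pc oC1 oC1 1 0xda88c041f0180819a710c07d9269a4004038,pc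 oC1 oC2 2 0x127818f0cd829e09b05ba3060c3c40c17e80d829f11b05b820002fc600166800028d100057a030073c46011e84601af18c043a018063040002e045,pc oC1 oC3 2 0x127819780d82af11b05da030077c46012682d82af15b05da11806fc0300ce8c6022d10c041a0b0077c56012686601bf1cc045a0980674530106045,pc oC1 oC4 2 0x369a69a48a28040001e045,pc oC1 oC5 2 0x369a69a4a00611ba880045ea20000f2052,pc oC1 oC6 2 0x369a69a400c005a230133c0602d68c604af08c0b1a21812340302b6060,pc oC1 oC7 2 0x369a80d863e21001878806002c203012fc4602ce846049f18c0afa01811f44302ae06a,pc oC1 oC8 2 0x12264a1c7c89438668cc3037e40820006001618f869e11f0dda2301a3cc6036e80c067d2180d9a10619b860c35e801865d2030d5a03c147c8782fe88d850f31b0bda03613f486c2ee84784ef28f0b9a01e137483c2de06f,pc oC1 oC9 2 0x17000bfe60017bcc002ee69a69269a4014072,pc oC1 oC10 2 0x540028f880050f10009f9a69a487061dba040074e83001cb400001607f,pc oC2 oC2 1 0x6271823789c608cc2718257c4604a69c6093d0181259a49a8a608fd10c11d92018408f007980a608ac00c013904004089,pc oC2 oC3 2 0x8a4e8a2a51c28214309ea4fc067804c4ec69226e93909884cc00600ac4d4006008c4bc69033c026690030056490030046097,pc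 oC2 oC4 2 0x186106102000a6035e8000061023003e614030036401800df00300660a5,pc oC2 oC5 2 0x1861061486c186200221180cf0118c069800301b661063003e6144300368c0035d10c155904300660b0,pc oC2 oC6 2 0x1a692728005f908c60bee23182f7230800518420015e0209806f40300d661483c03e860022f0800439023002e41003005e0ba,
 pc oC2 oC7 2 0x1a6926108c60cce231832f42005fe200866019d08c0318061403c03e62080083063002e41043005e0c8,pc oC2 oC8 2 0x189c60eff08318da7183bb420c69e61069282d824f01b04792492610610424b007748600e6ac60dee2b1837708c60dce231836f08c60dac2318367020000061024003e61403c03641003c06661023c02e41003c05e0d5,pc oC2 oC9 2 0xbc60b9f4831d5a7182dbc20c6169c60b5d08319fa7182e3c20c7469c60b7d0831c99a4211807fc2300f6412408000f05388000c04d808a0015c00c0f1,pc oC2 oC10 2 0x2b182bfd60c7668c60acf183189a3182af460c68e8c60aee30f047a3182b7460c736614e007b6846015f08c003904300f64146007962002000230005f46000b60f8,pc oC3 oC3 1 0x250e25bca104b600608de04c1fd8118233020c01e3fa810046e067803c0c011980983fb803046e041803c08c1198fda040117809804011580980270030456002420044e02008de8180233033c01e02008be801822b013004e02008ac04c840089c0040fd,pc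 oC3 oC4 2 0x16d8e3e2981c785b63878a6060e16d8dfc29819d85b63078a6070e16d8cec2981bf8098407803054e040007c08c1678098403803053e800006c08c16380983ff003052e03202305860200a9e81802cf033003e0200a7e81802c741300360200a5c81802c301300660ff,pc oC3 oC5 2 0x16d8e2e2981c585b63838a606069c181dc29819b85b63038a6070616d8cdd3cf03b809841380305a60c0007c08c151809840f8030596880006c08c14d809840b46301ae08000cc04c06f80802d3a0600a8c1cc00f80802cba0600a6d14c00da3800d720de0530066102,pc oC3 oC6 2 0x16d8efe2981dfa5000938a6056616d8e9c29816d85b62b3cb3012616d8b6c2981d3a39841f80305f6041807c08c197809841bc330116040005d0cc041809841700305de02e02306460200bee818032f493c03e840022ea100083033002e0200bbc8180323013005e105,pc oC3 oC7 2 0x5b63bb8a6077616d8e7e29815785b63970a605ae16d8abe2981cf85b62d70a6072e8e610ae00c199a00601f02305ee026109e00c195830001702305e6026108c00c193820002f02305d60200cce81802f7413c03e0200cae81802f3073002e0200c9c81802eb053005e108,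
 pc oC3 oC8 2 0x319e3c3e20c7868678eff08318fa19e3bb420c6a68678c7f0831dfa19e353420c77616d8ede29815f85b63af0a605ce16d8c5e29815d85b630f0a605c616d8d2c29815b85b63430a605be16d8afe2981db85b62e70a6075e16d8aee29818b85b62e30a6061e16d8adc2981a585b62df0a6068602610fe00c1bd810801f02306ee8e610ee00c1b9a00601b02306de8e610dc00c1b5800603302306ce02610ce00c1b1810601702306be02610bc00c1ad800602f02306ae0200dee8180377034003e0200dce818036f413c0360200dac8180367013c0660200d8e818035f033c02e0200d6c8180357013c05e10b,pc oC3 oC9 2 0x299e3afd20c75e8678e9f083187a19e397420c6868678c3f0831d3a19e343420c72e026112f3801f780060ab4a007ae026111f1801f582790801e9809844346007c6096420078e9e60fbea5983d7013c1568e60faea1983d3003013e8e60f8ca1983c7013012e110,pc oC3 oC10 2 0x2b9e3b7d60c76e181824f18318ba39e39f460c6968e78c5e34f049a39e34b460c73e026115f2801f9a79844b4e007be026114e18c02ba39844704300fe026113d0801f3a398443460079e9660fcea7983df4e008960e0015e820007f460088e8660f9ca3983cf4600886113,pc oC4 oC4 1 0x618422b047fc4608f682c11dd0182399a4988a611ad10c2339240841dc2107300080089c004116,pc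 oC4 oC5 2 0x618418420010f984184110311050801e4200750200247040048601c4123,pc oC4 oC6 2 0x618418ed1061023a443944039803f063008e2140602062107d0041ec12e,pc oC4 oC7 2 0x618418418421004cb800298037423008640851180838841fc0144301f613a,pc oC4 oC8 2 0x61841841841841040840840092c013c18c02598418410421064db8941941c1040842242108700421421083004204145,pc oC4 oC9 2 0x18610200200600000200cb08030402280037003001615f,pc oC4 oC10 2 0x820022000b98020062bc02c40002002000238003f4600076163,pc oC5 oC5 1 0x6184a2b05abc460b4e82c168c2801119a528f111988a6166d18c1079020041e408010988060117c08007788060116c080073828c0089c004164,pc oC5 oC6 2 0x1869084194be0800eb90610c6c27e8c0131e0800e7a0980374000016014600396201804f3406020e281804ef02001fe001804eb40301f616f,pc oC5 oC7 2 0x186108c194ae1061086c28686600ff08c01da3004f746003fe840170c046003a6201804c34460206201804bf02001f6001804bb02001ee178,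
 pc oC5 oC8 2 0x18610610610610410943953e009c0152e001ec013c10002580611c7828e61446042e414060436841935e2506503420c406841973c25065eb4e003b620180527020022620180523020021e0018051f02002162018051b020020e00180517020020617e,pc oC5 oC9 2 0x20800800808809008800800cd8803140a000fd0800238020030e18f,pc oC5 oC10 2 0xebc58b812d961e06b6583022800b78020020800ab802002b64002002000e000dd00002180193,pc oC6 oC6 1 0x1a69284194fe00c0f9a1066074060cbe02614ff11b0f9819860728c011bf1800f5a10049b00303c6026126d1000f1a10059f02100302162100301c608088004194,pc oC6 oC7 2 0x1a6908c194ee2306603002614df01b0f781985ff002611af0800f3a3004970026124d0000ef819859b020003021e2000301d602a013000301ce19e,pc oC6 oC8 2 0x1a61021269020048186013020c01e94395be250e62f09c0157e270061f0940156c250061b0026151e71f0bf819860f2026134e2180bd81985cb202613fc3180bb81985e7202611ff0830fda5064ab0026128d0030fb81985ab021147c22621446c20e01406c2062100301e60100301de1a3,pc oC6 oC9 2 0x7bc5dfa20006c172e00335383b05c72730c0a980608c0a780510c0a58180013020001e20003033e8c015fe044002460040002b61b6,pc oC6 oC10 2 0x6bc4e7a20426cc9602c134e20c0bd82b04cf26800801b7f18c0a78443022e4a080013060001e2008c0163e00100031f84200c8e1bb,pc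 oC7 oC7 1 0x1a6908c194cf118387a3065fb4060e160a614ce83985fb2840118e230048f4430e0e0a6123ca30059702208065b40302162208065740301c6000880041c1,pc oC7 oC8 2 0x1a6100039b1e007361806900801ace1003578186013020c01e00094395ae250e62b09c0155e27006170940154c250061300a6150e839860b20a6133e00337f83985c7000cdce0a613ec83985e320a611de25064a700a6127c03985a302018069f047c2262018069b4c6c20e00180697486c2062018069304301e60018068f04301de1c9,pc oC7 oC9 2 0x7bc5f7a20006c179e00335183b05e3000ce4e6800801bce1003778180013020001e4802004303462230064344002560040002c61d4,pc oC7 oC10 2 0x6bc513a20002c13fe30c0bb82b04fb000ce566800801b6e10c0a5a080013060001e0801d5c1003a9802002230064f00001d9,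
 pc oC8 oC8 1 0x200b44e0bf22e415a91382740b90469459b5e80b369901674f202ce9669222d0681f48ad0364809c21b3f32a409a5086cb48a901e9c21d1ca50874340a90162002000018c013021801e2809afe50135da5026b7489d00e9c09cfc50139da502737409d00694595ef1263f7a51663b4098fd69c215df3253f3a7086374894fc694215cd1253efa5086334094fb69c0959f3243eba7026274890fa6940958d1243e7a5026234090f9612d9b5f89b36985b674f606ce9612d9b3e85b6747487d02e12d9b2c85b6743284399de207339800e68b001cd0e12d9a2d09b343800e723001ce3e12d9aff49b35d85b673f506ce7612d9adc85b673728c019be30033582006830400cfe840199c250067b486cffe12d9a0d09b33f820071b0400e2e12d99eca5007130843939f69b381a50e513586cede843977d49b375a50e5f7506cec68c0138f3983e3a70050f4c60f868c0176ca7005f34860f7e840137ca50050b4460f76840174ca5005ef4060f6e12795ee859e63b212795de859e637212795cc859e6332127939e406381859e5df1018dd6127944c4063b7859e5f71018ec6127959e859e6272127958c859e6232127938e859e5db4c3cff6127937d28f3fb859e5d3483cfe6127943c859e5f32127942c859e5ef2843122ea50c4b74434f5e12792dca50c5bb28c1921ea7064b34c30f4612792cca7065b72841920c3032d7a5064af4430f3612792bca5065b3220004222620004021e0000402169431e4f2863c7a48c78b44a020e8431e1d0863c1a08c77f40a020669004020e49004020620003c1fe9419ded2833bba486773446c1f649003c1f600003c1ee2000401e60000401de20003c1d600003c1ce00003c1c602a01300880041dc,pc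 oC8 oC9 2 0x17da63ba820fd617518de0073f187d4633081cfb6200272183e4063558bc860b1018e5e20020000020000068068048180013020001e1801bee30037b801801dac3003b38068004034e68000c32648003c31e2044002660040002d620c,pc oC8 oC10 2 0x16da57ba820fde13515de0073f386d4573081cfbe200232151e6100bf8ac85431018e66200200000220f0b38083c2d6000380a17e70142d80080215e10042980180213c300425a080013060001e1801b8f18c0a9844302361801d7c3003ad8022d808475a010862258083f4a01076025808374a01066200000218,pc oC9 oC9 1 0x2f005bb9810f569c016de0033cfa7005b3080cf2e8ac222f118443a0b088340610fe6922229887b44310ee480680030cc6680030ca641002c98088004218,pc oC9 oC10 2 0x3af12de6043d784b64b3800cf461ad92bc2033cd8c660bae0080087f04630b7e000200200000a804c223,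
 pc oC10 oC10 1 0xa80122e6843d9a200487820cf4e880120c2802d7a2b08a3c46113e82c226d01844b9a4888a6224d10c4479202680873cc010de0010086b82010ce022808634000b26800008c004223]
def obC : List Ob := [
 oC0,oC1,oC2,oC3,oC4,oC5,oC6,oC7,oC8,oC9,oC10]
def rtC : ℕ :=
  0x5276633151766331627563316175633152366331513663316276634161766341527563415175634162366341613663414274634141746341426463414164634142546341629641856196418562864185618641856276418561764185429441854194418542844185418441854274418541744185b8924185b8914185b7924185b7914185589241855891418538914185698141855981418559714185958141859571418535814185638141855481418553814185b9614185b95141858961418589514185796141857951418598614185985141859761418597514185486141853861418538514185376141853751418594614185936141859351418584614185836141858351418573614185735141859842418598414185983241859742418597414185973241855842418558414185583241858197413552764135517641357197413562764135617641356236413561364135b9724135b971413569724135597241359672413596714135957241359761413597514135376141353751413589724135897141358672413586714135857241355761413567514135536141358197414581374145527641455176414552364145513641457197414571374145627641456246414562364145b9724145b971414569724145597241453972414539714145967241459671414595724145367241453671414597514145475141453751414597324145673241455732414576324145753241458972414589714145867241458671414585724145797241457971414576724145767141457572414575714145575141453732414536324145454141455236416451754164514541646236416451354164b9724164697241645972416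4497241643972416496724164957241644672416445724164367241643572416497624164975241644762416447524164376241643752416489724164867241648572416483724164576241646752416479724164767241647671416475724164737241646762416457524164535241644641416498724164687241645872416458714164756241647561416476524164456241643562416436524164534141645246416372974163726741637257416362464163b972416369724163597241634972416339724163967241639572416346724163457241633672416335724163937241636372416397624163975241634762416347524163376241633752416373624163735241639732416367324163573241637632416375324163897241638672416385724163847241638372416357624163675241636352416347324163463241634532416379724163767241637572416374724163737241636762416357524163545241636362416337324163363241633532416398724163687241635872416348724163387241637562416376524163456241634652416335624163365241639772416367724163577241637662416376614163755241637551416346624163366241633661416335524163733241636332416331744162316441623154416241744162416441624154416297414162674141625741416276414162754141623741416236414162354141624741416246414162454141627341416263414162534141627441416264414162544141627241416262414162527641616275416162454161523641616235416162764161617641615275416152454161623641616136416152354161b9724161497241613972416196724161967141619572416195714161457241614571416136724161367141613572416135714161947241619372416164724161637241615472416197424161973241616742416167324161574241615732416176424161763241617542416175324161897241618971416186724161867141618572416185714161847241618372416137424161473241613642416135424161453241617972416179714161767241617671416175724161757141617472416173724161575141614742416137324161363241614542416135324161987241616872416158724161487241613872416173424161743241616342416164324161543241619772416167724161577241614772416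137724161466141617442416173324161644241616332416154424161927141617162416172614161527141617251416171424161724141613271416142614161624141613261416151424161524141613251416192724161726241617161416172524161715141614262416141614161326241613161416172424161723241616242416152424161523241610081476300813763005176630061756300514663006145630051366300613563004173630041636300714763007137630061766300517563006146630051456300613663005135630041746300317363004164630031636300415463009671630095716300367163008971630086716300857163008471630083716300797163007671630075716300747163007371630067616300575163006461630054516300636163009871630068716300587163004871630038716300756163007651630045616300465163003561630036516300743163006431630054316300977163006771630057716300477163003771630076616300755163004661630045516300366163003551630073316300633163000097630000676300005763000076630000756300004663000036630000356300007463000073630000646300006363000054630032544100315441004254410041544100325341009752410097514100745141007351410067524100675141006451410063514100575241005751410053514100454241004541410035324100765241007651410046524100465141003652410053424100534141007552410075514100455241004551410035524100355141005442410054414100533241005241410072524100715141004151410031514100524241005141410052324100003541000053410000424100004141000032410000753100003531000053310000513200005131000000310000005300000000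
def tgC : List Tg := [
 ⟨2638827906662400, 0, 1, 0, 2, 0xe0000e0800040a0000e18000480000103000038400010200003060000c180004020000c08000404000101000030000010000003⟩,
 ⟨2638827906662400, 0, 1, 1, 2, 0xe000143000050e0002c30000b0a0002c20000b0a000142000050600014100005060002c10000b020002c00000b0200014000005⟩,
 ⟨2638827906662400, 1, 2, 0, 1, 0x860002e0800058e0002e280005840002e0000058c0002e200005860001608000b8e0001628000b840001600000b8c0001620000b⟩,
 ⟨2638827906662400, 0, 1, 2, 1, 0x8a0001a2000068a0003220000c820001a000006820003200000c0a0003020000c0a00018200006020003000000c0200018000006⟩,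
 ⟨2638827906662400, 2, 1, 0, 1, 0x8a0001a0800060a0003008000c880001a000006080003000000c8a0003208000c0a00018080006880003200000c0800018000006⟩,
 ⟨21110623253299200, 0, 1, 2, 3, 0x8a0001e2000078e0001e300007820001e000007860001e1000070e0001c3000070a0001c200007060001c100007020001c000007⟩,
 ⟨21110623253299200, 2, 3, 0, 1, 0x8a0001e0800070e0001c180007880001e0000070c0001c1000078e0001e1800070a0001c0800078c0001e100007080001c000007⟩]
def ltC : List It := [⟨851351853386956800, 0, 1, [(2, 4)]⟩, ⟨928867423145164800, 3710851743744000, 2, [(0, 2)]⟩]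

theorem c1 : fchk 2 553 (Nat.add (lsum prC fun q => zs2 (pits PT q)) (Nat.add (zs2 (List.cons ltC [])) (lsum tgC fun g => lsum (tits g) zit))) = true := by decide +kernel
theorem c2 : lall prC (fun q => chi2 0 553 PB rtC (pits PT q)) = true := by decide +kernel

theorem datC : Data 2 553 0 PB rtC PT obC prC ltC tgC where
  nr_le := by norm_num
  nl_lt := by norm_num
  nlm := Or.inr ⟨rfl, rfl, by decide +kernel⟩
  pt := PT_ok
  pb := PB_ok
  rp := by decide +kernel
  r0 := by decide +kernel
  r1 := by decide +kernel
  ob := obc_spec (by decide +kernel)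
  pr := rfl
  c1 := c1
  c2 := c2
  c3 := by decide +kernel
  c4 := by decide +kernel
  c5 := by decide +kernel

theorem certC {G : Type*} [Group G] (Ψ : Wd (Fin 6) → ℝ) (h : PS 0 G Ψ) :
    45 / 32 * pd1 Ψ - 21 / 8 * pd2 Ψ ≤ 4 * pA2 Ψ + 32 * pO3 Ψ := by
  have k := datC.pos h
  have a1 : ∀ i j i' j' : Fin 6, ∀ c H, rs (tits ⟨c, i, j, i', j', H⟩) (rit Ψ) = -(c * Wt Ψ i j i' j') :=
    fun i j i' j' c H => tits_sum c i j i' j' H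
  have b1 := a1 0 1 0 2
  have b2 := a1 0 1 1 2
  have b3 := a1 1 2 0 1
  have b4 := a1 0 1 2 1
  have b5 := a1 2 1 0 1
  have b6 := a1 0 1 2 3
  have b7 := a1 2 3 0 1
  simp only [Fin.val_zero, Fin.val_one, Fin.val_ofNat, show ((2 : Fin 6) : ℕ) = 2 from rfl,
    show ((3 : Fin 6) : ℕ) = 3 from rfl] at b1 b2 b3 b4 b5 b6 b7
  simp only [tgC, ltC, rs_cons, rs_nil, b1, b2, b3, b4, b5, b6, b7, rit] at k
  have l01 : ∀ s t, Ψ [((0, s), (1, t))] = V2 Ψ := fun s t => letter2 h (by decide) s t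
  have l02 : ∀ s t, Ψ [((0, s), (2, t))] = V2 Ψ := fun s t => letter2 h (by decide) s t
  have l12 : ∀ s t, Ψ [((1, s), (2, t))] = V1 Ψ := fun s t => letter1 h (by decide) (by decide) (by decide) s t
  have l21 : ∀ s t, Ψ [((2, s), (1, t))] = V1 Ψ := fun s t => letter1 h (by decide) (by decide) (by decide) s t
  have l23 : ∀ s t, Ψ [((2, s), (3, t))] = V1 Ψ := fun s t => letter1 h (by decide) (by decide) (by decide) s t
  rw [pd1, pd2, pA2, pO3, Dd_eq l01, Dd_eq l12, Ga_eq l01 l02, Ga_eq l01 l12, Ga_eq l12 l01,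
    Ga_eq l01 l21, Ga_eq l21 l01, Ga_eq l01 l23, Ga_eq l23 l01]
  have v1 : Ψ (wd [(2, 4)]) = V1 Ψ := rfl
  have v2 : Ψ (wd [(0, 2)]) = V2 Ψ := rfl
  rw [v1, v2] at k
  push_cast at k
  linarith

def v30 : MV := ⟨0x788888b888887888887888888,[145,145,145],[61,103,187]⟩
def v31 : MV := ⟨0x788888b888887888888888887,[145,145,145],[19,103,187]⟩
def v32 : MV := ⟨0x87a78787a8a78787a78888888,[75,75,117,117,131,131,173,173],[68,82,96,110,138,152,166,180]⟩
def v33 : MV := ⟨0x87a877878aa7887888887a788,[40,40,117,117,124,124,173,173],[33,47,89,110,138,152,159,180]⟩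
def v34 : MV := ⟨0x788888a888887888888888888,[145,145],[103,187]⟩
def v35 : MV := ⟨0x788888a888888888888888887,[145,145],[19,187]⟩
def v36 : MV := ⟨0x788888888888788888888888a,[19,19],[103,187]⟩
def v37 : MV := ⟨0x888888788888888888788888a,[19,19],[61,145]⟩
def v38 : MV := ⟨0x888888788888888888a888887,[61,61],[19,145]⟩
def v39 : MV := ⟨0x7888888888889888888888888,[103],[187]⟩
def v40 : MV := ⟨0x888888788888788888788888b,[19,19,19],[61,103,145]⟩
def v41 : MV := ⟨0x8888888a778a8778778a877a8,[26,26,54,54,110,110,138,138],[33,40,68,75,89,96,124,131]⟩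
def v42 : MV := ⟨0x88888887a78787a8a78787a78,[33,33,75,75,89,89,131,131],[26,40,54,68,96,110,124,138]⟩
def oN0 : Ob := ⟨2, 0, 1, [(2, 4)], [
 ⟨0,[
 ro 0 v0 1 0x676f536,ro 4 v1 1 0x3a65e75,ro 4 v2 2 0x758b85db94f5,ro 8 v3 1 0x3d048d5,ro 12 v4 1 0x6070616]⟩,
 ⟨2,[
 ro 14 v0 1 0x7f7f356,ro 18 v5 1 0xd1bd477]⟩,
 ⟨4,[
 ro 14 v0 2 0x61ffcc84bc697,ro 18 v6 2 0x6625e07f4dfd7]⟩,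
 ⟨6,[
 ro 24 v0 1 0xdea6557,ro 32 v7 1 0x1a39e418]⟩]⟩
def oN1 : Ob := ⟨3, 0, 2, [(2, 4), (2, 6)], [
 ⟨0,[
 ro 0 v0 2 0x70878613853,ro 4 v1 3 0x3e5c73ad9f55d2f3,ro 4 v2 4 0x1a48bafeb9b05fb933913,ro 4 v8 5 0xe2838f32cadfe7442bb902253,ro 7 v9 1 0x1fc7e74,ro 8 v3 2 0x7356066d673,
 ro 8 v10 3 0x388c25a27384f9f3,ro 8 v11 4 0x1c2a8ab42bd68f08bfdb3,ro 11 v12 1 0xe7dbb3,ro 11 v13 2 0x5fae5d22b93,ro 12 v4 2 0x78e95570333,ro 12 v14 3 0x31177cd74781cfd3,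
 ro 12 v15 4 0x18e3dd387c511f6507e894]⟩,
 ⟨2,[
 ro 14 v0 3 0x1f9974d210ec4a1b4,ro 18 v5 3 0xc4979402c71bd03b5,ro 18 v16 4 0x1f2cb74d109005bcff99f4,ro 21 v9 1 0x3f23035,ro 22 v20 1 0xf9fe93]⟩,
 ⟨4,[
 ro 14 v0 4 0x1a674e8231ba3d0da3ed155,ro 18 v6 5 0x1efb5105d0701412cc206fca4d4,ro 18 v17 6 0x647e4ab529af99a88ba914682721917b5,ro 21 v9 2 0x1a29b540ff656,ro 22 v21 2 0x62e6d839f13]⟩,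
 ⟨8,[
 ro 14 v0 5 0x32688d16f1183246bc69a6080395,ro 18 v18 7 0x1e7ddf1a95f028acb9e34fa22d09d3cee8b14,ro 18 v19 8 0x1ac5239c9be403afe3c92cf0a779686a48a649ff3bd5,ro 21 v9 3 0xfb89d41f1ce514d75,
 ro 22 v22 3 0x31565aa6515b8553]⟩,
 ⟨6,[
 ro 24 v0 2 0x69c129c9e8b5,ro 28 v23 1 0x343dc95,ro 31 v9 1 0x630f1d6,ro 32 v7 2 0x183282396f7f6]⟩,
 ⟨10,[
 ro 24 v0 3 0xc547c3daf39fa4955,ro 28 v24 2 0x6fae61e1bf15,ro 31 v9 2 0x19147ac18d016,ro 32 v26 3 0xef2673fb8763716f5]⟩,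
 ⟨12,[
 ro 24 v0 4 0x1e34eb7347bafd54e34ab95,ro 28 v25 3 0xccb7143225a715915,ro 31 v9 3 0xe8aec44ce19617ab5,ro 32 v27 4 0x1c4023c40b4762d11426a0d6]⟩,
 ⟨14,[
 ro 36 v0 1 0x1e08274,ro 40 v28 1 0x3bcdb15,ro 40 v29 2 0x637fe2ce3375,ro 47 v9 1 0x3b95815]⟩]⟩
def oN2 : Ob := ⟨3, 0, 0x100003, [(2, 4), (3, 6)], [
 ⟨0,[
 ro 0 v0 3 0x6cc5c8dbbdd7772,ro 4 v1 6 0x1e7d3c7b0ed1092d70108c738db92,ro 4 v2 7 0x3b2b4dbb067fc98557653f72bcf6f76d633,ro 8 v3 5 0xd6214bae322290c40658567d3,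
 ro 8 v11 6 0x60e88a8a42ec9c5b514c0d7291af73,ro 11 v13 3 0x3375c5331392fe53,ro 12 v4 5 0x1815bd096810526101cc2da6314]⟩,
 ⟨4,[
 ro 14 v0 6 0x1cfb02cd62aa745526760e0964b28134,ro 18 v6 10 0x1cef38fd5f0ef708fbe312e6e11fc6f12c9f0cd4106eeceff7b4,ro 18 v17 11 0xc933d50a6ce4af3ee77e876d1a40bfda0fb411af3d7e17f40b9f21de3f5,
 ro 21 v9 5 0x685b36f4531b7ccd303ca2bd84cb6,ro 22 v21 4 0x1b7ed270dad5a83a78013]⟩,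
 ⟨2,[
 ro 18 v5 9 0x1bb5694acaf255b90706313b7d02fb2cabd0d6ed2b19554,ro 21 v9 4 0x19f6c1bd7e22e9ed2c360616]⟩,
 ⟨6,[
 ro 24 v0 5 0x346ce2a021b84a93341271b2bb75,ro 28 v23 4 0x18b0273ae9130ac523dab796,ro 31 v9 4 0x18f9fa9eb4753f02fe8c085b7,ro 32 v7 5 0x6067333f119c41ff2f3f842f44f96]⟩,
 ⟨12,[
 ro 24 v0 6 0x1d1b50b39a0e83ef3c696fecc095b374,ro 28 v25 5 0x31447b094cb82727c6a681d58bd5]⟩,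
 ⟨14,[
 ro 40 v29 3 0x6063a0f4c0a3a7d9d6,ro 47 v9 2 0x188519c2d29d6]⟩]⟩
def oN3 : Ob := ⟨2, 0, 0x513, [(2, 4), (4, 2)], [
 ⟨0,[
 ro 0 v0 4 0x1bb87283e59bfd4d90,ro 4 v1 8 0x1e876f5f551159bf8ee40e2b1088547e50,ro 4 v2 9 0x1e0c721453955987cdfea91c307f0fc630ea70,ro 8 v3 7 0x1d2b4cae0ec7b4d2725c2d060e6e30,
 ro 12 v4 6 0x1d0c4cbb6629f2cdec2f8c5910]⟩,
 ⟨2,[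
 ro 14 v0 7 0x69116e3bfc50f8ee0243802fa9bb4c312,ro 18 v5 12 0x18de2471e895f0aebc52366c45d2da0dbfdfaf27c4509af46eca3ef2]⟩,
 ⟨4,[
 ro 14 v0 8 0x1da9fbed670748cd30cc115c1b9cf94dc794b2,ro 18 v6 13 0x6b820db3741f42d4ddb81a8c9da321dcfe54bf8ecfd88c1f371865c70ab2]⟩,
 ⟨6,[
 ro 24 v0 7 0x6d544b204c458504683f4f8e05b383432,ro 32 v7 6 0x6538e83ddeccca9f9023cdc88dda73]⟩]⟩
def oN4 : Ob := ⟨2, 0, 7, [(2, 4), (4, 3)], [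
 ⟨0,[
 ro 0 v0 5 0x47f1afca3c234b4a6c1c0b12,ro 4 v1 10 0x17726a9e29414cc27ac7fbeb25eef88dc5fa4f78292a252,ro 4 v2 11 0xddce3818de156709c5ac529f792f158ba9a69b8f08562291,
 ro 8 v3 8 0x1fd1e75df91a512cc4db28acba21a6e4f0,ro 12 v4 7 0x6bf993e753ab749de5b401ae8533d11f2]⟩,
 ⟨2,[
 ro 14 v0 9 0xceee16a64dd53453d8297d98993f672d1bff238484d3,ro 18 v5 14 0x1842bb2ae54cb9990426eea888e93a6e2e36e9510db53eed9511208d278bf09510c98874]⟩,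
 ⟨4,[
 ro 14 v0 10 0x623014721ac2dc276739ca9e7ac87788d61af3322c456e613,ro 18 v6 15 0x3f1a5d09357aa9d452ea6029321bf5e30e6fe21b83f30efe7ff62dbfe2793ba48ce7f6533]⟩,
 ⟨6,[
 ro 24 v0 8 0x1ac15c3ae33334a95c84fce4625d9c846d538f33,ro 32 v7 7 0x197a5d10066a4a54850272945943b52b29f34]⟩]⟩
def oN5 : Ob := ⟨2, 0, 8, [(2, 4), (5, 2)], [
 ⟨0,[
 ro 0 v0 6 0x1ae3968b0c1a5472d8fa03bb30,ro 4 v1 12 0x19ab54c334daaf1c6edc90acb0c1890e2b5b93adef88e79e90,ro 4 v2 13 0x296c2e1a093c8e3b41d5c315447f514414dfb3709d87a6636441dcff1,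
 ro 8 v3 9 0x1a1374e512e4cdc7d3f769dc0b3d7291af22b0,ro 12 v4 8 0x1e7611b1f5c053b554ce8c01f1b9cb9230]⟩,
 ⟨2,[
 ro 14 v0 11 0x61722b5deb7d88ec25cf5ff25ffdff9702fcb6ad11070b0ceb2,ro 18 v5 16 0x1c4d9c72650eb44706af0a24103eef853b54567c739fbd142e3862511d2c0720ee9cad9bf2]⟩,
 ⟨4,[
 ro 14 v0 12 0x1bd927e1f610b5991317b9805bcf6621fdb8cbf631b93fb55bbb1,ro 18 v6 17 0x3feb712e37d06274431ad3409484ebd8b1e0c4ce5b96b5eb26a22ba301337e46b1d7a17d51]⟩,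
 ⟨6,[
 ro 24 v0 9 0xc0462f3595a493381e37390ec5629ffa842a086acdf3,ro 32 v7 8 0x1c38e676c1c12dc5f72167e421339b76ed588433]⟩]⟩
def oN6 : Ob := ⟨2, 0, 0x2118513, [(2, 4), (5, 3)], [
 ⟨0,[
 ro 0 v0 7 0x98b6b7c9dc4c8e27e3c48b71f161e11,ro 4 v1 14 0x6cc62ac95230b6b0f767cc2c5e146028264347219c92a48af8436f,ro 4 v2 15 0x179017210f184aa2e984c706cfd08e308c662666b03a5311349d4bbe382a10,
 ro 8 v3 10 0x14cce95107670bb6937c0b3f0cd352188db48e58f0,ro 12 v4 9 0x1936f04576132f5134f02f77ee3f2d706f2e10]⟩,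
 ⟨2,[
 ro 14 v0 13 0x39cdaf4929850f2e29ff5318df5988b120e26fac55f8b57a84c8bedd1,ro 18 v5 18 0x7c432c33b41d19e2bb4bee4fbcfa016dafdf9cc8860f1126b5241d3dc844e0be7f5c285a9cab31]⟩,
 ⟨4,[
 ro 14 v0 14 0x5c39a12bc20dfb69dac2fa28770d7c7bd3c9a19e65695e98ad8cb1d628b91,ro 18 v6 19 0x605930083c8fcd2d8cc10ed1f2f38b68e331bfa2cc472490eefc4040abd10d042e98ff76c0754d31fbc98f2]⟩,
 ⟨6,[
 ro 24 v0 10 0x1ac6eb954cb878beffd3fc9a5b770ff0c09bb1cc2462e72,ro 32 v7 9 0xc56072a22a817ab4a5e67636df332130bc3af759df53]⟩]⟩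
def oN7 : Ob := ⟨3, 0, 4, [(2, 4), (4, 6)], [
 ⟨0,[
 ro 0 v0 8 0x11a805c918bdde782e14f6c5b38b2c63568957d3,ro 4 v1 16 0x127acc35c4f1cb3a21f348f34decf4713c323918650a73b2c039bfaf5ed5dad067f1bdd532,
 ro 4 v2 17 0x9fd1cf8fdd540043a5075c791c96a48163922e8986f17a2a2925e5e1e6fd4b40c7a7db131a437e1bb3,ro 4 v8 18 0x135f547bcaf4292ece32356c34a2cbaece776e29d3bb3afddcc80d5e11aca7cd7d7bbc81ea57ad93bd2,
 ro 7 v9 2 0x1d52ab62b1f4,ro 8 v3 11 0x634f4f95abf6715194c8b26a587c3a892582c719b5aaf3ef192,ro 8 v10 12 0x1a3e443586db79c9e80f65ac1cf95e584abd90b97465934600d8f0d2,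
 ro 8 v11 13 0xc00e519af1dcf5c95ec783e91effa2d04395aba2d2b16bb22a204dd9da09af3,ro 11 v12 4 0x1b99ba4036e4d8dbecb2,ro 11 v13 5 0x6f54163c92ba4f64f6e69252,
 ro 12 v4 10 0x50c96726b6f992b0847be44d72050d9fc9fd6a4e1536f4233,ro 12 v14 11 0x632173508c22871c864594ea752cfb02ea7a7196125f7c38612,
 ro 12 v15 12 0x15b0f5dbb734ed5d88d638d54e5270ea5e6afb9c450673433b440cd2]⟩,
 ⟨2,[
 ro 14 v0 15 0x323f0c508808b58a9c55809bcffd3a1f06f7f0dbe6037dfd919f6daf06c93a2f19f5599b3,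
 ro 18 v5 20 0x1da5ce7122b6a9272c34eaca5973c3e912871ef2893610b0b7e9ca4cef0803a1b71b52f283b2d024cb17c84d7c07bd553,
 ro 18 v16 21 0xd6de11ad81e94e498d39432f03b59faa6b7cab7577ac4751fcbab6f3a6c53518e2e3eccbf03c7c895a63fe2af747c18960e73,ro 21 v9 6 0x1ef4250b0eabaf5ab377cf3fbd549c34,
 ro 22 v20 5 0x60f2edebb5925ee7d0515ed2]⟩,
 ⟨4,[
 ro 14 v0 16 0x1e452e48404bdaa59fed92e1a9fcadc1c254840a8e8d8ab4488b9b70151c1e2914a93f5a991173,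
 ro 18 v6 22 0x18f931056ad1e8e8f971512930fe280fe0151944f3aac30b4ff07c4b065ad0a0f0d7e7ce7e8eceb85165c9604f1033bd01354edce5003bf4,
 ro 18 v17 23 0x18538b4636aeefe33246515fe5033874aa8d2eadf25e00ed676e2144f07e4eb720f57c143cc70ac24fcabd35a4942eccef9b53780af7e9f08d134,ro 21 v9 7 0xc8c42c3036634129403c284b58d4385e095495,
 ro 22 v21 6 0x1d431bcc5a3112b1bcdbd93421df2]⟩,
 ⟨8,[
 ro 14 v0 17 0x147522d3bfede6e100f3edf7113099b0ae41521ad34fed2aec8e2ca348325908472c6f72e1052019ef90df4,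
 ro 18 v18 24 0x141598fc2cf02a85047490aec0fe6cf0ddfcf93cd12c8d039b2fa9d6efca10b8b336e4f27a1d0e61ee9219a6d8d1414f06dacf63c4f9edaf7c690a5f94,
 ro 18 v19 25 0x18ccef28384cbcff16ca33e76ef974530777095210bccad9c6f10ccb04838f32a9108aaf879d6353924dff80bcb2cad1022874d120f81a8fe7ecdae28fe4f74,
 ro 21 v9 8 0x18518278d2e4d8c467fd71206dab8657c05c9209f355,ro 22 v22 7 0x62e4f1c17a9ea94b6d7bb847f305b2272]⟩,
 ⟨6,[
 ro 24 v0 11 0x3d2a4a7ed9804e3be7676fe9410caa4988e31de36a2ed6136489d3,ro 28 v23 6 0x19e90109efafdc00d03d90fd4d4b0f54,ro 31 v9 5 0x31af5ef19bc8c5693fd9de8201f5,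
 ro 32 v7 10 0x6149a5975dee62fe8b8e1c1abf62341af7774804fbd243d1e4e335]⟩,
 ⟨10,[
 ro 24 v0 12 0x1947e14f35f12732e0d62e2f40fc618dd980f6ff6e96d34a57f1b0e1021c54,ro 28 v24 7 0x1aeb23422bed2770f495f263f3cc9fd09e0b4,ro 31 v9 6 0x54d315e217af98b99a1b8f77bb62b1775,
 ro 32 v26 11 0x1ac3671c1f94a506d876ecc7e922bfb273972cee1b5f36fd948c04754]⟩,
 ⟨12,[
 ro 24 v0 13 0x1c52851c2130e09d0987d6de5b26a3331990dd6495ba41b1bad1a73ef38291a92b4,ro 28 v25 8 0x1a6992fc45d276f10574b7aa63dcc13083831cb2d4,ro 31 v9 7 0xbbb24ba6d11c121d1bc51d1229419c3de463d5,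
 ro 32 v27 12 0x1a476274fb4c7fbaa1ffeb152b48f20c2cc2ca520eb8bb0e79048dc7e359a6155]⟩,
 ⟨14,[
 ro 36 v0 2 0x16a779a60c74,ro 40 v28 4 0x1829358c99a435fc6b19cd5,ro 40 v29 5 0x1944ef8eb711427bc5d9b549ff4,ro 47 v9 3 0xcea0f3fd71af94e35]⟩]⟩
def oN8 : Ob := ⟨3, 0, 0x20000c, [(2, 4), (5, 6)], [
 ⟨0,[
 ro 0 v0 9 0xbd06b12a914225e3e79c80caa564e1a442246748eff3,ro 4 v1 19 0x55ffab1f367602e319c01518281362a7237f1b70ae000447a59a7454a7ac6ef29f6b4a3f46563446a3f0452,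
 ro 4 v2 20 0x1345262ecfc5e3b63fcf0bf0668d6baf7d612b0f2cd0ecd0bdb136dd4cd5bc568c25690583de13fa8234023ad71971093,
 ro 4 v8 21 0x9476746d1df94747ccc86f14f7708c2f9a5d3950384c2e70e7a44ea36640e9117525878438b788f50db5560c91bccdd793b53,ro 7 v9 3 0xc3055bc2751f41db5,
 ro 8 v3 14 0x16f79d6f714413dec17058650a4d935c302639c1ed8ba30fb9cef6b4d58c0b472,ro 8 v10 15 0x5cd7f2ed83bbd76683df4b101445a9fd5cbe523f54e1a50ceaddffe4e58b71358bc72,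
 ro 8 v11 16 0x1c0a7ad02fb41e2d445c5da29a233799677617aed2ea24cc0965303768e65f648c2dc31452,ro 11 v12 6 0x18c08509a01012011318d06844fef074,ro 11 v13 7 0x14426f8119d0bb3b0219f2c01106153016ef4,
 ro 12 v4 13 0xd951da20ea05bcbb4145218111d4187662f2866363ceebd2019fbe3767f5a13,ro 12 v14 14 0x1312dec4abaafa54df93a57babed143f4803f24d0b467f0a826bca4892843ff52,
 ro 12 v15 15 0x6859cfacd9a2cef25826abb88e8e0412e83ec9af4d135440e718786f3d06ebac376b2]⟩,
 ⟨2,[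
 ro 14 v0 18 0x1a85d34047efd68d6e44ac34909dfed19d7d4a736ffc02d30a4f7089720a0ca68515514d600ca80110bbef212394,
 ro 18 v5 26 0x1af50128914fb9935ebb71979f1056314082e99eeabf98ecf7f55e353fa910b6b501f1708eb51cff91a54a8f0f90696eeeec512ccadc883150e901e22eaaf4d468f4,
 ro 18 v16 27 0x1b0a5f767a6f530501f53360bce2deb04de991add10ab0c6c06cfc0f6002af518d547a924d5d9f78f05f330b14103b5310430fe67cee1c50121d4599aa62ecfa1c33f5c74,
 ro 21 v9 9 0x3a87b6ac5eb59e1dbf03823085319d49940c9c11f46573595,ro 22 v20 8 0x1ff565cf3c58d36bd7e6eef05d0703fd3b9fbcd3]⟩,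
 ⟨4,[
 ro 14 v0 19 0x1cc10325e991dbf6e8442c9ee6f95b103c83343c2ff20ede1058950cdf564f9ec8a39d965e21220d8f5e2103e4d08ac34,
 ro 18 v6 28 0x1a6a9e2958759ccb15c9386ea8dd9b749aa26513096ebaae148aa6936d3c13dae6a9c98166476b41861b0c9a1085edb8da77d6039cec5071b14d959ce7a9a8d1972a3d3,
 ro 18 v17 29 0x1a1a0941916cf15170f94fc4691c0712f73ad855f023f6fd93f3da010eaf907eaf1e72c984ab40c26dff9cc8d3ef12b6e2286acc84eb6852f88b06eef1dfbec90ff17adae0998f55934,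
 ro 21 v9 10 0x6ecd4d094053ff066cc6743d22611b9d067a056396d13c0216bfb5,ro 22 v21 9 0xc57ab7cd5a5864dc82cad29f2f9dd83d0ad07a589bb3]⟩,
 ⟨8,[
 ro 14 v0 20 0x172bf759e73cf164f65d0e11eb73fc7cf322aa5dd76d7aacd0e2d18579a2269fe87c3b7228d08206b9b223337f660ba13,
 ro 18 v18 30 0x5f7d16a3af5d5ba4ad83ddd9a8c3968b9121aa4eaf3b8b4eec879d7702f0b68c776fca114a53a3596c8c652a3f9f608c67a869c37165a19aae65d8f4d75b0d80e48d6dfa7671e313,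
 ro 18 v19 31 0x149985736d8fae7add3d4ebc750cf2119d077639b3743ceb65f543370d016fa7d9171cadadf705bcc70fa0fed58f5ef12317ee08a51c5d4f824ef620f280211c0eb19966f05951363b3e2b0d591f4,
 ro 21 v9 11 0x6980d4bb4c8c6452edbb25b98c43014ab43ff30fa48a4472ef228bac3d03b6,ro 22 v22 10 0x19ca6d8ddd1db0797737706284d87fb7b29ccaeb63d9872]⟩,
 ⟨6,[
 ro 24 v0 14 0x1d6d2d00f2d4723cc0691005cb5bbc0ef8c2edab35de08d573501e692f4e936b4ada45b4,ro 28 v23 9 0x354d92e4df289e4040ff621c649280b481817473e26344c55,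
 ro 31 v9 8 0x1bb2b541b0b29ca06c6df7d0920840614d22aa7c95c716,ro 32 v7 13 0x38ec594d400a8e1137ad19074eb480c38d8fe41829500e3f097566d34e3ef9896144f5]⟩,
 ⟨10,[
 ro 24 v0 15 0xc3dbfc9fcc5fdbb7056bb899d5b984ea3fa0f4add49bab54227f9b4f64b7abc9f15e37c40e7273d5,ro 28 v24 10 0x653986615610cd736538c43dba63ab2926b507a3f63b3c423d9cf5,
 ro 31 v9 9 0x3d219c4dfdf65951329b7e20ae901ad354a6c3c5579afa535,ro 32 v26 14 0x78f50ebbc912933f824cdd76aa5af0b6ad1a1a9cd2d7de8580ecf637839bc0aad6639fe39b5]⟩,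
 ⟨12,[
 ro 24 v0 16 0x190ee386494c78ff9d8bfb035817382350dd79eb3752ac0e7b1542d0c41cdfcf2014e7f739c7961dfa04d5,ro 28 v25 11 0xb829f6ba92a47b9cfc7657e2163d06e974cf2e9e226f5f63c5395fe54d5,
 ro 31 v9 10 0x68b6acd39b725a057bdcd3cd64e8ebe90fbd1806bcc6fc69dcef95,ro 32 v27 15 0xce699b604a62a250bb1a684b62363c7d8bc7b002d796bcd411311a3bb8ec6f07285cd047ddb6b1d5]⟩,
 ⟨14,[
 ro 36 v0 3 0x1e3e9d65cd71bff94,ro 40 v28 6 0x79ed5a63254d378c81347ad56e9d41715,ro 40 v29 7 0xd42293bff229b188f2f0b8cbb631ceb5b368b5,ro 47 v9 4 0x1f1dee7493f4282b212ec75]⟩]⟩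
def oN9 : Ob := ⟨3, 0, 0x243000c, [(2, 4), (6, 2)], [
 ⟨0,[
 ro 0 v0 10 0x4b547658d2da2b63b32bedd56083900a64de3fb47c997d5f3,ro 4 v1 22 0x13233bce9125bdbf6f90aa22270502b053db67dd5c91f3263e2028be229bb3be59db1d808644472a962db30a1a6f6771cfed2,
 ro 4 v2 23 0x4eb03393f3277ad3e9cfdb069812ce232b6279ea26d1e5f471da59407f98f9e44c6c73fea7f18f4693e630c8273574a94cb264752,
 ro 4 v8 24 0x136523a4a6f543ba400f8b135d39412db3bff0181bccbb2902ba2799eacd26574259c7558e2d8d1a967a88579e53f939476d2898a6e272,ro 7 v9 4 0x1936ee73a8e2fe175c423d5,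
 ro 8 v3 17 0x7d0d16baf257fd86e207cdadbd64541c79e62221aeb52c63610fa421f7eae56ba45075b49af1d2,ro 8 v10 18 0x163d4e6034ee0dd32b90338d380731991a1327d649f6f2700f3e29ee1a7b8efb731d4b54cbf754366b2,
 ro 8 v11 19 0x4e0b34147e8aab09b34d7991362b31dcbdf1af4047bba871f8eb78bd3771cc451a54d8cf2cf891d0b32ea72,ro 11 v12 8 0x181ba4cd8543eef5581f670a9e3d8bea2080a513,
 ro 11 v13 9 0x8fe330690955babddcf5500d86f7e5c0acd4b398c353,ro 12 v4 16 0x151ee33a14c34dc3c2cd77b8f1fe2e80aac56a8f4ba1acda8cbde3409539a38e61d2935bf2,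
 ro 12 v14 17 0x4dd6323df3b2a6e513bae14bda0157b0d8dc519822afff842d2c0dd91d2fe9e3d4ebaaf430ca32,ro 12 v15 18 0x182bdbef951bc55dddf1870c2345a35ed59a722d46f046f0c55d0434d27b235ed283f90270d023edfd2]⟩,
 ⟨2,[
 ro 14 v0 21 0x128d98eeec302c210ec0335bd670e90ca6bea65ced6758fd6cac2744cf06d0d0f715ed1130b6d91dd12f26bb39294063587227f9db4,
 ro 18 v5 32 0x1adc1880918e26bd1c12ed1240ef1a8c51914fda3584c89f7badad5d3c56cea7d51595f044f49374eed4cb1e710cea4501497115e914c38f50b8d06f4ebab8e9ff6b0922ddc3924e9c8c860efce2b41e54,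
 ro 18 v16 33 0xb17e3a4e6c9087cd1c770ab9153af26521b35ed27f1eb41e3738171ea8851b0eb99be10381519b26d1b0716ad3bb310755baa5e963f1627035803e14bf40f9d1431400b9acebfa209115237f853793,
 ro 21 v9 12 0x1882e8427e1d22133c8261126e53b27df0ee82c3645af37f48c606fae8483bc28376,ro 22 v20 11 0x3a9b4e67cd5d35cade6dd3e4a20959389cf53d92b082033969e613]⟩,
 ⟨4,[
 ro 14 v0 22 0x565554a15f556ea8bb0c00941964b6aecffb30dd02bb2ad912f8e3e858c67b28dd2deb29fa7fb748c0f074247a196723a8b86b6213,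
 ro 18 v6 34 0x13f47aeaee900ff533c2ef3b4af3ff8bb6a6c3bd1053de8f678f43f54e54b15312ed46d09032b6980c9bad473150a3c6da4cb092e12b2f4ce339472aec49771a898a6e3cca792b1f42642d10b7f0e63766f80f209834,
 ro 18 v17 35 0x132fc13950b03d1527315123d6f4193430dcb7a8cec4d4f76b908fd298f8317a08b340917d30ebcb6be81ef223f18748e1f06f783f0d6df33daaedf9904aa8f3ad31d86f1f8583ea3c9a8a0f1236da11107358f2b47123714,
 ro 21 v9 13 0x3587d90aeb39f70345e1fa1c55cae43f776beb41605e4b58e4ad832430bf5a4e970a55,ro 22 v21 12 0x194396c02442f0b8fbf8dd145d520ab4ea9ddab33d316823f50ad718f73]⟩,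
 ⟨8,[
 ro 14 v0 23 0x25e24c3e407bd910f1d2e4ccce2c8a2297061a8eae5c486eca831bfcda93ed252c558a10ed6f1e4ec3f4866bc82d8830fe492c875b8f0d3,
 ro 18 v18 36 0x1865bd3edba71a77054ce31162cb03de6085086c0b266642c3513936a6d1d7acef1cfd1f72e787e725a4b5a4c76b3478d695d58ecb07ac72f894adb2321127a574b858f1388fc1dd571b7d28b20d8cadad36e79afc113,
 ro 18 v19 37 0x11cf47109aaf3156fffeb09902efea3047ad10c4d213c8f994cd8686ca4070685316a3b0494d07e0671ff2c70850859cbc2a2f170aee49ed8eeb1540501641268b8ebb64e8c5b0077114de4ca7fb006c2fd372be4ab0ef72d96091a30b4,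
 ro 21 v9 14 0x673636343cd1bfce6f000b2cbe5e64a73bb766f3a71e5a8626f52ed90e8630cc03ead960ff5,ro 22 v22 13 0xc84e15b041e15733cf68d994be0158a34c873c857b4ce13de5ff43c6d64b093]⟩,
 ⟨6,[
 ro 24 v0 17 0x2dd39f3831963da63da250c62a4dad019b2a3b7aa91a2e48bd8b67d1ff49cf79da48cddc848308234102d89ca75,ro 28 v23 12 0x188bdebd13d2b0369fadc517ea593a89346c05eb3a518d00309b8c3eff64d58f5,
 ro 31 v9 11 0x69ff3531b123e3ffcfdf7b25da6d2986fc3a8e725c221ef5070dc53b87be56,ro 32 v7 16 0x1d334371594a941ca24fd6d9714925b2b58b3d5a29d0b97f771d54ffe96608d26bb137c83e1a39b95ccc15]⟩,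
 ⟨10,[
 ro 24 v0 18 0x19ab58f27b4ec1a31fa51002cb2aebd0b3ca52274efd74dde30b2bd108e7309b34dc0731535af910a900e54c5f34,ro 28 v24 13 0x3431794957569d01489c5e17c7f181bd70d6d2895f61017b269059564538999da541b5,
 ro 31 v9 12 0x1ffef79fb244dc6a9f52b70302180ddcce59d13bf0a4c66772fdfacc27d6add15,ro 32 v26 17 0x189408e8ec4ebcb101412c051c830f70f7352fdbedf78104429a378a82351de992d0c0aded63c8346e0b5f4]⟩,
 ⟨12,[
 ro 24 v0 19 0x3f9af41bb7a995b5a14a72652bc5c8c3928e4adde602247d8994f640521540d94f5561ad3df49aa94b019428a473,ro 28 v25 14 0x1deeb33576ad22b13eadaccfc30a5c12e88a4d4b6b9a0ed1976d2504e09e65a92b51b814,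
 ro 31 v9 13 0x51c324ffd8cbbc7df27a35c2bedf29b5ebe56faed896c6708b0ceeab76d6e64aed3d9f236,
 ro 32 v27 18 0x4e69e21bdb31aca46e529ba641e88176f6480c5d1bbc7a5a939850b75876aa6415c5e26c251a946b2904ccb3d65ada55]⟩,
 ⟨14,[
 ro 36 v0 4 0x168f7ea610031b598b843b5,ro 40 v28 8 0x1caee161f47b552fda319f094295b2760eec05eab915,ro 40 v29 9 0x36a8973e75f515b1b6594a3f399523d44af142effa67369b5,
 ro 47 v9 5 0x60a480fa209afdaa0cf38f32ca656]⟩]⟩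
def oN10 : Ob := ⟨3, 0, 0x2430004, [(2, 4), (6, 3)], [
 ⟨0,[
 ro 0 v0 11 0x46edeaddbc30d5130c4a7e6959bbdef36f09b0c281f7523a832,
 ro 4 v1 25 0x84184fda85f3fabaaee84ffcef2c1e3c341c6e89ad2fb1a1dd3bca5d980094b91c6782c258d19ca7d12f19d36cab63b242d3349dd526738c42669193,
 ro 4 v2 26 0x433b7859def06f608d4bacbf8f216f917de533bfdfe949f8f5d756d5a3ea4d6c85a9bfd29e5c09843856f7397953f379f80871f7e97259b6572ea3c804fd3,
 ro 4 v8 27 0x211ab40fe882434e6192284bc24f085e52feee22c54b420e91078fa535d7a8b396783838c0b5dd451a96df7cb4cf9631394a3acbb74f8ee4100c1e7bbe3c988133,ro 7 v9 5 0x186c8db86bf04d0edc937670454,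
 ro 8 v3 20 0x12290c11fb36e939202ac3a5104ec322cbceec3f53e21ca380a6c28e2141f2b130933d3664455300b037dca97bd2,
 ro 8 v10 21 0x85c0109db9df974278e893aef3c9e0e52bf75777dcefe5e62083b64d58a282d95d18c9fa9aa582b0703464fbc3258f28d9213,
 ro 8 v11 22 0x43aa7817870943dfda0be58d884c72177dadb8c36b56f8f2facf5d7833aec16e50b261518e46c027d736b6d80ea055988878897773,ro 11 v12 10 0x4af93786dd2aab1141e48a586843d460765681cf05f289453,
 ro 11 v13 11 0x482af15fc37eafddb119bfef3993cb2b56a443f1fec26179d72,ro 12 v4 19 0x228f1bdfee7e5cd11489c06539a6a75ac0edad60090ab8518e5d2d859eae7ea04c493d2d9b4b20d47b214f75afb3,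
 ro 12 v14 20 0x128d0c13e47ed347f52f116a64fcd69cbe4447cc917f6d37aca8d2119f2c9b68de7bde1d0cd23cf02162243c9952,
 ro 12 v15 21 0x85ccf05c55e8c1bc6f27dd7eda4323d3dc5f6f8907d0bdf1fcd65d9c9549ef558417f26cf0a072cbef16e19504f09006d3b13]⟩,
 ⟨2,[
 ro 14 v0 24 0x113a1d0578b1aab6d6303179c11be64f9566d331d1c1d725bcd427e752462fe4fac01730033cef9ece0e58b5b093595d9524d3519125ceb2501ad82854,
 ro 18 v5 38 0x113847055d30c0aeed1c920f4cfb1e8e4a3524666fc6092714f05f48d1ce8eff38d1f9721c071db430f92af209ef7ea4e1db6e1d69592130d89d02fab245ef1021eb2dcef80831fb40bb0bfa2a0ef8be13c396edb90d8a74f84c51563abcbef4,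
 ro 18 v16 39 0x29967c318da2a2eed9fac486ea5c78614b6bcfe4abd52de981af2c57663c0c198bac20028959ae6c633cfb5529cc60763fac2963891e38f206e05554d1b9893d5071d6dcefc319148e8d1b762b24248550752d890a653cdcc75ba766893,
 ro 21 v9 15 0x9b9bb4181d8fbb7cf848a907f6b6ef8a47501237656e59144a6b152cb5356c34d32ab81f7d1c8ed5,ro 22 v20 14 0x4e85f7a7c53d9f6b7f93e9f1a0f04bdcc5b4743bcb17edb8f3a1b0c8a3e6004d89f3]⟩,
 ⟨4,[
 ro 14 v0 25 0x10e3070be63045bce585d2dac6d015aca45b27cef5d362d37f0b95bebfee4e5a56d6402d465b08a453e4cea91d710edf6523730ffba519cd322a35d0b195014,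
 ro 18 v6 40 0x126e8de97dbbccf7a5512396a0a7fb0cd5880315bc597140b74a76edfc7e8e9b9acc055a9978cb9d267329346b56e7c1534333478548563e088d57ef106b52d5f3fc92b3105ddaa9fc6aa07354ee4973ccee28aa399d0fe41d8acbf5ab919b93,
 ro 18 v17 41 0x1153b7141e900bc2f7cd106600fe38b13862fa3fd4d237250449b3750c4c30d0492d7a53c322fc70315c2d25b9ef4e88de7a2caf751892ed42d2e3e892dd57080db14984c70e51d54abbfad41444dca84cb59b10b48ded5cebe0df5e690d33903afb044fefdcff4,
 ro 21 v9 16 0x1347d9c7066cf7f0346262ef4897c90e2ef97f23cd03ed03f140556ced056c93764db1b5c11e4e660843da9eb6,ro 22 v21 15 0x4eefaef2934b675f346e9675260addd0db78c5374f89e4bfaaec0c3350d2f39487b12]⟩,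
 ⟨8,[
 ro 14 v0 26 0x10c1c9024eaf859aef4d0f56a50b53ef499edd0e4e65a0e3d1f0d12512480f235ee8f02a1778f8ceae9c51110faf7320f58553e90ad042f1fd9e632d5523c2f9c254,
 ro 18 v18 42 0x112facfaab6f6de30216f0af64eef570395100c31187d6df0890ded122efaddfaf17ebb108e93168efee79168c102e98fe8171f4e95cbd11c490e207b24bd0faa2d267c94ac3d02c92fcca0f707536f6325632f6e60ecb8d02e96fcb93123dc701e8d12e102643100994,
 ro 18 v19 43 0x118308fe538fe7cef9de0f148b081caf6e2cc17bb2a49b402b9153a1178db04b2cfc3f906991077e7083eccffd51c4b3575e4f5230ea1c33080b219a4df7873c11aedc895933373b6d23d4b1a84301386eee2356d68fa384ca140f0f6cfb707033591dafc16f60f855d1b09d4,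
 ro 21 v9 17 0x23145eff96e70c42ddcbb5ec808f80a785d47290892017f143980846fc39a65eb53a0bc79d7f361c0692f752a75,
 ro 22 v22 16 0x12ca56207dbc92952a671a4fe09fcc01c18e90ad328a4497c09636600127e81cd4934f9b3806d3]⟩,
 ⟨6,[
 ro 24 v0 20 0x1719612a6fd0bcd2a89051b6510416b29b3b535dcfefe4e674dad713116531f9a2a318aa758a9242eadcdd07e0903c86807af4,
 ro 28 v23 15 0x1633c12e6f931456bc4c6c4a890f4331140d2355727b3ae296505b3ad68fc768d6fd5da424134,ro 31 v9 14 0x56393674fab3768cc2cad30c676496510aa9e523ef436fddf86b146170b265cbe39c50fe155,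
 ro 32 v7 19 0xa32f8b63912424c4e6e8e7f5552e3f1dd43ccecc9d7dff8c388ca44cb30f83796a0c28a9a185e239a48687feeb971597cb2b5]⟩,
 ⟨10,[
 ro 24 v0 21 0x1e6a449c0c185ef8e0318e496b1be9939aa72d22cf3987220a31e664f9dc6fa340b3a7cf94f6c5e41153ab079b16339aeed28e1d894,
 ro 28 v24 16 0x1c381b059d387dfaf6f00f71dd1c3decac7b1a8e6fd41267bbf0d5725e592cf3d702fdbbcf0b067d34,ro 31 v9 15 0xdff8ac030296ded92863480b2a358ae2080e49fb767470b36e38a02c830f8d683a2f3141061dfed5,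
 ro 32 v26 20 0x16146d4b78d65eedbeac108e753159f574dd5c346f6379c9f9d04271307370454e9fc913fb5afbac73ea76371f4cc052cc39f4]⟩,
 ⟨12,[
 ro 24 v0 22 0x44511dd0148d705d7bb7848261dd0993365b286c74beecc629fc715e744d0bfb642dd752b71b31b84d3c36119695fa0e312a8e791674f5e3078b5,
 ro 28 v25 17 0x185d7ae5420b5deaf7d055e2312957eba17d45e1d468bf02834ae9e33fbd10b1292afe113fa116aabb799f4,
 ro 31 v9 16 0x166d2c8832a3a4a79f41bc8794c8cb5143b17e500e6e2e1b5294fc1c1c5993494de83994393ee158c1fe75,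
 ro 32 v27 21 0x22b10d1a71f8223b49eefab213533b6e31a573e32c153b65566588ca3e4286fe1824f22f8cdfb553576c21b094c4f417847c028499ed2e35]⟩,
 ⟨14,[
 ro 36 v0 5 0x170540b09d4e8d9ba0044bb2934,ro 40 v28 10 0x5aca89805e6f5c7170224c2ec1e15642de61799c9c3fd0a3022095,ro 40 v29 11 0x1a349d53b9cb5b50a0a030682ec7283910b4dee5f6e0c6894bf655f14,
 ro 47 v9 6 0x50ceb2696e6e7c625d3be315cdb3338d5]⟩]⟩
def oN11 : Ob := ⟨3, 0, 5, [(2, 4), (6, 4)], [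
 ⟨0,[
 ro 0 v0 12 0x10dfe9fe5c4179f47c12ed486ef8eabe2a4a0bb1b49da209e9579693073,
 ro 4 v1 28 0x111b31fe15bca7d785c712289d8fb3f6fe7de1ed897160cf5316f652fefa2b1894b42716a8d8f291272f897ae3f5eafca918b9dfbaeef581544aed6d5f61429b937b933,
 ro 4 v2 29 0x85986ff31dffd2be4a77e77f0250e02b84375f6b70acc41e0708b811079b7506af733d1d8533a86796708e938f4aeec761a4c5a85ade7373989064904cf19f6135f36823e33,
 ro 8 v3 23 0x23df63ffdf7f63ee5b96208abe592975b2c8eda2e4fa9a318b0310e1e1eb5046abe387b28b42189a74948572614944b09fbc621ec6083b3,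
 ro 8 v10 24 0x10d24a0a38bca6487b3af882e0406bf64686c02ff0be398d35fc25bdcd2ed919e7f41dad8c1ca4b8022625aaf6aa2272b6ab5dfe7be6077bb293,
 ro 11 v12 12 0x16fc82e7637bc0b030b978606a451a2dc62070bafc48c688b2267692,ro 12 v4 22 0x11115100a46f8716fefff08312ee8d0ffb0ed4e3aff0470e5ced3a6718024d0378729392bcbedbbdae547f01ca72c598c3cf33bfd4f00ad4]⟩,
 ⟨2,[
 ro 14 v0 27 0x1185190228500bbceb4e8f8cfcf239b21f92f193be3aa0fb7dd10f44f5638935bcde5c328b650123349ca8ebf6335e46f899ad2fd26a1fb579d153fcd1b0fcf6676677d74,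
 ro 18 v5 44 0x114368fde450a904fae4af3bdf1aa8300c2310a1319a1b02c3b14792ed25efa9773a031359258a3fb31a6e6f59ee3d9d11feedd1ed1577734590d7a8444bf92378925454ee3d6cf8663b920d6fa29ed52847bd2044cd4e2a914132ec2903f6706c08cb6ad22b61b15cd1d272a4cb54,
 ro 18 v16 45 0x118b80fe57ceae3f19994edf88fa6eb25c24ed78f087bceab153f69f47f36d319d14cdf59a9d19402e2be14f8e346c52d531f0f744a3b209cefb0d0f737e0afdae1d71274afda7eb085aaf4a5cb0d23247b18af8aa547be63655991037447130316ec1a66e534713f17086171a416db1f14,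
 ro 21 v9 18 0x62c009fc410a49d17353db7d8cdc341ee83bf81b176b692373570ddcd944eeaa6e46670eb1ae0714c12ab0269abcf9f5,
 ro 22 v20 17 0xcae491368e9a6fbc456686199a729c21bbd363cc9c414ae5066b6a4c1950376fdca4c8036f04980333]⟩,
 ⟨4,[
 ro 14 v0 28 0x10ab45087af00764fbdccfb97b008d8fa4491cacad298ac20332d9113dcdeac10ae030ebf50b113209c5a318cd6bfc310ff06e3122f5f3cc329f1eecf8c2c700abcace9d2d8bf4,
 ro 18 v6 46 0x1214a504df3025c910c2aea268fa666f2dc8de36100fb0db28cd90d0fc75af422126cb5270fc6136c2b0dcdcc66ff7fb2612742552a04d29228cc45ae9f7d0ad376e446b3f832c90db5715b3178f3337efc83eb90f0bb2d19bf2ab230d19994b8af8d3d2757129193c30669b0b40cc6477091194,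
 ro 22 v21 18 0x4b69097068c0e99f4a2c509a77fded68b641dec4022747eb027fd8f2337bd5853458dcb5b95b62f92845f33]⟩,
 ⟨6,[
 ro 24 v0 23 0x12758d056c50070c65108ccfe1722fd4bdefde4d42be251127ee7885588ec75297449e4f940aff83844ba4f17aaa6aa1177a4b75d39db02d4bbd4,
 ro 28 v23 18 0x56ab061b6468cc81501edc1247e397d3147b19e4292f311df722ac1d52abc0044b268d6b8d1ba4f819e0448ec97f59b5,
 ro 31 v9 17 0x53d64f879fe459cb518a27487b991c753caf5dd1bbf65b8ccd04dafcd5ed503f9cd377dd1e1ad3191e4e0e132f389b6,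
 ro 32 v7 22 0x4db519ec5591441d64147c12cb5524fd60112961c41ec5e9ab9987837d9ef1822cb8d21baf64a4556cf92edc70cf5990d2716d134d92171489bd5]⟩,
 ⟨10,[
 ro 24 v0 24 0x11f779080d6dc4ecc8d4d702672a72b9a3b92ca3f14240a13e1dc4e4f41cd5ef6b0866d60209a615ef1307275314561d04cb7611c3315791499ce2cd34,
 ro 28 v24 19 0xa1e533d43d5a1dbb4fd6a7f9c6395bdd9ec60e9e9a7da98340cc357984d1b4a8467c45a915dcf212eaef6bec538e5be4b2195]⟩,
 ⟨14,[
 ro 36 v0 6 0x49cf566a8ff186cac7ed6b9250e8a85f5,ro 40 v28 12 0x1b2fca3dfd85b89817037b3f371d0c9de2eecb99fc70055887aa227e4de6cfd95]⟩]⟩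
def oN12 : Ob := ⟨3, 0, 0x200000d, [(2, 4), (6, 5)], [
 ⟨0,[
 ro 0 v0 13 0x44390e84dbf33315f2d2664eefca5ee9213e4825aea20ad51c18b5d8a712,
 ro 4 v1 30 0x117e93e622eef24184307383f1171026414b4f483bc72cd87ec89ba98d3cb866fb5dd449f0dd4476fd10b5b34c0a32750255b78fdcca01d95fccbe7d54353e30c249accd2,
 ro 4 v2 31 0x427e50208bb138fcd7415d10859c2136fc60beaccf204c3870ff8ac2636e8a93b42f03a84268acd1c3d5f0afbebb49a52e9edad4fa8c3d894c8b02c602b0404a69486aac6f4b2,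
 ro 8 v3 25 0x4c39303d746e4b008dc16b4fbcac6c4b49966a71aec40c818784a49daf13d105c5ae181f8ef02fae40a4efa5615d66f6021418dd115e1f3432,
 ro 8 v10 26 0x10f72c54a4ff5946ba6f2e544254f559c4c011780d5cb6f93a4ee4b398733e06de515ba1ce1cf2ab9cf8f40ea16dd0367abf17eac634f215bb63f52,
 ro 11 v12 13 0x4c1fafb06c16659d8222fffb345c00bd274a388e0c4f94a5b4dc1ad91b72,ro 12 v4 23 0x47c92e8af3d62714ca49856bb69c2932f2a8a208ae46d3060ad3e5e1352671bf389ed2c6a8eecf7f2277a62d2ec1f1cb20c2422f2]⟩,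
 ⟨2,[
 ro 14 v0 29 0x8cb430fef9bbfbbcb6a7d4171fb163cd547dfd60a0530db8d376a645c822864f2553a945d6b8d78ed45d70f54535eea87f055c1fd9f73cfc185940299b7211a2d3f51a30d53,
 ro 18 v5 47 0x2393ec0460856f0ed13e1f6f3f5be813290b4419e7b40c2f6dd98f1bce297040ff9952eac525e6a1fbe088c11b8fdda91be262488b865f941016e9bb30b798376a739d567ab10f7af65f2a19b33f6d5e3a9bed50fe42191eb9b9949904840d9aa8e2f5a28facad9d354696b5a7c239213,
 ro 18 v16 48 0x1155360918426967d55afab99e43f4ae7f75638e7ffe7c16c9fbe92c7d1f9c216c9612ef535a553982c2bc33e35993511aaf694301d70fc49db3977686f0c99ce2b8030d896566a221b57d3a14ffc26fd83becd61b116c245bfc4499e441a5310831d3eed1835885ce9907e004644c6c57fef3,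
 ro 21 v9 19 0x8f703b0f6f5dfb88c19019662a303fd9a1932e1e267f482bfbec5fb2aec1b6f8991a1ed281c2ef558c0f6560d424c52237055,
 ro 22 v20 19 0x47dd6fea161edf2c3155497307ead1f9675f50934d9e9da8c264721808596f528bd7558bd1ede0267f23a12]⟩,
 ⟨4,[
 ro 18 v6 49 0x87e9cfeb1602d0bab2c830370241dcad6446de7f5230881232213b4938ba31212a9fcc23508476e64fadc24860d64436a81f3ce6248dbb17e88b6250be0b076e47136781d5020da2445552a13f42eec56ecb3447b2060d82ed191235f034a87fe20b2ffe21f91b5115b2db021ddf387a0e9271f0d3,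
 ro 21 v9 20 0x138e63569f84bd6d4a115b4ea0b25da47f3b537ab515bf42db6d259cf556f60bda84524ec621461c2fc3f4d118afa34f000014]⟩,
 ⟨6,[
 ro 24 v0 25 0x11d29703028f6b48e1715150f57608536d0efdc72c4d88959ed178fd86ebe939b70357ee69294d020db5eca8b16ebf86bf3ff068ed1826ad8f92a49ecacfd54,
 ro 28 v23 20 0x13e6c2be21cf27e50c7fb049bd1d06d3dacedf302b7b8caec8119d64fa395433834c67031089202452e05a71b48ff791353774,
 ro 31 v9 18 0x5a45e2663574e2f69c07bc8eb4ed541142df4ae3104661562ad40f57697f2593278c4cce492f2b5bdb2a40ad4a5c2c75,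
 ro 32 v7 23 0x12b5bcc3c1b19b9cf09f96b76af5c3992a947a5353ff0c9bfad37ca7456b925b6a42e573635f10a597e0d7e18516b4dc30e06d8f3a73518acf994]⟩,
 ⟨10,[
 ro 24 v0 26 0x4c7287af9f05811d6903cc4f5f6eb700fabbe4e18c591a6712912948d4a7b5463bdc1576d955c96249f0eceb1f64f2f3d2f2b64bd0cb9e4f48caf035e0213,
 ro 28 v24 21 0x11c00afa95104d7cd61db0fe6baa370cbb1102df911d7701e2eff6b3006b8db272f3975341d54438cfd21ae71e702c77256c9044fb4]⟩,
 ⟨14,[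
 ro 40 v28 13 0x1e74e70dea10b48144462e0e6f20dc4d80f31ea392fb59563e308a8515f910e10f4,ro 47 v9 7 0x12111dbf21d1fa82d46498e9e1057532e9974]⟩]⟩
def oN13 : Ob := ⟨4, 0, 6, [(2, 4), (6, 8)], [
 ⟨0,[
 ro 0 v0 14 0x1018f0fcea4ff56af9caef79e4f58af01a4706b72eaf74efe910c591019ff2d580192f74,ro 3 v0 1 0x1f577d4,
 ro 4 v1 32 0x1029317fd3cbf1f0a010f4fcd1a7f7a1404889fc5b8f8a9e845b83fbab20b8aefc49e7f87dbe689a0dbb2fed3276a333977da09128e780a88f8934369dea8a8f211b86940bd1d3e6e0f6fc82b86e41b5d2e8b55b95,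
 ro 4 v2 33 0x20138b022ad7ea553fb309ff856ff76a804183f2b51efb75033297ec3a3e7f1207d3ef55057bb95c171362dadefacb06a9d1c1c9460e94effcf88533ac3dc59c76d7270bea1f7dbd1a0a57e090fb5d858d7956681cb3155,
 ro 7 v1 6 0x582f395027f313fdc640d92fd0e0ad275,ro 7 v2 7 0x9f9b929b728f16df63737c191416dc0ddcf075,
 ro 8 v3 27 0x82cc4bfe035ea216fcffd748d6bf478e0e8f1186f87470742fe0a0754ce74b978b733a2835ea3406c12a7abcb334e6628894da229819dcb2b43db93570b4229f2ab361e8d343c15,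
 ro 8 v10 28 0x1075b30828afce5eea232fa9a2d73390d84d07b1b2b6ece48a32b8910fa8cdb720fdf6cb5168d950236c8a8c91c7906af8940c4e45277349f1b0cae510abbb4b45ac7f512d1034,
 ro 8 v11 29 0x20161cfd656835a3bfd999eeaaefd30e756713d923a0f6e71d62670362c4ced2490fede2e06f50fc291aa0fe04471a69a580af737dfdb74e715e71e2932bb0db3d34e8e88a2af3bf9e4247e135,
 ro 11 v3 14 0x1750feb0d850d868f2eea1a155727d8ef5a264def3f6b5ccaae0fe7938292fdc1e6391f4,ro 11 v10 15 0x111dfd09e38cc6bf094c90b52a845a549f548e6aa75f6d53f21320fa6d6c8a5b7b536b82850f4,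
 ro 11 v11 16 0x113066ffd3159548bfd20dd31d0a6086924d32f4ec18ac1e7eb5b09ba3e3e4a0ac8c002f94b889a314,
 ro 12 v4 24 0x10d40f7c060bfab61f36d307c8e8087a3f2286223a10037b71a69c1021df2baade663868e93e1cae55698f18d66791840726dfac42d58028460746fa04a528d5,
 ro 12 v15 25 0x105726dc67310c96fb8d11227cede0ee9700f95b0ed1fce210b7471b16840ba890f842ec904b85b6edc7f4e6f17499f780ef6e3b394e2bd260506af8f01ed34]⟩,
 ⟨2,[
 ro 14 v0 30 0x101ec9bf4b46fe7b1bfb5eefebc340360efd46cbecca6f9c743fe7a2fb15dbc9bace41143b2e6113f243d904d09052c1e4ceeddf0bebe2b0018444db42f6fc63fd6eb0bb3cb3f3af041423b0e90fc36715c4e96,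
 ro 17 v0 1 0x6eb9656,
 ro 18 v5 50 0x107ac03f64a503a7bc0895d003fec047a8ff566c00ff50c63bbeeae0fb863420ed302a3f407e96f351dc64dfd2b2b8bdd1c501662c94182fa17c4311cb04411cd79e6da44fbdd886e8fd1bd0e94f748c3c8f8514656bfdcdd0163b3d347cf70c33cdbb0ffcc3bf0167130bb41d02ef908cc31d64d571abc2fe0f6e5b3fd14929f383e9dd30a9ee0caff16,
 ro 18 v16 51 0x87d6f468ef9fc0410ef9383529439c79f2c2efdb2f89c914a581dc56a2dbca17ee224a8c29f1aa301cf881ca15c7a555d55b4a0c2aabb79ffecee811f00d3e99bb31ea08aeae2f205a27df0da98e364b4e713d6873a13aab189ea017464566f29137cd61a55a1022645d9144154ca3646ed24432907d42c449f83853cb39bc3fa4742fe1324b5,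
 ro 18 v30 52 0x1070297b4f1c5651df22410646789874bdb9ee2363307798843b7492101fdd04fd6ff898cd416d11f27faef272ac397e54271f09e52e3a8c11974a09ff46da8dbaf074bc5d511521f13f01ee085a9a63e94a04b850aa5871aa539c249aac77363548935fc0a85e20f06f3f04c1bd6352375fa7710e4116ded447e7a1f49e7f2edd92124bd1d7e0d02f5,
 ro 21 v5 21 0x2afa8d0c41b9b83023d24a21dd6f18cc171b36d1a826c30134e1b4c7b8756217c7e0c348ff2a6923b577689c4ea5fe45b968bbb2b62c3455,
 ro 21 v16 22 0x13ab5dc5763ee79c13d940b2610e3f9f4b1784ab08b2f2a081d3268b0075b2d2c8b244d4cb6ec69f0b98d541b050b6c357c70e3964520830a3cfb1fb296,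
 ro 21 v30 23 0x4576f2c79583cd4ed109ae38353f1fff43a626b158d4cce3df5d850d685d2f00a1b764377844d5f7f8ee481b9ebdeadfc00c362db077e5c7a7a2ff17bbd1a7f6,
 ro 22 v20 20 0x12bb6585fe5cc171a841c2a3be688ed6bfbd76d34688644d84c94e05835e87eab5f1aa14fc50bac1fe02740e697bf6e41b429c2c315,
 ro 22 v32 21 0x21fe01120e1831b0438afa99f50ca16d8d049c96eb9cbb30bf404949a74e4ef61093906c48650196324da45ecd11a54b80e947b1aed523d5]⟩,
 ⟨4,[
 ro 14 v0 31 0x40c16d00f2cbfc2fcfd14dbfa9f6ff991401760fd629400066fb4f93e40a303b3b3774bae6d9a3aadf117f79c0cc0f0f9f4c4bdc4eda4d4295e70d3d341a5b91b71342d0beedef6b8908896abc3f0cc47721e3ae7e76,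
 ro 17 v0 2 0x1d2499bfb2f36,
 ro 18 v6 53 0x40f21d002f3c0540b06ed9bef67d0471cc0fe7700f5abff962fea3f4137ef078de400aaefc7783e2b9304a1ebde3cefb67344142f156583f1ec500b6e442beee9e3d4ffbd2edf16c08a84f69c93cf53aee1f5b5bce0dc971c037fafda3931b3430424bc313e0f80f238f11eef792c898430d667c5c73d182a2ca9de10707dc54c3eed100434a4b116314862a23195d3af8e56,
 ro 18 v17 54 0x42d6ba1a5defc17b841fd462bcdf61570f6e088d26409cba00adf012aa822eec6b4b1c868ae71af686f5c37a75950590fc398539dc5ec999798b330d8866031667b3918acd66b074458c6117575374c381e72e8f2f550a03d6f1e98b3a6803a85ca19e1f186d46cf3230815206f44fe0b4a1f17cf34e32bc350e96a5408d0ac73945f5b1de26a2a8b5c3ef99583f5,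
 ro 18 v31 55 0x81b23be27ce14abb0918c812ff44c361f719f0b298846bbc40bcdfdbf0fd55a8cd0041520a087d90b4cd6f8293e6719be3b2e506996c4ad0bc862f53d167c4a14213f08f9d533e76be47063648b6667af0b31d5774f9fb374ba86ba92103379e92b56f3a51700edc507399a440ba27c956c9ec38d19a2c95070bcd8a1eb17d42857ba02a4b6f4ad099b60a470bd53b57f5,
 ro 21 v6 24 0x119448c38a06e339f36ed050bd3db0e54d9fd84458279462d5331ccedbe44c103033135a522d3f0db8bc3f5308d9575453d48a7bb3e3f3310554ca1ca8fcb21bc50296,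
 ro 21 v17 25 0x45132109c353e18a6fefb1bf80e8eb2a9b6a0276d86e39b1babd5923b5fbefac18aff1af364a054b7092bc88aef2e2715b6c960fab5334c5cc0f0c5934d7710a53a63c0e976,
 ro 21 v31 26 0x10b5123dc166ff9e43c40e512321c03208e7d813908d5330503b3eab5042c5af6df1f23db555434fdead455b11c834b75dc6746afc8e9f6d4928c6d3412b31b4bc7b73dfca3e95116,
 ro 22 v21 22 0x45b59e15575031bc7d4ccbfb2818bc34f919961461500d75f2922a8764acd6a33d5870802afee4a543112d56068a36f855b365dda46acd5823bb5,
 ro 22 v33 23 0x84e42c33cee28a32febb37b063c51dd93d6d8e1d2a5dd835e3b097629695aacbcb8e3ebb5f58eb92f2e3bec123c8de92978ae587c7ae754e1e75eaa355]⟩,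
 ⟨6,[
 ro 24 v0 27 0x201460c023c57e2ef50234d5f906dc0513d7b9206f98895f27b13c46ff7609df04d11a19f7db677b0890744f8f999fea543dfc277962d90736ae3483e3e706d810ba3162a99f6b92bf27c93b95057,ro 27 v0 1 0xc617e37,
 ro 28 v23 22 0x115d6ab9ddc8d8554403c8336676a48eeae6b1dfa0de9698a4d7f3b502d2bc61520f94e946c9da931fe64de3ebb15229c2d9171e04e32d31d0fcced98d6,
 ro 28 v34 23 0x44716d123c3b0c5fd06680a1afd5af66457f45abc53d623f6996c8cc546bf2ab7919971f3eda7c529bf15887c93c557001e2e1acf2cc50c5e8512f81ac861776,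
 ro 31 v23 19 0x5f6c80a3d762724a93ac79c0a0fac6ddd13a8f4dfc07b513b5d105464516f179e09331cf318a7b687a6ba1433d76baf505c33e5a56,
 ro 31 v34 20 0x13c2f2b6ee14d9448c18fb9cfe542324e106a029a4241023893f453763d916183d0dcb34011cf8c7abcb85e22aabdf33a288eba8e4fda5f6,
 ro 32 v7 24 0x1029ef9f4ea73e0b957eec9af82109e01b9c1cba87ca5dacf0db222de3497d806ce22ce77731a3d39449ac799758edba3d1bdc8bb922bf809048d2ee260dd3abd9e5e1e28997,ro 35 v7 1 0xe8d9197]⟩,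
 ⟨10,[
 ro 24 v0 28 0x12c0d781b83c19d6d9b192eb9846d7e5463d172c6815dcefb1017c9aa19f5acd33060c4f113588c5ebd1a4ba7783dbb2ebe29caa06da221a20d8549ce1b388514df354ed0588f6581fb95,ro 27 v0 2 0x1ee7b9420ce76,
 ro 28 v24 24 0x1604cf41cbaf18983c5e0d2c20d4c4f9d7d6d31b1fe5da04b44334f7500443ba13cf01d5b3b3d2feb593d2d454cddfb3db39063f0414024bdf6c3c6f029ff575177336,
 ro 31 v24 21 0xb02149397e012112831377e6a9e72fabf268e462c7888374e60cd77f7a1ece64a811f83f04b0755ee19b154c49c58a308d28b352564851ec523a4fdab7]⟩,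
 ⟨12,[
 ro 24 v0 29 0x44a6a71b667bf6d23058703db936f286ebe439115050adb0c381945d571a96d420553c14dfce637ffd6d6d61ce4b5cd83e2494d36bfb8e3be40d462cab8e47cf25abad2192d93104945251f1c647bf256,
 ro 27 v0 3 0x33614342d0597260d17,ro 28 v25 25 0x52beef5359b3b39950f46e60c7d691883b599ed22a11d649e32260a8ffed6e6aad40fda4e52b7d9fca8e57a3ae90bce6e24adcd80cfbc1df05cafc4402364e755ead482df96,
 ro 28 v35 26 0x11d4e7c3373d3e1983977f3115c1561f2ece96564be78d7a9c3542df1442aa8f64f539ded3857c94fd5569a8ed3260299779aa9ae567aa8f1a6ad46b5b2572fad3bccbfb6246a40d6,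
 ro 31 v25 22 0x14924db90298cbb4844b8f479eebac57f1a78d01cca96bedb3bdffae925f566fb8edd16ec722bb0c560c66407975a4097c0efda00be45e128989aa25776,
 ro 31 v35 23 0x4b6d99570fb38d1aee60382073ea3091a294b41d1cf94ce47af9ca459e258c892ad31896a3fe0bd9196e9e64304808e82e0a7a211090dcad68fd663dd2dfd4d6,
 ro 32 v27 25 0x48d5511d7e2bea976c7f5bc11f429603737eeb710e3b1e217d5c575b7420c3202bf54496cffb33f68175b7be481d5d36f093b09ff1e50f53f308838d549968b1b3663283056,ro 35 v27 2 0x782a6b7ab1cf7]⟩,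
 ⟨20,[
 ro 24 v0 30 0x44575640e7510dbd862423ef595f331cfd8a280815468356c917ad13768a37ed3e08dadceca80ff4fccd381c032ecd99da06a74e0c5c4e57cd9cd2f9c76ef2d840cd1e064550887afded5a934ff79f5,
 ro 27 v0 4 0x1fb46c483d5501f404011776,
 ro 28 v36 27 0x446121250bccf58af2b66bba746f23cad4da24ea28963879595782d62202edb947c8f833e89245879f4db6cf402240e1ac145787cd79985740978a32b518ae56623f48b76f3f1312b39e36,
 ro 31 v36 24 0x119d8adfd9c7b07c5b7986310ef30ebcc86b828eb8a491ec1a7563d46ce703046a81c4f072a1f0f3b9a9c4b962fdb3c4c6979dbfd081bf6d969503aaa23252cb2b04b7507db7]⟩,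
 ⟨14,[
 ro 36 v0 7 0x4895432a04c66c052ef901bcc2a8babf3ba6cc56,ro 39 v0 1 0xd2be797,ro 40 v28 14 0x54824f5740e91a3bfec6048eae3136efbbb09beb5eff8ec57285741f70febce1fa1674862545fb8f97,
 ro 40 v29 15 0x6b83c501aab9b431363ef2cec771d3b393132a3027074c822532b171e54053099bcbcd029110520eb256,ro 43 v28 1 0xdd447d7,ro 43 v29 2 0x736fb7a02ec77,ro 44 v9 1 0x72890d6,
 ro 47 v9 8 0x1933c4d282e7e2c6fa9dc64cd6cbb969b94c4eee87d49a57]⟩,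
 ⟨22,[
 ro 36 v0 8 0x11367947d6252d3cc64fcaf19ccdc0da609739dcaa6116,ro 39 v0 2 0x6a828e81f6397,ro 40 v37 16 0x16b0a2d0f3bf752876ac18148a51db1fb2e3b296647399c85ffe9a86d410246142858c19b05b931950945faaf6,
 ro 40 v38 17 0x49af50bec355a5c970cf15540e9d662d5fbf45e89ba0d5e98a7e51ef7e59f436ba57de60807ec20661eb3038298ca76,ro 43 v37 3 0x3e1573befcbd849b757,ro 43 v38 4 0x19ef856537c2c05d646a5b417,
 ro 44 v39 2 0x10c6b86f33316,ro 47 v39 9 0xc7fc90b92b2a7b812c04c62ac7e46ab86a15204043fe49966f6d7]⟩,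
 ⟨30,[
 ro 48 v0 1 0x31117b5,ro 51 v0 1 0x68c0d96,ro 52 v40 1 0x7a5dcb6,ro 55 v40 1 0xcd29d37,ro 56 v41 1 0x3e9fe75,ro 56 v42 2 0x6ed16eb4b8f5]⟩]⟩
def prN : List Pr := [
 pn oN0 oN0 1 0x20000de00000bd40c0013c0c00330400013a080003f80c289e080289e08000460c0001f0800016690004009,pn oN0 oN1 2 0x1d4000a3d40009f34d08c0033a49a6908c001334d24d24d4c00043a98000764d2003000e00e,pn oN0 oN2 2 0x6200039e200038c200036e200035cd08000d388000cf210001966988000df24002031e80be818402d805d1a4870c029c71802980b282000430218007060003b0200043a0c00076043000e02c,pn oN0 oN3 2 0x1b4d34c2513002ff030017cc200c000e03b,pn oN0 oN4 2 0x6d34d18c001fe4a060061e2600318100079c280c000e047,pn oN0 oN5 2 0xda69a880024780001ee4236005be16002b980c0023e04c000e051,pn oN0 oN6 2 0x981023769a6a000093e20007d8460014b42c00bbc6c005b020014780c001de84c000e05a,pn oN0 oN7 2 0x369a6806c09fc26c0bd806c08b826c0af9a2808c000b34d2528604df086043d20605dd006056d23c036f03c023d336034f136021d236033d03601fcd200f000e060,pn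 oN0 oN8 2 0x369a613606cc03605fe13604ec036058c136044d00e06aea2000d3d48c000b269a4a40c099e00c085a50c0b9a10c0aba57806be178045a36c06fe36c041a56c065a60c0099a0c0030604f000e073,pn oN0 oN9 2 0xe82041f29e037729e03fe39e01af29e014ea810417a81040e01b01bf19b019601b012e09b012682a033f92a03ce84f032f94f03be80f031e90f03ae69a4006005c23004af036040d33605ad236053d34a031f24a01dd398030f29801bd31802ed218019cd2018000e084,pn oN0 oN10 2 0xc82039729e037f29e040639e01b729e0156881038f881038611b01a719b019e103006609b01368aa03479aa03d68cf03379cf03c688f032698f03b6735008bce70011394c0021f0cc012fc4d810748d816f4cd815351200c7cd2807b4a600bfce6007348600b74c6006b020021ba0c00426818000e08c,pn oN0 oN11 2 0x329e038f29e041691e01cf81e01466824a84840918036001d13206df03207ed33004ff23005fd130045d030058c554071e554082d09e034f21e037d30000cd01e025d33004ff130045d23005fd030058d254039f054028d09e034f30000cd21e037d01e025cd201b000e090,pn oN0 oN12 2 0x329e038729e040e39e01c781e013e827049f81b049e84004870979036001c12d20940d9e0640d9a6600bde46009da2600afa06008988a80e1c8a8103a13c067e03c065a13c04da03c049a46009d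e060089a6600bda2600afa6a8071e2a804fa33c067e33c04da23c065a23c0499a840048681b000e096,
 pn oN0 oN13 2 0xa7812bca78131a0800e5e8801078a780e5ca781078a780a1e07c08d8a7808d8a780b38a78075ca78057826e84d4099803c001c55a095e55a098d138071f038070d538082d438081c036039e136038c036028c136027d05e072f45e083d150071f550082d050070d450081d0a606ff4a6080d02606ed42607fc55a072e55a083d0a006ff02006ed4a0080d42007fd49e036f41e035d49e02ad41e029c53c050f03e046c53c046c53c059c55a03ae55a02bc04e039e04e028c14e038c14e027d4a4036f4a402ad424035d424029cd201e000e099,pn oN1 oN1 1 0x6c1834fec1834b6c18367ec18363496833bc16833734e60c1ad929aa066792a065e50540cacd398306864a2040d5e49c18ba29c18da09c189a298177e098175a694173e494171a29416fa09416da690167e490165a29016388100d59a723e0d4c9391e06464816c0d5d2530004cf100042ca46c183816c085924e26416b940c82d34ec02c3ccc02bf2918057651300add30005dd100056cd3494a902ffc8902fb24d2a120356731e0bdd29e0bcc11e05dc9208f02b6311a0acc8198c055e4044602ab20c5c182838b8304fe17060a8f20c0a7d7060a6d00c0a5cd24d4a1828b48182872403082100059814304ee003005641000409c,pn oN1 oN2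 2 0xf83088ff830886200088f2000886200085f2000856d83088fd830886200087f20008769830876200086e200084f20008464400107cd3b8308764880020dc80020b9100041334c80022592640010cc9000440fa102a0b607dc201040607f50ff81f903f602d81f7a4816c0b9c3ee07c40f980b6055c1f503da07bc69260b605cc816c0ab92480021ebd079d0f4811e06bc1e503c2878c0ee81df1a411e06bc1d943b6074c08f026e0ea81d703a2047810f3493490478137208f021e40010e7e839687340e381c9038687140c4001e0e08d241bd437e06dc0dc800600bc1bb000c013836a3483100079a400600bc92003004e0da,pn oN1 oN3 2 0x1b4d10d4c1817fa48800820440017b30130400c280c0066113,pn oN1 oN4 2 0x1b4d1570c12ff20c12ed30604ee9222760251a46024f9a69440013f34930c04c280c0026122,pn oN1 oN5 2 0x1b4d10d4418163a488008204c0015f34030400c284c0066139,pn oN1 oN6 2 0x5c1c487b4d10d4418113a488008204c0011730830400c284c0026148,pn oN1 oN7 2 0x1a69a684ac117d24d24d34a60011f9a48820020102008b34d24d250a4080e928cc03c74942601df248800800010300b610300ae208008008103c06fc4089803360040c019710010000030c20c20400286089e8000061041801b30a00c00b900c00476003006e156,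
 pn oN1 oN8 2 0x1a69a69c41822b24d24d3530008bc9a48820020010055834d24d2502407fe9288c03b74940601d724880184000c039800c0378020808800810bc06ec408d803260042c018f30030024130c20c22e701562002220c11180983043e000608dcc218300366148180174c00227481856f2103006e18c,pn oN1 oN9 2 0x69af830caf5b071c6fb071c5cd25706192f706191c96c1c723ec1c71f3495c18653dc1864f24410010034d2b060d7669088403f74944181d3a4a20c0e782040040010444c2066f80081024028c40a270366204a001830003048e001e001cc00c20800c30830810010000030a094019984106513c8208300461c9,pn oN1 oN10 2 0x69ad830b075307189f307188cd2530615df30615cc94c1c62fcc1c62b3494c1857fcc1857b453808b220800801a692685c0078744201b3a4a20c0c1d250b6001c206073c26003b5880080000082002002054081b71026000c5801300061cc00c00800c30830810010024030a094009984106007c82818289e1fa,pn oN1 oN11 2 0x24b3c0024b180024a1c00249f8002477c002475a60c4b7e60c4b5892a92442499054071d30622ef30622cc46908ce3514e082e4ad095e12ac22ea45908b6502001b104a9494a129c251848f491612342448d127524c849b092e11cd238950221ed1021f0d14e082e9215b01bf22a845708a202d8083114c08300260030066692243a47f090611ec242847d090211e469a488de91b42d2014e2358d282a038e232a46108c604780d30278097117c0cf012608f010e69269249269d40887b28810f8665a4029c94c188bba98311664c13c04b906780932411e034c11e021cd2a04003615b01bf05b01064106004c920030066228,pn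 oN1 oN12 2 0x2009487200947e2009437200942e200938f20093869839497983149627ea50122a80e189fe4c18987cc1898f44008cf135400094974519609c1038a2e146c261a4c7201000d898a0004a47a288a5150a1e144c27ba4fb09ea13e468800509c80050791000a0b10009bf90009bb5c088774c087bf4138207a4816c065c972130425e8306004c20600cc4bf097634913bd27384f309d613b427284f109d234c80051d92200136f2001366440026bcd28aa0386267a4cb09a604780cf133426484d1023c03f9a49a49249a750221dca2043df99000a0725306263ea60c4c3a2004679a4823c067823c03f9269402001b340b6032c306004c92103006625c,
 pn oN1 oN13 2 0x416c20f980c30085ff0be297bc2f685eb0b7296dc2da985a072c5a74b4a168c2d09b062a0e55f360c53d8aba150529f853d021200d8002631c00262fa60c62f800262d8002621c00261f90004c3b3000976640012ebc59f4b2e16742ca859b0b2616642c89b06312f7072bfd10423ad104270c53b4a6e14e429a93062acc533201000b801001b9cc1cc5f2400130de00130cc800261798004c1b2000982e2f4a5e10bce177c2f285dd0bc6176c60012bfc800257da60c53be60c5378ab615542ac9306299c5570aa6300098de498004c5724c00260990004c0f45281ebc1281e717f42fb85fb0bea17e42f98c0025d590004ba716cd2d685b10b5616bc2d49548068d448067c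001314e001313c90004c2b8004c27240012e8e0012e7c80025cd8b1e961c2c685850b16160c2c48581000257bc002579ba08447b2083eb8a6294ac29785290a5a149c0840026004006682d841f4945281eba4a0940f39240b6035e5770aea15cc05b01168810f56a8110c68810f4e6926924922e5a5c70b8616fc2e485c50b8216f400098d700098ce48002611c00260f926001302c93492490004ae38004adf200095b62a8a5490a9e151c2a685450a96150c6961681cb34aa900d1925448067c56b4ace158c08f01b62b485650ac2047808f3493492493492496c1cc4bc4088eb5c18aff44089c30004c4b8004c4724fa04447964087d702d80d782d808b28810f565502218ca2043d398004b7724d24904780db047808f6c18a83ad8314f6530629de9298314de5306299c9a49249a4109006cd4c18ab3402001724801001b9a4108004c920040066293,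
 pn oN2 oN2 1 0x48632fe48632ec40032fe40032ed1cd327f0cc327c08632fe08632ec40032de40032cd38632cc40032bd3ca326f1ca324ca19464b9a778632cc90218cc3c720c974b20c9b4320c934534c9fc130c9f4d28c9b9000cc34528c934128c971218cc3c920c9b4520c974120c93021cc9f8218c9f0218c9bc8f8cc30218c930218c970218c8b8218c8f40c8c8f195491f19870431936043192e04319260431907043190e04318f604318fe918190e329903031fc651010c647c10c645940c8c8f0218c878218c832918190e04318fe04318f6503031fc001327e8c9ad898cc31924325911a323e08632ac6450c8e5898cc3a4a630643c10c653a23063f810c6518c82190c31e863f010c655e23464792043194f98c190e4810c651a23063f92a82854fa81854e003050704318ee08304fe081001631da0800a0c188002c18009fc08631de0060a0c102002c10609fc639410013d802a0200277021802b0018277000488004e60400507418009fc188002c08009ee800c13b810c015810013b802a4400273000431c,pn oN2 oN3 2 0xc10c67dc10c67b9a04319e74086339e086338c086337e086336c086335c086334c086333e086332c934d2408633be08633ac9163880f943080f0218cc7801848f40c00130418523020048fa0c00a4688c0026331,pn oN2 oN4 2 0x30431a5f0431a566810c693d0218d1f8218d1b0218d178218d130218d0f0218d0b04184a38218d0704184ab269a48300255c10c69183002519163874394307430218d03801845340c003304184e70200453a0c009ce88c0066340,pn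 oN2 oN5 2 0xc10c6b5c10c6b39a0431ac74086355e086354c086353e086352c086351c086350c08634fe08634ec934d24086357e086356c9163880b943080b0218d37801852742c0013041848b0200527a0c009168cc002634d,pn oN2 oN6 2 0xb8099ff0431b3f0431b366810c6cbd0218d8f8218d8b0218d878218d830218d7f0218d7b041852f8218d770418533269a48300299c10c6c983002979163873f943073f0218d7380184eb42c0033041844f02004eba0c0089e8cc006635c,
 pn oN2 oN7 2 0x218e6f8218e6b34086399e810c72dc10c72b810c729c10c727810c725810c723810c721c10c71f9269a4810c731c10c72f920431c77408638be880404790218e37a0431c66244011e0431c070431bfe0431bf70431bee0431be60431bde0431bd70431bce4810c6f1c10c6ef810c6ed810c6eb810c6e9c10c6e7810c6e5810c6e3924810c6e1c10c6df920431b770431b6e4810c6d9810c6d7850c031850c02f9a6920431c570431c4e49a4810c711c10c70f810c70d810c70b924810c709c10c707920431c170431c0e48400031840002f922c715c728615c62c715af28611be2c7158e286136e2c711bf28615ae2c7136e286158e0431b570030ad608000360830c7e0431b4f0030ac6800002e0830c6e0431b460030ab600d810618cc08015ae830031f830c00d81002b1d06006374218017020055b20c00c66043006e368,pn oN2 oN8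 2 0x863cfe0863cecd0218f37a0431e570431e4e0431e470431e3e0431e360431e2e0431e270431e1e49a6920431e670431e5e4810c785d0218f03a0431dfe001014e0431e0f4088029c810c765c10c763810c761c10c75f810c75d810c75b810c759c10c757920431d570431d4e0431d460431d3e0431d370431d2e0431d260431d1e4920431d170431d0e4810c741c10c73f9204300d604300ce49a6920431df70431dee49a4810c779c10c777810c775810c773924810c771c10c76f920431db70431dae4810c769810c767806a00cc2c715bf28615be2c7159f28611b63ea01b628613662c711b7286159e2c713662e701b60431cf70030c8618000360830ace0431cef0030c76900002e0830abe0431ce6983044e100006e04304760400c874180159c386006c08018ee83002afa50c00ba70011390474143006e39c,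
 pn oN2 oN9 2 0x218fdb8218fd7359882bcf9022bcdb873cffb873cec0863f4e0863f3c0863f2c0863f1d1882bbf1882b9d102238d10226edb013cffb013cecd25188238f18826ed1022bbd1022b9c0863f0e810c7dbd0218fb320431f7f40863eec810c7cbc10c7c9810c7c7c10c7c5810c7c3810c7c1810c7bfe478073ae00421aa003c5810c7bdc10c7bb810c7b9810c7b7810c7b5c24a0218f67048498010668800eee98010568800ede0431ec70431ebe4810c7adc10c7ab920431ea60431e9e49a692bc31087ac30f165024039cd2538620cf1861ddd38620ad1861dbc800c125902182430218faf8218fab240863e9e0863e8c90218f9f0218f9b2458e206e50c206c58e205e50c126c58e204c50c14ac58e126e50c205c58e14ac50c204c0863d2e0061ffd048004c1061fec0863d1e0061fdc100007c1061fcc0863d0c0061fbd018513c1061fac0801ffe83003fda29400981003fbd06007f3061801f02007ef20c00fd6898289e3d0,pn oN2 oN10 2 0x8641de08641ccd6e20af7ec08af74e1ce6fce1ce6b021906f821906b021906702190634d500d7ce20aeb4c088e74c089bf4c04e6fcc04e6b3494e208e7ce209bf45380d74c08aeb021905fa04320a74086413c810c82dd021905720432067043205e0432057043204e0432046043203e0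432037bc31efea80108eb800f1e043202f0432026043201e0432016043200f9c31ed604320069c31ece183030610303a6880105e9800ee60431fff0431ff64810c7fbc10c7f9920431fde0431fd649a692ac3108fbc30f1e57003dfcd24380060e200074d18620bd3861dcca6007b594c00f67021904b821904724086410e08640fc9021903b02190372458e1d3e50c1d3c58e1d2e50c115c58e1d1c50c13bc58e115e50c1d2c58e13bc50c1d1c0863f9e0061ced04800cc1061cdc0863f8e0061ccc100513c1061cbc0863f7c0061cac100008c1061c9c0801cee830039ba2940198100399d060072f061944f020072b20c00e4e0c300463f7,
 pn oN2 oN11 2 0x8742fe08742ec00142fe00142ec995312e913312d386434f386433c85550a2214c4279386420e102006c00622ec106261cd02190ab82190a302190a7021909f02008bb86009872104a44003604321974086426e863010c84b90c202190c7a1340432186425808642fe08642ec85b50b202190b3215c3de01af2c715de2860aee2860c960432157043214e0432146043213e05b01bf04011561db01960c012e641f883d030c009810c019810c84dc10c84b920432127043211e4248845010c845810c843908e210c6982190b32458e15de58e192c5a4035c50c2bbcd2408641fe08641ec100004c019053c06f800c455833c065820c4b9810c863c10c86192043212704321164810c847810c843924c7989748698963de01af2860aee2c715de2860c962c70aef2d201ae2c70c9628615de9c3210700311760810036083130e04320ff14f01be08000260cf019604320f6003115600c810625cc08022ee83004c3a91000d816c06fd0ed80cb061801302008ab20c012e6043006641e,pn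 oN2 oN12 2 0x121d11f921d11b100511f900511b1250aff9048aff4e1d133ce19133220d4428881010c895a00400de70c86f820c459800c4c78002899d0219107821910b021910322540c01167040131e8440036437800144be912682190ff224404321f643fa086449c87d010c891810c88fc10c88d880088bc800889810c8898800887891c575c91c57388182b98818323810c885d0219107021910306008af86008a30200983020097b0e180130a1803321b4435808643fe08643ec921dd439887b010c879810c87390e221e443a8d324322264891c2b9c91c323881857588185739821912b24300004e20000cc086436c086435c10622bc106228c006260c00625ec086449e086448c934810c873810c87992458e2bfe50c2bfc58e2bae50c15cc58e2b9c50c191c58e15ce50c2bac58e191c50c2b9d386437e006263d002006c10622cc086436e006260c300004c10622bc086435c00625ec20000cc106228c080263e8300459a11000d81004c1d06008af0e18013020097b20c011461430066435,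
 pn oN2 oN13 2 0x43231f0432316043230e043230604322df04322d647488e7118ea31446188c1010c8e9c10c8e7916e22d4043228f0031506081803608314f60401507451818029ec189006c001482e001481d386481c001480c08647fe08747bc80028f9810c8fdc0028dd810c8fb80028db810c8e5c10c8e1810c8e3810c8df916622bc45888ad2316625e31457fa208477a2084e3810053bc1005379142227c8c315660c014ce844002e044006e7387481c9021920f821d1f32000a3de608746ec810e8db810c8b3c10c8af810c8b1810c8ad91ca238447188df2314477e3144e3a20a625a20857fa70c8a1e70c89f800c53b800c537a00400b800401ba200559820c533810e8ffc002907810c8f79021d20f80051ff02191f32043a367000a3d6043a35e000a3ce04322ff478808645ec8ef010c8bb91da021917323ac043a3d7000a366043a3ce000a35e04323c745f8086477c8bd010c8ed917602191d722e4000a3f7000a3ee0432376043236e0432367043235e480028d5c0028d3810c8d380028d1810c8cfc10c8cd810c8cb810c8c99156229c45488a50b2857bcb285798a242c18a2432b8100531c10052b913a226c0c014b60c0149e0c400260440066043231f0432316043230e043230604322ff04322f604322ee04322e64922c711cf2c711c62c7137e2c713762860afe2860ca62860af62860c9e04322df04322d64810c8b3c10c8b19204322be04322b64810c8abc10c8a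9919e232c043229e043229646688c9010e8fdc10e8fb9204323d704323ce49821d1a724086455e086453c086454c086452c924594160e594195c5122bdc5122bcc08644ee08644dc006298c006295c102004c00200cc106296c106293cd24086478e086477c086476c086475c92458e15fe58e194c58e15ec58e193c50c239c50c238c50c26fc50c26ec086474e086473c902191cb82191c724086470c08646fc9021919f821919724086466c086464c94624c4bc4088ef4620aff44089c746208efc40cc4b46209c74408aff1638af794305831638af3143065716388e7943057f16388e3143065316389bf143057b16389bb143064f16385839430af716386571430af3163857f94308e7163865314308e3163857b14309bf163864f14309bb02191478018a83040c01b0418a7b4e191438018a7740080174400ab34e1913f0018a6f00080370418a67021913b8018a6304080130418a5b02191370018a5700080330418a4f0200a83a0c014f60c4803604014ef51862acd088005c08029bc8300533811001b8100531d0600a5b06200130200a5720c0149e044006644d,pn oN3 oN3 1 0x1b5130488f030487cd188c243641800ba10004484,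
 pn oN3 oN4 2 0x6d1421840ee11e1d4c100007e10400023305200c005648c,pn oN3 oN5 2 0xda2082006188cc246e00c004e494,pn oN3 oN6 2 0x6d10430830c000c005e499,pn oN3 oN7 2 0x369a69a08820006009b10401180129e040004f330c20c208c00164a0,pn oN3 oN8 2 0xda69a71984a7c8104006008302080240c691c08431ab66185206076cc20cc001e4af,pn oN3 oN9 2 0x36aa008a7ea005839a8801c3f8801dce8800b1e8800cf620800820401809730130c24c200c006e4bd,pn oN3 oN10 2 0x1b5700455f7002c5cd4c00e23cc00eeb08601df4c0067f10400410030130420c280c002e4ca,pn oN3 oN11 2 0x300126ff00126f688122cf881166e6935ea6ac4d6903600cc426ed4db89b9136a349b3640c339a60005d93623494401167c400b37398001769030ce64d281b00664d5,pn oN3 oN12 2 0xc4049dfc4049dda6048afe60459380049e3d271d4e59036004c9c900049e1d27554ec89d313ae342004e8e2004e7c84009cd9a4a2008afe200593988013b724d281b00264e3,pn oN3 oN13 2 0x2285f00228560022847002283e002280f00228064fca9f713ea27ccc8222dfc82168e4f5a9e913ce10f801b34002506e002505c8004a09a204721e204787a2042eba2043639a6002509c9300127fe40024fecd000940f800940b240024f8e0024f7c80049ed9a4b2008b7f2005a3a200721e2002eba200787a200363980093f724d221f00364f3,pn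 oN4 oN4 1 0xda9c320879800eb618c208718f0eb66180513d118513c1800ba1000450c,pn oN4 oN5 2 0x6d440081fca18f9f1418050ee8060100933c080c005e512,pn oN4 oN6 2 0x35924fb5300208f3863e9c5020001fc26123f20c0201253808c246e80c004e518,pn oN4 oN7 2 0x1b4d345440129f294620978810ebe8c0272f0006c0198a28284009578400a6688008be88009ee61840100943c200c001651d,pn oN4 oN8 2 0x369a69841184a7d102209f28c3ebc63009af806c00981450510012af10014cd28633bd286357cc30a40c0f18100961c204c001e52d,pn oN4 oN9 2 0x1c1c53ceec30a67ad0c8cdea005879a9431b9f9431d1e8800b368800d0ea0d29cfa0d29c66a430a65a430a638a0c3092f024300199a08c26ee4c108c260e40100997c200c002e53d,pn oN4 oN10 2 0x60714b3ba0c291ebc3233fb80163e6a70c6e9e70c74986300f1a600345a034a53e034a519a80c291680c290e288800453061849300c02a170c02a0e08c27664c4c0130784010097dc280c006e549,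
 pn oN4 oN11 2 0x30012acf0012ac69462397881167e681009afd54e2aa491b00666a100a85e200989955e2ab469556ca18edb4c000c34400667420150ba88026265286472f1002cfce600061a50c76da20033381009afd291b0066553,pn oN4 oN12 2 0x31012b2f1012b269c62387981165e0012b3f4abf41009cba46c0099582000959ba880267f8802a165628180557cd0801587ce18ed329800cc68802a170c02abe880267e5286470f1002cbcc400ac7a50c769a20033181009cbd291b002655f,pn oN4 oN13 2 0x8afbc008af98008af5c008af38008ae7c008ae595baab6ca8027e656c9a92474f9042d3c0804f5ead515a600f801b34002578e002577c8004aeda518731e518797a2042efa2043679a600257bc930012b8e4002570cd00095d780095d32400256bf68c3b8caa043359aa8027e65a86474f9002d3d286398f100177d2863cbd1001b3cc004adfad0c771aa0033581009ebd201f0036569,pn oN5 oN5 1 0x36a260b05e060b039a3118580c830c4401433000457e,pn oN5 oN6 2 0x36b24c76882020000fc06014670608880246604c0056586,pn oN5 oN7 2 0x1b4d35100534ea2009698104004c012620802200683c440045b06184180c0296e08c001e589,pn oN5 oN8 2 0x369a69c4014930880252e20804c010e04100440049f888019960c30a40c0c9980c028ee0cc0016595,pn oN5 oN9 2 0x1d9c5a0ed540114bd400b03351003bbf100385d1001a0d100161c4100104080301be8802ab700984dac189802a5704c25fe4180c02a4e04c006e5a1,pn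 oN5 oN10 2 0x6671653b5700454f7002c4cd4c00ef3cc00e1b0a601d74c0058b104004100440158b804c274e0c4c0133380180c029ee84c002e5a8,pn oN5 oN11 2 0xc004b6bc004b69a2048b1e2045999a5afa18055fcb5d226c0098804c2a6704c261e5b38b651a9800cb75b19300019cb610130a99d026130f288022c788016669800cb798000ce49a0c02afe89b00265ae,pn oN5 oN12 2 0x31012e171012e0e98122b798116460012e274180553eb75226c01996e6000970fa04c267704c2a065be8b7f1a1002def1002de642005bbc098540e813099d9440115bc400b2331002e0649a0c02a9e89b00665b9,pn oN5 oN13 2 0x8bb7c008bb58008bb1c008baf8008ba3c008ba1aa00ad9d73254013e72e5cc8222d7c8216865c7ab8d0300ad38c7c00d9a0012eb70012eae40025d4d1023c4f10238fd1021b2d102174cd30012ece49800973f20012e7668004ba7c004ba5920012e570012e4e40025c8d50056ceaa009f39640116be400b434400f13c4006cb4400e3f44005d330012e6e49a0c02b4e31f00365c6,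
 pn oN6 oN6 1 0xb5922fb51305def0305ddcd0601273c26126f060126f060100afdc440121300045dc,pn oN6 oN7 2 0xa4da6a769a6a200a6bc44012d7440163710400cc012e20802300251d00c308020162780c0257e00c001e5e1,pn oN6 oN8 2 0x2d36993da69a3100525d100599d1004a6c41019801fc0820080009470c02f2601861481819b020165780c0250604c00165eb,pn oN6 oN9 2 0xe4e25e76ad0c8c9ea005859a9431d2f9431b8e8800d1e8800b262080082048180d3420155fa01898029f70002016a380c0265604c002e5f4,pn oN6 oN10 2 0x189c4aeed5e19197dc00b1b353863a6f386372c398076d300165c410010401100557e1805f5c0313004c0e2600b458020168780c025ee84c006e5fa,pn oN6 oN11 2 0xa4c2717001303f0013036946238f881167668100b5fc3009c797fe4cd801310118541ec091816301c6980ab00c98000de6008118541e92943238f8801676730001bc902016bfa0c0271e99b00265ff,pn oN6 oN12 2 0x29309e5c404c25c404c23a7188dfe6045958004c29d060135782016eb4cd80333054001309f4c1f4130a83983a06018173420060de20060cc8400c178130a83c300c0b92943237f88016566200610c902016eba0c026ae99b006660a,pn oN6 oN13 2 0x8c51c008c4f8008c4bc008c498008c3dc008c3ba900adbd86654013ef54017336a491cfe410b4b020171fb0ac0c0279e11f003668004c47c004c45900098874a30f33ca30e5f44086d344085db34c004c4d92600261cc8004c379a001310700130fe48004c31c004c2f9000985b52015b7aa8027dea802e66d43239fc8016969431e678800da69431cbe8800bb6600261ac9020171fa0c0279e11f0036615,pn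 oN7 oN7 1 0x1a92e32df82e32d692d329f82d329669c95996325354651f254650ca0a8c9f8a28080033f440949fc4097bb44092a7440966b453191fc13191b4d29917c929913452990f412990b4d218ffc9218fb45218f700800ab34e47ccad92723c64dc902d949f80d92a706d97bb04d966b4c0144380d924b4c0177f04d961f4c0124b440122b4c0161f440160f3899320e5032640d3b063cf33063bca460c75944c18e70078073007806f34d252a464bf22464ac934a0780559cc799274a7992344c007324a0600378c4698e3206630c6f901118636c830c2128c632f20c631d08c630d00c62fcd24c4a198b748198b324810824000588401e00ac008002730004629,
 pn oN7 oN8 2 0xd34d34d24d244102000d7c2204bcde204a6da204b1fa20496d8820020840045834d24d240b6537e0364b7c1b65e5c13658ec0b651ce03649ed30051bd100515c0b6516c036497d30049dd100496c40040021e016c21e015c0104030011062002042f00a71023600358010b0019c1a6349e002000200200c0400403986106148301eb308308298302a6520605bc400d0001e20007802f0800293080028f000f004e65e,pn oN7 oN9 2 0x69ac81234fc81173e69a4a204859e204889a204499a2045079a6929461bbf9461d3e8810b4e8810d2620800801a6108009375e19027da18f8b5c00853540079702d95ef80d942706e188704e17534e18d13ca18cdb4e18d7b4a18d434c004cb440046b4c0053744004fb100100010012160200240c410010201805188144e027c409400076001e091c000c003a200ae3c0130054ee008802a260030c2130256be2604c318308440155789802b0e1100602c2600c1b830a84000d98411e004c8200f0066683,pn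 oN7 oN10 2 0xd35b0246afb022e8cd3460019bca60485be60488ba60449da6045099a6929c61bc79c61d4620f04069810d2e20800801a370068fc95a1902bde18f8f54008575c0079b02e15e380e141b06e188b04e17574a18d17ce18cdf4a18d7f4e18d47041813b001817f440053b4c004ff1001000001040040040aa70146204e0004300260001fa204aebc0130054fe008802a2e0030c213024f8e2604b9583084401367898027460200196c200197d3005bdc0100d11c2810003604034370863c0098100d098210f00666a2,pn oN7 oN11 2 0x2dc5c002dc38002db9c002db7a5268fde20a6359a6d9adaf1b6215500a34c010abc4011074c0092b44009fb140b655de1b6614c0364e1c1365c4cd8b5b0e3624828006621b82b6f46df8dbb1b5ab6a46d58da71aa8135b788134de9060d766da968c41bf28c3f4d502222d1021f4c0b655de0364e1c1b6614c1365c4cd855afe36046bd8d831afa047944f047802334936956d08da31b3a0800767367c1000ec66cd8d5409adbc8306bb4409a6f26ccad9726040639b2a348aa80519b26b63c6c88386010c01e086cd8d003c109860c0259a49880076721000ec6492946a3f788198d6b4620dfa8111169461fa68810fa67302031c94c010abcc0092b440110744009fb300f0436401e084c90e180430c1804b34a0a00199a411e513c9208f00466bd,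
 pn oN7 oN12 2 0x1005c3f9005c3b1005c239005c1f4c111bbcc10bb30005c4ba88036bf7048454027ce072200851e600885a200491a6005018002e23d06d982382e159f04d96db00e13c737656ee9050004cddb0002e21d385570c8e131c2e38057028dff1c06357026b5f30269ac8800e0daf18835e7187e7ae04443a6043e78170acfc0709e3836cc11826cb6d9ba6b7346eb8dd1023c00fa06ca279baa373c6926fcadf11bfa37d46fb8def1bf637cc6aa04d6bc800e1ba204d3591001bdb9001bd7220037a66a200daf88a804f9bcab784880364614300766f18ddf1bce441804734934924944091bbc408bb35a3106bd4088874a30fcf44087cf3200382e4a600885e600501a200851a200491a200d91d2428600ed106011c934a0a00099a411e007c9281b289e6e6,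
 pn oN7 oN13 2 0x16cafbc06ca17836cc4f826cbb59d3aba6c74c8e971ce6b9c4737985a02bd900573f90061ed900501d9005d1db00463fb002dcd900461d9002dace435c8238fc0908036000bb0f000bb06400175fc00175ce00175bc8002eb5a208db9e208e1190005d1b4401567c401597440181f440184b440137f44013bf44016d7440170b44110bfc41111f44109434410a1b38f571b8e3b1c6a38e47199020005c02000dcc002ec992028359f000bace02834be000bac66001753c8002ea580a0d63dd2a0141abf3a4c02834ae7488050693ce8f220a72de20a793a20a2f9a20a371a600729e60078fa6002f5a60036da200725a20078ba2002f1a20036b98005d8f240686b3e068697c93000ba8e4001750c0b6551e0b6547c0364d1c0364c6c1b65fbc1b65f6c1365aac1365a4cc002e8b90005d1339b57338e6b1cca39a4731954801ed44801dc00175ee00175dc90005d5f8005d5b25d046baf90469fc8002e87ae00aa5ea00a91ae00bfdaa00bf3ae009a7aa00991ae00b5baa00b4fba0883bf2087edba0844bb2083ef9c62b8ac7178e291c5a389c0900026010006605b2bef01b285e0db313e09b2ed605b2a8f01b268e0db2fde09b2d5605b2a3e01b26360db2fb609b2d26a811a5f88119f6a811b368811acea8109ae88108f6a810a968810a1e6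92028358f028357e02834ae028349e492742ae811cfa39e47418e7f1cf639dc88136e7000bb1688138464001755e001754c97409aeb8005d3f6409a7f2692492000b987000b97e400172ed1026ccee4b1c9e3924a8137b67238e4d1c8a34b0b40579a554801ec92a2400ee72dae571ca65230053396472a8e51060c027b200ae7f200c3db200a03b200ba3a200ab3e200c0fa2009bfa200b6ba200acba200c25a2009dfa200b85ae00aa5ee00bfdae009a7ae00b5baa00a91aa00bf3aa00991aa00b4fa20485fe2044a1a20488fa20450da20672de2062f9a206793a206371ba0483bfa0444bb2047edb2043efaa04697ea0426ba20467da20423daa046cdaa042a5a2046b3a20428798005ceb24d24952300530c1804f6c0118fec00b7364011876400b6b4c00e53cc005eb4400e4b44005e34c00f1f4c006db4400f1744006d74409b33aa8137b64924d2090803669408001724804001b9a4120004c920100066713,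
 pn oN8 oN8 1 0xd4971e47c171e434969e2fc169e2b34e4acf1d929aa3c4f92a3c465054787c620acab8cc019530980067e8812f7f88129368812cde88125468a63bff8263bf69a53bef9253be6b2a10de8253bde9a43bc79243bbe250011e8243bb669c8f9e3324e478f0b9205b2f7f01b2cde0db293609b25469802f0701b2c46980287e09b248e9802c468802c26980248e880244e713277aca064ef3a760eebe660ee9948c1dcf0a780630a7805f28183b9669a20310de52a4783f224782c9350bc023c9cc79e0746c00634879e03250b0017caa10267e234ee3903318770c8040001f48787f300187f306184a518ed7e418ed5a118ed3a4180d19a4200068cc4a19d9f08001072983020e420004bc406018ab068000b10180629c09e00ac14c002730004765,pn oN8 oN9 2 0x1ac813a1f5902468f9022e6cd4409b6bc409c1b2510242bf102443d10224bd102282cc2a2eb198541d2320a83a3e9461d4f9461bae8810d368810b3e20800801ab803557b80126e42f0c80fed0c7c1ae004258a1835d816cc4dc06cbb38370aed8270a09a70c6c1e50c6a5a70c685a50c669a60029fa200281a600261a2002318800801890b00031206000208008100c039c411380a30205000218000f0496880009604f04868802b87000a61487800530a63800c3081630ee3898130be0c2ad004060431db701863b4c20001ad100601c2600c19840005b980c03526a50003660300d47833c009900c0351604f0066794,pn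 oN8 oN10 2 0x6ae06e9fd5e351a7dc0cc0b11dda7799dda7310186bbdc09c372538c42cf78c444d30224dd70228ecc2a2eb398541d2b20a83a4e9c61d579c61bb624f03fe9810b4620800801aa80355fb803476170079cd686408f7863e1d500213d7001e4c0b8623e0385d6c1b8577c138505d286361f386353d286343d386335c306044c206058d100131d300119c40040000041001001054e027c081c0007600400004708812ba7000a6148b800530a65800c3084c093df89812e4e0c28d0037e0030ce70030cee980273e10000e68802d8e13005bcc20002fc080796e0300d0fa14000d8100f2bc0601a170e780130201e5300c0341e14f00667a9,
 pn oN8 oN11 2 0x2fa7c002fa5a20aec5c002f9ba5268fbe20a6339a98036c782a013e7cc8f972600853e200881a6004938aa80e188541c4702d982786d959f00d96df04d93c73ded0c037667bc9150004c43e8d7cf8fa11f3a0a61537be4c7ca8f911a9810cdf88134cea813da68813d1eb4620cf9461f96a8111068810f9605b304f01b2dbe0db2b3e09b278e7bbaf730300dd38300dcd9eea3dc40cf003e89b289e6920030eb714c28d60030eae7c48f8f1f163e347c39103762ea604337ea04f69a204d33a204f47a204e4bdf0a4c080773e0c98036c75054027ca600d8fdf02421803b3df404f042e7bf9000001d19e084c29854de920030eb740061d5c8530a3592528d47df103319d68c419f502220d28c3f2d1021f2d102725f30201dc94c010a7cc00927440110315501c34c01b1f8278217421803b400000724a33c1099a0c037668a8002668300dd3833c00f920c0373689b289e7b8,pn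 oN8 oN12 2 0x200bf8f200bf869823a37200bf5e982236f982175e000bf9f5154028f300703d1007cbcfd3220084fe70c89588a80e3a6004ff82d0dc7c2a0dc7836cab9c170c29826c9c18070b898300d87df6e45400333ed4000bf974fdb5fbe3f647ee8fcf4530a879f9a3f446ae04d69e604d31ae04f67a604f45af18831e7187e3ae0443fa6043e38170c29c070b89836cab9826c9c18300d81c300d7b9f663ebc0cf289e0cf00467d88fad1a49f92bf0c983248614c28a67e38fc11f963f148813a3755026b4f5027b3d102698d1027a2d102723e4007dfc8800fbda600e07d45500a34401f2f4c01bc3bee48c300868803df68cf04668cf0436883007e7dd8298543e929832487490a6145324a2048dbe2045d7ad18831ea0443fa5187e3a2043e3a604e47c800fd5929c3225798013fe880213e22a038e8c30087883007e98037868cf04668803df64a33c10d9a0c0361e8a8006668300d81833ca27920c035ee0cf00467d6,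
 pn oN8 oN13 2 0x2d98a380d976f06d95f304d942b40ed81c9037206a6c01ce3c0746ad015e80d9900572f90061dd900500d9005d0db00462fb002dbd900460cd5a072cffb5ff20601c7f068401b00060ab80060a705a5d9305a1d7f000609b80060972000c12688236df882383e8823e6e8823f5e8802ac78802b268803036880308e88026f688027768802da68802e0e88221778822236882127e882142e7fbaff31fea3fc40c038e60c038ce850002e050006e6151764c82a0ebf80a0f65c2a0d6580a0f4382a0d2d98545d4f20a8ba960283d8f0a835860283d860a835760283d060a834a60283cfe0a834968829e578829cae8828dce8828bde9801e479801c9e9800dbe9800bce8801e368801c8e100045e100047e600182bc901a1ecb81a1e8705a1acb05a1a5b3000c0fe400181ec0b65fce0b65f7c0365abc0365a5c1b6550c1b6546c1364d0c1364c5cc00303390006063406580990172022452807b412807740548078001828e001827c169753c169752c001823e001822c97411ae7e411a7b7411ed76411e9b0a6148f8a614cf5c017f754017e35c0134b540131f5c016b3540169b7411073e410fd7741089364107db3fbd7f58fed1fd20601c5b0601c4f0680013028003302d98a380d976f06d95f304d942b02d97f380d96af06d954304d934302d97df00d969706d951b04d93175408d9fc408d6b5408d2b4408cf7540854f4408513540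84d344084773490141ec78141ec30141e830141e7f0541ac30541abb0541a530541a4b40bd8159027204640b4814902520424409b6fc409f374409c1f4409faf0006087800608325d026b9fd027b5d90269ed9027a6cd2492550372fe001806c800300ba204d97e204f859ffe3ff4a8137aea813efe10000f6201018ed8039c74d5a02bc9a8a500f64941280772b80395f803878c014d00320124014100009e8009900572f90061dd900500d9005d0d100558f100606d1004ded1005b4d100564d100611d1004eed1005c1c298523f7005fdd7004d2d7005acc298533d5005f8d5004c7d5005a6d10242ef10224fd102446d102285d1033caf1031b9d103395d10317bdd0241cfd02224d9023f5d9021f6d502367f502153d10235ad102144d50234ad502134d10233dd10211dd50572fe00180fc95c01cafa48f18029840002792d802317d8016dec8023066ad03969801e479800dbe8801e36100045e9801c9e9800bce8801c8e100047e881365f55026f5c20001ed1027c2caa04fbf88040639a0c038fe0d0803668300e39a14000b920c038ce050006e68300e2d8340009920c0389e05000667f4,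
 pn oN9 oN9 1 0x1f3076feaa06ea1ea0703daa068f3ea0660788a8ea1caa903da204c99ea04cd388a8cd3aa04f09a204713ea0477ba2042d5aa0434f92eaf27d6eaf25ae60eddee60edb9288123bf88123ae88117de88117ce8a64247826423e9a54237925422e8a54226825421e9a4420f92442068a441fe82441f62de23cf29e181e2de1c4f29e0b562de1dee29e0d3eb80195729e07eeb8007eea80063e05b23bf01b17de0db23ae09b17ce980194f01b07d6980194609b07be98007d6880061698007be88006067132842caa04105a76107be6610799022c513083bc816234d252a484df22484cc8a4c1059a49cc7a12f4a7a12b487a127288f022e501e058d10055af11a83ac8198c41ce4044620e320c30a2041afa604a97e419069a604bf5a019067850ca97d0e197eb2880286f1300518d206832c286518ca600bb9830806401b984030009c908c1d97000482c,pn oN9 oN10 2 0x3b019a3ab81ba8fb81c0feb81a3d7b81982642abab74aac116981326fb81335622a335eb813c2e9811c57b811df69810b5eb810d4643ab41753ab40e25f333f35f33364a6048f1e6048ed8c640f3a6045f5882007c441810018c91afa4f4c2718c8de794f05b318c8eaf14f06a718c8c8f94f03ff54003f35c0032300c117b80d8bfb08c117304d8bf300c0c8780d83ef08c0c7f04d83e746d815744d810b44003db4c003071022040e388009f0000bf082002002002000008802b3700100040001f4cd9eeb0041004c0933789812d4e028653fe070cbe98440123b898024d60286512c2600b0d810206400b88003000bc000180056851,pn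 oN9 oN11 2 0x13868fbd286627a20aec7e20b057a20a907e20a63790aaebbd2ab04fa600cade200ce988a8cdfa200f19a600731e200799a6002fda200377a660fabe660fa98060853c460881806c4af826c517a16ac2c48598450006c4433d86590cd2a701058134af7e18e432486289bd47de93d313c63237de53c170c6323afc53c1add502330f50007dd502112d1020d4c030429e036257c230440c13628bd0af41000f9a15644001ef42b485481b0003c130002cd2a9c041699b1a2799b09668608036045d0c3217a42fc01b02c6881bb1f881c15e3191bef3191d7e29e0b8629e0d6e88135378813d562d303fe85d9300656e45466fd100674d10078cc28651fe28652fc3865e2c3865ecd100063d0b926000eba16e02695efa4a66c689d2533612cc806c08b806c0b1a206907e206637aa04661ea04225aa000fba2041a9a204d4dcb4c0ffa204f5594c00e63cc005fb4400f3344006ef0a1947fc40018f0e1978b4c001d70a194bf21c32f664d222800366906c000f02001f3288003de0980016854,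
 pn oN9 oN12 2 0x43446de442305d30475af304824d30447cf30430ec454752e46c752c45464ff300673c45466dc554787d100397f3003cbd10017dd3001bad3317f3f3307f3c230427e0b644ac136255c03628dd0dd61c2414001b437c000c41750ff620644e01c7440487ca098576d0f721f618c91b794f0c1718c8def94f05bb18c8eb714f06af18c8c9794f04074c0841f14f032b02d912b80d8a3708c109f04d8957435d86890db21aa42c000f0cc000b43648698d289c038e879b0ef226c685806c09fa1e243b487a803605fd10275af102824c43237be4323adc43c16ec43c1abd1026a5f1027a9c88010eba600ce7caa8f0f88a8c9f88a8cdb870cbc3c70cbd7850ca3d850ca5da1ce438c87490e50130aedd25136342e9201b027e01b02fe4a2048f9e20461d886464be20420f88782038878195a604d4bc8010fda604f5394c00f2fcc006eb4400e5f44005f70a1947ba1c32f0e428652ec870cbd7934a0a000d9a50b0003c921980016868,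
 pn oN9 oN13 2 0x18231701b180e118230609b17fe8b4b16722ca15682576c01d33ec0206f6401d2f640206b64015e7e401893640141f640175f6c011d3ec00bdb64011cf6400bd7448d890911f08bc00d88a8dc3caa8fa588a8e1d8aa8fe188a8d59caa8f5d88a8d218aa8f3b88a8ca5f20acfb88a8ce38aa8f15a204a51ea04a71a204bcfaa04be1a204955aa04971a204b21aa04b39a20a733f20a79ba20a30db20a387a23ac45c88d91152232444c82a002682a0066236370f23638762b63e962b63f86000c5cf000c5c640018b7c63442ee634446c542258c54228fd16362ba45848ad915f22b204a4827049e882a3ff88223de88298ae882185e9802397980238698017969801776880238e880237e880178e880176e236356723634862b63d762b63cee60018bac918d102f98d0f93150885b150879f00c101380c0f7700d883f00d878308c100b08c0f6f04d883704d877b3000c55e40018aad145627a450c89d9141227244fc89b863242ee53c258c632446c53c28fc63240be53c216c6323e4c53c1e7c63237fe53c172c6323b1c53c1afc632346f13812ec632362c53c150c632338c53c11bc632354c53c141c632327e53c103d90410ac53c0cdd1116216443c884910d220e06c800f04c800b00c118b80d8c0708c118304d8bff00c101380d883f08c100b04d883700c0f7700d878308c0f6f04d877b00c0c9b80d840b0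8c0c9304d8403540843300d831b440841304d8313348ab412b9a412912504e093d153629e452c06d9151229a452407e846c652e46c671d90367dc56c78ac0018b6e0018b5c918d0dff98d0ec715085cb15086bf349240db01fa540daa7d40deb72000c4d6143290714329868959127070cbc7870cbdba2524494d803a67d8040dec803a5ec8040d6692492b803547b803d66a80353ea803d5e8999131225e44b4c802bcfc803126c80283ec802ebe88129478812f3e88125568812c86a8129c6a812f86a8125c6a812ce63191a373191b1631919c63191aa689c097629e0a8629e08de29e0a0e8819ccf8818c36c819e6ec818e1e881a3ff88198ae88123de881185e31a193fc8108562a1081e2a1066e0181937a81086601b081601b06361181926881082609b080609b0626a82b54f000c51ea82bd6e57006a8eae00f5995401a9f2a803d5e5b00474fb002f6d900473d9002f5d300472f3002f2d100471d1002f1d300470d3002eed10046fd1002edc286520e870cbc790a194c321c32f6e4d222f003669415001324a0a80199a41b2003c920990016883,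
 pn oN10 oN10 1 0x3460c6bd6c09d5fec0a08f5e351b3ec08c2b2955d5fad5608f4c0993bdc099b319519b35c09e1b4e30debde30eb34c085b75c086ab01d597789d597348c18d3c8c18cf22983b669c622ff9c622ee39903d698117ee8a6468f82646869a5467f92546768a5466e82546669a4464f92446468a4463e8244636399236759e98563991bd739e0b6e3991d6639e0d56b43191739e07f6a8007f6b80064e09822ff9aa03d619822ee19b17ee943190705c928631ec3360f8d1b605cc09922001f1a6001879c4ca32f281946569d8462f998462652308c3ca261185940c230734d252a48d6f2248d5c9349398f46a694f469e90f46964928802adf88d460640cc622ff20223117d90a82c1bf1700836e2a0106b84c0930bc8322f74c0968f40322f30a1930ba1c32d1e5100485e260092ba40d177850c92b94c015ff0040418f0180830d03200dc08082fe030105da060013810105b840c1d9700048bb,pn oN10 oN11 2 0x17868fdd686629a208eb9e20904da5268ffe20862194aaebdd6ab0518ca8ca3e200ced8ca8ce18ea8f13a70c721e50c789a600301a20037ba460dcbe460dc98260855c660883aaa0105866c51981010b5c3010dda36a014001b111d1639a473c8e58098578f1c7239247145dea3f759e98a63991bf739e0b8e3991d8639e0d76399193739e0816881084e39e06660982157a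a80416198220e19b146604042bf07c818086bc180868d1b301a602c000f00c000b34948d8d17c8d84b747048de91c32060231a37e40c05034409d73c40a09b1cc8dfb9cc8ec31cf05c71cf06bb4409a2bc409e6306981bb46ec32a328f32a338688033b63aa3c4e143251f14325961c32c5e1c32cbe880032e8dc9300077d1b70130af1d25236345e9291b096e81808c65030140d28d47ff102310c732326f102109c73c102c73c0ccd10268ae1a606ed102798ca70c721e600301a50c789a20037b850c947e2000cb870cb17a6000ef850c96590e1965f204042d7418086ec050006c080857e83010d7816000781f2034c0c0434601800168d9,
 pn oN10 oN12 2 0x14d11bb9908c1b4c11d6fcc120974e491efcc10c3f1951d4f99b1d4f1951943cc019d719519bb1d51e234a18e3fce18f0f44005ff4c006f348c5c4bc8c1c4b0cc10a384c110b0cd895b5140207060216382021c3514001b475c000c7ff51f963fa47dc8fd91f14130aefa3de47cc399237739e18363991be739e0b7e3991d7639e0d66399192739e0806981084639e065e0982217a28040e198214619b12b60c042af07b808086dc08086ad1b0003c230002d1d523a634947ad8f29036343d03612bd1e923c647b48f3910275bf102825c53237ce5323aec63c16fc63c1acd102689f102797c88011e1a600cebcea8f118ca8ca18ca8cdd870c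b15c70cb2d850c945850c963a3ba47648ef91db0130aefd25036343e9281b095e494a311efc408c3f14c8c93c40842318f040318f032f4c09a2790023eb4c09e5f29c31e1f9800de69431c7e8800bfe1432517438658ac850c96390e1965b204043874180858d450006c08086de83010aba36000781010d5903dc11800168e9,
 pn oN10 oN13 2 0x2608c7e8bc10786608c3866c601a49ac92cd8045a6c80459ed803a77d8040eec803a6ec8040e6c802bd7c80312ec802846c802ec6dc322dfd8017c6d4322d6c8017be040448f904818088fc05e006c6546e2e7547d3c65470fc7547f1c6546ade7547afc654691c75479ec654653f90567ec654672c75478bd102529f502539d1025e8d5025f1d1024abd5024b9d102591d50259dd293399fa933cdd105187d9051c4c08088ee08088bd207240a060223306022274950013495003319b1b8b99b1c3f1db1f4f1db1fc700064ab80064a744122e744122e31cd10bf9cd111f1d089671d08a434925922924724864c022c74c022bb44022c344022b74a4d20fca491f34410c374410c334e19167ce1915f4c00bd34c00bc34a191634a1915b4400bcf4400bbf19b1ab799b1a471db1ebf1db1e7b388145ce51028b8c73440ce7343e5c742217c7421e8c130405e1303ded03206cd03207ec330403c3303dcc33620ec3361dfcc0032419000647f48ad91192292442489c90f9225243a1c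c90bf9cf09671cc911f1cf0a431cc90339cf085f1cc8f971cf07a31cc8e039cf05cf1cc8ecb1cf06c31cc8d1fc0e04bf1cc8d8f1cf05471cc8ce71cf04731cc8d571cf050b2cccc9facf440f641042f1cf033b02022238202217480c9008180886c180883c0b2003c032002c130463f45e083c330461c336300c130405f03206cc330403c33620ec1303ded03207ec3303dcc3361dfd68c330e0fb066064b866c203a20420d81aa44084170cd831735b008b4d9008b3cd4c022c744022c3253008aed1008add23d647248d4918923b246e48cc917866c653e66c672d90367ec76c78bc001928e001927c91cd0e039cd0ecb1d085cf1d086c3349249540da37d40de6f2000c86e1432527143259e908920d070cb19870cb31a41e482cd803a77d8040eec803a6ec8040e6692492b803467b803cd6a80345ea803cce90c9217242a484cc802bd7c80312ec802846c802ec6881294f8812f46881255e8812c8ea8129cea812f8ea8125cea812cee3991a3f3991b1e39919ce3991aae81c097e39e0a8e39e08e639e0a169469ccf8818c3ed469e6ec818e26946a41f881186e94623e6881186659a993fc81085e5a1881e3a10676b461987881083607d80d5066064ba20420b866c203866c18baa0ad1bc00322daa0af3795c01a33ab803cd6550068bcaa00f3396e1916fec00be36a1916b6400bdf4e19167cc0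0bd34a191634400bcf4e1915f4c00bc34a1915b4400bbf0a19293a1c32c6642864b3c870cb3190202247a0c0447e02f00360404477418088cd254004c08088bc8301113a4a80198101111d060221b02c800f020221720c0441e0190016900,
 pn oN11 oN11 1 0x38a905c28a631a208ec3e209055a208905e20863180aeec3c2af055a600cb3e200cf580accf5a200f1fa70c729e50c791a2ac117a2003818a01b498701b497601b497e001006e930b25d24be00e00370125d8785260ab4ec0e53cac0f23452022f44d87034cd9967c4d99eb01219eb0521e3f06fd20b84fcc6308e0e53800822f08e0f2304f87034408cb7c4e043f440843f440835f00da4c380da4bf00da4bb0008037496d92b9259002600da4af416401b004e00093b0394f14808bd2b03c8d1361c0c0b062ee23004ad136661d33605ac0b0661c23005ac1b0768d030931d102761f10282ac238394e2383c8c00208bc13e1c0c202394e2023c8c03808bc10c1c0d300659e05667ad10067ad10078fd30062ee086661d100661d100768d10004ac20605ad30005ad263266ccb3c090cf5a26ccf58290f1f8160c5dc160cc3a26ccc38360ed1846009584600b5a66c0b5a061263a204905e204631a20465be20421fa27021fa2041af8404729c07011784047918218381a70c729e2ac117a50c791a200381a600c5de200095a200cc3a6000b5810ccc3840c0b5a200ed1934807001b980da4af201b004e50590026000492b,pn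 oN11 oN12 2 0x3a481f33a317d304760f304829c004481f304317c056764e06e764c056658f300679c056678c15678ed286393f3863c7d100183c20608ac00193ae806d26bc06d26fa00400b806d26da4d6c9bc81c002e9368048764e060764d2b0393f3b03c7d136183c23008ac048658f336679c048678c14878ed138481f138317c238392e13e182c2383c6c13e1bfc00232cf13810ed30210ec00c0d6c036937e036936c036935d002005d26964ce00da4d3005c01b005e01b005601b499e00a93b03c7e23008ad2b0393d136183c0b062de230040d336660d2730160cbf84600a78360ecf806d271a204ec1e2050538070725c07078d807c305807c37f8004725c00478d8018305801837fa600cf3c2acf1d80accb180accf1a600cc1c30cecf810cc5b810ccbf806d273a4e20818103081814f4cd99e78521e3b012196301219e34cd998386c1d9f02c18b702c197f201b49c61180206118029e881240f88118be8811967881087699c087608606b61011c970860c161011e360860dfe9c31e3f10304569431c9e8800c1e043316f1030206980330601b49ce04332fe103029e0c33b3e4d281c002e01b49a701b499e403600bc017002a201b0056933,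
 pn oN11 oN13 2 0x6d291c06d28f806d28d820600db7608c7dabc107b5608c5b26c603b26cafbf26cc51b26ca17b26cbb7b200afbf200c51b200a17b200bb7b70c8c7dab6107b50c8c5b200603a522ca3c946845f006c0566e5e1567d5c057712c1577f3c0566b8e06069dc05669dc1567a5c05665bf905680c05667cc156791d10252bf50253bd1025ead5025f3d1024add5024bbd102593d50259fd10539bf9053cfd105189d9051c6d28b650e4a24942803694bd28320ac009a0ac01980dcdcbc0dee2582dcfab82defe780c0dcbc0c2e2582c0fab82c2fe7a274869e276899a2744b7a276525a760855e76088588a01058aa0103a560853a26c895a26c4afa26c51ba208869e20a899a2084b7a20a525a70c855e70c885889c1058a9c103a50c853a200895a2004afa20051b80dcd71c0dcd3b8090d3b82dcf4b8090dcbc290fab8092e258292fe7a276737f27679fa276313b27638d806d28bc06d287806d289806d285a52e00da50741200134120033012196fe4eda0301219f30521e4744e14afd4e14ef44e17ab54e17cf44e12b754e12ef44e164f54e167f44e10d3c4e096f44e513344e4a4b44e4e6fc4e462764e4f3f64e471b08e0e5b84f861708e0f2b04f870b08e0d2f84f84df08e0d9f04f855708e0cfb04f848308e0d6b04f851b0810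cbfe4e0447641044704483674a0593d927f24f249f493b81b8003c138002c036948e036947c036946c103006c036945e036944ca090009806d287806d285806d283a090019806d281c06d27f806d27d8304007806d27b806d279806d2778204005b7608c7dabc107b5608c5b26c603a760855c8a0105a560853a26c4afa7608858aa0103a26c895a26c51b8160c65c4600cfaa70ccb806d2958160cc784600f38360ed7806d29380dccb7c0dccf9b206d0182dcf2380c0cb7c0c0cf9b272d0182c0f23847472dc474795828830b82883858160c65c160cc784600cf84600f3aa70ccb8360ed7806d295806d293840872dc408795822430b8224385810cc65c10ccc7840c0cf840c0f3aa04ccb830ced7a52a4a4cc9b2befc9b3146c9b285ec9b2ede89c295f89c2f5689c256e89c2c9ea9c29dea9c2f9ea9c25dea9c2cfe1011a5f1011b3e10119f61011ad608609be0860aae08609060860a36c802befc803146c80285ec802ede881295f8812f56881256e8812c9ea8129dea812f9ea8125dea812cfe11c1a5f11c1b3e11c19f611c1ad609f09be09f0aae09f090609f0a368819cdf8818c4ec819e7ec818e3688121a788112de881a2668819496101197fc81088ec9d088e08606ce01b4a0701b49ee01b49fe01b49e601b49f601b49de0c1001e08100161011cb70860c2e1011e560860e161011a5f08609be1011b3e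0860aae10119f608609061011ad60860a36dc3231f6ad841ed432316c80180e9c321572270416943214e88012be9c322162a7040e8802256880146e0433197103033ea81332e4086663c206079c18676bc9a445f006cd00da52f415801324a0ac0199a41b8003c9209c001693b,
 pn oN12 oN12 1 0x162a40712298b69823aff91d3afe002240798218b612bbaff137bafe88032bf98033be12b33be9803c6e9431c8f9c31e2e8800c0e9800df600149970024996953a0b692ed2a5000401ba10125de06d2a7a07001ba06d2a58092ebfc0c2ebfa160723e36078ba06c303a46c37d8090cefe46cf1ba06ccafa46ccefa17e901c67e62d8670723c67c303867078b867c37d8004657e07021ba60421ba6041ab816d25dc00401b928404967009929d206d29ba06c01380024a6c94c91b03c5f2361bed0b0391d036181c0b065ee136950c1b0766d23094fc0b062bd2a3246ccbda0612a1a204ebfe070ebf8270723c27078b847c303847c37d800478bc004723801837d8018303a600cefe600f1ba200caf84accefa600cbde600ecda200c57850ccbda40d2a1a53e427a5474a8491b3c6f91b33be02433be81b32be0d83b3791b32f605832f6058315e9184a7e8184a8609b4a865102480f102316d10232bf10210dd23810dd1020d5c2023c5e10c1bec202391c10c181d3863c5f3001bed286391d100181d10062bf09e951d30065ed206950c2866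5eca600ecd940da54fc0da54b42024bb40e00373508092cd036009d03694dc8026000494c,
 pn oN12 oN13 2 0x5b4a37081803696192c133608c3f46c601b1608c1b06c5ffb06cc4ff06caf9b06cbb5b06ca15b200af9f200c4fb200a15b200bb5b70c8c3f600601b50c8c1b2005ff826d2c3c26d2c1830128d80be00d84acdc9c6acfa984ace2586acfe784acd6fc0c0d3984acd3986acf4984accb5f20acff84accf786acf21a204a55ea04a75a204bd3aa04be5a204959aa04975a204b25aa04b3da20a735f20a79da20a311b20a38b826d2bfc26d2bb826d2bd826d2b9866d2978301283a4ac009a4ac01984dcdc9c4dce2586dcfa986dcfe780c0e25c0c0dc982c0fe782c0fa9a074867e074899a0744b5a074525a360851e360883a46c4ada46c519a16084fa160881a06c4aba06c517a208899e208867a208525a2084b5a70c883e70c851a600519a6004ada50c881a50c84fa200517a2004ab84dcd6fc4dcd398090d3986dcf498090e25c290fe78090dc98290fa9a076735f07679da076311b07638b8401297c16d283a090009a090019a57e4aec95e92b90090cf7c290f218090cb5b076cffa070bd3e870be5a070a55a870a75a070b25a870b3da070959a870975a070867e0704b5a070899a070525a072735e072311b07279db07238b867072bc67c3098670793867c3838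670695c67c26d86706cd867c2a9867067b867c23f86706b3867c28bb20865df070221b20822182241b1826d2b3c26d2b1826d2af826d2ad830127d830127781700078070005816d28dc20600d921004a5f82400264816d283a0900199205b49f70c1001e95992af016d2778204005a5624ab4cd8230fd1b1806c582306c1b17fe8d8214791b12b6858213e81b12ae8d8220e91b1466858220681b145e058331709b4aae0d83b4e09b4aa6058318695b9438664d2b504dccb5c4dccf7b206cff86dcf2180c0cf7c0c0cb582c0f21b072cff867472bc674793868830986883838160cc5c160c61826d2ab906c1da750e199304da55321021e4f1021cae0890e0e0890c261433187143331609b4ade9559502664c386769c13695ad2a9306cc4ff06caf9b06cbb5b06ca15a070bd3e070a55a070b25a070959a870be5a870a75a870b3da87097584046cdc40469584046b3840467b82182a9821826d821828b821823fb200af9f200c4fb200a15b200bb5a204a55e204bd3a204959a204b25aa04a75aa04be5aa04975aa04b3d8670695c6706cd867067b86706b3867c26d867c2a9867c23f867c28ba206735e206311b20679db20638ba204899e204525a204867a2044b5840465df204221b07422182181b1816d27dc16d277830400782040059248404793c218383840472b821830984046cdc2182a98404695821826d84046b3821828b840467b821823fb70c8c3f600601b50c8c1b2005ffa70c883e6005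19a50c881a200517a70c851a6004ada50c84fa2004ab850cc61c26d2b7aa04cc9826d2b5850ccc590e19da7209b4b0f09b4b060c04a3602f803609b4aff09b4af619b4a5e92b002609b4aee09b4ae60c04a0e92b006609b4acf09b4abe0c049f605c001e09b4ac609b4ab60c049de01c0016954,
 pn oN13 oN13 1 0x267e905c170903a67e631807062fa27e903847e901a27e62fa27e62da67a8fde7648dda67a629a67860da27a8fba5648dba27a627a27860ba600dc5e600e1fa600fa7a600fe3a200dc3a200e1da200fa5a200fe1a200abde200ad188309c588309e5a2009c5a2009e5a200b71a200b8ba70c85fe70c88fa6004b3a600521a50c85da50c88da2004b1a20051fa5fecbec97e92f92679311a5ee4100017010003711c5b8b95c5f4f11c5b8715c5f4b01c5c3f05c5fc701c5c3b05c5fc321c1af3a5c1edf21c1aef25c1edb21c1a8725c1ea321c1a8325c1e9f4c0d977ec0da0b21c1a0b6c0de4f440d973640da0721c1a07640de4b44114b3d4114f31061353106132744112bb54112f3441165354116834e34e6fee34f3f4c0c62f6c0c7234a34e6b6a34f3b440c62b640c71f54125ebc4125df54125e744125db52125e342125d741c001341c003344f157bc4f15a3115138b11513cb44f138b44f13cb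44f16e344f17174cf1b8bccf1c3f4cf1f4f4cf1fc744f1b8744f1c3b44f1f4b44f1fc300f25ff80f25f700f25fb00f25f34c44a5e4bde802002e002006e9d9217f9d9223e99e12ce99e14869592176959223689e12c689e147e001a4179c6240e98198c600618be881a40e881a40688198be88198b6980a3f79c3237698098a69801836880a3ee943236e880989e880182e8a02967aa029e622a26a622a264e8a02576aa025e68a02ca6aa02d0699fb2efd9fb4164303416d9fbc9e89fb2e6c9fb40e430340ec9fbc96aa04bd78a04bbeaa04bce8a04bb6a604bc68604bae830002683000669dc9cdfddc9e7e99f8c5ed9f8e4695c9cd6d5c9e7689f8c56c9f8e3e230b7172b0be9e230b70e2b0be96030b87e0b0bf8e030b8760b0bf8643035e74b03dbe43035de4b03db6430350e4b03d4643035064b03d3e05c23f705c23ee01c18a601c189e11fa37611fa36e09c983609c982e25831af2583346e8046c64af429eaa033462d83b7ee80429ec804286f8035e7d80350ef803dbed803d46e8035dec803506e803db6c803d3e24c296724c29e620c257620c25e6b81a6a6a81a64e28c2ca628c2d06fc320efdc31fb6f80113ed800fcef4320e6d431faee801136c800fc697ab2ef25e64bb497892eb02800098080019a278abdc8a89c5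a2789c5a278b71a278ad188a89e5a2789e5a278b8ba280a59c8a89a9a28095da280b29aa80a7988a8993aa80979aa80b4189a8a59c8a895dae7e9a98aa8b2989a8a7988a8979aa7e9938aa8b41a604a23c8a8927a67c927aa04a2f883092788a893fa27c9178830931a604927a204917ae0493faa0493189a8a2f88a8931aa7c931aa04b0b9408699e20a67f940867f94086b7aa0a271a20a2439224243b20a28fa5d2d40a5cf4b9c970803c981d502972d2e525be00f2603520a5c74b8c96e813c007d054513c13c513c13c008c4716e2e4716e1c07170fc07170ec5717d3c5717d2c1717f1c1717f0d33f65de860682d13f65cc860681db3f682db3f793d93f681d93f792c64142fe64142ec241447c241446c547259c547258c147290c14728fc4b0634e4b0667c4b0633c4b0666d5008d7c050852d33076cc150851d73e667c5b076ed53e666c5b076dd500852d10084fd500851d10084eca0439bea043cfca0439aca043cec91218bc9121c8c91218ac9121c7d70041bf3003f4d70041ad3003f3d70021cd3001eed70021bd3001edd500419d1003f2d500418d1003f1d50021ad1001ecd500219d1001ebc8706bce8706bbc8706a1c8706a0c9707b7c9707b6c9707a8c9707a7d33c6e2f33c7d3d13c6e1d13c7d2d33c70fd33c7f1d13c70ed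13c7f0ca4041dea4041cca403f6ca403f5c946227c946226c9461f9c9461f8c0b841be0b8419c0b83f4c0b83f2c03821cc03821ac0381eec0381ecc1b841ac1b8418c1b83f3c1b83f1c13821bc138219c1381edc1381ebdf3c6bcff3c7b7dd3c6bbdd3c7b6db3c6a1db3c7a8d93c6a0d93c7a7d30f6e9130da61a4c24b904c36a904c2e9904c268904c1e01e4c369a44c2698593070079309a2913078079307a60a19050bf951c96719050bb151c963090511f051ca43090511b051ca3f2901077a51889f2901073251889b2900fdb25187e72900fd725187e32900e6fa51862f2900f3f25187232900e6b251862b2900f3b251871f2900d33a5184e34504cff45044872900cff25184872900d6f650451f0230cbfd5004470030447003034f0630cbb55004430430443043034b4b6d96a92d925a64b5c96881c0003c140002c03c97fe03c97eca00800b80792fb80792f9a9792f7800801baa812f5ea812f3a9812f1a0c0009a2812efa2812eda1812eba0c001980792f5c0792f380792f1820800980792ef80792ed80792eb800801980792e9e6064c04080003ea9f4b9ea9f4b96a5f4b8e80c289e01e4b9e01e4b9601e4b8e080289e01e4b8601e4b7e01e4b76080004601e4b6f01e4b6601e4b5e0c2001e01e4b5601e4b4e01e4b460820016967b2cd2592005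c01e4b3696592c7002a4cf25934cf258f4b14009803c00bc03c00ac03c009c001267e905e67e631a27e903a27e62f8170903807062f847e901a27e62da772737e67e317a572735a27e315b77279fb67e391b57279db27e38f81708fdc070629847e8dd827260d81708fb8070627847e8db827260b8170837c07043983708358270437817083380704358370831827043381707e980703dd83707e782703db81707e580703d983707e382703d79c0865fc070223aa0865d8270221aa08223a2081a7aa08221a2081a5880465bc07021fa718659aa7c21dae0421fa6041a3801821d80181a1aa04659807021daa04657827021baa0421da2041a1aa0421ba20419fa67a8fde67a629a27a8fba27a627a7648dda67860da5648dba27860ba76485fe6784b3a56485da2784b1a76488fa678521a56488da27851f8960c6bfa011b1aa80cd1ba010a78960cd192bd0a78b60edfb2010a18960c69ea011afae7cccfaa010a58960ccf80a10a58b60edda20109f8960c67a660ed9aa7cccdaa010a38960ccd82a10a38b60edba20109dbf6483bfe7844fbd64839ba7844db7647edb6783f3b5647ebb2783f1ae78837ee78439aa78833aa78435a6787e9a6783dda2787e5a2783d9ae78835ae78437aa78831aa78433a6787e7a6783dba2787e3a2783d789a8a59c9a8a7988a895d88a8979ae7e9a9aa7e9938aa8b298aa8b41be78d79f678d43be78f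6fb678f51ba78d77b278d41ba78f6db278f4f80792f5c0792ef80792f380792ed80792f180792eb82080098008019bf6483bf7647edbe7844fb6783f3bd64839b5647ebba7844db2783f181188fdc1188fb8018629801862784068dd84068db821a60d821a60ba208c6bc910cd193551b192550a7aa08cd1aa08edfba790a792550a1a606cbbd0e0d05a206cb990e0d03b606d05b606f27b206d03b206f2588c2dc5c8c2dc380c2e1f80c2e1d8ac2fa78ac2fa582c2fe382c2fe19480737d48079f9480735948079d928c317928c391928c315928c38fae78837e6787e9ae78835a6787e7ae78439a6783ddae78437a6783dbaa78833a2787e5aa78831a2787e3aa78435a2783d9aa78433a2783d78c0a85fcc0a85d840a88f840a88d8a264b38a264b18226521822651fa604c69c910ccfa204c678910ccd81491af80490a58c04ed982490a3ae04ccfae04eddaa04ccdaa04edbaa790a5804909faa790a3824909da600dc5e600fa7a200dc3a200fa5a600e1fa600fe3a200e1da200fe190c0d79d0c0d7790c0d4390c0d4192c0f6f92c0f6d92c0f5192c0f4fbe00d79fe00f6fba00d77ba00f6db600d43b600f51b200d41b200f4f9dc8261b00f261b00f26135d2261b54826174d22613452260f29904c26403c983ca2413079250220ef50220e65021fb6502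1fae489113e48911364890fce4890fc604620df04620ce0461fa60461f9600610e600610d60060f760060f660c620d60c620c60c61f9e0c61f8e08610de08610ce0860f6e0860f5e8802af720c271688027168802dc68802b4620c279688027968802e2e882296720c26a688225768822ca6a8229e620c264ea8225e6a822d0624c296720c2576b81a6a628c2ca624c29e620c25e6a81a64e28c2d06981288f20c249e981249e26a28be22a249e22a24fe881245e22a24c699f249e89f245eb8124fea9f24c6a8128be20c24c6a8124c6a812c2e5201a678a099fe52019fe5201ade4a309c68a0890e4a3090eca08a3e01e4ba7a9f4b9e01e4b9e01e4b86553e972c03c972c03c96fca97d2e380792e380792dd820000fa030a278200a2782000119408699ea0a271a20a67fa20a243940867f922424394086b7b20a28f9408737d224317940879f922439194087359224315940879d922438f80792dbc0792d580792d980792d380792d780792d1830800782080059c0865fea082238070223a2081a7aa0865daa082218270221a2081a58c0a85fca264b38c0a85d8a264b1840a88f8226521840a88d822651f940883bd22444f9408839922444d94087ed92243f394087eb92243f1a71a737e606317a51a735a206315b71a79fb606391b51a79db20638f8006905e606631a206903a20662fa718903801862fa206901a20662d811865fc018223831865d8218221aa8022380181a7aa8022182181a5880465bee0421faa04659aa0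421d807021fa6041a3807021da2041a1a718659801821daa04657aa0421baa7c21d80181a1827021ba20419f81188fdc01862984068dd821a60d81188fb801862784068db821a60b8118837c01843983188358218437811883380184358318831821843381187e980183dd83187e782183db81187e580183d983187e382183d7a70c85fe6004b3a50c85da2004b1a70c88fa600521a50c88da20051fa6028fde602629a2028fba202627a70c8dda60060da50c8dba20060bbf0c83bfe0044fbd0c839ba0044db70c7edb6003f3b50c7ebb2003f1ae00837ee00439aa00833aa00435a6007e9a6003dda2007e5a2003d9ae00835ae00437aa00831aa00433a6007e7a6003dba2007e3a2003d7a208c6bd3551b1aa08cd1ba790a78910cd192550a7aa08edf92550a1a604c69c1491afae04ccfaa790a58910ccf80490a5ae04edd804909fa204c678c04ed9aa04ccdaa790a38910ccd82490a3aa04edb824909d9a99e4c46820002e49010003754125ebd4125e752125e341c001344125df44125db42125d741c003334828000992404000ccc0793038079301827800faa052e7aa052e5a9052e3a0a8a2792413c513c9209e004669070000f248280005980f259b4cf259300f002f2533c963c03c00ac9201e004e00b801500260004962]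
def obN : List Ob := [
 oN0,oN1,oN2,oN3,oN4,oN5,oN6,oN7,oN8,oN9,oN10,oN11,oN12,oN13]
def rtN : ℕ :=
  0x986b63a74a8663a73a8663a73a7663a7398663a7397663a7397563a7a74663a7984663a7ab6463a7ab6363a79b6463a79b6363a79b5463a7ba6463a7ba6363a7ba5463a7b96463a7b96363a7b95463a78a6463a77a6463a77a6363a77a5463a7796463a7796363a7795463a7b86463a7b86363a7b85463a7b76463a7b76363a7b75463a7a86463a7a76463a7a76363a7986463a7986363a7985463a7b9586357b95763575849635757496357395863573957635795476357379563575894635793586357579463575793635795836357957363576958635769576357473563578375635785736357645863576358635763576357584963677396636795736367b9646367b9636367b954636789646367896363677964636779636367795463679864636798636367985463679764636797636367975463676b596367374663678573636759646367635963676954636768546367675463675b596367757363676964636769636367595463676864636758546367676463676b4963375b496337b6496337b5496337b9486337b9476337694863376947633759486337594763373b9663373b9563379648633795486337964763379547633738966337953863373796633737956337b39663374986633749856337764963377549633739866337398563373976633739756337b59363379386633793856337937663377593633796836337739663379583633795736337b9636337896363377963633798636337976363374b39633739486337473963374938633749376337a3966337453963374936633749356337453863374836633735486337453763374736633747356337a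59363378376633773866337837563378573633763596337635863376357633749486337494763373938633739376337494563373936633739356337454863373836633735386337373663379593633785836337757363376963633763686337a7b96337a769633779486337793863377638633775486337753863375b9663376b9563375896633768956337579663376795633753966337639563375986633769856337597663376975633754866337538663376385633753766337637563375936633758366337573663374983633749736337458363373b6963476b4963475b4963475b396347b6496347b5496347b9486347b9476347b93863476948634769476347386963475948634759476347593863473b9663473b956347964863479548634796476347954763473896634795386347b39663474986634749856347764963477549634739866347398563473976634739756347b59363479386634793856347937663477593634796836347739663479583634795736347b9646347b9636347b95463478964634789636347548963477964634779636347795463479864634798636347985463479764634797636347975463474b396347394863474739634749386347a39663474539634749366347493563474538634748366347354863474736634747356347a5936347837663477386634783756347857363475964634763596347695463476458634763586347685463475764634763576347675463474948634749476347393863474945634739366347393563474548634738366347353863474745634795936347858363477573634769646347696363475954634768646347636863475854634767636347a7b96347a7696347a759634797b96347976963479759634789486347893863478638634785486347853863476b9663475b9563476896634758956347679663475795634763966347698663475985634769766347597563476486634763866347637663476936634768366347673663474b94634748946347479463473983634739736347358363474964634749546347486463474854634747646347376363473b8963868b6963867b696386b8696386b76963868b4963867b4963867b396386b8496386b7496386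b6496386b54963863b9863863b976386b9486386b9476386b9386386b93763863b9663863b9563869648638695486386964763869547638638966386953863863796638637956386b3966386b9856386b9756386498663864985638675496386398663863985638639756386b5946386b593638693866386948563869385638675946386759363869683638695836386b9646386b963638689646386896363867964638679636386986463869863638697646386976363868b7963864b396386ab986386ab97638639486386473963864938638649376386ab956386a396638685796386453963864936638649356386453863864836638635486386453763864736638647356386a5946386a593638683756386857463865964638663596386645863866358638657646386635763868b8963867b7963869b9863869b976386494863864947638639386386393763869b956386898563867975638649456386393663863935638645486386353863864745638637366386373563869594638695936386858463868583638675746386696463866963638668646386636863866764638667636386a8b96386a7b96386a5b96386a5896386a5796386ab696386a8696386a76963867b9863868b9763863b9463863894638637946386398463863974638698b9638697b9638695b963869b8963869b79638695896386957963869b69638698696386976963868b9863867b976386859863864b946386489463864794638649846386497463864964638648646386476463868cb963867cb96386b7896386b879638667896386578963865879638637896386ba986386ba9763866a9863865a9863865a9763864a9863863a9863863a97638693486386943863866438638654386386ba966386ba9563868a9663868a9563867a9563863a9663863a956386978663869785638698756386478663863786638637856386387563869436638684366386ba9463868a9463867a9463867a936386978463869783638698746386678463865784638658746386756363865b8963853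b896385b58963858b6963857b6963857b596385b8696385b76963858b4963857b4963857b3963855b4963855b396385b8496385b7496385b6496385b54963855b9863855b9763853b9863853b976385b5986385b9486385b9476385b9386385b9376385594863855947638559386385593763857b9563853b9663853b956385b79563859648638595486385964763859547638538966385953863853796638537956385b3966385b9866385b9856385b9766385498663854985638576496385398663853985638539766385b6946385b5946385b5936385948663859386638594856385938563857694638593766385968363857396638595846385958363859574638595736385b9646385b9636385b95463858964638589636385548963857964638579636385795463859864638598636385985463859764638597636385975463858b7963856b5963854b396385ab986385ab976385a598638539486385473963854938638549376385ab966385ab956385a7956385a39663857986638585796385394663854539638549366385493563854638638545386385483663853548638537466385453763854736638547356385a6946385a5946385a593638583766385867463857386638585746385857363855964638563596385695463856458638563586385685463855764638563576385675463858b8963857b7963855b5963859b9863859b976385494863854947638539386385393763859b9663859b956385979563858986638589856385797663854946638549456385393663853935638548466385383663854746638547456385373663853735638596946385959463859593638586846385767463858584638585836385696463856963638559546385686463856368638558546385676463856763638557546385a8b96385a7b96385a6b96385a5b96385ab896385ab796385a6896385a6796385a5796385ab696385ab596385a8696385a8596385a7696385a75963857b9863858b97638575986385859763853b9463853894638537946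385398463853974638539546385385463853754638598b9638597b9638596b9638595b963859b8963859b796385968963859679638595896385957963859b6963859b596385986963859859638597696385975963858b9863857b97638586986385859863854b946385489463854794638549846385497463854964638549546385486463854854638547646385475463858cb963857cb963856cb963855cb963854cb963853cb96385b7896385b87963856789638568796385578963855879638547896385487963853789638538796385ba986385ba9763856a9863856a9763855a9863855a9763854a9863854a9763853a9863853a976385ba9463858a9463857a9463856a9463855a9463859784638598746385678463856874638557846385587463858bb963857bb96385b8896385b779638568896385588963855779638538896385b559638585596385b9986385b997638569986385599863855997638549986385399863853997638594486385933863856338638554486385b9966385b995638589966385899563857996638579956385399663853995638598866385988563859776638548866385388663853885638537766385933663858336638573366385b9946385899463857994638598846385988363859774638597736385688463855884638558836385577463859554638585546385b9676336b957633639676336b9476336b93763366947633659476336593763369647633695476336b9766336b975633639766336397563369376633697456336967463369574633695736336976363366957633649376336897663368975633683766336473663364735633686746336857463368573633663576336696763365957633679766336797563364745633637366336373563367674633675746336757363366763633686976336859763368967633689576336397463367697633675976336796763367957633657456336497463366a9763365a9763364a9763363a9763369567633696576336987463366874633658746336699763365997633649976336399763369667633695576336744563369774633667746336577463368567633686576336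587663366875633638746336b9676346b957634639676346b9476346b93763466947634659476346593763469647634695476346b9766346b975634639766346397563469376634697456346973563469674634695746346957363469764634697636346ab9763466957634649376346897663468975634683766346453763464735634686746346857463468573634657646346635763469b9763466967634659576346797663467975634647456346373563467574634675736346676463466763634686976346859763468967634689576346397463463764634676976346759763467967634679576346497463464574634647646346ba9763466a9763465a9763464a9763463a97634695676346965763464567634698746346687463465874634675646346b997634669976346599763464997634639976346966763469557634645576346977463466774634657746346766463468567634686576346387463467a97634675676346765763466876634658756346643663464874634645646346b9676335b957633539676335b9476335b93763356947633559476335593763359647633595476335b9766335b9756335397663353975633593766335974663359745633597356335967463359763633597546335ab9763356957633549376335897663358975633583766335473563358674633563576335675463359b976335696763355957633549476335393763357976633579756335474563353735633576746335676363355754633586976335896763358957633586476335863763356975633567356335397463353574633537546335769763357967633579576335764763357637633559756335674663355745633557356335497463354574633547546335ba9763356a9763355a9763354a9763353a9763359567633596576335456763353567633598756335487563353875633598746335687463355874633576546335b997633569976335599763354997633539976335966763359557633545576335355763359775633547756335377563359774633567746335577463357554633585676335865763356875633554366335387463357a9763357567633576576335587563350000355348746335899763358667633585576335544663353774633535546335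b9676345b957634539676345b9476345b93763456947634559476345593763459647634595476345b9766345b975634539766345397563459376634597466345974563459736634597356345967463459574634595736345976463459763634597546345ab9763456957634549376345897663458975634583766345374663454537634547366345473563458674634585746345857363455764634563576345675463459b976345696763455957634579766345797563454746634547456345373663453735634576746345757363456764634567636345575463458b976345869763458597634589676345895763455746634567356345397463453574634537646345375463457b976345769763457597634579676345795763456746634557356345497463454674634545746345357363454764634547546345ba9763456a9763455a9763454a9763453a976345956763459657634545676345356763459874634568746345587463457564634576546345b997634569976345599763454997634539976345966763459557634546676345455763453557634597746345677463455774634576646345755463458a9763458567634586576345534663455436634538746345356463457a97634575676345765763454874634545646345899763458667634585576345833763455336634537746345466363453554634579976345766763457557634567766345577563456336634547746345455463453b8963848b6963847b6963847b5963843b696384b8696384b76963847b3963845b3963843b9863843b97638439686384396763843958638439576384b9386384b9376384386963843769638459386384593763847b9663847b9563843b9663843b956384b8966384b7966384b795638438966384953863843796638437956384b9866384b9856384b9766384b975638439866384398563843976638439756384b9366384b93563843689638435896384793663847935638498366384359863849736638497356384b9636384896363847963638498636384976363846b5963844b396384675963844938638449376384ab966384ab956384a8966384a7966384a7956384798663848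97663848975638449366384493563844638638445386384483663844537638447366384473563846359638463586384635763846b6963845b5963843b39638439386384393763849b9663849b95638498966384979663849795638489866384898563847976638479756384393663843935638438366384353863843736638437356384696363846368638467636384a6b96384a5b96384a8696384a8596384a7696384a7596384ab396384a8396384a7396384a6396384a53963847938638489376384763863848637638475386384853763845b9663846b956384589663846895638457966384679563845396638459866384698563845976638469756384538663845376638459366384693563845836638468356384573663846735638449636384486363844763638496b9638495b96384986963849859638497696384975963849b396384983963849739638496396384953963848938638479376384863863847637638485386384753763846b9663845b95638468966384589563846796638457956384639663846986638459856384697663845975638463866384637663846936638459356384683663845835638467366384573563843963638438636384376363846cb963845cb963843cb963843789638438796384b5696384b6596384856963848659638475696384765963843569638436596384b43963848439638464396384543963843a9863843a97638435686384356763843658638436576384943863849437638464386384643763845438638454376384ba966384ba9563848a9663848a9563847a9663847a9563843a9663843a9563849786638497856384987663849875638437866384378563843876638438756384943663849435638484366384843563849563638485636384756363846bb963845bb963843bb963843889638437796384b6696384b5596384866963848559638476696384755963843669638435596384b339638483396384733963846339638439986384399763843668638436676384355863843557638493386384933763846338638463376384b9966384b9956384899663848995638479966384799563843996638439956384988663849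8856384977663849775638438866384388563843776638437756384933663849335638483366384833563847336638473356384966363848663638476636384a5696384a6596384a4396384843763845a9663846a9563845786638467856384587663846875638464356384456363849cb9638495696384965963849439638484386384743763846a9663845a95638467866384578563846876638458756384643663845435638435636384abb96384a6696384a5596384a33963848337638459966384699563845886638468856384577663846775638463356384466363849bb9638496696384955963849339638483386384733763846996638459956384688663845885638467766384577563846336638453356384366363843a896384ba696384ba5963848a6963847a6963847a596384389763843867638438576384b695638496856384769563849675638436956384963563843685638435866384367563847635638494636384846363843b896383b6896383b58963838b6963837b6963837b5963833b696383b8696383b7696383b4696383b36963838b4963837b4963837b3963836b4963835b4963835b396383b8496383b7496383b6496383b54963835b9863835b9763833b9863833b976383b5986383b9676383b9586383b9576383496763835849638357496383396763833958638339576383b9486383b9476383b9386383b937638369486383694763833869638337696383594863835947638359386383593763837b9663837b9563833b9663833b956383b8966383b7966383b79563839648638395486383964763839547638338966383953863833796638337956383b3966383b9866383b9856383b9766383498663834985638376496383398663833985638339766383b9466383b9456383b9366383b9356383894663838945638336896383358963837946638379456383793663837935638398466383984563839836638335986383974663839745638397366383973563835b9463835b936383b8946383b7946383946763835894638357946383b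6946383b5946383b5936383948663839386638394856383938563837694638393766383b9836383b973638369836383746963837369638359836383597363839684638396836383967463837396638395846383958363839574638395736383b9646383b9636383b954638389646383896363837964638379636383795463839864638398636383985463839764638397636383975463836b5963834b396383ab986383ab976383a598638367596383695863836957638339486383473963834938638349376383ab966383ab956383a8966383a7966383a7956383a3966383798663838579638389766383394663834539638349366383493563834638638345386383483663833548638337466383453763834736638347356383ab946383ab936383a8946383a7946383a6946383a5946383a59363838379638384766383837663838674638373866383857463838573638359646383635963836954638364586383635863835764638363576383675463836b6963835b5963839b9863839b976383696763835958638359576383494863834947638339386383393763839b9663839b956383989663839598638397966383979563838986638389856383797663834946638349456383393663833935638348466383454863833836638335386383474663834745638337366383373563839b9463839b936383989463839794638396946383959463839593638389836383797363838684638376746383858463838583638369646383696363835954638358546383676463836763638357546383a8b96383a7b96383a6b96383a5b96383a3b96383a6896383a6796383a5896383a5796383a3896383a3796383a8696383a8596383a7696383a7596383a35963837b9863838b9763837698638386976383759863838597638374986383849763838967638379586383895763838467638374586383845763835946638358466383574663833b94638338946383379463833694638335946383358463834583638339646383395463833864638338546383376463833754638398b9638397b9638396b9638395b9638393b9638396896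38396796383958963839579638393896383937963839869638398596383976963839759638393696383935963838b9863837b976383869863837697638385986383849863837497638383986383796763838958638379576383746763838458638374576383835863837547638375376383694663836846638368366383674663834b946383489463834794638346946383459463834964638349546383486463834854638347646383475463838cb963837cb963836cb963835cb963834cb963833cb96383b7896383b879638367896383578963835879638347896383487963833789638338796383b5696383b659638385696383865963837659638345696383465963833569638336596383ba986383ba9763836a9863836a9763835a9863835a9763834a9863834a9763833a9863833a97638395676383965863839657638345676383465863834657638335676383365863833657638363486383643863837a9563839346638383466383734663837345638374356383ba9463838a9463837a9463836a9463835a94638395646383965463838564638386546383765463838bb963837bb963836bb963835bb963834bb963833bb96383b8896383b779638367796383588963835779638348896383477963833889638337796383b6696383b559638386696383855963837669638346696383455963833669638335596383b9986383b99763836998638369976383599863835997638349986383499763833998638339976383966763839558638395576383466763834558638345576383366763833558638335576383b994638389946383799463836994638359946383688363839664638395546383866463838554638376646383a7896383a8796383a5696383a65963837a9863838a97638385676383765863838657638353466383543663833a94638335646383365463839cb96383978963839879638395696383965963838a9863837a97638375676383865863837657638363466383534563834a9463834564638346546383abb96383a8896383a7796383a6696383a5596383a3396383866763837558638385576383599663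83699563835886638368856383577663835446638364456383533663836335638339946383388463834773638336646383355463839bb9638398896383977963839669638395596383899863837997638376676383855863837557638364466383533563834994638346646383455463833a896383ba696383ba5963838a6963837a6963837a5963833a696383ba496383ba3963838a4963837a4963837a3963836a4963835a4963835a396383b897638398676383589763839857638397486383984763833897638398376383486763833867638357486383584763833857638358376383b695638395866383968563837695638395466383964563833695638396356383468563838645638336856383358663837645638376356383b493638393846383948363837493638394736383936463839463638354936383648363838463638354836383736463837463638354736383b9896383b979638369896383598963835979638339896383b9696383b9596383896963837969638379596383b8986383b79763836898638358986383579763834898638338986383379763839767638398586383975763834858638337676383385863833757638398486383983863836838638358486383b6966383b595638386966383859563837696638375956383369663833595638396866383958563839676638346866383368663833585638336766383963663838636638376366383b49463839484638393836383947463839373638364846383638363835484638353836383946463839454638384646383746463837454638300976463009763630097546300ab97630057646300635763009b9763006967630059576300676463006763630057546300597663005476630053766300476363006976630059756300647663005475630063766300476463003763630047546300ba9763006a9763005a9763004a9763003a976300956763009437630064376300543763009876630098756300487663004875630038766300387563007564630075636300b9976300699763005997630049976300399763009667630095576300944763009337630063376300977663009775630047766300477563003776630037756300766463007663630075546300856763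0086576300834763008437630058766300687563007a976300756763007657630073476300743763006876630058756300643663004564630089976300866763008557630084476300833763005776630067756300533663006335630035546300799763007667630075576300744763007337630067766300577563006446630063366300533563004664630045546300b89763009867630098576300386763009847630098376300684763005847630058376300967563007546630076456300367563007635630074636300b7976300479763003797630097676300975763004757630037676300375763009747630097376300674763006737630057476300967663009575630046766300457563003676630035756300764663007545630076366300753563009474630093736300637363005373630074646300736363007454630000576300007563000064630000636300005463000036530000455300009753000057530000755300007354000073530000005300000000
def tgN : List Tg := [
 ⟨494780232499200, 1, 2, 1, 3, 0x1c0000a100003140000a300003800000c600002880000c4000020c000083000030400008100003080000c200002000000c000002⟩,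
 ⟨494780232499200, 1, 2, 2, 3, 0x1c000106000041c0003060000c140003040000c14000104000040c000102000040c0003020000c040003000000c0400010000004⟩,
 ⟨494780232499200, 1, 2, 3, 1, 0x8cc00321300049cc003253000488c003203000498c00324300048cc001213000c9cc001253000c88c001203000c98c001243000c⟩,
 ⟨494780232499200, 1, 2, 3, 2, 0x9400016400005940003640000d8400016000005840003600000d140003440000d1400014400005040003400000d0400014000005⟩,
 ⟨2968681394995200, 1, 2, 3, 4, 0x940001a4000069c0001a600006840001a0000068c0001a2000061c0001860000614000184000060c000182000060400018000006⟩]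
def ltN : List It := [⟨158329674399744000, 958636700467200, 1, [(2, 4)]⟩]

theorem n1 : fchk 1 2441 (Nat.add (lsum prN fun q => zs2 (pits PT q)) (Nat.add (zs2 (List.cons ltN [])) (lsum tgN fun g => lsum (tits g) zit))) = true := by decide +kernel
theorem n2 : lall prN (fun q => chi2 2 2441 PB rtN (pits PT q)) = true := by decide +kernel
theorem n3 : Nat.ble (lsum prN fun q => cn2 (pits PT q)) 16000 = true := by decide +kernel

theorem datN : Data 1 2441 2 PB rtN PT obN prN ltN tgN where
  nr_le := by norm_num
  nl_lt := by norm_num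
  nlm := Or.inl ⟨rfl, rfl⟩
  pt := PT_ok
  pb := PB_ok
  rp := by decide +kernel
  r0 := by decide +kernel
  r1 := by decide +kernel
  ob := obc_spec (by decide +kernel)
  pr := rfl
  c1 := n1
  c2 := n2
  c3 := n3
  c4 := by decide +kernel
  c5 := by decide +kernel

theorem certN {G : Type*} [Group G] (Ψ : Wd (Fin 6) → ℝ) (h : PS 0 G Ψ) :
    93 / 64 * pd2 Ψ ≤ 3 * pA3 Ψ + 18 * pO4 Ψ := by
  have k := datN.pos h
  have a1 : ∀ i j i' j' : Fin 6, ∀ c H, rs (tits ⟨c, i, j, i', j', H⟩) (rit Ψ) = -(c * Wt Ψ i j i' j') :=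
    fun i j i' j' c H => tits_sum c i j i' j' H
  have b1 := a1 1 2 1 3
  have b2 := a1 1 2 2 3
  have b3 := a1 1 2 3 1
  have b4 := a1 1 2 3 2
  have b5 := a1 1 2 3 4
  simp only [Fin.val_zero, Fin.val_one, Fin.val_ofNat, show ((2 : Fin 6) : ℕ) = 2 from rfl,
    show ((3 : Fin 6) : ℕ) = 3 from rfl, show ((4 : Fin 6) : ℕ) = 4 from rfl] at b1 b2 b3 b4 b5
  simp only [tgN, ltN, rs_cons, rs_nil, b1, b2, b3, b4, b5, rit] at k
  have l : ∀ i j : Fin 6, i ≠ j → j ≠ 0 → i ≠ 0 → ∀ s t, Ψ [((i, s), (j, t))] = V1 Ψ :=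
    fun i j a b c s t => letter1 h a b c s t
  have l12 := l 1 2 (by decide) (by decide) (by decide)
  have l13 := l 1 3 (by decide) (by decide) (by decide)
  have l23 := l 2 3 (by decide) (by decide) (by decide)
  have l31 := l 3 1 (by decide) (by decide) (by decide)
  have l32 := l 3 2 (by decide) (by decide) (by decide)
  have l34 := l 3 4 (by decide) (by decide) (by decide)
  rw [pd2, pA3, pO4, Dd_eq l12, Ga_eq l12 l13, Ga_eq l12 l23, Ga_eq l12 l31, Ga_eq l12 l32, Ga_eq l12 l34]
  have v1 : Ψ (wd [(2, 4)]) = V1 Ψ := rfl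
  rw [v1] at k
  push_cast at k
  linarith

end PRA5

open PRA in
open scoped Classical in
/-- For `k > 5`, every nonzero eigenvalue of the non-normalized graph
Laplacian `Δ_{Σ'} = 4k²·I − A` on `ℂ^V`, `V = Σ'_k(G)`, is at least `0.35·(k−5)`
(where `A(u,w)` counts the generators `s` of `A_k` with `s.u = w`). -/
theorem statement5 (k : ℕ) (hk : 5 < k) (G : Type*) [Group G] [Fintype G]
    (S0 : Fin k → G) (hS0 : Subgroup.closure (Set.range S0) = ⊤)
    (f : {v : Fin (k + 1) → G // v ∈ SigmaSet k G S0} → ℂ) (hf : f ≠ 0) (μ : ℂ)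
    (heig : ∀ u : {v : Fin (k + 1) → G // v ∈ SigmaSet k G S0},
      4 * (k : ℂ) ^ 2 * f u -
          (∑ c : Fin 4, ∑ i : Fin (k + 1), ∑ j : Fin (k + 1),
            if h : (i ≠ j ∧ j ≠ 0) ∧ tupAct (genAut k c i j) u.val ∈ SigmaSet k G S0 then
              f ⟨tupAct (genAut k c i j) u.val, h.2⟩ else 0)
        = μ * f u)
    (hμ : μ ≠ 0) :
    0.35 * ((k : ℝ) - 5) ≤ μ.re := by
  exact PRA5.reduce k hk G (PRA5.key_of_certs hk PRA5.certN PRA5.certC) S0 f hf μ heig hμ
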